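/- Let G be a claw-free perfect graph with clique number ω(G) ≤ 4. Then the choice number of G equals its chromatic number: ch(G) = χ(G). -/

import Mathlib

open SimpleGraph

variable {V : Type*}

/-- An `L`-coloring: a proper vertex coloring `c` with `c v ∈ L v` for every vertex. -/
def ListColorable (G : SimpleGraph V) (L : V → Finset ℕ) : Prop :=
  ∃ c : V → ℕ, (∀ v, c v ∈ L v) ∧ ∀ ⦃u w : V⦄, G.Adj u w → c u ≠ c w

/-- `G` is `k`-choosable: `L`-colorable for every list assignment with lists of size `k`. -/
def Choosable (G : SimpleGraph V) (k : ℕ) : Prop :=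
  ∀ L : V → Finset ℕ, (∀ v, (L v).card = k) → ListColorable G L

/-- The choice number (list-chromatic number) of `G`. -/
noncomputable def choiceNumber (G : SimpleGraph V) : ℕ :=
  sInf {k | Choosable G k}

/-- The clique number of `G`. -/
noncomputable def cliqueNumber (G : SimpleGraph V) : ℕ :=
  sSup {n | ∃ s : Finset V, G.IsNClique n s}

/-- `G` has no induced claw (`K_{1,3}`). -/
def IsClawFree (G : SimpleGraph V) : Prop :=
  ∀ a b c d : V, G.Adj a b → G.Adj a c → G.Adj a d →
    ¬G.Adj b c → ¬G.Adj b d → ¬G.Adj c d → b ≠ c → b ≠ d → c ≠ d → False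

/-- `G` is perfect: every induced subgraph has chromatic number equal to clique number. -/
def IsPerfect (G : SimpleGraph V) : Prop :=
  ∀ s : Set V, (G.induce s).chromaticNumber = (cliqueNumber (G.induce s) : ℕ∞)

/-- `S` is complete to `T`: every vertex of `S` is adjacent to every vertex of `T`. -/
def IsCompleteTo (G : SimpleGraph V) (S T : Set V) : Prop :=
  ∀ ⦃s⦄, s ∈ S → ∀ ⦃t⦄, t ∈ T → G.Adj s t

/-- `S` is anticomplete to `T`: no vertex of `S` is adjacent to any vertex of `T`. -/
def IsAnticompleteTo (G : SimpleGraph V) (S T : Set V) : Prop :=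
  ∀ ⦃s⦄, s ∈ S → ∀ ⦃t⦄, t ∈ T → ¬G.Adj s t

/-- `(A, B, Q)` is a peculiar partition of `G` (indices mod 3). -/
structure IsPeculiarPartition (G : SimpleGraph V) (A B Q : Fin 3 → Set V) : Prop where
  cover : ∀ v : V, (∃ i, v ∈ A i) ∨ (∃ i, v ∈ B i) ∨ (∃ i, v ∈ Q i)
  pairwiseDisjoint :
    Pairwise (Function.onFun Disjoint (fun p : Fin 3 × Fin 3 => ![A, B, Q] p.1 p.2))
  nonemptyA : ∀ i, (A i).Nonempty
  nonemptyB : ∀ i, (B i).Nonempty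
  nonemptyQ : ∀ i, (Q i).Nonempty
  cliqueA : ∀ i, G.IsClique (A i)
  cliqueB : ∀ i, G.IsClique (B i)
  cliqueQ : ∀ i, G.IsClique (Q i)
  A_complete : ∀ i, IsCompleteTo G (A i) (B i ∪ A (i + 1) ∪ A (i + 2) ∪ B (i + 2))
  A_not_complete : ∀ i, ¬ IsCompleteTo G (A i) (B (i + 1))
  B_complete : ∀ i, IsCompleteTo G (B i) (A i ∪ B (i + 1) ∪ B (i + 2) ∪ A (i + 1))
  B_not_complete : ∀ i, ¬ IsCompleteTo G (B i) (A (i + 2))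
  Q_complete : ∀ i, IsCompleteTo G (Q i) (A (i + 1) ∪ B (i + 1) ∪ A (i + 2) ∪ B (i + 2))
  Q_anticomplete : ∀ i, IsAnticompleteTo G (Q i) (A i ∪ B i ∪ Q (i + 1) ∪ Q (i + 2))

/-- `G` is peculiar if it admits a peculiar partition. -/
def IsPeculiar (G : SimpleGraph V) : Prop :=
  ∃ A B Q : Fin 3 → Set V, IsPeculiarPartition G A B Q

/-- `G` is cobipartite: its vertex set is covered by at most two cliques. -/
def Cobipartite (G : SimpleGraph V) : Prop :=
  ∃ S T : Set V, S ∪ T = Set.univ ∧ G.IsClique S ∧ G.IsClique T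

/-! ### Perfection as a colouring property of vertex subsets -/

/-- Every vertex subset can be properly coloured with as many colours as its cliques require. -/
def PerfCol (G : SimpleGraph V) : Prop :=
  ∀ (S : Finset V) (m : ℕ), (∀ Q ⊆ S, G.IsClique (Q : Set V) → Q.card ≤ m) →
    ∃ c : V → ℕ, (∀ v ∈ S, c v < m) ∧ ∀ u ∈ S, ∀ v ∈ S, G.Adj u v → c u ≠ c v

lemma cliqueNumber_le_of_forall {W : Type*} {H : SimpleGraph W} {m : ℕ}
    (h : ∀ Q : Finset W, H.IsClique (Q : Set W) → Q.card ≤ m) : cliqueNumber H ≤ m := by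
  refine csSup_le ⟨0, ∅, by simp [isNClique_iff]⟩ ?_
  rintro n ⟨s, hs⟩
  rw [isNClique_iff] at hs
  exact hs.2 ▸ h s hs.1

lemma card_le_cliqueNumber {W : Type*} [Fintype W] {H : SimpleGraph W} {Q : Finset W}
    (h : H.IsClique (Q : Set W)) : Q.card ≤ cliqueNumber H := by
  refine le_csSup ⟨Fintype.card W, ?_⟩ ⟨Q, by simp [isNClique_iff, h]⟩
  rintro n ⟨s, hs⟩
  rw [isNClique_iff] at hs
  exact hs.2 ▸ s.card_le_univ

lemma perfCol_of_isPerfect {G : SimpleGraph V} (h : IsPerfect G) : PerfCol G := by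
  classical
  intro S m hS
  have h1 : cliqueNumber (G.induce (S : Set V)) ≤ m := by
    refine cliqueNumber_le_of_forall fun Q hQ => ?_
    rw [← Finset.card_map (Function.Embedding.subtype _)]
    refine hS _ ?_ ?_
    · intro v hv
      simp only [Finset.mem_map, Function.Embedding.coe_subtype] at hv
      obtain ⟨a, _, rfl⟩ := hv
      exact a.2
    · intro u hu v hv huv
      simp only [Finset.coe_map, Function.Embedding.coe_subtype, Set.mem_image,
        Finset.mem_coe] at hu hv
      obtain ⟨a, ha, rfl⟩ := hu
      obtain ⟨b, hb, rfl⟩ := hv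
      exact hQ ha hb (fun hab => huv (by rw [hab]))
  have h2 : (G.induce (S : Set V)).Colorable m := by
    rw [← chromaticNumber_le_iff_colorable, h]
    exact_mod_cast h1
  obtain ⟨c⟩ := h2
  refine ⟨fun v => if hv : v ∈ S then (c ⟨v, hv⟩ : ℕ) else 0, ?_, ?_⟩
  · intro v hv
    simp [hv]
  · intro u hu v hv huv
    simp only [hu, hv, dif_pos]
    intro he
    exact c.valid (v := ⟨u, hu⟩) (w := ⟨v, hv⟩) huv (Fin.ext he)

lemma PerfCol.induce {G : SimpleGraph V} (h : PerfCol G) (s : Set V) : PerfCol (G.induce s) := by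
  classical
  intro S m hS
  obtain ⟨c, hc, hc'⟩ := h (S.map (Function.Embedding.subtype _)) m (by
    intro Q hQ hQc
    have h3 : Q = (S.filter fun v : s => (v : V) ∈ Q).map (Function.Embedding.subtype _) := by
      ext v
      simp only [Finset.mem_map, Finset.mem_filter, Function.Embedding.coe_subtype]
      constructor
      · intro hv
        have := hQ hv
        simp only [Finset.mem_map, Function.Embedding.coe_subtype] at this
        obtain ⟨a, ha, rfl⟩ := this
        exact ⟨a, ⟨ha, hv⟩, rfl⟩
      · rintro ⟨a, ⟨_, ha⟩, rfl⟩
        exact ha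
    rw [h3, Finset.card_map]
    refine hS _ (Finset.filter_subset _ _) ?_
    intro u hu v hv huv
    simp only [Finset.coe_filter, Set.mem_ofPred_eq] at hu hv
    exact hQc hu.2 hv.2 (fun he => huv (Subtype.ext he)))
  refine ⟨fun v => c v, ?_, ?_⟩
  · intro v hv
    exact hc _ (by simpa using hv)
  · intro u hu v hv huv
    exact hc' _ (by simpa using hu) _ (by simpa using hv) huv

lemma IsClawFree.induce {G : SimpleGraph V} (h : IsClawFree G) (s : Set V) :
    IsClawFree (G.induce s) := by
  intro a b c d hab hac had hbc hbd hcd h1 h2 h3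
  exact h a b c d hab hac had hbc hbd hcd (fun e => h1 (Subtype.ext e))
    (fun e => h2 (Subtype.ext e)) (fun e => h3 (Subtype.ext e))

/-! ### Odd cycles -/

lemma walk_fun {G : SimpleGraph V} {u v : V} (p : G.Walk u v) :
    ∃ g : ℕ → V, g 0 = u ∧ g p.length = v ∧ ∀ i < p.length, G.Adj (g i) (g (i + 1)) :=
  ⟨p.getVert, by simp, by simp, fun i hi => p.adj_getVert_succ hi⟩

/-- A graph which is not 2-colourable contains an odd cycle. -/
lemma exists_odd_cycle {G : SimpleGraph V} (h : ¬ G.Colorable 2) :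
    ∃ (n : ℕ) (g : ℕ → V), Odd n ∧ g n = g 0 ∧ (∀ i < n, G.Adj (g i) (g (i + 1))) ∧
      Set.InjOn g (Set.Iio n) := by
  classical
  let P : ℕ → Prop := fun n => Odd n ∧ ∃ g : ℕ → V, g n = g 0 ∧ ∀ i < n, G.Adj (g i) (g (i + 1))
  have hP : ∃ n, P n := by
    rw [two_colorable_iff_forall_loop_even] at h
    push Not at h
    obtain ⟨u, w, hw⟩ := h
    obtain ⟨g, h0, h1, h2⟩ := walk_fun w
    exact ⟨w.length, Nat.not_even_iff_odd.mp hw, g, by rw [h0, h1], h2⟩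
  obtain ⟨hodd, g, hg, hadj⟩ := Nat.find_spec hP
  have hmin : ∀ m < Nat.find hP, ¬ P m := fun m hm => Nat.find_min hP hm
  generalize Nat.find hP = n at *
  refine ⟨n, g, hodd, hg, hadj, ?_⟩
  have key : ∀ i j, i < j → j < n → g i ≠ g j := by
    intro i j hij hjn he
    rcases Nat.even_or_odd (j - i) with hev | hod
    · refine hmin (n - (j - i)) (by omega) ⟨?_, fun t => if t ≤ i then g t else g (t + (j - i)), ?_, ?_⟩
      · rw [Nat.odd_sub (by omega)]; simp [hodd, hev]
      · have : ¬ (n - (j - i) ≤ i) := by omega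
        simp only [this, if_false, Nat.zero_le, if_true]
        rw [← hg]; congr 1; omega
      · intro t ht
        by_cases h1 : t + 1 ≤ i
        · have h2 : t ≤ i := by omega
          simp only [h1, h2, if_true]; exact hadj t (by omega)
        · by_cases h2 : t ≤ i
          · have h3 : t = i := by omega
            subst h3
            simp only [h1, if_false, le_refl, if_true]
            rw [he]
            have := hadj j (by omega)
            convert this using 2; omega
          · simp only [h1, h2, if_false]
            have := hadj (t + (j - i)) (by omega)
            convert this using 2; omega
    · refine hmin (j - i) (by omega) ⟨hod, fun t => g (t + i), ?_, ?_⟩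
      · simp only [Nat.zero_add]; rw [he]; congr 1; omega
      · intro t ht
        have := hadj (t + i) (by omega)
        convert this using 2; omega
  intro i hi j hj he
  rcases lt_trichotomy i j with hl | hl | hl
  · exact absurd he (key i j hl hj)
  · exact hl
  · exact absurd he.symm (key j i hl hi)

/-- An induced cycle in a perfect graph has even length. -/
lemma PerfCol.even_hole {G : SimpleGraph V} (h : PerfCol G) {n : ℕ} (hn : 4 ≤ n) (g : ℕ → V)
    (hadj : ∀ i, i + 1 < n → G.Adj (g i) (g (i + 1))) (hclose : G.Adj (g 0) (g (n - 1)))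
    (hno : ∀ i j, i + 1 < j → j < n → (i = 0 → j ≠ n - 1) → ¬ G.Adj (g i) (g j)) : Even n := by
  classical
  obtain ⟨c, hc, hc'⟩ := h ((Finset.range n).image g) 2 (by
    intro Q hQ hQc
    by_contra hcard
    push Not at hcard
    obtain ⟨x, y, z, hx, hy, hz, hxy, hxz, hyz⟩ := Finset.two_lt_card_iff.mp hcard
    have hidx : ∀ v ∈ Q, ∃ i < n, g i = v := by
      intro v hv
      simpa using hQ hv
    obtain ⟨i, hi, rfl⟩ := hidx x hx
    obtain ⟨j, hj, rfl⟩ := hidx y hy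
    obtain ⟨k, hk, rfl⟩ := hidx z hz
    have step : ∀ a b, a < n → b < n → G.Adj (g a) (g b) →
        b = a + 1 ∨ a = b + 1 ∨ (a = 0 ∧ b = n - 1) ∨ (b = 0 ∧ a = n - 1) := by
      intro a b ha hb hab
      by_contra hne
      push Not at hne
      rcases lt_trichotomy a b with hl | hl | hl
      · exact hno a b (by omega) hb (by omega) hab
      · subst hl; exact G.loopless.irrefl _ hab
      · exact hno b a (by omega) ha (by omega) hab.symm
    have s1 := step i j hi hj (hQc hx hy hxy)
    have s2 := step i k hi hk (hQc hx hz hxz)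
    have s3 := step j k hj hk (hQc hy hz hyz)
    have n1 : i ≠ j := fun e => hxy (by rw [e])
    have n2 : i ≠ k := fun e => hxz (by rw [e])
    have n3 : j ≠ k := fun e => hyz (by rw [e])
    omega)
  have hm : ∀ i < n, c (g i) < 2 := fun i hi => hc _ (Finset.mem_image_of_mem _ (by simpa using hi))
  have hmem : ∀ i < n, g i ∈ (Finset.range n).image g :=
    fun i hi => Finset.mem_image_of_mem _ (by simpa using hi)
  have par : ∀ i < n, (c (g i) + c (g 0)) % 2 = i % 2 := by
    intro i
    induction i with
    | zero => intro _; omega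
    | succ i ih =>
      intro hi
      have := ih (by omega)
      have h1 := hc' _ (hmem i (by omega)) _ (hmem (i + 1) hi) (hadj i hi)
      have h2 := hm i (by omega)
      have h3 := hm (i + 1) hi
      omega
  have h1 := par (n - 1) (by omega)
  have h2 := hc' _ (hmem 0 (by omega)) _ (hmem (n - 1) (by omega)) hclose
  have h3 := hm 0 (by omega)
  have h4 := hm (n - 1) (by omega)
  rw [Nat.even_iff]
  omega

/-- In a perfect graph, a vertex set without stable triples is covered by two cliques. -/
lemma PerfCol.exists_cobipartition {G : SimpleGraph V} (h : PerfCol G) (S : Finset V)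
    (hS : ∀ x ∈ S, ∀ y ∈ S, ∀ z ∈ S, x ≠ y → x ≠ z → y ≠ z → ¬ G.Adj x y → ¬ G.Adj x z →
      ¬ G.Adj y z → False) :
    ∃ f : V → Bool, ∀ u ∈ S, ∀ v ∈ S, u ≠ v → ¬ G.Adj u v → f u ≠ f v := by
  classical
  by_cases hcol : ((G.induce (S : Set V))ᶜ).Colorable 2
  · obtain ⟨c⟩ := hcol
    refine ⟨fun v => if hv : v ∈ S then decide (c ⟨v, hv⟩ = 0) else true, ?_⟩
    intro u hu v hv huv hna he
    have hval := c.valid (v := ⟨u, hu⟩) (w := ⟨v, hv⟩) (by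
      rw [compl_adj]
      exact ⟨fun e => huv (congrArg Subtype.val e), hna⟩)
    simp only [hu, hv, dif_pos, decide_eq_decide] at he
    apply hval
    generalize c ⟨u, hu⟩ = a at *
    generalize c ⟨v, hv⟩ = b at *
    revert a b; decide
  · exfalso
    obtain ⟨n, g, hodd, hg, hadj, hinj⟩ := exists_odd_cycle hcol
    let g' : ℕ → V := fun i => (g i : V)
    have hinj' : Set.InjOn g' (Set.Iio n) := fun i hi j hj e => hinj hi hj (Subtype.ext e)
    have hnad : ∀ i < n, g' i ≠ g' (i + 1) ∧ ¬ G.Adj (g' i) (g' (i + 1)) := by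
      intro i hi
      have := hadj i hi
      rw [compl_adj] at this
      exact ⟨fun e => this.1 (Subtype.ext e), this.2⟩
    let F := (Finset.range n).image g'
    have hFS : ∀ v ∈ F, v ∈ S := by
      intro v hv
      simp only [F, Finset.mem_image] at hv
      obtain ⟨i, _, rfl⟩ := hv
      exact (g i).2
    have hFn : F.card = n := by
      rw [Finset.card_image_of_injOn, Finset.card_range]
      simpa using hinj'
    -- a clique of `F` contains at most half of it
    have hcl : ∀ Q ⊆ F, G.IsClique (Q : Set V) → Q.card ≤ n / 2 := by
      intro Q hQ hQc
      let I := (Finset.range n).filter fun i => g' i ∈ Q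
      have hIQ : Q.card = I.card := by
        have : Q = I.image g' := by
          ext v
          simp only [I, Finset.mem_image, Finset.mem_filter]
          constructor
          · intro hv
            have := hQ hv
            simp only [F, Finset.mem_image] at this
            obtain ⟨i, hi, rfl⟩ := this
            exact ⟨i, ⟨hi, hv⟩, rfl⟩
          · rintro ⟨i, ⟨_, hi⟩, rfl⟩; exact hi
        conv_lhs => rw [this]
        refine Finset.card_image_of_injOn fun i hi j hj e => hinj' ?_ ?_ e
        · simpa using (Finset.mem_filter.mp hi).1
        · simpa using (Finset.mem_filter.mp hj).1
      let sh : ℕ → ℕ := fun i => if i + 1 < n then i + 1 else 0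
      have hg'0 : g' n = g' 0 := by simp only [g', hg]
      have hsh : ∀ i < n, g' (sh i) = g' (i + 1) := by
        intro i hi
        simp only [sh]
        split_ifs with h1
        · rfl
        · have : i + 1 = n := by omega
          rw [this, hg'0]
      have hdisj : Disjoint I (I.image sh) := by
        rw [Finset.disjoint_left]
        intro i hi hi'
        simp only [I, Finset.mem_image, Finset.mem_filter, Finset.mem_range] at hi hi'
        obtain ⟨j, ⟨hj, hjQ⟩, rfl⟩ := hi'
        rw [hsh j hj] at hi
        exact (hnad j hj).2 (hQc hjQ hi.2 (hnad j hj).1)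
      have hsub : I ∪ I.image sh ⊆ Finset.range n := by
        intro i hi
        simp only [I, Finset.mem_union, Finset.mem_image, Finset.mem_filter, Finset.mem_range] at hi ⊢
        rcases hi with hi | ⟨j, ⟨hj, _⟩, rfl⟩
        · exact hi.1
        · simp only [sh]; split_ifs <;> omega
      have hshinj : (I.image sh).card = I.card := by
        refine Finset.card_image_of_injOn fun i hi j hj e => ?_
        have h1 := (Finset.mem_filter.mp hi).1
        have h2 := (Finset.mem_filter.mp hj).1
        simp only [Finset.mem_range] at h1 h2
        simp only [sh] at e
        split_ifs at e <;> omega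
      have := Finset.card_le_card hsub
      rw [Finset.card_union_of_disjoint hdisj, hshinj, Finset.card_range] at this
      omega
    obtain ⟨c, hc, hc'⟩ := h F (n / 2) hcl
    have hcard : F.card ≤ 2 * (n / 2) := by
      have hmaps : ∀ v ∈ F, c v ∈ Finset.range (n / 2) := fun v hv => by simpa using hc v hv
      have := Finset.card_le_mul_card_image_of_maps_to hmaps 2 (by
        intro b _
        by_contra hlt
        push Not at hlt
        obtain ⟨x, y, z, hx, hy, hz, hxy, hxz, hyz⟩ := Finset.two_lt_card_iff.mp hlt
        simp only [Finset.mem_filter] at hx hy hz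
        refine hS x (hFS _ hx.1) y (hFS _ hy.1) z (hFS _ hz.1) hxy hxz hyz ?_ ?_ ?_
        · intro ha; exact hc' _ hx.1 _ hy.1 ha (hx.2.trans hy.2.symm)
        · intro ha; exact hc' _ hx.1 _ hz.1 ha (hx.2.trans hz.2.symm)
        · intro ha; exact hc' _ hy.1 _ hz.1 ha (hy.2.trans hz.2.symm))
      simpa using this
    rw [hFn] at hcard
    obtain ⟨r, hr⟩ := hodd
    omega

/-! ### List colouring of vertices grouped in parts of size at most two -/

lemma exists_injOn_choice (U : Finset V) (L : V → Finset ℕ)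
    (h : ∀ Q ⊆ U, Q.card ≤ (Q.biUnion L).card) :
    ∃ c : V → ℕ, Set.InjOn c U ∧ ∀ v ∈ U, c v ∈ L v := by
  classical
  obtain ⟨f, hf, hf'⟩ := (Finset.all_card_le_biUnion_card_iff_exists_injective
    (fun v : U => L v)).mp (by
      intro s
      have := h (s.map (Function.Embedding.subtype _)) (by
        intro v hv
        simp only [Finset.mem_map, Function.Embedding.coe_subtype] at hv
        obtain ⟨a, _, rfl⟩ := hv
        exact a.2)
      rw [Finset.card_map, Finset.map_eq_image, Finset.image_biUnion] at this
      exact this)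
  refine ⟨fun v => if hv : v ∈ U then f ⟨v, hv⟩ else 0, ?_, ?_⟩
  · intro u hu v hv he
    have hu' : u ∈ U := hu
    have hv' : v ∈ U := hv
    simp only [hu', hv', dif_pos] at he
    exact congrArg Subtype.val (hf he)
  · intro v hv
    simp only [hv, dif_pos]
    exact hf' ⟨v, hv⟩

lemma card_erase_ge (s : Finset ℕ) (a : ℕ) : s.card ≤ (s.erase a).card + 1 := by
  classical
  have := Finset.pred_card_le_card_erase (s := s) (a := a)
  omega

lemma card_le_card_biUnion_of_mem {U : Finset V} {L : V → Finset ℕ} {v : V} (hv : v ∈ U) :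
    (L v).card ≤ (U.biUnion L).card :=
  Finset.card_le_card (Finset.subset_biUnion_of_mem L hv)

lemma card_add_le_card_biUnion {U : Finset V} {L : V → Finset ℕ} {u v : V} (hu : u ∈ U)
    (hv : v ∈ U) (hd : Disjoint (L u) (L v)) : (L u).card + (L v).card ≤ (U.biUnion L).card := by
  classical
  rw [← Finset.card_union_of_disjoint hd]
  exact Finset.card_le_card (Finset.union_subset (Finset.subset_biUnion_of_mem L hu)
    (Finset.subset_biUnion_of_mem L hv))

/-- The vertices of `Q` with a partner in `U` are at most as many as the pairs of `U`. -/
lemma card_paired_add_card_image_le [DecidableEq V] (U Q : Finset V) (χ : V → ℕ) (hQ : Q ⊆ U)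
    (hinj : Set.InjOn χ Q) (hp : ∀ q ∈ Q, ∃ v ∈ U, v ≠ q ∧ χ v = χ q) :
    Q.card + (U.image χ).card ≤ U.card := by
  classical
  choose! m hm hmne hmχ using hp
  have hM : (Q.image m).card = Q.card := by
    refine Finset.card_image_of_injOn fun x hx y hy e => hinj hx hy ?_
    rw [← hmχ x hx, ← hmχ y hy, e]
  have hMU : Q.image m ⊆ U := by
    intro v hv
    obtain ⟨q, hq, rfl⟩ := Finset.mem_image.mp hv
    exact hm q hq
  have himg : U.image χ ⊆ (U \ Q.image m).image χ := by
    intro t ht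
    obtain ⟨x, hx, rfl⟩ := Finset.mem_image.mp ht
    by_cases hxm : x ∈ Q.image m
    · obtain ⟨q, hq, rfl⟩ := Finset.mem_image.mp hxm
      refine Finset.mem_image.mpr ⟨q, Finset.mem_sdiff.mpr ⟨hQ hq, ?_⟩, (hmχ q hq).symm⟩
      intro hq'
      obtain ⟨r, hr, hrq⟩ := Finset.mem_image.mp hq'
      have : r = q := hinj hr hq (by rw [← hmχ r hr, hrq])
      subst this
      exact hmne r hr hrq
    · exact Finset.mem_image.mpr ⟨x, Finset.mem_sdiff.mpr ⟨hx, hxm⟩, rfl⟩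
  have h1 := (Finset.card_le_card himg).trans Finset.card_image_le
  rw [Finset.card_sdiff_of_subset hMU, hM] at h1
  have h2 := Finset.card_le_card hMU
  omega

/-- A list colouring of parts of size at most two in which different parts get different colours;
this generalizes the Erdős–Rubin–Taylor theorem on complete multipartite graphs. -/
lemma exists_coloring_of_parts (U : Finset V) (χ : V → ℕ) (L : V → Finset ℕ)
    (h2 : ∀ u ∈ U, ∀ v ∈ U, ∀ w ∈ U, χ u = χ v → χ u = χ w → u = v ∨ u = w ∨ v = w)
    (hm : ∀ u ∈ U, ∀ v ∈ U, u ≠ v → χ u = χ v → U.card ≤ (L u).card + (U.image χ).card)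
    (hs : ∀ u ∈ U, ∀ v ∈ U, u ≠ v → χ u = χ v → U.card ≤ (L u).card + (L v).card)
    (hq : ∀ Q ⊆ U, Q.Nonempty → (∀ q ∈ Q, ∀ v ∈ U, χ v = χ q → v = q) →
      Q.card + U.card ≤ (Q.biUnion L).card + (U.image χ).card) :
    ∃ c : V → ℕ, (∀ v ∈ U, c v ∈ L v) ∧ ∀ u ∈ U, ∀ v ∈ U, χ u ≠ χ v → c u ≠ c v := by
  classical
  induction hn : U.card using Nat.strong_induction_on generalizing U L with
  | _ n ih =>
  subst hn
  by_cases hcom : ∃ u ∈ U, ∃ v ∈ U, u ≠ v ∧ χ u = χ v ∧ ∃ a, a ∈ L u ∧ a ∈ L v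
  · obtain ⟨u, hu, v, hv, huv, hχ, a, hau, hav⟩ := hcom
    let U' := U.filter fun w => χ w ≠ χ u
    have hU'mem : ∀ w, w ∈ U' ↔ w ∈ U ∧ χ w ≠ χ u := fun w => by simp [U']
    have hUe : U = insert u (insert v U') := by
      ext w
      simp only [Finset.mem_insert, hU'mem]
      constructor
      · intro hw
        by_cases hwu : χ w = χ u
        · rcases h2 w hw u hu v hv hwu (hwu.trans hχ) with h | h | h
          · exact Or.inl h
          · exact Or.inr (Or.inl h)
          · exact absurd h huv
        · exact Or.inr (Or.inr ⟨hw, hwu⟩)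
      · rintro (rfl | rfl | h)
        · exact hu
        · exact hv
        · exact h.1
    have hvU' : v ∉ U' := by simp [hU'mem, hχ]
    have huU' : u ∉ insert v U' := by simp [hU'mem, huv]
    have hcard : U.card = U'.card + 2 := by
      conv_lhs => rw [hUe]
      rw [Finset.card_insert_of_notMem huU', Finset.card_insert_of_notMem hvU']
    have himg : (U.image χ).card = (U'.image χ).card + 1 := by
      have : U.image χ = insert (χ u) (U'.image χ) := by
        conv_lhs => rw [hUe]
        simp [Finset.image_insert, hχ]
      rw [this, Finset.card_insert_of_notMem]
      simp only [Finset.mem_image, hU'mem, not_exists, not_and]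
      rintro w ⟨_, h⟩; exact h
    have hsub : ∀ w ∈ U', w ∈ U := fun w hw => ((hU'mem w).mp hw).1
    obtain ⟨c, hc, hc'⟩ := ih U'.card (by omega) U' (fun w => (L w).erase a)
      (fun x hx y hy z hz => h2 x (hsub x hx) y (hsub y hy) z (hsub z hz))
      (fun x hx y hy hxy he => by
        have := hm x (hsub x hx) y (hsub y hy) hxy he
        have := card_erase_ge (L x) a
        omega)
      (fun x hx y hy hxy he => by
        have := hs x (hsub x hx) y (hsub y hy) hxy he
        have := card_erase_ge (L x) a
        have := card_erase_ge (L y) a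
        omega)
      (fun Q hQ hne hsing => by
        have h1 := hq Q (fun x hx => hsub x (hQ hx)) hne (by
          intro q hq' w hw he
          by_cases hwu : χ w = χ u
          · exact absurd (he.symm.trans hwu) ((hU'mem q).mp (hQ hq')).2
          · exact hsing q hq' w ((hU'mem w).mpr ⟨hw, hwu⟩) he)
        have h3 : (Q.biUnion L).erase a ⊆ Q.biUnion fun w => (L w).erase a := by
          intro t ht
          simp only [Finset.mem_erase, Finset.mem_biUnion] at ht ⊢
          obtain ⟨hta, w, hw, htw⟩ := ht
          exact ⟨w, hw, hta, htw⟩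
        have h4 := Finset.card_le_card h3
        have h5 := card_erase_ge (Q.biUnion L) a
        omega) rfl
    refine ⟨fun w => if χ w = χ u then a else c w, ?_, ?_⟩
    · intro w hw
      by_cases hwu : χ w = χ u
      · simp only [hwu, if_true]
        rcases h2 w hw u hu v hv hwu (hwu.trans hχ) with h | h | h
        · rwa [h]
        · rwa [h]
        · exact absurd h huv
      · simp only [hwu, if_false]
        exact Finset.mem_of_mem_erase (hc w ((hU'mem w).mpr ⟨hw, hwu⟩))
    · intro x hx y hy hxy
      by_cases h1 : χ x = χ u <;> by_cases h3 : χ y = χ u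
      · exact absurd (h1.trans h3.symm) hxy
      · simp only [h1, h3, if_true, if_false]
        exact (Finset.ne_of_mem_erase (hc y ((hU'mem y).mpr ⟨hy, h3⟩))).symm
      · simp only [h1, h3, if_true, if_false]
        exact Finset.ne_of_mem_erase (hc x ((hU'mem x).mpr ⟨hx, h1⟩))
      · simp only [h1, h3, if_false]
        exact hc' x ((hU'mem x).mpr ⟨hx, h1⟩) y ((hU'mem y).mpr ⟨hy, h3⟩) hxy
  · have hdisj : ∀ u ∈ U, ∀ v ∈ U, u ≠ v → χ u = χ v → Disjoint (L u) (L v) := by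
      intro u hu v hv huv hχ
      rw [Finset.disjoint_left]
      intro a ha hb
      exact hcom ⟨u, hu, v, hv, huv, hχ, a, ha, hb⟩
    obtain ⟨c, hc, hc'⟩ := exists_injOn_choice U L (by
      intro Q hQ
      by_cases hpair : ∃ u ∈ Q, ∃ v ∈ Q, u ≠ v ∧ χ u = χ v
      · obtain ⟨u, hu, v, hv, huv, hχ⟩ := hpair
        have h1 := hs u (hQ hu) v (hQ hv) huv hχ
        have h3 := card_add_le_card_biUnion hu hv (hdisj u (hQ hu) v (hQ hv) huv hχ)
        have := Finset.card_le_card hQ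
        omega
      · push Not at hpair
        have hinj : Set.InjOn χ Q := by
          intro x hx y hy e
          by_contra hne
          exact hpair x hx y hy hne e
        let Q1 := Q.filter fun q => ∀ v ∈ U, χ v = χ q → v = q
        let Q2 := Q.filter fun q => ¬ ∀ v ∈ U, χ v = χ q → v = q
        have hQ12 : Q1.card + Q2.card = Q.card := Finset.card_filter_add_card_filter_not _
        have hQ2 := card_paired_add_card_image_le U Q2 χ
          (fun x hx => hQ (Finset.mem_filter.mp hx).1)
          (fun x hx y hy e => hinj (Finset.mem_filter.mp hx).1 (Finset.mem_filter.mp hy).1 e)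
          (by
            intro q hq'
            have := (Finset.mem_filter.mp hq').2
            push Not at this
            obtain ⟨v, hv, he, hne⟩ := this
            exact ⟨v, hv, hne, he⟩)
        by_cases hne : Q1.Nonempty
        · have h1 := hq Q1 (fun x hx => hQ (Finset.mem_filter.mp hx).1) hne
            (fun q hq' => (Finset.mem_filter.mp hq').2)
          have h3 : (Q1.biUnion L).card ≤ (Q.biUnion L).card :=
            Finset.card_le_card (Finset.biUnion_subset_biUnion_of_subset_left L
              (Finset.filter_subset _ _))
          omega
        · rw [Finset.not_nonempty_iff_eq_empty] at hne
          rw [hne, Finset.card_empty] at hQ12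
          by_cases hQe : Q2.Nonempty
          · obtain ⟨q, hq'⟩ := hQe
            obtain ⟨hqQ, hqp⟩ := Finset.mem_filter.mp hq'
            push Not at hqp
            obtain ⟨v, hv, he, hvq⟩ := hqp
            have h1 := hm q (hQ hqQ) v hv hvq.symm he.symm
            have h3 := card_le_card_biUnion_of_mem (L := L) hqQ
            omega
          · rw [Finset.not_nonempty_iff_eq_empty] at hQe
            rw [hQe, Finset.card_empty] at hQ12
            omega)
    exact ⟨c, hc', fun u hu v hv hne he => hne (by rw [hc hu hv he])⟩

/-! ### Extending a colouring of an attached clique -/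

/-- `T` is a clique of pairwise twin vertices of `S` whose common neighbourhood is a clique. -/
structure Attached (G : SimpleGraph V) (S T : Finset V) : Prop where
  sub : T ⊆ S
  clique : ∀ u ∈ T, ∀ v ∈ T, u ≠ v → G.Adj u v
  twin : ∀ v ∈ S, v ∉ T → ∀ t ∈ T, G.Adj v t → ∀ t' ∈ T, G.Adj v t'
  nbr : ∀ u ∈ S, u ∉ T → ∀ v ∈ S, v ∉ T → u ≠ v → ∀ t ∈ T, G.Adj u t → G.Adj v t → G.Adj u v

/-- Every injective colouring of `T` extends to a list colouring of `S` from lists of size `k`. -/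
def Extendable (G : SimpleGraph V) (k : ℕ) (S T : Finset V) : Prop :=
  ∀ (L : V → Finset ℕ) (f : V → ℕ), (∀ v ∈ S, v ∉ T → k ≤ (L v).card) → Set.InjOn f T →
    ∃ c : V → ℕ, (∀ v ∈ S, v ∉ T → c v ∈ L v) ∧ (∀ t ∈ T, c t = f t) ∧
      ∀ u ∈ S, ∀ v ∈ S, G.Adj u v → c u ≠ c v

lemma Attached.mono {G : SimpleGraph V} {S S' T : Finset V} (h : Attached G S T) (hS : S' ⊆ S)
    (hT : T ⊆ S') : Attached G S' T where
  sub := hT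
  clique := h.clique
  twin v hv := h.twin v (hS hv)
  nbr u hu hu' v hv := h.nbr u (hS hu) hu' v (hS hv)

lemma attached_empty (G : SimpleGraph V) (S : Finset V) : Attached G S ∅ where
  sub := by simp
  clique := by simp
  twin := by simp
  nbr := by simp

lemma exists_mem_sdiff_image [DecidableEq V] {s : Finset ℕ} {N : Finset V} (c : V → ℕ)
    (h : N.card < s.card) : ∃ a ∈ s, ∀ v ∈ N, c v ≠ a := by
  have h1 : (N.image c).card < s.card := lt_of_le_of_lt Finset.card_image_le h
  obtain ⟨a, ha, hn⟩ := Finset.exists_mem_notMem_of_card_lt_card h1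
  exact ⟨a, ha, fun v hv e => hn (e ▸ Finset.mem_image_of_mem c hv)⟩

/-- A vertex with fewer than `k` neighbours can be coloured last. -/
lemma Extendable.of_erase [DecidableEq V] {G : SimpleGraph V} {k : ℕ} {S T : Finset V} {v : V}
    (hv : v ∈ S) (hvT : v ∉ T) (N : Finset V) (hN : N.card < k)
    (hadj : ∀ u ∈ S, G.Adj v u → u ∈ N) (h : Extendable G k (S.erase v) T) :
    Extendable G k S T := by
  intro L f hL hf
  obtain ⟨c, hc, hcT, hcp⟩ := h L f (fun u hu => hL u (Finset.mem_of_mem_erase hu)) hf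
  obtain ⟨a, ha, hna⟩ := exists_mem_sdiff_image c (lt_of_lt_of_le hN (hL v hv hvT))
  refine ⟨Function.update c v a, ?_, ?_, ?_⟩
  · intro u hu huT
    by_cases huv : u = v
    · subst huv; simpa using ha
    · rw [Function.update_of_ne huv]; exact hc u (Finset.mem_erase.mpr ⟨huv, hu⟩) huT
  · intro t ht
    have : t ≠ v := fun e => hvT (e ▸ ht)
    rw [Function.update_of_ne this]; exact hcT t ht
  · intro u hu w hw huw
    by_cases h1 : u = v
    · subst h1
      have h2 : w ≠ u := huw.ne'
      rw [Function.update_self, Function.update_of_ne h2]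
      exact (hna w (hadj w hw huw)).symm
    · by_cases h2 : w = v
      · subst h2
        rw [Function.update_self, Function.update_of_ne h1]
        exact hna u (hadj u hu huw.symm)
      · rw [Function.update_of_ne h1, Function.update_of_ne h2]
        exact hcp u (Finset.mem_erase.mpr ⟨h1, hu⟩) w (Finset.mem_erase.mpr ⟨h2, hw⟩) huw

/-- Colour the part of `S` beyond `C`, then the part `A ∪ C` with the clique `D` precoloured. -/
lemma Extendable.glue [DecidableEq V] {G : SimpleGraph V} {k : ℕ} {S T A C D : Finset V}
    (hω : ∀ Q : Finset V, G.IsClique (Q : Set V) → Q.card ≤ k)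
    (hT : Attached G S T)
    (ih : ∀ S' T', S'.card < S.card → Attached G S' T' → Extendable G k S' T')
    (hA : A ⊆ S) (hC : C ⊆ S) (hDS : D ⊆ S) (hAT : Disjoint A T) (hCT : Disjoint C T)
    (hDA : Disjoint D A) (hDC : Disjoint D C) (hne : A.Nonempty)
    (hCc : ∀ u ∈ C, ∀ v ∈ C, u ≠ v → G.Adj u v)
    (hDc : ∀ u ∈ D, ∀ v ∈ D, u ≠ v → G.Adj u v)
    (hclosed : ∀ a ∈ A, ∀ v ∈ S, G.Adj a v → v ∈ A ∨ v ∈ C)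
    (hCD : ∀ c ∈ C, ∀ v ∈ S, v ∉ A → v ∉ C → (G.Adj c v ↔ v ∈ D))
    (hb : ∃ b ∈ S, b ∉ A ∧ b ∉ C ∧ b ∉ T) : Extendable G k S T := by
  obtain ⟨b, hbS, hbA, hbC, hbT⟩ := hb
  have hnot : ∀ v ∈ D, v ∉ A ∧ v ∉ C := fun v hv =>
    ⟨Finset.disjoint_left.mp hDA hv, Finset.disjoint_left.mp hDC hv⟩
  have hCD' : ∀ c ∈ C, ∀ v ∈ D, G.Adj c v := fun c hc v hv =>
    (hCD c hc v (hDS hv) (hnot v hv).1 (hnot v hv).2).mpr hv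
  have hTA : ∀ t ∈ T, t ∉ A := fun t ht h => Finset.disjoint_left.mp hAT h ht
  have hTC : ∀ t ∈ T, t ∉ C := fun t ht h => Finset.disjoint_left.mp hCT h ht
  by_cases hBD : ∀ v ∈ S, v ∉ A → v ∉ C → v ∈ D
  · have hbD := hBD b hbS hbA hbC
    refine Extendable.of_erase hbS hbT ((C ∪ D).erase b) ?_ ?_ (ih _ _ ?_ (hT.mono
      (Finset.erase_subset _ _) ?_))
    · have : (C ∪ D).card ≤ k := by
        refine hω _ ?_
        intro u hu v hv huv
        simp only [Finset.coe_union, Set.mem_union, Finset.mem_coe] at hu hv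
        rcases hu with hu | hu <;> rcases hv with hv | hv
        · exact hCc u hu v hv huv
        · exact hCD' u hu v hv
        · exact (hCD' v hv u hu).symm
        · exact hDc u hu v hv huv
      have h1 := Finset.card_erase_of_mem (Finset.mem_union_right C hbD)
      have h2 : 0 < (C ∪ D).card := Finset.card_pos.mpr ⟨b, Finset.mem_union_right C hbD⟩
      omega
    · intro u hu hbu
      refine Finset.mem_erase.mpr ⟨hbu.ne', Finset.mem_union.mpr ?_⟩
      by_cases huA : u ∈ A
      · rcases hclosed u huA b hbS hbu.symm with h | h
        · exact absurd h hbA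
        · exact absurd h hbC
      · by_cases huC : u ∈ C
        · exact Or.inl huC
        · exact Or.inr (hBD u hu huA huC)
    · exact Finset.card_erase_lt_of_mem hbS
    · intro t ht
      exact Finset.mem_erase.mpr ⟨fun e => hbT (e ▸ ht), hT.sub ht⟩
  · push Not at hBD
    obtain ⟨w, hwS, hwA, hwC, hwD⟩ := hBD
    intro L f hL hf
    let S1 := S \ (A ∪ C)
    have hS1 : ∀ v, v ∈ S1 ↔ v ∈ S ∧ v ∉ A ∧ v ∉ C := fun v => by simp [S1]
    have hT1 : Attached G S1 T := hT.mono Finset.sdiff_subset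
      (fun t ht => (hS1 t).mpr ⟨hT.sub ht, hTA t ht, hTC t ht⟩)
    obtain ⟨a, ha⟩ := hne
    obtain ⟨c1, hc1, hc1T, hc1p⟩ := ih S1 T (Finset.card_lt_card (Finset.ssubset_iff_subset_ne.mpr
      ⟨Finset.sdiff_subset, fun e => ((hS1 a).mp (e ▸ hA ha)).2.1 ha⟩)) hT1 L f
      (fun v hv => hL v ((hS1 v).mp hv).1) hf
    have hD1 : ∀ v ∈ D, v ∈ S1 := fun v hv => (hS1 v).mpr ⟨hDS hv, hnot v hv⟩
    let S2 := A ∪ C ∪ D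
    have hS2 : ∀ v, v ∈ S2 ↔ (v ∈ A ∨ v ∈ C) ∨ v ∈ D := fun v => by simp [S2, or_assoc]
    have hS2S : S2 ⊆ S := Finset.union_subset (Finset.union_subset hA hC) hDS
    have hAD : ∀ v ∈ A, ∀ d ∈ D, ¬ G.Adj v d := by
      intro v hv d hd had
      rcases hclosed v hv d (hDS hd) had with h | h
      · exact (hnot d hd).1 h
      · exact (hnot d hd).2 h
    have hC2 : ∀ v ∈ S2, v ∉ D → ∀ d ∈ D, G.Adj v d → v ∈ C := by
      intro v hv hvD d hd had
      rcases (hS2 v).mp hv with (h | h) | h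
      · exact absurd had (hAD v h d hd)
      · exact h
      · exact absurd h hvD
    have hT2 : Attached G S2 D :=
      { sub := Finset.subset_union_right
        clique := hDc
        twin := fun v hv hvD t ht had t' ht' => hCD' v (hC2 v hv hvD t ht had) t' ht'
        nbr := fun u hu huD v hv hvD huv t ht hut hvt =>
          hCc u (hC2 u hu huD t ht hut) v (hC2 v hv hvD t ht hvt) huv }
    obtain ⟨c2, hc2, hc2D, hc2p⟩ := ih S2 D (Finset.card_lt_card (Finset.ssubset_iff_subset_ne.mpr
      ⟨hS2S, fun e => by
        rcases (hS2 w).mp (e ▸ hwS) with (h | h) | h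
        · exact hwA h
        · exact hwC h
        · exact hwD h⟩)) hT2 L c1
      (fun v hv hvD => by
        refine hL v (hS2S hv) fun hvT => ?_
        rcases (hS2 v).mp hv with (h | h) | h
        · exact hTA v hvT h
        · exact hTC v hvT h
        · exact hvD h)
      (by
        intro u hu v hv e
        by_contra hne
        exact hc1p u (hD1 u hu) v (hD1 v hv) (hDc u hu v hv hne) e)
    have key : ∀ u ∈ S, (u ∈ A ∨ u ∈ C) → ∀ v ∈ S, ¬ (v ∈ A ∨ v ∈ C) → G.Adj u v → c2 u ≠ c1 v := by
      intro u hu hu1 v hv hv1 huv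
      push Not at hv1
      have huC : u ∈ C := by
        rcases hu1 with h | h
        · rcases hclosed u h v hv huv with h' | h'
          · exact absurd h' hv1.1
          · exact absurd h' hv1.2
        · exact h
      have hvD := (hCD u huC v hv hv1.1 hv1.2).mp huv
      rw [← hc2D v hvD]
      exact hc2p u ((hS2 u).mpr (Or.inl hu1)) v ((hS2 v).mpr (Or.inr hvD)) huv
    refine ⟨fun v => if v ∈ A ∨ v ∈ C then c2 v else c1 v, ?_, ?_, ?_⟩
    · intro v hv hvT
      by_cases h1 : v ∈ A ∨ v ∈ C
      · simp only [h1, if_true]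
        refine hc2 v ((hS2 v).mpr (Or.inl h1)) fun hvD => ?_
        rcases h1 with h | h
        · exact (hnot v hvD).1 h
        · exact (hnot v hvD).2 h
      · simp only [h1, if_false]
        push Not at h1
        exact hc1 v ((hS1 v).mpr ⟨hv, h1⟩) hvT
    · intro t ht
      have : ¬ (t ∈ A ∨ t ∈ C) := by
        push Not; exact ⟨hTA t ht, hTC t ht⟩
      simp only [this, if_false]
      exact hc1T t ht
    · intro u hu v hv huv
      by_cases h1 : u ∈ A ∨ u ∈ C <;> by_cases h2 : v ∈ A ∨ v ∈ C
      · simp only [h1, h2, if_true]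
        exact hc2p u ((hS2 u).mpr (Or.inl h1)) v ((hS2 v).mpr (Or.inl h2)) huv
      · simp only [h1, h2, if_true, if_false]
        exact key u hu h1 v hv h2 huv
      · simp only [h1, h2, if_true, if_false]
        exact (key v hv h2 u hu h1 huv.symm).symm
      · simp only [h1, h2, if_false]
        push Not at h1 h2
        exact hc1p u ((hS1 u).mpr ⟨hu, h1⟩) v ((hS1 v).mpr ⟨hv, h2⟩) huv

/-- Two disjoint triangles `0,1,2` and `3,4,5`, where `0,4` and `1,3` may share a colour. -/
lemma exists_coloring_two_triangles (L : Fin 6 → Finset ℕ) (h0 : 4 ≤ (L 0).card)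
    (h1 : 4 ≤ (L 1).card) (h2 : 4 ≤ (L 2).card) (h3 : 2 ≤ (L 3).card) (h4 : 2 ≤ (L 4).card)
    (h5 : 3 ≤ (L 5).card) :
    ∃ c : Fin 6 → ℕ, (∀ i, c i ∈ L i) ∧ ∀ i j, i ≠ j → ¬ (i = 0 ∧ j = 4) → ¬ (i = 4 ∧ j = 0) →
      ¬ (i = 1 ∧ j = 3) → ¬ (i = 3 ∧ j = 1) → c i ≠ c j := by
  classical
  let χ : Fin 6 → ℕ := ![0, 1, 2, 1, 0, 3]
  have hi : ((Finset.univ : Finset (Fin 6)).image χ).card = 4 := by decide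
  have hu : (Finset.univ : Finset (Fin 6)).card = 6 := rfl
  have hL2 : ∀ i, 2 ≤ (L i).card := by
    intro i; fin_cases i <;> simp <;> omega
  obtain ⟨c, hc, hc'⟩ := exists_coloring_of_parts (Finset.univ : Finset (Fin 6)) χ L
    (by decide)
    (by intro u _ v _ _ _; rw [hi, hu]; have := hL2 u; omega)
    (by
      intro u _ v _ huv he
      rw [hu]
      revert he huv
      fin_cases u <;> fin_cases v <;> simp [χ] <;> omega)
    (by
      intro Q _ hne hs
      rw [hi, hu]
      have hsub : Q ⊆ {2, 5} := by
        intro q hq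
        have := hs q hq
        revert this
        fin_cases q <;> simp [χ, Fin.forall_fin_succ]
      have hcard : Q.card ≤ 2 := (Finset.card_le_card hsub).trans (by decide)
      by_cases h : (2 : Fin 6) ∈ Q
      · have := card_le_card_biUnion_of_mem (L := L) h
        omega
      · have hsub' : Q ⊆ {5} := by
          intro q hq
          have := hsub hq
          simp only [Finset.mem_insert, Finset.mem_singleton] at this ⊢
          rcases this with e | e
          · exact absurd (e ▸ hq) h
          · exact e
        have hcard' : Q.card ≤ 1 := (Finset.card_le_card hsub').trans (by decide)
        obtain ⟨q, hq⟩ := hne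
        have h' : q = 5 := by simpa using hsub' hq
        subst h'
        have := card_le_card_biUnion_of_mem (L := L) hq
        omega)
  refine ⟨c, fun i => hc i (Finset.mem_univ i), fun i j hij a1 a2 a3 a4 =>
    hc' i (Finset.mem_univ i) j (Finset.mem_univ j) ?_⟩
  revert hij a1 a2 a3 a4
  revert i j
  decide

/-- `A` is a nonempty part of `S` cut off by the clique `C`. -/
structure CutPair (G : SimpleGraph V) (S T C A : Finset V) : Prop where
  subC : C ⊆ S
  subA : A ⊆ S
  disjCT : ∀ v ∈ C, v ∉ T
  disjAT : ∀ v ∈ A, v ∉ T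
  disjAC : ∀ v ∈ A, v ∉ C
  ne : A.Nonempty
  clique : ∀ u ∈ C, ∀ v ∈ C, u ≠ v → G.Adj u v
  closed : ∀ a ∈ A, ∀ v ∈ S, G.Adj a v → v ∈ A ∨ v ∈ C
  rest : ∃ b ∈ S, b ∉ A ∧ b ∉ C ∧ b ∉ T

lemma exists_min_cutPair {G : SimpleGraph V} {S T C A : Finset V} (h : CutPair G S T C A) :
    ∃ C A, CutPair G S T C A ∧ ∀ C' A', CutPair G S T C' A' →
      (A.card + C.card < A'.card + C'.card ∨
        (A.card + C.card = A'.card + C'.card ∧ C.card ≤ C'.card)) := by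
  classical
  let P : ℕ → Prop := fun n => ∃ C A, CutPair G S T C A ∧ A.card + C.card = n
  have hP : ∃ n, P n := ⟨_, C, A, h, rfl⟩
  let P' : ℕ → Prop := fun m => ∃ C A, CutPair G S T C A ∧ A.card + C.card = Nat.find hP ∧ C.card = m
  have hP' : ∃ m, P' m := by
    obtain ⟨C, A, h1, h2⟩ := Nat.find_spec hP
    exact ⟨_, C, A, h1, h2, rfl⟩
  obtain ⟨C, A, h1, h2, h3⟩ := Nat.find_spec hP'
  refine ⟨C, A, h1, fun C' A' h' => ?_⟩
  have h4 : Nat.find hP ≤ A'.card + C'.card := Nat.find_min' hP ⟨C', A', h', rfl⟩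
  rcases Nat.lt_or_ge (Nat.find hP) (A'.card + C'.card) with hlt | hge
  · left; omega
  · right
    have h5 : A'.card + C'.card = Nat.find hP := le_antisymm hge h4
    exact ⟨by omega, by rw [h3]; exact Nat.find_min' hP' ⟨C', A', h', h5, rfl⟩⟩

lemma card_le_of_clique_insert [DecidableEq V] {G : SimpleGraph V} {k : ℕ}
    (hω : ∀ Q : Finset V, G.IsClique (Q : Set V) → Q.card ≤ k) (Q : Finset V)
    (h : ∀ u ∈ Q, ∀ v ∈ Q, u ≠ v → G.Adj u v) : Q.card ≤ k :=
  hω Q (fun u hu v hv huv => h u hu v hv huv)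

section cut
variable [DecidableEq V] {G : SimpleGraph V} {k : ℕ} {S T C A : Finset V}

lemma CutPair.exists_adj_right (h : CutPair G S T C A)
    (hmin : ∀ C' A', CutPair G S T C' A' → (A.card + C.card < A'.card + C'.card ∨
        (A.card + C.card = A'.card + C'.card ∧ C.card ≤ C'.card))) {c : V} (hc : c ∈ C) :
    ∃ b ∈ S, b ∉ A ∧ b ∉ C ∧ G.Adj c b := by
  by_contra hno
  push Not at hno
  have hcA : c ∉ A := fun hA => h.disjAC c hA hc
  have := hmin (C.erase c) (insert c A)
    { subC := (Finset.erase_subset _ _).trans h.subC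
      subA := Finset.insert_subset (h.subC hc) h.subA
      disjCT := fun v hv => h.disjCT v (Finset.mem_of_mem_erase hv)
      disjAT := by
        intro v hv
        rcases Finset.mem_insert.mp hv with rfl | hv
        · exact h.disjCT v hc
        · exact h.disjAT v hv
      disjAC := by
        intro v hv hv'
        rcases Finset.mem_insert.mp hv with rfl | hv
        · exact absurd rfl (Finset.ne_of_mem_erase hv')
        · exact h.disjAC v hv (Finset.mem_of_mem_erase hv')
      ne := ⟨c, Finset.mem_insert_self _ _⟩
      clique := fun u hu v hv => h.clique u (Finset.mem_of_mem_erase hu) v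
        (Finset.mem_of_mem_erase hv)
      closed := by
        intro a ha v hv hav
        have : v ∈ A ∨ v ∈ C := by
          rcases Finset.mem_insert.mp ha with rfl | ha
          · by_contra hn
            push Not at hn
            exact hno v hv hn.1 hn.2 hav
          · exact h.closed a ha v hv hav
        rcases this with h' | h'
        · exact Or.inl (Finset.mem_insert_of_mem h')
        · by_cases e : v = c
          · exact Or.inl (e ▸ Finset.mem_insert_self _ _)
          · exact Or.inr (Finset.mem_erase.mpr ⟨e, h'⟩)
      rest := by
        obtain ⟨b, h1, h2, h3, h4⟩ := h.rest
        refine ⟨b, h1, fun hb => ?_, fun hb => h3 (Finset.mem_of_mem_erase hb), h4⟩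
        rcases Finset.mem_insert.mp hb with rfl | hb
        · exact h3 hc
        · exact h2 hb }
  have h1 := Finset.card_erase_of_mem hc
  have h2 := Finset.card_insert_of_notMem hcA
  have h3 : 0 < C.card := Finset.card_pos.mpr ⟨c, hc⟩
  omega

/-- A minimal cut pair cannot be shifted past a vertex with smallest neighbourhood. -/
lemma CutPair.extendable_of_dominated (h : CutPair G S T C A)
    (hmin : ∀ C' A', CutPair G S T C' A' → (A.card + C.card < A'.card + C'.card ∨
        (A.card + C.card = A'.card + C'.card ∧ C.card ≤ C'.card)))
    (hω : ∀ Q : Finset V, G.IsClique (Q : Set V) → Q.card ≤ k) (hT : Attached G S T)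
    (ih : ∀ S' T', S'.card < S.card → Attached G S' T' → Extendable G k S' T')
    {c : V} (hc : c ∈ C)
    (hAA : ∀ a ∈ A, ∀ a' ∈ A, a ≠ a' → G.Adj c a → G.Adj c a' → G.Adj a a')
    (hdom : ∀ c' ∈ C, ∀ a ∈ A, G.Adj c a → G.Adj c' a) : Extendable G k S T := by
  classical
  by_cases hall : ∀ a ∈ A, G.Adj c a
  · obtain ⟨a, ha⟩ := h.ne
    refine Extendable.of_erase (h.subA ha) (h.disjAT a ha) ((A ∪ C).erase a) ?_ ?_
      (ih _ _ (Finset.card_erase_lt_of_mem (h.subA ha)) (hT.mono (Finset.erase_subset _ _) ?_))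
    · have : (A ∪ C).card ≤ k := by
        refine card_le_of_clique_insert hω _ ?_
        intro u hu v hv huv
        rcases Finset.mem_union.mp hu with hu | hu <;> rcases Finset.mem_union.mp hv with hv | hv
        · exact hAA u hu v hv huv (hall u hu) (hall v hv)
        · exact (hdom v hv u hu (hall u hu)).symm
        · exact hdom u hu v hv (hall v hv)
        · exact h.clique u hu v hv huv
      have h1 := Finset.card_erase_lt_of_mem (Finset.mem_union_left C ha)
      omega
    · intro u hu hau
      exact Finset.mem_erase.mpr ⟨hau.ne', Finset.mem_union.mpr (h.closed a ha u hu hau)⟩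
    · intro t ht
      exact Finset.mem_erase.mpr ⟨fun e => h.disjAT a ha (e ▸ ht), hT.sub ht⟩
  · exfalso
    push Not at hall
    obtain ⟨a0, ha0, hna0⟩ := hall
    let N := A.filter fun a => G.Adj c a
    have hN : ∀ v, v ∈ N ↔ v ∈ A ∧ G.Adj c v := fun v => by simp [N]
    have hNA : N ⊆ A := Finset.filter_subset _ _
    have hdisj : Disjoint (C.erase c) N := by
      rw [Finset.disjoint_left]
      intro v hv hv'
      exact h.disjAC v (hNA hv') (Finset.mem_of_mem_erase hv)
    have := hmin (C.erase c ∪ N) (A \ N)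
      { subC := Finset.union_subset ((Finset.erase_subset _ _).trans h.subC) (hNA.trans h.subA)
        subA := Finset.sdiff_subset.trans h.subA
        disjCT := by
          intro v hv
          rcases Finset.mem_union.mp hv with hv | hv
          · exact h.disjCT v (Finset.mem_of_mem_erase hv)
          · exact h.disjAT v (hNA hv)
        disjAT := fun v hv => h.disjAT v (Finset.mem_sdiff.mp hv).1
        disjAC := by
          intro v hv hv'
          obtain ⟨h1, h2⟩ := Finset.mem_sdiff.mp hv
          rcases Finset.mem_union.mp hv' with hv' | hv'
          · exact h.disjAC v h1 (Finset.mem_of_mem_erase hv')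
          · exact h2 hv'
        ne := ⟨a0, Finset.mem_sdiff.mpr ⟨ha0, fun hn => hna0 ((hN a0).mp hn).2⟩⟩
        clique := by
          intro u hu v hv huv
          rcases Finset.mem_union.mp hu with hu | hu <;> rcases Finset.mem_union.mp hv with hv | hv
          · exact h.clique u (Finset.mem_of_mem_erase hu) v (Finset.mem_of_mem_erase hv) huv
          · exact hdom u (Finset.mem_of_mem_erase hu) v (hNA hv) ((hN v).mp hv).2
          · exact (hdom v (Finset.mem_of_mem_erase hv) u (hNA hu) ((hN u).mp hu).2).symm
          · exact hAA u (hNA hu) v (hNA hv) huv ((hN u).mp hu).2 ((hN v).mp hv).2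
        closed := by
          intro a ha v hv hav
          obtain ⟨h1, h2⟩ := Finset.mem_sdiff.mp ha
          rcases h.closed a h1 v hv hav with h' | h'
          · by_cases hvN : v ∈ N
            · exact Or.inr (Finset.mem_union_right _ hvN)
            · exact Or.inl (Finset.mem_sdiff.mpr ⟨h', hvN⟩)
          · refine Or.inr (Finset.mem_union_left _ (Finset.mem_erase.mpr ⟨?_, h'⟩))
            rintro rfl
            exact h2 ((hN a).mpr ⟨h1, hav.symm⟩)
        rest := by
          obtain ⟨b, h1, h2, h3, h4⟩ := h.rest
          refine ⟨b, h1, fun hb => h2 (Finset.mem_sdiff.mp hb).1, fun hb => ?_, h4⟩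
          rcases Finset.mem_union.mp hb with hb | hb
          · exact h3 (Finset.mem_of_mem_erase hb)
          · exact h2 (hNA hb) }
    have h1 := Finset.card_erase_lt_of_mem hc
    have h2 := Finset.card_union_of_disjoint hdisj
    have h3 := Finset.card_sdiff_of_subset hNA
    have h4 := Finset.card_le_card hNA
    omega

end cut

lemma four_le_of_clique {G : SimpleGraph V} {k : ℕ}
    (hω : ∀ Q : Finset V, G.IsClique (Q : Set V) → Q.card ≤ k) {a b c d : V}
    (h1 : G.Adj a b) (h2 : G.Adj a c) (h3 : G.Adj a d) (h4 : G.Adj b c) (h5 : G.Adj b d)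
    (h6 : G.Adj c d) : 4 ≤ k := by
  classical
  have h := hω {a, b, c, d} (by
    intro u hu v hv huv
    simp only [Finset.coe_insert, Finset.coe_singleton, Set.mem_insert_iff,
      Set.mem_singleton_iff] at hu hv
    rcases hu with rfl | rfl | rfl | rfl <;> rcases hv with rfl | rfl | rfl | rfl <;>
      first | exact absurd rfl huv | assumption | (apply SimpleGraph.Adj.symm; assumption))
  have e : ({a, b, c, d} : Finset V).card = 4 := by
    rw [Finset.card_eq_succ]
    refine ⟨a, {b, c, d}, ?_, rfl, Finset.card_eq_three.mpr ⟨b, c, d, h4.ne, h5.ne, h6.ne, rfl⟩⟩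
    simp [h1.ne, h2.ne, h3.ne]
  omega

lemma five_le_of_clique {G : SimpleGraph V} {k : ℕ}
    (hω : ∀ Q : Finset V, G.IsClique (Q : Set V) → Q.card ≤ k) {a b c d e : V}
    (h1 : G.Adj a b) (h2 : G.Adj a c) (h3 : G.Adj a d) (h4 : G.Adj b c) (h5 : G.Adj b d)
    (h6 : G.Adj c d) (h7 : G.Adj a e) (h8 : G.Adj b e) (h9 : G.Adj c e) (h10 : G.Adj d e) :
    5 ≤ k := by
  classical
  have h := hω {a, b, c, d, e} (by
    intro u hu v hv huv
    simp only [Finset.coe_insert, Finset.coe_singleton, Set.mem_insert_iff,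
      Set.mem_singleton_iff] at hu hv
    rcases hu with rfl | rfl | rfl | rfl | rfl <;> rcases hv with rfl | rfl | rfl | rfl | rfl <;>
      first | exact absurd rfl huv | assumption | (apply SimpleGraph.Adj.symm; assumption))
  have e : ({a, b, c, d, e} : Finset V).card = 5 := by
    rw [Finset.card_insert_of_notMem, Finset.card_insert_of_notMem,
      Finset.card_eq_three.mpr ⟨c, d, e, h6.ne, h9.ne, h10.ne, rfl⟩]
    · simp [h4.ne, h5.ne, h8.ne]
    · simp [h1.ne, h2.ne, h3.ne, h7.ne]
  omega

section cut
variable [DecidableEq V] {G : SimpleGraph V} {k : ℕ} {S T C A : Finset V}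

/-- The end `A ∪ C` of a cut consists of two triangles and is coloured last. -/
lemma extendable_of_two_triangles {a1 a2 a3 c1 c2 c3 b b' : V} (hk : k = 4)
    (hT : Attached G S T)
    (ih : ∀ S' T', S'.card < S.card → Attached G S' T' → Extendable G k S' T')
    (hA : ∀ v, v ∈ A ↔ v = a1 ∨ v = a2 ∨ v = a3) (hC : ∀ v, v ∈ C ↔ v = c1 ∨ v = c2 ∨ v = c3)
    (h : CutPair G S T C A) (n12 : a1 ≠ a2) (n13 : a1 ≠ a3) (n23 : a2 ≠ a3)
    (m12 : c1 ≠ c2) (m13 : c1 ≠ c3) (m23 : c2 ≠ c3) (h15 : ¬ G.Adj a1 c2) (h24 : ¬ G.Adj a2 c1)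
    (hD : ∀ c ∈ C, ∀ v ∈ S, v ∉ A → v ∉ C → G.Adj c v → v = b ∨ v = b')
    (hD3 : ∀ v ∈ S, v ∉ A → v ∉ C → G.Adj c3 v → v = b) : Extendable G k S T := by
  intro L f hL hf
  let S1 := S \ (A ∪ C)
  have hS1 : ∀ v, v ∈ S1 ↔ v ∈ S ∧ v ∉ A ∧ v ∉ C := fun v => by simp [S1]
  have ha1 : a1 ∈ A := (hA a1).mpr (Or.inl rfl)
  have hT1 : Attached G S1 T := hT.mono Finset.sdiff_subset
    (fun t ht => (hS1 t).mpr ⟨hT.sub ht, fun h' => h.disjAT t h' ht, fun h' => h.disjCT t h' ht⟩)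
  obtain ⟨c, hc, hcT, hcp⟩ := ih S1 T (Finset.card_lt_card (Finset.ssubset_iff_subset_ne.mpr
      ⟨Finset.sdiff_subset, fun e => ((hS1 a1).mp (e ▸ h.subA ha1)).2.1 ha1⟩)) hT1 L f
      (fun v hv => hL v ((hS1 v).mp hv).1) hf
  let e : Fin 6 → V := ![a1, a2, a3, c1, c2, c3]
  have hAC : ∀ a c, (a = a1 ∨ a = a2 ∨ a = a3) → (c = c1 ∨ c = c2 ∨ c = c3) → a ≠ c := by
    intro a c ha hc e
    exact h.disjAC a ((hA a).mpr ha) (e ▸ (hC c).mpr hc)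
  have he : Function.Injective e := by
    have d : ∀ i j, i < j → e i ≠ e j := by
      intro i j
      fin_cases i <;> fin_cases j <;> simp [e, n12, n13, n23, m12, m13, m23] <;>
        exact hAC _ _ (by simp) (by simp)
    intro i j hij
    rcases lt_trichotomy i j with hl | hl | hl
    · exact absurd hij (d i j hl)
    · exact hl
    · exact absurd hij.symm (d j i hl)
  have heA : ∀ v, v ∈ A ∨ v ∈ C ↔ ∃ i, e i = v := by
    intro v
    rw [hA, hC]
    simp only [Fin.exists_fin_succ, e]
    simp [eq_comm, or_assoc]
  let M : Fin 6 → Finset ℕ := ![L a1, L a2, L a3, L c1 \ {c b, c b'}, L c2 \ {c b, c b'}, L c3 \ {c b}]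
  have hLv : ∀ v, v ∈ A ∨ v ∈ C → 4 ≤ (L v).card := by
    intro v hv
    rw [← hk]
    rcases hv with hv | hv
    · exact hL v (h.subA hv) (h.disjAT v hv)
    · exact hL v (h.subC hv) (h.disjCT v hv)
  have hpair : ∀ s : Finset ℕ, 4 ≤ s.card → 2 ≤ (s \ {c b, c b'}).card := by
    intro s hs
    have h1 := Finset.le_card_sdiff ({c b, c b'} : Finset ℕ) s
    have h2 := Finset.card_le_two (a := c b) (b := c b')
    omega
  obtain ⟨g, hg, hgp⟩ := exists_coloring_two_triangles M
    (hLv a1 (by simp [hA])) (hLv a2 (by simp [hA])) (hLv a3 (by simp [hA]))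
    (hpair _ (hLv c1 (by simp [hC]))) (hpair _ (hLv c2 (by simp [hC])))
    (by
      have h1 := Finset.le_card_sdiff ({c b} : Finset ℕ) (L c3)
      have h2 := hLv c3 (by simp [hC])
      have h3 : (M 5).card = (L c3 \ {c b}).card := rfl
      rw [Finset.card_singleton] at h1
      omega)
  have hML : ∀ i, M i ⊆ L (e i) := by
    intro i
    fin_cases i <;> simp [M, e, Finset.sdiff_subset]
  have hout : ∀ i, ∀ v ∈ S, v ∉ A → v ∉ C → G.Adj (e i) v → g i ≠ c v := by
    intro i v hv hvA hvC hadj heq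
    by_cases hiC : e i ∈ C
    · have h1 := hD _ hiC v hv hvA hvC hadj
      have h2 := hg i
      rw [heq] at h2
      have h3 : e i = c1 ∨ e i = c2 ∨ e i = c3 := (hC _).mp hiC
      rcases h3 with h3 | h3 | h3
      · have h4 : i = 3 := he h3
        subst h4
        have : c v ∈ L c1 \ {c b, c b'} := h2
        rcases h1 with rfl | rfl <;> simp at this
      · have h4 : i = 4 := he h3
        subst h4
        have : c v ∈ L c2 \ {c b, c b'} := h2
        rcases h1 with rfl | rfl <;> simp at this
      · have h4 : i = 5 := he h3
        subst h4
        have : c v ∈ L c3 \ {c b} := h2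
        have h5 := hD3 v hv hvA hvC (h3 ▸ hadj)
        subst h5
        simp at this
    · have hiA : e i ∈ A := ((heA (e i)).mpr ⟨i, rfl⟩).resolve_right hiC
      rcases h.closed _ hiA v hv hadj with h' | h'
      · exact hvA h'
      · exact hvC h'
  let c' : V → ℕ := Function.extend e g c
  have hc'e : ∀ i, c' (e i) = g i := fun i => he.extend_apply g c i
  have hc'o : ∀ v, v ∉ A → v ∉ C → c' v = c v := fun v h1 h2 =>
    Function.extend_apply' g c v (fun h' => by
      rcases (heA v).mpr h' with h' | h'
      · exact h1 h'
      · exact h2 h')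
  refine ⟨c', ?_, ?_, ?_⟩
  · intro v hv hvT
    by_cases hvAC : v ∈ A ∨ v ∈ C
    · obtain ⟨i, rfl⟩ := (heA v).mp hvAC
      rw [hc'e]; exact hML i (hg i)
    · push Not at hvAC
      rw [hc'o v hvAC.1 hvAC.2]
      exact hc v ((hS1 v).mpr ⟨hv, hvAC⟩) hvT
  · intro t ht
    rw [hc'o t (fun h' => h.disjAT t h' ht) (fun h' => h.disjCT t h' ht)]
    exact hcT t ht
  · intro u hu v hv huv
    by_cases hu1 : u ∈ A ∨ u ∈ C <;> by_cases hv1 : v ∈ A ∨ v ∈ C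
    · obtain ⟨i, rfl⟩ := (heA u).mp hu1
      obtain ⟨j, rfl⟩ := (heA v).mp hv1
      rw [hc'e, hc'e]
      refine hgp i j (fun e' => huv.ne (by rw [e'])) ?_ ?_ ?_ ?_
      · rintro ⟨rfl, rfl⟩; exact h15 huv
      · rintro ⟨rfl, rfl⟩; exact h15 huv.symm
      · rintro ⟨rfl, rfl⟩; exact h24 huv
      · rintro ⟨rfl, rfl⟩; exact h24 huv.symm
    · obtain ⟨i, rfl⟩ := (heA u).mp hu1
      push Not at hv1
      rw [hc'e, hc'o v hv1.1 hv1.2]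
      exact hout i v hv hv1.1 hv1.2 huv
    · obtain ⟨i, rfl⟩ := (heA v).mp hv1
      push Not at hu1
      rw [hc'e, hc'o u hu1.1 hu1.2]
      exact (hout i u hu hu1.1 hu1.2 huv.symm).symm
    · push Not at hu1 hv1
      rw [hc'o u hu1.1 hu1.2, hc'o v hv1.1 hv1.2]
      exact hcp u ((hS1 u).mpr ⟨hu, hu1⟩) v ((hS1 v).mpr ⟨hv, hv1⟩) huv

end cut

lemma adj_of_four {G : SimpleGraph V} {a b c d : V} (h1 : G.Adj a b) (h2 : G.Adj a c)
    (h3 : G.Adj a d) (h4 : G.Adj b c) (h5 : G.Adj b d) (h6 : G.Adj c d) (u v : V)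
    (hu : u = a ∨ u = b ∨ u = c ∨ u = d) (hv : v = a ∨ v = b ∨ v = c ∨ v = d) (huv : u ≠ v) :
    G.Adj u v := by
  rcases hu with rfl | rfl | rfl | rfl <;> rcases hv with rfl | rfl | rfl | rfl <;>
    first | exact absurd rfl huv | assumption | (apply SimpleGraph.Adj.symm; assumption)

section cut
variable [DecidableEq V] {G : SimpleGraph V} {k : ℕ} {S T : Finset V}

set_option maxHeartbeats 1000000 in
/-- Clique cutsets are reducible. -/
lemma extendable_of_cutPair (hclaw : IsClawFree G)
    (hω : ∀ Q : Finset V, G.IsClique (Q : Set V) → Q.card ≤ k) (hk : k ≤ 4)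
    (hT : Attached G S T)
    (ih : ∀ S' T', S'.card < S.card → Attached G S' T' → Extendable G k S' T')
    (hα : (∀ x ∈ S, ∀ y ∈ S, ∀ z ∈ S, x ∉ T → y ∉ T → z ∉ T → x ≠ y → x ≠ z → y ≠ z →
      ¬ G.Adj x y → ¬ G.Adj x z → ¬ G.Adj y z → False) → Extendable G k S T)
    {C₀ A₀ : Finset V} (h₀ : CutPair G S T C₀ A₀) : Extendable G k S T := by
  classical
  obtain ⟨C, A, h, hmin⟩ := exists_min_cutPair h₀
  have hno : ∀ a ∈ A, ∀ b ∈ S, b ∉ A → b ∉ C → ¬ G.Adj a b := by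
    intro a ha b hb h1 h2 hab
    rcases h.closed a ha b hb hab with h' | h'
    · exact h1 h'
    · exact h2 h'
  have hAA : ∀ c ∈ C, ∀ a ∈ A, ∀ a' ∈ A, a ≠ a' → G.Adj c a → G.Adj c a' → G.Adj a a' := by
    intro c hc a ha a' ha' hne h1 h2
    by_contra hn
    obtain ⟨b, hb, hbA, hbC, hcb⟩ := h.exists_adj_right hmin hc
    exact hclaw c a a' b h1 h2 hcb hn (hno a ha b hb hbA hbC) (hno a' ha' b hb hbA hbC) hne
      (fun e => hbA (e ▸ ha)) (fun e => hbA (e ▸ ha'))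
  have hAT : Disjoint A T := Finset.disjoint_left.mpr h.disjAT
  have hCT : Disjoint C T := Finset.disjoint_left.mpr h.disjCT
  by_cases hdom : ∃ c ∈ C, ∀ c' ∈ C, ∀ a ∈ A, G.Adj c a → G.Adj c' a
  · obtain ⟨c, hc, hdom⟩ := hdom
    exact h.extendable_of_dominated hmin hω hT ih hc (hAA c hc) hdom
  push Not at hdom
  rcases C.eq_empty_or_nonempty with hCe | hCne
  · refine Extendable.glue (D := ∅) hω hT ih h.subA h.subC (by simp) hAT hCT (by simp)
      (by simp) h.ne h.clique (by simp) h.closed (by simp [hCe]) h.rest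
  obtain ⟨c1, hc1, hc1min⟩ := Finset.exists_min_image C
    (fun c => (A.filter fun a => G.Adj c a).card) hCne
  obtain ⟨c2, hc2, a1, ha1, h11, h21⟩ := hdom c1 hc1
  have h12 : c1 ≠ c2 := by rintro rfl; exact h21 h11
  have sub_absurd : ∀ c ∈ C, (∀ a ∈ A, G.Adj c a → G.Adj c1 a) →
      ∀ a ∈ A, G.Adj c1 a → G.Adj c a := by
    intro c hc hsub a ha h1
    by_contra hn
    have hlt : (A.filter fun a => G.Adj c a).card < (A.filter fun a => G.Adj c1 a).card := by
      refine Finset.card_lt_card (Finset.ssubset_iff_subset_ne.mpr ⟨?_, ?_⟩)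
      · intro x hx
        obtain ⟨h2, h3⟩ := Finset.mem_filter.mp hx
        exact Finset.mem_filter.mpr ⟨h2, hsub x h2 h3⟩
      · intro e
        have : a ∈ A.filter fun a => G.Adj c a := by
          rw [e]; exact Finset.mem_filter.mpr ⟨ha, h1⟩
        exact hn (Finset.mem_filter.mp this).2
    exact absurd (hc1min c hc) (not_le.mpr hlt)
  obtain ⟨a2, ha2, h22, h1n2⟩ : ∃ a2 ∈ A, G.Adj c2 a2 ∧ ¬ G.Adj c1 a2 := by
    by_contra hn
    push Not at hn
    exact h21 (sub_absurd c2 hc2 hn a1 ha1 h11)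
  -- comparing neighbourhoods on the two sides
  have cmp : ∀ c ∈ C, ∀ c' ∈ C, ∀ a ∈ A, G.Adj c a → ¬ G.Adj c' a →
      ∀ b ∈ S, b ∉ A → b ∉ C → G.Adj c b → G.Adj c' b := by
    intro c hc c' hc' a ha h1 h2 b hb hbA hbC h3
    by_contra hn
    have hcc : c ≠ c' := by rintro rfl; exact h2 h1
    exact hclaw c a b c' h1 h3 (h.clique c hc c' hc' hcc) (hno a ha b hb hbA hbC)
      (fun e => h2 e.symm) (fun e => hn e.symm) (fun e => hbA (e ▸ ha))
      (fun e => h.disjAC a ha (e ▸ hc')) (fun e => hbC (e ▸ hc'))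
  let D := S.filter fun b => b ∉ A ∧ b ∉ C ∧ G.Adj c1 b
  have hD : ∀ b, b ∈ D ↔ b ∈ S ∧ b ∉ A ∧ b ∉ C ∧ G.Adj c1 b := fun b => by simp [D]
  have hDS : D ⊆ S := Finset.filter_subset _ _
  have hD2 : ∀ b ∈ D, G.Adj c2 b := by
    intro b hb
    obtain ⟨h1, h2, h3, h4⟩ := (hD b).mp hb
    exact cmp c1 hc1 c2 hc2 a1 ha1 h11 h21 b h1 h2 h3 h4
  have hDc : ∀ u ∈ D, ∀ v ∈ D, u ≠ v → G.Adj u v := by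
    intro u hu v hv huv
    by_contra hn
    obtain ⟨u1, u2, u3, u4⟩ := (hD u).mp hu
    obtain ⟨v1, v2, v3, v4⟩ := (hD v).mp hv
    exact hclaw c1 u v a1 u4 v4 h11 hn (fun e => hno a1 ha1 u u1 u2 u3 e.symm)
      (fun e => hno a1 ha1 v v1 v2 v3 e.symm) huv (fun e => u2 (e ▸ ha1)) (fun e => v2 (e ▸ ha1))
  have hND : ∀ c ∈ C, ∀ b ∈ S, b ∉ A → b ∉ C → G.Adj c b → b ∈ D := by
    intro c hc b hb hbA hbC hcb
    by_contra hbD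
    have hc1b : ¬ G.Adj c1 b := fun e => hbD ((hD b).mpr ⟨hb, hbA, hbC, e⟩)
    have hc2b : ¬ G.Adj c2 b := fun e =>
      hc1b (cmp c2 hc2 c1 hc1 a2 ha2 h22 h1n2 b hb hbA hbC e)
    have hs1 : ∀ a ∈ A, G.Adj c a → G.Adj c1 a := by
      intro a ha h1
      by_contra hn
      exact hc1b (cmp c hc c1 hc1 a ha h1 hn b hb hbA hbC hcb)
    have hs2 : ∀ a ∈ A, G.Adj c a → G.Adj c2 a := by
      intro a ha h1
      by_contra hn
      exact hc2b (cmp c hc c2 hc2 a ha h1 hn b hb hbA hbC hcb)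
    exact h21 (hs2 a1 ha1 (sub_absurd c hc hs1 a1 ha1 h11))
  have hDA : Disjoint D A := Finset.disjoint_left.mpr fun b hb => ((hD b).mp hb).2.1
  have hDC : Disjoint D C := Finset.disjoint_left.mpr fun b hb => ((hD b).mp hb).2.2.1
  by_cases hall : ∀ c ∈ C, ∀ b ∈ D, G.Adj c b
  · exact Extendable.glue (D := D) hω hT ih h.subA h.subC hDS hAT hCT hDA hDC h.ne h.clique
      hDc h.closed (fun c hc v hv hvA hvC => ⟨hND c hc v hv hvA hvC, hall c hc v⟩) h.rest
  push Not at hall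
  obtain ⟨c3, hc3, b, hbD, h3b⟩ := hall
  obtain ⟨hbS, hbA, hbC, h1b⟩ := (hD b).mp hbD
  have h2b := hD2 b hbD
  obtain ⟨b', hb'S, hb'A, hb'C, h3b'⟩ := h.exists_adj_right hmin hc3
  have hb'D := hND c3 hc3 b' hb'S hb'A hb'C h3b'
  have h1b' := ((hD b').mp hb'D).2.2.2
  have h2b' := hD2 b' hb'D
  have hbb' : b ≠ b' := by rintro rfl; exact h3b h3b'
  have h13 : c1 ≠ c3 := by rintro rfl; exact h3b h1b
  have h23 : c2 ≠ c3 := by rintro rfl; exact h3b h2b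
  have A12 := h.clique c1 hc1 c2 hc2 h12
  have A13 := h.clique c1 hc1 c3 hc3 h13
  have A23 := h.clique c2 hc2 c3 hc3 h23
  have Abb := hDc b hbD b' hb'D hbb'
  have hk4 : k = 4 := le_antisymm hk (four_le_of_clique hω A12 A13 h1b' A23 h2b' h3b')
  have no5 : ∀ {a b c d e : V}, G.Adj a b → G.Adj a c → G.Adj a d → G.Adj b c → G.Adj b d →
      G.Adj c d → G.Adj a e → G.Adj b e → G.Adj c e → G.Adj d e → False := by
    intro a b c d e g1 g2 g3 g4 g5 g6 g7 g8 g9 g10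
    have := five_le_of_clique hω g1 g2 g3 g4 g5 g6 g7 g8 g9 g10
    omega
  have hDbb : ∀ d ∈ D, d = b ∨ d = b' := by
    intro d hd
    by_contra hn
    push Not at hn
    exact no5 A12 h1b h1b' h2b h2b' Abb ((hD d).mp hd).2.2.2 (hD2 d hd)
      (hDc b hbD d hd hn.1.symm) (hDc b' hb'D d hd hn.2.symm)
  have h31 : G.Adj c3 a1 := by
    by_contra hn
    exact h3b (cmp c1 hc1 c3 hc3 a1 ha1 h11 hn b hbS hbA hbC h1b)
  have h32 : G.Adj c3 a2 := by
    by_contra hn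
    exact h3b (cmp c2 hc2 c3 hc3 a2 ha2 h22 hn b hbS hbA hbC h2b)
  -- a further vertex of the cut misses `b'` and sees `b`
  have hc4 : ∀ c ∈ C, c ≠ c1 → c ≠ c2 → c ≠ c3 → G.Adj c b ∧ ¬ G.Adj c b' := by
    intro c hc n1 n2 n3
    have hnb' : ¬ G.Adj c b' := fun e => no5 A12 A13 (h.clique c1 hc1 c hc n1.symm) A23
      (h.clique c2 hc2 c hc n2.symm) (h.clique c3 hc3 c hc n3.symm) h1b' h2b' h3b' e
    refine ⟨?_, hnb'⟩
    obtain ⟨d, hdS, hdA, hdC, hcd⟩ := h.exists_adj_right hmin hc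
    rcases hDbb d (hND c hc d hdS hdA hdC hcd) with rfl | rfl
    · exact hcd
    · exact absurd hcd hnb'
  have h3A : ∀ c ∈ C, ∀ a ∈ A, G.Adj c a → G.Adj c3 a := by
    intro c hc a ha hca
    by_contra hn
    have hcb : G.Adj c b := by
      by_cases n1 : c = c1
      · rw [n1]; exact h1b
      by_cases n2 : c = c2
      · rw [n2]; exact h2b
      by_cases n3 : c = c3
      · rw [n3] at hca; exact absurd hca hn
      exact (hc4 c hc n1 n2 n3).1
    exact h3b (cmp c hc c3 hc3 a ha hca hn b hbS hbA hbC hcb)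
  have hA3 : ∀ a ∈ A, G.Adj c3 a := by
    by_contra hn
    push Not at hn
    obtain ⟨a0, ha0, hna0⟩ := hn
    let N := A.filter fun a => G.Adj c3 a
    have hN : ∀ v, v ∈ N ↔ v ∈ A ∧ G.Adj c3 v := fun v => by simp [N]
    have hNA : N ⊆ A := Finset.filter_subset _ _
    have := hmin N (A \ N)
      { subC := hNA.trans h.subA
        subA := Finset.sdiff_subset.trans h.subA
        disjCT := fun v hv => h.disjAT v (hNA hv)
        disjAT := fun v hv => h.disjAT v (Finset.mem_sdiff.mp hv).1
        disjAC := fun v hv => (Finset.mem_sdiff.mp hv).2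
        ne := ⟨a0, Finset.mem_sdiff.mpr ⟨ha0, fun hn => hna0 ((hN a0).mp hn).2⟩⟩
        clique := fun u hu v hv huv => hAA c3 hc3 u (hNA hu) v (hNA hv) huv ((hN u).mp hu).2
          ((hN v).mp hv).2
        closed := by
          intro a ha v hv hav
          obtain ⟨g1, g2⟩ := Finset.mem_sdiff.mp ha
          rcases h.closed a g1 v hv hav with h' | h'
          · by_cases hvN : v ∈ N
            · exact Or.inr hvN
            · exact Or.inl (Finset.mem_sdiff.mpr ⟨h', hvN⟩)
          · exact absurd ((hN a).mpr ⟨g1, h3A v h' a g1 hav.symm⟩) g2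
        rest := by
          obtain ⟨b, g1, g2, g3, g4⟩ := h.rest
          exact ⟨b, g1, fun hb => g2 (Finset.mem_sdiff.mp hb).1, fun hb => g2 (hNA hb), g4⟩ }
    have g3 := Finset.card_sdiff_of_subset hNA
    have g4 := Finset.card_le_card hNA
    have g5 := Finset.card_pos.mpr hCne
    omega
  have hAcl : ∀ a ∈ A, ∀ a' ∈ A, a ≠ a' → G.Adj a a' := fun a ha a' ha' hne =>
    hAA c3 hc3 a ha a' ha' hne (hA3 a ha) (hA3 a' ha')
  have ha12 : a1 ≠ a2 := by rintro rfl; exact h1n2 h11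
  have Aa := hAcl a1 ha1 a2 ha2 ha12
  have hnoA : ∀ c ∈ C, ∀ d ∈ S, d ∉ A → d ∉ C → d ∉ D → ¬ G.Adj c d :=
    fun c hc d hd g1 g2 g3 g4 => g3 (hND c hc d hd g1 g2 g4)
  by_cases hex : ∃ c ∈ C, c ≠ c1 ∧ c ≠ c2 ∧ c ≠ c3
  · obtain ⟨c4, hc4C, n41, n42, n43⟩ := hex
    obtain ⟨h4b, h4b'⟩ := hc4 c4 hc4C n41 n42 n43
    have A14 := h.clique c1 hc1 c4 hc4C n41.symm
    have A24 := h.clique c2 hc2 c4 hc4C n42.symm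
    have A34 := h.clique c3 hc3 c4 hc4C n43.symm
    have hA4 : ∀ a ∈ A, G.Adj c4 a := by
      intro a ha
      by_contra hn
      exact h4b' (cmp c3 hc3 c4 hc4C a ha (hA3 a ha) hn b' hb'S hb'A hb'C h3b')
    have hA2 : ∀ a ∈ A, a = a1 ∨ a = a2 := by
      intro a ha
      by_contra hn
      push Not at hn
      exact no5 A34 h31 h32 (hA4 a1 ha1) (hA4 a2 ha2) Aa (hA3 a ha) (hA4 a ha)
        (hAcl a1 ha1 a ha hn.1.symm) (hAcl a2 ha2 a ha hn.2.symm)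
    have hC4 : ∀ c ∈ C, c = c1 ∨ c = c2 ∨ c = c3 ∨ c = c4 := by
      intro c hc
      by_contra hn
      push Not at hn
      exact no5 A12 A13 A14 A23 A24 A34 (h.clique c1 hc1 c hc hn.1.symm)
        (h.clique c2 hc2 c hc hn.2.1.symm) (h.clique c3 hc3 c hc hn.2.2.1.symm)
        (h.clique c4 hc4C c hc hn.2.2.2.symm)
    have hc4T := h.disjCT c4 hc4C
    have hc3T := h.disjCT c3 hc3
    have hbT : b ∉ T := by
      intro hb
      by_cases hb' : b' ∈ T
      · exact h4b' (hT.twin c4 (h.subC hc4C) hc4T b hb h4b b' hb')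
      · exact h4b' (hT.nbr c4 (h.subC hc4C) hc4T b' hb'S hb' (fun e => hb'C (e ▸ hc4C)) b hb h4b
          Abb.symm)
    have hb'T : b' ∉ T := by
      intro hb
      exact h3b (hT.nbr c3 (h.subC hc3) hc3T b hbS hbT (fun e => hbC (e ▸ hc3)) b' hb h3b' Abb)
    by_cases hrest : ∃ e ∈ S, e ∉ A ∪ C ∧ e ∉ D ∧ e ∉ T
    · let E := S.filter fun e => e ∉ A ∧ e ∉ C ∧ e ∉ D ∧ G.Adj b e
      have hE : ∀ e, e ∈ E ↔ e ∈ S ∧ e ∉ A ∧ e ∉ C ∧ e ∉ D ∧ G.Adj b e := fun e => by simp [E]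
      have hEb : ∀ e ∈ S, e ∉ A → e ∉ C → e ∉ D → (G.Adj b e ↔ G.Adj b' e) := by
        intro e he g1 g2 g3
        constructor
        · intro hbe
          by_contra hn
          exact hclaw b c4 b' e h4b.symm Abb hbe h4b' (hnoA c4 hc4C e he g1 g2 g3)
            hn (fun e' => hb'C (e' ▸ hc4C)) (fun e' => g2 (e' ▸ hc4C)) (fun e' => g3 (e' ▸ hb'D))
        · intro hbe
          by_contra hn
          exact hclaw b' c3 b e h3b'.symm Abb.symm hbe h3b (hnoA c3 hc3 e he g1 g2 g3)
            hn (fun e' => hbC (e' ▸ hc3)) (fun e' => g2 (e' ▸ hc3)) (fun e' => g3 (e' ▸ hbD))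
      refine Extendable.glue (A := A ∪ C) (C := D) (D := E) hω hT ih
        (Finset.union_subset h.subA h.subC) hDS (Finset.filter_subset _ _) ?_ ?_ ?_ ?_ ?_ hDc ?_ ?_
        ?_ hrest
      · exact Finset.disjoint_union_left.mpr ⟨hAT, hCT⟩
      · rw [Finset.disjoint_left]
        intro d hd
        rcases hDbb d hd with rfl | rfl
        · exact hbT
        · exact hb'T
      · rw [Finset.disjoint_left]
        intro e he he'
        obtain ⟨_, g1, g2, _⟩ := (hE e).mp he
        rcases Finset.mem_union.mp he' with h' | h'
        · exact g1 h'
        · exact g2 h'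
      · rw [Finset.disjoint_left]
        exact fun e he => ((hE e).mp he).2.2.2.1
      · exact ⟨a1, Finset.mem_union_left _ ha1⟩
      · intro u hu v hv huv
        by_contra hn
        obtain ⟨u1, u2, u3, u4, u5⟩ := (hE u).mp hu
        obtain ⟨v1, v2, v3, v4, v5⟩ := (hE v).mp hv
        exact hclaw b u v c1 u5 v5 h1b.symm hn (fun e => hnoA c1 hc1 u u1 u2 u3 u4 e.symm)
          (fun e => hnoA c1 hc1 v v1 v2 v3 v4 e.symm) huv (fun e => u3 (e ▸ hc1))
          (fun e => v3 (e ▸ hc1))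
      · intro x hx v hv hxv
        by_cases hvA : v ∈ A
        · exact Or.inl (Finset.mem_union_left _ hvA)
        by_cases hvC : v ∈ C
        · exact Or.inl (Finset.mem_union_right _ hvC)
        rcases Finset.mem_union.mp hx with hx | hx
        · exact absurd hxv (hno x hx v hv hvA hvC)
        · exact Or.inr (hND x hx v hv hvA hvC hxv)
      · intro d hd v hv hvAC hvD
        have g1 : v ∉ A := fun e => hvAC (Finset.mem_union_left _ e)
        have g2 : v ∉ C := fun e => hvAC (Finset.mem_union_right _ e)
        rw [hE]
        rcases hDbb d hd with rfl | rfl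
        · exact ⟨fun e => ⟨hv, g1, g2, hvD, e⟩, fun e => e.2.2.2.2⟩
        · rw [← hEb v hv g1 g2 hvD]
          exact ⟨fun e => ⟨hv, g1, g2, hvD, e⟩, fun e => e.2.2.2.2⟩
    · push Not at hrest
      apply hα
      have cover : ∀ v ∈ S, v ∉ T → (v = a1 ∨ v = a2 ∨ v = c3 ∨ v = c4) ∨
          (v = c1 ∨ v = c2 ∨ v = b ∨ v = b') := by
        intro v hv hvT
        by_cases hvA : v ∈ A
        · have := hA2 v hvA; tauto
        by_cases hvC : v ∈ C
        · have := hC4 v hvC; tauto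
        by_cases hvD : v ∈ D
        · have := hDbb v hvD; tauto
        · exact absurd (hrest v hv (by simp [hvA, hvC]) hvD) hvT
      have K1 := adj_of_four Aa h31.symm (hA4 a1 ha1).symm h32.symm (hA4 a2 ha2).symm A34
      have K2 := adj_of_four A12 h1b h1b' h2b h2b' Abb
      intro x hx y hy z hz hxT hyT hzT hxy hxz hyz nxy nxz nyz
      rcases cover x hx hxT with c1 | c1 <;> rcases cover y hy hyT with c2 | c2 <;>
        rcases cover z hz hzT with c3 | c3
      · exact nxy (K1 x y c1 c2 hxy)
      · exact nxy (K1 x y c1 c2 hxy)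
      · exact nxz (K1 x z c1 c3 hxz)
      · exact nyz (K2 y z c2 c3 hyz)
      · exact nyz (K1 y z c2 c3 hyz)
      · exact nxz (K2 x z c1 c3 hxz)
      · exact nxy (K2 x y c1 c2 hxy)
      · exact nxy (K2 x y c1 c2 hxy)
  · push Not at hex
    have hC3 : ∀ v, v ∈ C ↔ v = c1 ∨ v = c2 ∨ v = c3 := by
      intro v
      constructor
      · intro hv
        by_contra hn
        push Not at hn
        exact hn.2.2 (hex v hv hn.1 hn.2.1)
      · rintro (rfl | rfl | rfl) <;> assumption
    by_cases ha3 : ∃ a ∈ A, a ≠ a1 ∧ a ≠ a2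
    · obtain ⟨a3, ha3, n31, n32⟩ := ha3
      have hA4 : ∀ v, v ∈ A ↔ v = a1 ∨ v = a2 ∨ v = a3 := by
        intro v
        constructor
        · intro hv
          by_contra hn
          push Not at hn
          exact no5 h31 h32 (hA3 a3 ha3) Aa (hAcl a1 ha1 a3 ha3 n31.symm)
            (hAcl a2 ha2 a3 ha3 n32.symm) (hA3 v hv) (hAcl a1 ha1 v hv hn.1.symm)
            (hAcl a2 ha2 v hv hn.2.1.symm) (hAcl a3 ha3 v hv hn.2.2.symm)
        · rintro (rfl | rfl | rfl) <;> assumption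
      refine extendable_of_two_triangles (b := b') (b' := b) hk4 hT ih hA4 hC3 h ha12 n31.symm
        n32.symm h12 h13 h23 (fun e => h21 e.symm) (fun e => h1n2 e.symm) ?_ ?_
      · intro c hc v hv hvA hvC hcv
        exact (hDbb v (hND c hc v hv hvA hvC hcv)).symm
      · intro v hv hvA hvC hcv
        rcases hDbb v (hND c3 hc3 v hv hvA hvC hcv) with rfl | rfl
        · exact absurd hcv h3b
        · rfl
    · push Not at ha3
      refine Extendable.of_erase (h.subA ha1) (h.disjAT a1 ha1) {a2, c1, c3} ?_ ?_
        (ih _ _ (Finset.card_erase_lt_of_mem (h.subA ha1)) (hT.mono (Finset.erase_subset _ _) ?_))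
      · have := Finset.card_le_three (a := a2) (b := c1) (c := c3)
        omega
      · intro u hu hau
        simp only [Finset.mem_insert, Finset.mem_singleton]
        rcases h.closed a1 ha1 u hu hau with h' | h'
        · exact Or.inl (ha3 u h' hau.ne')
        · rcases (hC3 u).mp h' with rfl | rfl | rfl
          · simp
          · exact absurd hau.symm h21
          · simp
      · intro t ht
        exact Finset.mem_erase.mpr ⟨fun e => h.disjAT a1 ha1 (e ▸ ht), hT.sub ht⟩

/-- An instance without reducible clique cutset is an atom. -/
lemma extendable_or_atom (hclaw : IsClawFree G)
    (hω : ∀ Q : Finset V, G.IsClique (Q : Set V) → Q.card ≤ k) (hk : k ≤ 4)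
    (hT : Attached G S T)
    (ih : ∀ S' T', S'.card < S.card → Attached G S' T' → Extendable G k S' T')
    (hα : (∀ x ∈ S, ∀ y ∈ S, ∀ z ∈ S, x ∉ T → y ∉ T → z ∉ T → x ≠ y → x ≠ z → y ≠ z →
      ¬ G.Adj x y → ¬ G.Adj x z → ¬ G.Adj y z → False) → Extendable G k S T) :
    Extendable G k S T ∨ ∀ A C : Finset V, A ⊆ S \ T → C ⊆ S \ T → A.Nonempty →
      (∀ v ∈ A, v ∉ C) → (∀ u ∈ C, ∀ v ∈ C, u ≠ v → G.Adj u v) →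
      (∀ a ∈ A, ∀ v ∈ S \ T, G.Adj a v → v ∈ A ∨ v ∈ C) → ∀ v ∈ S \ T, v ∈ A ∨ v ∈ C := by
  classical
  by_contra hcon
  push Not at hcon
  obtain ⟨hne, A, C, hA, hC, hAne, hAC, hCc, hcl, b, hb, hbA, hbC⟩ := hcon
  apply hne
  have hmem : ∀ v, v ∈ S \ T ↔ v ∈ S ∧ v ∉ T := fun v => Finset.mem_sdiff
  by_cases hAT : ∃ a ∈ A, ∃ t ∈ T, G.Adj a t
  · obtain ⟨a, ha, t, ht, hat⟩ := hAT
    have haST := (hmem a).mp (hA ha)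
    refine extendable_of_cutPair hclaw hω hk hT ih hα (C₀ := C) (A₀ := (S \ T) \ (A ∪ C)) ?_
    have hB : ∀ v, v ∈ (S \ T) \ (A ∪ C) ↔ v ∈ S ∧ v ∉ T ∧ v ∉ A ∧ v ∉ C := by
      intro v; simp [and_assoc]
    exact
      { subC := fun v hv => ((hmem v).mp (hC hv)).1
        subA := fun v hv => ((hB v).mp hv).1
        disjCT := fun v hv => ((hmem v).mp (hC hv)).2
        disjAT := fun v hv => ((hB v).mp hv).2.1
        disjAC := fun v hv => ((hB v).mp hv).2.2.2
        ne := ⟨b, (hB b).mpr ⟨((hmem b).mp hb).1, ((hmem b).mp hb).2, hbA, hbC⟩⟩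
        clique := hCc
        closed := by
          intro x hx v hv hxv
          obtain ⟨x1, x2, x3, x4⟩ := (hB x).mp hx
          by_cases hvC : v ∈ C
          · exact Or.inr hvC
          left
          by_cases hvT : v ∈ T
          · exfalso
            have hat' := hT.twin a haST.1 haST.2 t ht hat v hvT
            have hax := hT.nbr a haST.1 haST.2 x x1 x2 (fun e => x3 (e ▸ ha)) v hvT hat' hxv
            rcases hcl a ha x ((hmem x).mpr ⟨x1, x2⟩) hax with h' | h'
            · exact x3 h'
            · exact x4 h'
          · refine (hB v).mpr ⟨hv, hvT, fun hvA => ?_, hvC⟩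
            rcases hcl v hvA x ((hmem x).mpr ⟨x1, x2⟩) hxv.symm with h' | h'
            · exact x3 h'
            · exact x4 h'
        rest := ⟨a, haST.1, fun h' => ((hB a).mp h').2.2.1 ha, hAC a ha, haST.2⟩ }
  · push Not at hAT
    refine extendable_of_cutPair hclaw hω hk hT ih hα (C₀ := C) (A₀ := A) ?_
    exact
      { subC := fun v hv => ((hmem v).mp (hC hv)).1
        subA := fun v hv => ((hmem v).mp (hA hv)).1
        disjCT := fun v hv => ((hmem v).mp (hC hv)).2
        disjAT := fun v hv => ((hmem v).mp (hA hv)).2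
        disjAC := hAC
        ne := hAne
        clique := hCc
        closed := by
          intro x hx v hv hxv
          by_cases hvT : v ∈ T
          · exact absurd hxv (hAT x hx v hvT)
          · exact hcl x hx v ((hmem v).mpr ⟨hv, hvT⟩) hxv
        rest := ⟨b, ((hmem b).mp hb).1, hbA, hbC, ((hmem b).mp hb).2⟩ }

end cut

/-! ### List colouring of vertex sets without stable triples -/

/-- `U` can be properly coloured from the lists `L`. -/
def ColOn (G : SimpleGraph V) (U : Finset V) (L : V → Finset ℕ) : Prop :=
  ∃ c : V → ℕ, (∀ v ∈ U, c v ∈ L v) ∧ ∀ u ∈ U, ∀ v ∈ U, G.Adj u v → c u ≠ c v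

/-- `χ` divides `U` into at most `k` stable parts of size at most two. -/
structure PartData (G : SimpleGraph V) (U : Finset V) (χ : V → ℕ) (k : ℕ) : Prop where
  proper : ∀ u ∈ U, ∀ v ∈ U, G.Adj u v → χ u ≠ χ v
  two : ∀ u ∈ U, ∀ v ∈ U, ∀ w ∈ U, χ u = χ v → χ u = χ w → u = v ∨ u = w ∨ v = w
  card : (U.image χ).card ≤ k

section parts
variable {G : SimpleGraph V} {U : Finset V} {χ : V → ℕ} {k : ℕ} {L : V → Finset ℕ}

lemma PartData.sub (h : PartData G U χ k) {U' : Finset V} (hU : U' ⊆ U) : PartData G U' χ k where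
  proper u hu v hv := h.proper u (hU hu) v (hU hv)
  two u hu v hv w hw := h.two u (hU hu) v (hU hv) w (hU hw)
  card := (Finset.card_le_card (Finset.image_subset_image hU)).trans h.card

lemma PartData.remove (h : PartData G U χ (k + 1)) {u : V} (hu : u ∈ U) :
    PartData G (U.filter fun w => χ w ≠ χ u) χ k := by
  refine ⟨(h.sub (Finset.filter_subset _ _)).proper, (h.sub (Finset.filter_subset _ _)).two, ?_⟩
  have h1 : (U.filter fun w => χ w ≠ χ u).image χ ⊆ (U.image χ).erase (χ u) := by
    intro t ht
    obtain ⟨w, hw, rfl⟩ := Finset.mem_image.mp ht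
    obtain ⟨h1, h2⟩ := Finset.mem_filter.mp hw
    exact Finset.mem_erase.mpr ⟨h2, Finset.mem_image_of_mem χ h1⟩
  have h2 := Finset.card_le_card h1
  have h3 := Finset.card_erase_lt_of_mem (Finset.mem_image_of_mem χ hu)
  have h4 := h.card
  omega

lemma PartData.card_le_of_injOn (h : PartData G U χ k) {Q : Finset V} (hQ : Q ⊆ U)
    (hinj : Set.InjOn χ Q) : Q.card ≤ k := by
  rw [← Finset.card_image_of_injOn hinj]
  exact (Finset.card_le_card (Finset.image_subset_image hQ)).trans h.card

lemma PartData.card_le_two_mul (h : PartData G U χ k) : U.card ≤ 2 * k := by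
  classical
  have := Finset.card_le_mul_card_image (f := χ) U 2 (by
    intro b _
    by_contra hlt
    push Not at hlt
    obtain ⟨x, y, z, hx, hy, hz, hxy, hxz, hyz⟩ := Finset.two_lt_card_iff.mp hlt
    simp only [Finset.mem_filter] at hx hy hz
    rcases h.two x hx.1 y hy.1 z hz.1 (hx.2.trans hy.2.symm) (hx.2.trans hz.2.symm) with e | e | e
    · exact hxy e
    · exact hxz e
    · exact hyz e)
  have := h.card
  nlinarith

lemma ColOn.of_injOn {c : V → ℕ} (h1 : Set.InjOn c U) (h2 : ∀ v ∈ U, c v ∈ L v) : ColOn G U L :=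
  ⟨c, h2, fun _ hu _ hv huv e => huv.ne (h1 hu hv e)⟩

/-- Give the colour `a` to the stable set `M` and colour the rest without `a`. -/
lemma ColOn.of_stable {M U' : Finset V} {a : ℕ} (hM : ∀ m ∈ M, a ∈ L m)
    (hst : ∀ m ∈ M, ∀ m' ∈ M, ¬ G.Adj m m') (hU : ∀ v ∈ U, v ∈ M ∨ v ∈ U')
    (h : ColOn G U' fun v => (L v).erase a) : ColOn G U L := by
  classical
  obtain ⟨c, h1, h2⟩ := h
  refine ⟨fun v => if v ∈ M then a else c v, ?_, ?_⟩
  · intro v hv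
    by_cases hvM : v ∈ M
    · simp only [hvM, if_true]; exact hM v hvM
    · simp only [hvM, if_false]
      exact Finset.mem_of_mem_erase (h1 v ((hU v hv).resolve_left hvM))
  · intro u hu v hv huv
    by_cases hu' : u ∈ M <;> by_cases hv' : v ∈ M
    · exact absurd huv (hst u hu' v hv')
    · simp only [hu', hv', if_true, if_false]
      exact (Finset.ne_of_mem_erase (h1 v ((hU v hv).resolve_left hv'))).symm
    · simp only [hu', hv', if_true, if_false]
      exact Finset.ne_of_mem_erase (h1 u ((hU u hu).resolve_left hu'))
    · simp only [hu', hv', if_false]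
      exact h2 u ((hU u hu).resolve_left hu') v ((hU v hv).resolve_left hv') huv

/-- Give the colour `a` to the whole part `{u, v}`. -/
lemma ColOn.of_part (h : PartData G U χ k) {u v : V} (hu : u ∈ U) (hv : v ∈ U)
    (huv : u ≠ v) (hχ : χ u = χ v) {a : ℕ} (hau : a ∈ L u) (hav : a ∈ L v)
    (hc : ColOn G (U.filter fun w => χ w ≠ χ u) fun v => (L v).erase a) : ColOn G U L := by
  classical
  refine ColOn.of_stable (M := {u, v}) (a := a) ?_ ?_ ?_ hc
  · intro m hm
    rcases Finset.mem_insert.mp hm with rfl | hm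
    · exact hau
    · rw [Finset.mem_singleton.mp hm]; exact hav
  · intro m hm m' hm' hadj
    have e : ∀ x ∈ ({u, v} : Finset V), x ∈ U ∧ χ x = χ u := by
      intro x hx
      rcases Finset.mem_insert.mp hx with rfl | hx
      · exact ⟨hu, rfl⟩
      · rw [Finset.mem_singleton.mp hx]; exact ⟨hv, hχ.symm⟩
    exact h.proper m (e m hm).1 m' (e m' hm').1 hadj ((e m hm).2.trans (e m' hm').2.symm)
  · intro w hw
    by_cases hwu : χ w = χ u
    · left
      rcases h.two w hw u hu v hv hwu (hwu.trans hχ) with e | e | e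
      · simp [e]
      · simp [e]
      · exact absurd e huv
    · exact Or.inr (Finset.mem_filter.mpr ⟨hw, hwu⟩)

/-- Lists of size `k` suffice for at most `k` parts. -/
lemma PartData.colOn (h : PartData G U χ k) (hL : ∀ v ∈ U, k ≤ (L v).card) : ColOn G U L := by
  classical
  have h2t : U.card ≤ 2 * (U.image χ).card :=
    PartData.card_le_two_mul (G := G) (χ := χ) ⟨h.proper, h.two, le_refl _⟩
  obtain ⟨c, hc, hc'⟩ := exists_coloring_of_parts U χ L h.two
    (by intro u hu v _ _ _; have := hL u hu; have := h.card; omega)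
    (by intro u hu v hv _ _; have := hL u hu; have := hL v hv; have := h.card; omega)
    (by
      intro Q hQ hne hs
      obtain ⟨q, hq⟩ := hne
      have h1 := card_le_card_biUnion_of_mem (L := L) hq
      have h2 := hL q (hQ hq)
      have hinj : Set.InjOn χ Q := fun x hx y hy e => hs y hy x (hQ hx) e
      have h3 : (Q.image χ).card = Q.card := Finset.card_image_of_injOn hinj
      have h4 : PartData G (U \ Q) χ ((U.image χ).card - Q.card) := by
        refine ⟨(h.sub Finset.sdiff_subset).proper, (h.sub Finset.sdiff_subset).two, ?_⟩
        rw [← h3, ← Finset.card_sdiff_of_subset (Finset.image_subset_image hQ)]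
        refine Finset.card_le_card ?_
        intro t ht
        obtain ⟨w, hw, rfl⟩ := Finset.mem_image.mp ht
        obtain ⟨w1, w2⟩ := Finset.mem_sdiff.mp hw
        refine Finset.mem_sdiff.mpr ⟨Finset.mem_image_of_mem χ w1, fun hw' => ?_⟩
        obtain ⟨x, hx, hxw⟩ := Finset.mem_image.mp hw'
        exact w2 (hs x hx w w1 hxw.symm ▸ hx)
      have h5 := h4.card_le_two_mul
      rw [Finset.card_sdiff_of_subset hQ] at h5
      have h6 := Finset.card_le_card hQ
      have h7 : Q.card ≤ (U.image χ).card := by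
        rw [← h3]; exact Finset.card_le_card (Finset.image_subset_image hQ)
      have := h.card
      omega)
  exact ⟨c, hc, fun u hu v hv huv => hc' u hu v hv (h.proper u hu v hv huv)⟩

/-- A set meeting the parts outside `R` at most once has at most `k + |R|` elements. -/
lemma PartData.card_le_add (h : PartData G U χ k) {R Q : Finset V} (hR : R ⊆ U) (hQ : Q ⊆ U)
    (hinj : Set.InjOn χ R)
    (hno : ∀ u ∈ Q, ∀ v ∈ Q, u ≠ v → χ u = χ v → ∃ r ∈ R, χ r = χ u) :
    Q.card ≤ k + R.card := by
  classical
  let Q1 := Q.filter fun q => χ q ∈ R.image χ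
  let Q0 := Q.filter fun q => ¬ χ q ∈ R.image χ
  have hsplit : Q1.card + Q0.card = Q.card := Finset.card_filter_add_card_filter_not _
  have hRi : (R.image χ).card = R.card := Finset.card_image_of_injOn hinj
  have h1 : Q1.card ≤ 2 * R.card := by
    refine PartData.card_le_two_mul (G := G) (χ := χ)
      ⟨(h.sub ((Finset.filter_subset _ _).trans hQ)).proper,
        (h.sub ((Finset.filter_subset _ _).trans hQ)).two, ?_⟩
    rw [← hRi]
    refine Finset.card_le_card ?_
    intro t ht
    obtain ⟨w, hw, rfl⟩ := Finset.mem_image.mp ht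
    exact (Finset.mem_filter.mp hw).2
  have h0 : Q0.card ≤ k - R.card := by
    have hinj0 : Set.InjOn χ Q0 := by
      intro x hx y hy e
      by_contra hne
      obtain ⟨x1, x2⟩ := Finset.mem_filter.mp hx
      obtain ⟨y1, _⟩ := Finset.mem_filter.mp hy
      obtain ⟨r, hr, hrx⟩ := hno x x1 y y1 hne e
      exact x2 (Finset.mem_image.mpr ⟨r, hr, hrx⟩)
    rw [← Finset.card_image_of_injOn hinj0, ← hRi]
    have hs : R.image χ ⊆ U.image χ := Finset.image_subset_image hR
    have : Q0.image χ ⊆ U.image χ \ R.image χ := by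
      intro t ht
      obtain ⟨w, hw, rfl⟩ := Finset.mem_image.mp ht
      obtain ⟨w1, w2⟩ := Finset.mem_filter.mp hw
      exact Finset.mem_sdiff.mpr ⟨Finset.mem_image_of_mem χ (hQ w1), w2⟩
    have h2 := Finset.card_le_card this
    rw [Finset.card_sdiff_of_subset hs] at h2
    have := h.card
    omega
  have h3 : R.card ≤ k := h.card_le_of_injOn hR hinj
  omega

/-- If no part has a common colour, Hall's theorem applies. -/
lemma PartData.colOn_of_disjoint (h : PartData G U χ k) {R : Finset V} (hR : R ⊆ U)
    (hinj : Set.InjOn χ R) (hLR : ∀ r ∈ R, R.card ≤ (L r).card)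
    (hL : ∀ v ∈ U, v ∉ R → k ≤ (L v).card)
    (hd : ∀ u ∈ U, ∀ v ∈ U, u ≠ v → χ u = χ v → Disjoint (L u) (L v)) : ColOn G U L := by
  classical
  obtain ⟨c, hc, hc'⟩ := exists_injOn_choice U L (by
    intro Q hQ
    by_cases hp : ∃ u ∈ Q, ∃ v ∈ Q, u ≠ v ∧ χ u = χ v ∧ ∀ r ∈ R, χ r ≠ χ u
    · obtain ⟨u, hu, v, hv, huv, hχ, hr⟩ := hp
      have h1 := card_add_le_card_biUnion hu hv (hd u (hQ hu) v (hQ hv) huv hχ)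
      have h2 := hL u (hQ hu) (fun e => hr u e rfl)
      have h3 := hL v (hQ hv) (fun e => hr v e hχ.symm)
      have h4 := Finset.card_le_card hQ
      have h5 := h.card_le_two_mul
      omega
    · push Not at hp
      by_cases hp' : ∃ u ∈ Q, ∃ v ∈ Q, u ≠ v ∧ χ u = χ v
      · obtain ⟨u, hu, v, hv, huv, hχ⟩ := hp'
        have h1 := card_add_le_card_biUnion hu hv (hd u (hQ hu) v (hQ hv) huv hχ)
        have h2 := h.card_le_add hR hQ hinj hp
        by_cases huR : u ∈ R
        · have hvR : v ∉ R := fun e => huv (hinj huR e hχ)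
          have := hLR u huR
          have := hL v (hQ hv) hvR
          omega
        · have := hL u (hQ hu) huR
          by_cases hvR : v ∈ R
          · have := hLR v hvR
            omega
          · have := hL v (hQ hv) hvR
            have := h.card_le_of_injOn hR hinj
            omega
      · push Not at hp'
        have hinjQ : Set.InjOn χ Q := by
          intro x hx y hy e
          by_contra hne
          exact hp' x hx y hy hne e
        have h1 := h.card_le_of_injOn hQ hinjQ
        by_cases hQR : Q ⊆ R
        · rcases Q.eq_empty_or_nonempty with rfl | ⟨q, hq⟩
          · simp
          · have := card_le_card_biUnion_of_mem (L := L) hq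
            have := hLR q (hQR hq)
            have := Finset.card_le_card hQR
            omega
        · obtain ⟨q, hq, hqR⟩ := Finset.not_subset.mp hQR
          have := card_le_card_biUnion_of_mem (L := L) hq
          have := hL q (hQ hq) hqR
          omega)
  exact ColOn.of_injOn hc hc'

end parts

section rooted
variable {G : SimpleGraph V} {U : Finset V} {χ : V → ℕ} {k : ℕ} {L : V → Finset ℕ}

lemma PartData.card_add_card_le (h : PartData G U χ k) {Q : Finset V} (hQ : Q ⊆ U)
    (hs : ∀ q ∈ Q, ∀ v ∈ U, χ v = χ q → v = q) : U.card + Q.card ≤ 2 * (U.image χ).card := by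
  classical
  have hinj : Set.InjOn χ Q := fun x hx y hy e => hs y hy x (hQ hx) e
  have h3 : (Q.image χ).card = Q.card := Finset.card_image_of_injOn hinj
  have h4 : PartData G (U \ Q) χ ((U.image χ).card - Q.card) := by
    refine ⟨(h.sub Finset.sdiff_subset).proper, (h.sub Finset.sdiff_subset).two, ?_⟩
    rw [← h3, ← Finset.card_sdiff_of_subset (Finset.image_subset_image hQ)]
    refine Finset.card_le_card ?_
    intro t ht
    obtain ⟨w, hw, rfl⟩ := Finset.mem_image.mp ht
    obtain ⟨w1, w2⟩ := Finset.mem_sdiff.mp hw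
    refine Finset.mem_sdiff.mpr ⟨Finset.mem_image_of_mem χ w1, fun hw' => ?_⟩
    obtain ⟨x, hx, hxw⟩ := Finset.mem_image.mp hw'
    exact w2 (hs x hx w w1 hxw.symm ▸ hx)
  have h5 := h4.card_le_two_mul
  rw [Finset.card_sdiff_of_subset hQ] at h5
  have h6 := Finset.card_le_card hQ
  have h7 : Q.card ≤ (U.image χ).card := by
    rw [← h3]; exact Finset.card_le_card (Finset.image_subset_image hQ)
  omega

/-- Colour what remains after the root `r` has been coloured. -/
lemma PartData.colOn_of_root (h : PartData G U χ (k + 1)) {r : V} (hr : r ∈ U) {U' : Finset V}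
    (hU : U' ⊆ U) (hrU : r ∉ U') (hL : ∀ v ∈ U', k ≤ (L v).card)
    (hLs : ∀ v ∈ U', χ v = χ r → k + 1 ≤ (L v).card)
    (hp : ∀ u ∈ U', ∀ v ∈ U', u ≠ v → χ u = χ v → U'.card ≤ (L u).card + (L v).card) :
    ColOn G U' L := by
  classical
  have hU1 : PartData G (U'.filter fun w => χ w ≠ χ r) χ k := (h.remove hr).sub
    (Finset.filter_subset_filter _ hU)
  have hs : ∀ s ∈ U', ∀ s' ∈ U', χ s = χ r → χ s' = χ r → s = s' := by
    intro s hs s' hs' e e'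
    rcases h.two r hr s (hU hs) s' (hU hs') e.symm e'.symm with e | e | e
    · exact absurd (e ▸ hs) hrU
    · exact absurd (e ▸ hs') hrU
    · exact e
  have hsplit : (U'.filter fun w => χ w ≠ χ r).card + 1 = U'.card ∧
      ((U'.filter fun w => χ w ≠ χ r).image χ).card + 1 = (U'.image χ).card ∧
      (∃ s ∈ U', χ s = χ r) ∨ (U'.filter fun w => χ w ≠ χ r) = U' := by
    by_cases hex : ∃ s ∈ U', χ s = χ r
    · obtain ⟨s, hsU, hsr⟩ := hex
      left
      have hU'e : U' = insert s (U'.filter fun w => χ w ≠ χ r) := by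
        ext w
        simp only [Finset.mem_insert, Finset.mem_filter]
        constructor
        · intro hw
          by_cases e : χ w = χ r
          · exact Or.inl (hs w hw s hsU e hsr)
          · exact Or.inr ⟨hw, e⟩
        · rintro (rfl | h)
          · exact hsU
          · exact h.1
      refine ⟨?_, ?_, s, hsU, hsr⟩
      · conv_rhs => rw [hU'e]
        rw [Finset.card_insert_of_notMem (by simp [hsr])]
      · conv_rhs => rw [hU'e]
        rw [Finset.image_insert, Finset.card_insert_of_notMem]
        simp only [Finset.mem_image, Finset.mem_filter, not_exists, not_and]
        rintro w ⟨_, h⟩ e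
        exact h (e.trans hsr)
    · right
      push Not at hex
      exact Finset.filter_true_of_mem hex
  have h1 := PartData.card_add_card_le hU1 (Finset.empty_subset _) (by simp)
  have h2 := hU1.card
  simp only [Finset.card_empty, add_zero] at h1
  obtain ⟨c, hc, hc'⟩ := exists_coloring_of_parts U' χ L (h.sub hU).two
    (by
      intro u hu v hv huv e
      have := hL u hu
      rcases hsplit with ⟨e1, e2, _⟩ | e
      · omega
      · rw [e] at h1 h2; omega)
    hp
    (by
      intro Q hQ hne hsing
      obtain ⟨q, hq⟩ := hne
      have h3 := card_le_card_biUnion_of_mem (L := L) hq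
      have h4 := hL q (hQ hq)
      have h5 := (h.sub hU).card_add_card_le hQ hsing
      have h6 := (h.sub hU).card
      rcases hsplit with ⟨e1, e2, s, hsU, hsr⟩ | e
      · by_cases hsQ : s ∈ Q
        · have h7 := card_le_card_biUnion_of_mem (L := L) hsQ
          have h8 := hLs s hsU hsr
          omega
        · have h7 := hU1.card_add_card_le (Q := Q) (by
            intro w hw
            refine Finset.mem_filter.mpr ⟨hQ hw, fun e => hsQ (hs w (hQ hw) s hsU e hsr ▸ hw)⟩)
            (fun w hw v hv => hsing w hw v (Finset.mem_filter.mp hv).1)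
          omega
      · rw [e] at h1 h2; omega)
  exact ⟨c, hc, fun u hu v hv huv => hc' u hu v hv ((h.sub hU).proper u hu v hv huv)⟩

/-- One root with a nonempty list. -/
lemma PartData.colOn_one_root (h : PartData G U χ k) {r : V} (hr : r ∈ U) (hLr : (L r).Nonempty)
    (hL : ∀ v ∈ U, v ≠ r → k ≤ (L v).card)
    (hadj : ∀ p ∈ U, ∀ q ∈ U, p ≠ r → q ≠ r → p ≠ q → χ p = χ q → ¬ G.Adj r p ∨ ¬ G.Adj r q) :
    ColOn G U L := by
  classical
  obtain ⟨a, ha⟩ := hLr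
  obtain ⟨k, rfl⟩ : ∃ k', k = k' + 1 := by
    have := h.card
    have : 0 < (U.image χ).card := Finset.card_pos.mpr ⟨_, Finset.mem_image_of_mem χ hr⟩
    exact ⟨k - 1, by omega⟩
  by_cases h1 : ∃ s ∈ U, s ≠ r ∧ χ s = χ r ∧ a ∈ L s
  · obtain ⟨s, hs, hsr, hχ, has⟩ := h1
    refine ColOn.of_part h hr hs hsr.symm hχ.symm ha has ((h.remove hr).colOn ?_)
    intro v hv
    obtain ⟨hv1, hv2⟩ := Finset.mem_filter.mp hv
    have := hL v hv1 (fun e => hv2 (e ▸ rfl))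
    have := card_erase_ge (L v) a
    omega
  · push Not at h1
    have hcard := h.card_le_two_mul
    by_cases h2 : ∃ p ∈ U, ∃ q ∈ U, p ≠ r ∧ q ≠ r ∧ p ≠ q ∧ χ p = χ q ∧ a ∈ L p ∧ ¬ G.Adj r p
    · obtain ⟨p, hp, q, hq, hpr, hqr, hpq, hχ, hap, hrp⟩ := h2
      refine ColOn.of_stable (M := {r, p}) (U' := (U.erase r).erase p) (a := a) ?_ ?_ ?_
        (h.colOn_of_root hr (((Finset.erase_subset _ _).trans (Finset.erase_subset _ _))) ?_ ?_ ?_ ?_)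
      · intro m hm
        rcases Finset.mem_insert.mp hm with rfl | hm
        · exact ha
        · rw [Finset.mem_singleton.mp hm]; exact hap
      · intro m hm m' hm' hadj'
        simp only [Finset.mem_insert, Finset.mem_singleton] at hm hm'
        rcases hm with rfl | rfl <;> rcases hm' with rfl | rfl
        · exact hadj'.ne rfl
        · exact hrp hadj'
        · exact hrp hadj'.symm
        · exact hadj'.ne rfl
      · intro v hv
        simp only [Finset.mem_insert, Finset.mem_singleton, Finset.mem_erase]
        tauto
      · simp
      · intro v hv
        simp only [Finset.mem_erase] at hv
        have := hL v hv.2.2 hv.2.1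
        have := card_erase_ge (L v) a
        omega
      · intro v hv e
        simp only [Finset.mem_erase] at hv
        have := hL v hv.2.2 hv.2.1
        rwa [Finset.erase_eq_of_notMem (h1 v hv.2.2 hv.2.1 e)]
      · intro u hu v hv _ _
        simp only [Finset.mem_erase] at hu hv
        have := hL v hv.2.2 hv.2.1
        have := card_erase_ge (L v) a
        have := hL u hu.2.2 hu.2.1
        have := card_erase_ge (L u) a
        rw [Finset.card_erase_of_mem (Finset.mem_erase.mpr ⟨hpr, hp⟩), Finset.card_erase_of_mem hr]
        omega
    · push Not at h2
      refine ColOn.of_stable (M := {r}) (U' := U.erase r) (a := a) ?_ ?_ ?_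
        (h.colOn_of_root hr (Finset.erase_subset _ _) ?_ ?_ ?_ ?_)
      · intro m hm
        rw [Finset.mem_singleton.mp hm]; exact ha
      · intro m hm m' hm' hadj'
        rw [Finset.mem_singleton.mp hm, Finset.mem_singleton.mp hm'] at hadj'
        exact hadj'.ne rfl
      · intro v hv
        simp only [Finset.mem_singleton, Finset.mem_erase]
        tauto
      · simp
      · intro v hv
        simp only [Finset.mem_erase] at hv
        have := hL v hv.2 hv.1
        have := card_erase_ge (L v) a
        omega
      · intro v hv e
        simp only [Finset.mem_erase] at hv
        have := hL v hv.2 hv.1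
        rwa [Finset.erase_eq_of_notMem (h1 v hv.2 hv.1 e)]
      · intro u hu v hv huv e
        simp only [Finset.mem_erase] at hu hv
        have h3 := hL v hv.2 hv.1
        have h4 := card_erase_ge (L v) a
        have h5 := hL u hu.2 hu.1
        have h6 := card_erase_ge (L u) a
        rw [Finset.card_erase_of_mem hr]
        rcases hadj u hu.2 v hv.2 hu.1 hv.1 huv e with h7 | h7
        · have : a ∉ L u := fun h8 => h7 (h2 u hu.2 v hv.2 hu.1 hv.1 huv e h8)
          rw [Finset.erase_eq_of_notMem this]
          omega
        · have : a ∉ L v := fun h8 => h7 (h2 v hv.2 u hu.2 hv.1 hu.1 huv.symm e.symm h8)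
          rw [Finset.erase_eq_of_notMem this]
          omega

end rooted

section rooted
variable {G : SimpleGraph V} {U : Finset V} {χ : V → ℕ} {k : ℕ} {L : V → Finset ℕ}

/-- Give the colour `a` to the nonadjacent vertices `r` and `p`. -/
lemma ColOn.of_pair [DecidableEq V] {r p : V} {a : ℕ} (hr : a ∈ L r) (hp : a ∈ L p)
    (hrp : ¬ G.Adj r p) (h : ColOn G ((U.erase r).erase p) fun v => (L v).erase a) :
    ColOn G U L := by
  refine ColOn.of_stable (M := {r, p}) (a := a) ?_ ?_ ?_ h
  · intro m hm
    rcases Finset.mem_insert.mp hm with rfl | hm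
    · exact hr
    · rw [Finset.mem_singleton.mp hm]; exact hp
  · intro m hm m' hm' hadj'
    simp only [Finset.mem_insert, Finset.mem_singleton] at hm hm'
    rcases hm with rfl | rfl <;> rcases hm' with rfl | rfl
    · exact hadj'.ne rfl
    · exact hrp hadj'
    · exact hrp hadj'.symm
    · exact hadj'.ne rfl
  · intro v hv
    simp only [Finset.mem_insert, Finset.mem_singleton, Finset.mem_erase]
    tauto

lemma disjoint_erase_erase {s t : Finset ℕ} (h : Disjoint s t) (a : ℕ) :
    Disjoint (s.erase a) (t.erase a) :=
  h.mono (Finset.erase_subset _ _) (Finset.erase_subset _ _)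

lemma card_erase_add_of_disjoint {s t : Finset ℕ} (h : Disjoint s t) (a : ℕ) :
    s.card + t.card ≤ (s.erase a).card + (t.erase a).card + 1 := by
  have h1 := card_erase_ge s a
  have h2 := card_erase_ge t a
  by_cases ha : a ∈ s
  · rw [Finset.erase_eq_of_notMem (Finset.disjoint_left.mp h ha)]; omega
  · rw [Finset.erase_eq_of_notMem ha]; omega

/-- All but one part contain a root. -/
lemma PartData.colOn_roots_pred : ∀ (k : ℕ) (U R : Finset V) (L : V → Finset ℕ),
    PartData G U χ (k + 1) → R ⊆ U → Set.InjOn χ R → R.card = k → (∀ r ∈ R, k ≤ (L r).card) →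
    (∀ v ∈ U, v ∉ R → k + 1 ≤ (L v).card) →
    (∀ r ∈ R, ∀ p ∈ U, ∀ q ∈ U, p ∉ R → q ∉ R → p ≠ q → χ p = χ q → ¬ G.Adj r p ∨ ¬ G.Adj r q) →
    ColOn G U L := by
  classical
  intro k
  induction k with
  | zero =>
    intro U R L h _ _ hRk _ hL _
    rw [Finset.card_eq_zero] at hRk
    subst hRk
    exact h.colOn fun v hv => hL v hv (by simp)
  | succ k ih =>
    intro U R L h hRU hinj hRk hLR hL hadj
    by_cases h1 : ∃ r ∈ R, ∃ s ∈ U, s ≠ r ∧ χ s = χ r ∧ ∃ a, a ∈ L r ∧ a ∈ L s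
    · obtain ⟨r, hr, s, hs, hsr, hχ, a, har, has⟩ := h1
      refine ColOn.of_part h (hRU hr) hs hsr.symm hχ.symm har has
        (ih _ (R.erase r) _ (h.remove (hRU hr)) ?_ ?_ ?_ ?_ ?_ ?_)
      · intro x hx
        obtain ⟨hx1, hx2⟩ := Finset.mem_erase.mp hx
        exact Finset.mem_filter.mpr ⟨hRU hx2, fun e => hx1 (hinj hx2 hr e)⟩
      · exact hinj.mono (by simp)
      · rw [Finset.card_erase_of_mem hr, hRk]; rfl
      · intro x hx
        have := hLR x (Finset.mem_of_mem_erase hx)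
        have := card_erase_ge (L x) a
        omega
      · intro x hx hxR
        obtain ⟨hx1, hx2⟩ := Finset.mem_filter.mp hx
        have := hL x hx1 (fun e => hxR (Finset.mem_erase.mpr ⟨fun e => hx2 (e ▸ rfl), e⟩))
        have := card_erase_ge (L x) a
        omega
      · intro x hx p hp q hq hpR hqR
        obtain ⟨hp1, hp2⟩ := Finset.mem_filter.mp hp
        obtain ⟨hq1, hq2⟩ := Finset.mem_filter.mp hq
        exact hadj x (Finset.mem_of_mem_erase hx) p hp1 q hq1
          (fun e => hpR (Finset.mem_erase.mpr ⟨fun e => hp2 (e ▸ rfl), e⟩))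
          (fun e => hqR (Finset.mem_erase.mpr ⟨fun e => hq2 (e ▸ rfl), e⟩))
    push Not at h1
    have hdR : ∀ r ∈ R, ∀ s ∈ U, s ≠ r → χ s = χ r → Disjoint (L r) (L s) := by
      intro r hr s hs hsr e
      exact Finset.disjoint_left.mpr fun a ha => h1 r hr s hs hsr e a ha
    by_cases h2 : ∃ p ∈ U, ∃ q ∈ U, p ∉ R ∧ q ∉ R ∧ p ≠ q ∧ χ p = χ q ∧ ∃ a, a ∈ L p ∧ a ∈ L q
    swap
    · push Not at h2
      refine h.colOn_of_disjoint hRU hinj (fun r hr => hRk ▸ hLR r hr) hL ?_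
      intro u hu v hv huv e
      by_cases huR : u ∈ R
      · exact hdR u huR v hv huv.symm e.symm
      · by_cases hvR : v ∈ R
        · exact (hdR v hvR u hu huv e).symm
        · exact Finset.disjoint_left.mpr fun a ha => h2 u hu v hv huR hvR huv e a ha
    obtain ⟨p, hp, q, hq, hpR, hqR, hpq, hχ, c, hcp, hcq⟩ := h2
    have hpr : ∀ r ∈ R, χ r ≠ χ p := by
      intro r hr e
      rcases h.two r (hRU hr) p hp q hq e (e.trans hχ) with e | e | e
      · exact hpR (e ▸ hr)
      · exact hqR (e ▸ hr)
      · exact hpq e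
    have hRi : (R.image χ).card = k + 1 := by rw [Finset.card_image_of_injOn hinj, hRk]
    have himg : ∀ v ∈ U, χ v ≠ χ p → ∃ r ∈ R, χ r = χ v := by
      intro v hv hvp
      by_contra hno
      push Not at hno
      have hsub : insert (χ p) (insert (χ v) (R.image χ)) ⊆ U.image χ := by
        intro t ht
        simp only [Finset.mem_insert] at ht
        rcases ht with rfl | rfl | ht
        · exact Finset.mem_image_of_mem χ hp
        · exact Finset.mem_image_of_mem χ hv
        · exact Finset.image_subset_image hRU ht
      have := Finset.card_le_card hsub
      rw [Finset.card_insert_of_notMem, Finset.card_insert_of_notMem, hRi] at this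
      · have := h.card
        omega
      · simp only [Finset.mem_image, not_exists, not_and]; exact hno
      · simp only [Finset.mem_insert, Finset.mem_image, not_or, not_exists, not_and]
        exact ⟨hvp.symm, hpr⟩
    by_cases h3 : k + 1 ≤ (R.biUnion fun r => (L r).erase c).card
    · refine ColOn.of_part h hp hq hpq hχ hcp hcq ?_
      have hU' := h.remove hp
      obtain ⟨f, hf, hf'⟩ := exists_injOn_choice (U.filter fun w => χ w ≠ χ p)
        (fun v => (L v).erase c) (by
        intro Q hQ
        have hQU : ∀ x ∈ Q, x ∈ U ∧ χ x ≠ χ p := fun x hx => Finset.mem_filter.mp (hQ hx)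
        by_cases hpair : ∃ u ∈ Q, ∃ v ∈ Q, u ≠ v ∧ χ u = χ v
        · obtain ⟨u, hu, v, hv, huv, e⟩ := hpair
          have h5 := Finset.card_le_card hQ
          have h6 := hU'.card_le_two_mul
          have key : ∀ r ∈ R, ∀ s ∈ Q, r ∈ Q → s ≠ r → χ s = χ r →
              Q.card ≤ (Q.biUnion fun v => (L v).erase c).card := by
            intro r hr s hs hrQ hsr e
            have hsR : s ∉ R := fun hsR => hsr (hinj hsR hr e)
            have hd := hdR r hr s (hQU s hs).1 hsr e
            have h7 := card_erase_add_of_disjoint hd c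
            have h8 := card_add_le_card_biUnion (L := fun v => (L v).erase c) hrQ hs
              (disjoint_erase_erase hd c)
            have := hLR r hr
            have := hL s (hQU s hs).1 hsR
            omega
          obtain ⟨r, hr, hru⟩ := himg u (hQU u hu).1 (hQU u hu).2
          rcases h.two r (hRU hr) u (hQU u hu).1 v (hQU v hv).1 hru (hru.trans e) with e' | e' | e'
          · exact key r hr v hv (e' ▸ hu) (fun e'' => huv (by rw [e'', ← e'])) (e.symm.trans hru.symm)
          · exact key r hr u hu (e' ▸ hv) (fun e'' => huv (by rw [e'', ← e'])) hru.symm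
          · exact absurd e' huv
        · push Not at hpair
          have hQinj : Set.InjOn χ Q := by
            intro x hx y hy e
            by_contra hne
            exact hpair x hx y hy hne e
          have h5 := hU'.card_le_of_injOn hQ hQinj
          by_cases hQR : Q ⊆ R
          · rcases Q.eq_empty_or_nonempty with rfl | ⟨x, hx⟩
            · simp
            by_cases hRQ : R ⊆ Q
            · rw [Finset.Subset.antisymm hQR hRQ, hRk]; exact h3
            · have h6 : Q.card < R.card := Finset.card_lt_card ⟨hQR, hRQ⟩
              have h7 := card_le_card_biUnion_of_mem (L := fun v => (L v).erase c) hx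
              have := hLR x (hQR hx)
              have := card_erase_ge (L x) c
              omega
          · obtain ⟨x, hx, hxR⟩ := Finset.not_subset.mp hQR
            have h7 := card_le_card_biUnion_of_mem (L := fun v => (L v).erase c) hx
            have := hL x (hQU x hx).1 hxR
            have := card_erase_ge (L x) c
            omega)
      exact ColOn.of_injOn hf hf'
    · have hsz : ∀ r ∈ R, c ∈ L r ∧ (L r).erase c = R.biUnion fun r => (L r).erase c := by
        intro r hr
        have h4 := Finset.card_le_card (Finset.subset_biUnion_of_mem (fun r => (L r).erase c) hr)
        have h5 := hLR r hr
        have h6 := card_erase_ge (L r) c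
        refine ⟨?_, Finset.eq_of_subset_of_card_le
          (Finset.subset_biUnion_of_mem (fun r => (L r).erase c) hr) (by omega)⟩
        by_contra hc
        rw [Finset.erase_eq_of_notMem hc] at h4
        omega
      have hLeq : ∀ r ∈ R, ∀ r' ∈ R, L r = L r' := by
        intro r hr r' hr'
        rw [← Finset.insert_erase (hsz r hr).1, ← Finset.insert_erase (hsz r' hr').1,
          (hsz r hr).2, (hsz r' hr').2]
      obtain ⟨r, hr⟩ : R.Nonempty := Finset.card_pos.mp (by omega)
      have key : ∀ p ∈ U, ∀ q ∈ U, p ∉ R → q ∉ R → p ≠ q → χ p = χ q → c ∈ L p → c ∈ L q →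
          (∀ v ∈ U, χ v ≠ χ p → ∃ r ∈ R, χ r = χ v) → ¬ G.Adj r p → ColOn G U L := by
        intro p hp q hq hpR hqR hpq hχ hcp hcq himg hrp
        refine ColOn.of_pair (hsz r hr).1 hcp hrp ?_
        have hcardU : ((U.erase r).erase p).card ≤ 2 * (k + 1) := by
          have := h.card_le_two_mul
          rw [Finset.card_erase_of_mem (Finset.mem_erase.mpr ⟨fun e : p = r => hpR (e ▸ hr), hp⟩),
            Finset.card_erase_of_mem (hRU hr)]
          omega
        have hds : ∀ s ∈ U, s ∉ R → s ≠ p → s ≠ q → ∀ r' ∈ R, Disjoint (L r') (L s) := by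
          intro s hs hsR hsp hsq r' hr'
          obtain ⟨r2, hr2, e⟩ := himg s hs (fun e => by
            rcases h.two s hs p hp q hq e (e.trans hχ) with e | e | e
            · exact hsp e
            · exact hsq e
            · exact hpq e)
          rw [hLeq r' hr' r2 hr2]
          exact hdR r2 hr2 s hs (fun e => hsR (e ▸ hr2)) e.symm
        obtain ⟨f, hf, hf'⟩ := exists_injOn_choice ((U.erase r).erase p)
          (fun v => (L v).erase c) (by
          intro Q hQ
          have hQU : ∀ x ∈ Q, x ≠ p ∧ x ≠ r ∧ x ∈ U := fun x hx => by
            have := hQ hx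
            simpa only [Finset.mem_erase] using this
          by_cases hs : ∃ s ∈ Q, s ∉ R ∧ s ≠ q
          · obtain ⟨s, hsQ, hsR, hsq⟩ := hs
            have hcs : c ∉ L s := Finset.disjoint_left.mp
              (hds s (hQU s hsQ).2.2 hsR (hQU s hsQ).1 hsq r hr) (hsz r hr).1
            have h5 := hL s (hQU s hsQ).2.2 hsR
            by_cases hr' : ∃ r' ∈ Q, r' ∈ R
            · obtain ⟨r', hr'Q, hr'R⟩ := hr'
              have hd := hds s (hQU s hsQ).2.2 hsR (hQU s hsQ).1 hsq r' hr'R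
              have h8 := card_add_le_card_biUnion (L := fun v => (L v).erase c) hr'Q hsQ
                (disjoint_erase_erase hd c)
              have h6 := hLR r' hr'R
              have h7 := card_erase_ge (L r') c
              have h9 := Finset.card_le_card hQ
              simp only [Finset.erase_eq_of_notMem hcs] at h8
              omega
            · push Not at hr'
              have hQinj : Set.InjOn χ Q := by
                intro x hx y hy e
                by_contra hne
                by_cases hxp : χ x = χ p
                · rcases h.two p hp x (hQU x hx).2.2 y (hQU y hy).2.2 hxp.symm
                    (hxp.symm.trans e) with e' | e' | e'
                  · exact (hQU x hx).1 e'.symm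
                  · exact (hQU y hy).1 e'.symm
                  · exact hne e'
                · obtain ⟨r2, hr2, e2⟩ := himg x (hQU x hx).2.2 hxp
                  rcases h.two r2 (hRU hr2) x (hQU x hx).2.2 y (hQU y hy).2.2 e2
                    (e2.trans e) with e' | e' | e'
                  · exact hr' x hx (e' ▸ hr2)
                  · exact hr' y hy (e' ▸ hr2)
                  · exact hne e'
              have h6 := h.card_le_of_injOn (fun x hx => (hQU x hx).2.2) hQinj
              have h8 := card_le_card_biUnion_of_mem (L := fun v => (L v).erase c) hsQ
              simp only [Finset.erase_eq_of_notMem hcs] at h8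
              omega
          · push Not at hs
            have hsub : Q ⊆ insert q (R.erase r) := by
              intro x hx
              by_cases hxR : x ∈ R
              · exact Finset.mem_insert_of_mem (Finset.mem_erase.mpr ⟨(hQU x hx).2.1, hxR⟩)
              · exact Finset.mem_insert.mpr (Or.inl (hs x hx hxR))
            have hcR := Finset.card_erase_of_mem hr
            by_cases hqQ : q ∈ Q
            · have h5 := Finset.card_le_card hsub
              have h6 := Finset.card_insert_le q (R.erase r)
              have h7 := hL q hq hqR
              have h8 := card_erase_ge (L q) c
              have h9 := card_le_card_biUnion_of_mem (L := fun v => (L v).erase c) hqQ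
              omega
            · have hsub' : Q ⊆ R.erase r := by
                intro x hx
                rcases Finset.mem_insert.mp (hsub hx) with rfl | h'
                · exact absurd hx hqQ
                · exact h'
              have h5 := Finset.card_le_card hsub'
              rcases Q.eq_empty_or_nonempty with rfl | ⟨x, hx⟩
              · simp
              have h7 := hLR x (Finset.mem_of_mem_erase (hsub' hx))
              have h8 := card_erase_ge (L x) c
              have h9 := card_le_card_biUnion_of_mem (L := fun v => (L v).erase c) hx
              omega)
        exact ColOn.of_injOn hf hf'
      rcases hadj r hr p hp q hq hpR hqR hpq hχ with h5 | h5
      · exact key p hp q hq hpR hqR hpq hχ hcp hcq himg h5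
      · exact key q hq p hp hqR hpR hpq.symm hχ.symm hcq hcp (hχ ▸ himg) h5

end rooted

section rooted
variable {G : SimpleGraph V} {U : Finset V} {χ : V → ℕ} {L : V → Finset ℕ}

/-- Two roots and four parts: the hypotheses for which a direct colouring is sought. -/
structure TwoRoots (G : SimpleGraph V) (U : Finset V) (χ : V → ℕ) (L : V → Finset ℕ)
    (r r' : V) : Prop where
  part : PartData G U χ 4
  memr : r ∈ U
  memr' : r' ∈ U
  ne : χ r ≠ χ r'
  listr : 2 ≤ (L r).card
  listr' : 2 ≤ (L r').card
  list : ∀ v ∈ U, v ≠ r → v ≠ r' → 4 ≤ (L v).card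
  disj : ∀ s ∈ U, s ≠ r → χ s = χ r → Disjoint (L r) (L s)
  disj' : ∀ s ∈ U, s ≠ r' → χ s = χ r' → Disjoint (L r') (L s)

namespace TwoRoots
variable {r r' p q p' q' : V} {c c' : ℕ}

lemma symm (h : TwoRoots G U χ L r r') : TwoRoots G U χ L r' r :=
  ⟨h.part, h.memr', h.memr, h.ne.symm, h.listr', h.listr, fun v hv h1 h2 => h.list v hv h2 h1,
    h.disj', h.disj⟩

/-- A part without roots. -/
structure Free (U : Finset V) (χ : V → ℕ) (r r' p q : V) : Prop where
  memp : p ∈ U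
  memq : q ∈ U
  ne : p ≠ q
  eq : χ p = χ q
  ner : χ p ≠ χ r
  ner' : χ p ≠ χ r'

lemma Free.symm (h : Free U χ r r' p q) : Free U χ r r' q p :=
  ⟨h.memq, h.memp, h.ne.symm, h.eq.symm, h.eq ▸ h.ner, h.eq ▸ h.ner'⟩

lemma Free.swap (h : Free U χ r r' p q) : Free U χ r' r p q :=
  ⟨h.memp, h.memq, h.ne, h.eq, h.ner', h.ner⟩

/-- Two vertices of a common part, both different from the roots, form a free part. -/
lemma free (h : TwoRoots G U χ L r r') {u v : V} (hu : u ∈ U) (hv : v ∈ U) (huv : u ≠ v)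
    (e : χ u = χ v) (hur : u ≠ r) (hur' : u ≠ r') (hvr : v ≠ r) (hvr' : v ≠ r') :
    Free U χ r r' u v := by
  refine ⟨hu, hv, huv, e, fun e' => ?_, fun e' => ?_⟩
  · rcases h.part.two u hu v hv r h.memr e e' with e | e | e
    exacts [huv e, hur e, hvr e]
  · rcases h.part.two u hu v hv r' h.memr' e e' with e | e | e
    exacts [huv e, hur' e, hvr' e]

/-- There are at most two free parts. -/
lemma eq_or_eq (h : TwoRoots G U χ L r r') (hp : Free U χ r r' p q) (hp' : Free U χ r r' p' q')
    (hpp : χ p ≠ χ p') {u v : V} (hu : Free U χ r r' u v) : χ u = χ p ∨ χ u = χ p' := by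
  classical
  by_contra hno
  push Not at hno
  have hsub : ({χ r, χ r', χ p, χ p', χ u} : Finset ℕ) ⊆ U.image χ := by
    intro t ht
    simp only [Finset.mem_insert, Finset.mem_singleton] at ht
    rcases ht with rfl | rfl | rfl | rfl | rfl
    · exact Finset.mem_image_of_mem χ h.memr
    · exact Finset.mem_image_of_mem χ h.memr'
    · exact Finset.mem_image_of_mem χ hp.memp
    · exact Finset.mem_image_of_mem χ hp'.memp
    · exact Finset.mem_image_of_mem χ hu.memp
  have h1 := Finset.card_le_card hsub
  have h2 := h.part.card
  rw [Finset.card_insert_of_notMem, Finset.card_insert_of_notMem, Finset.card_insert_of_notMem,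
    Finset.card_insert_of_notMem, Finset.card_singleton] at h1
  · omega
  · simpa using hno.2.symm
  · simpa using ⟨hpp, hno.1.symm⟩
  · simpa using ⟨hp.ner'.symm, hp'.ner'.symm, hu.ner'.symm⟩
  · simpa using ⟨h.ne, hp.ner.symm, hp'.ner.symm, hu.ner.symm⟩

lemma card_erase (h : TwoRoots G U χ L r r') [DecidableEq V] (hp : Free U χ r r' p q) :
    ((U.erase r).erase p).card ≤ 6 := by
  have := h.part.card_le_two_mul
  rw [Finset.card_erase_of_mem (Finset.mem_erase.mpr ⟨fun e : p = r => hp.ner (e ▸ rfl), hp.memp⟩),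
    Finset.card_erase_of_mem h.memr]
  omega

/-- Colour `r` and `p` with `c`; if this does not extend, the list of `r'` is `{c, c'}` for a
common colour `c'` of the other free part. -/
lemma colOn_or (h : TwoRoots G U χ L r r') (hp : Free U χ r r' p q) (hrp : ¬ G.Adj r p)
    (hcr : c ∈ L r) (hcp : c ∈ L p) :
    ColOn G U L ∨ ∃ p' q' c', Free U χ r r' p' q' ∧ χ p ≠ χ p' ∧ c' ∈ L p' ∧ c' ∈ L q' ∧ c' ≠ c ∧
      L r' = {c, c'} := by
  classical
  by_cases hcom : ∃ p' q' c', Free U χ r r' p' q' ∧ χ p ≠ χ p' ∧ c' ∈ L p' ∧ c' ∈ L q' ∧ c' ≠ c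
  · obtain ⟨p', q', c', hp', hpp, hcp', hcq', hcc⟩ := hcom
    by_cases hsub : L r' ⊆ {c, c'}
    · refine Or.inr ⟨p', q', c', hp', hpp, hcp', hcq', hcc, Finset.eq_of_subset_of_card_le hsub ?_⟩
      rw [Finset.card_pair hcc.symm]
      exact h.listr'
    obtain ⟨b, hb, hbc⟩ := Finset.not_subset.mp hsub
    left
    refine ColOn.of_pair hcr hcp hrp ?_
    have hU' : PartData G ((U.erase r).erase p) χ 4 :=
      h.part.sub ((Finset.erase_subset _ _).trans (Finset.erase_subset _ _))
    have hmem : ∀ v, v ∈ (U.erase r).erase p ↔ v ≠ p ∧ v ≠ r ∧ v ∈ U := fun v => by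
      simp only [Finset.mem_erase]
    have hp'm : p' ∈ (U.erase r).erase p := (hmem p').mpr
      ⟨fun e => hpp (e ▸ rfl), fun e => hp'.ner (e ▸ rfl), hp'.memp⟩
    have hq'm : q' ∈ (U.erase r).erase p := (hmem q').mpr
      ⟨fun e => hpp (e ▸ hp'.eq.symm), fun e => hp'.ner (e ▸ hp'.eq), hp'.memq⟩
    refine ColOn.of_part hU' hp'm hq'm hp'.ne hp'.eq (a := c') (by simp [hcc, hcp'])
      (by simp [hcc, hcq']) ?_
    have hU3 := hU'.remove hp'm
    have hcard : ((((U.erase r).erase p).filter fun w => χ w ≠ χ p')).card ≤ 4 := by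
      have h1 := (h.part.remove hp'.memp).card_le_two_mul
      have h2 : (((U.erase r).erase p).filter fun w => χ w ≠ χ p') =
          ((U.filter fun w => χ w ≠ χ p').erase r).erase p := by
        ext w; simp only [Finset.mem_filter, Finset.mem_erase]; tauto
      rw [h2, Finset.card_erase_of_mem, Finset.card_erase_of_mem]
      · omega
      · exact Finset.mem_filter.mpr ⟨h.memr, hp'.ner.symm⟩
      · exact Finset.mem_erase.mpr ⟨fun e : p = r => hp.ner (e ▸ rfl),
          Finset.mem_filter.mpr ⟨hp.memp, hpp⟩⟩
    have hbig : ∀ v, 4 ≤ (L v).card → 2 ≤ (((L v).erase c).erase c').card := by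
      intro v hv
      have := card_erase_ge (L v) c
      have := card_erase_ge ((L v).erase c) c'
      omega
    obtain ⟨f, hf, hf'⟩ := exists_injOn_choice (((U.erase r).erase p).filter fun w => χ w ≠ χ p')
      (fun v => ((L v).erase c).erase c') (by
      intro Q hQ
      have hQU : ∀ x ∈ Q, (x ≠ p ∧ x ≠ r ∧ x ∈ U) ∧ χ x ≠ χ p' := fun x hx => by
        have := Finset.mem_filter.mp (hQ hx)
        rwa [hmem] at this
      have hQ4 := (Finset.card_le_card hQ).trans hcard
      by_cases hpair : ∃ u ∈ Q, r' ∈ Q ∧ u ≠ r' ∧ χ u = χ r'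
      · obtain ⟨u, hu, hr'Q, hur, e⟩ := hpair
        have hur2 : u ≠ r := fun e' => h.ne (e' ▸ e)
        have hd := h.disj' u (hQU u hu).1.2.2 hur e
        have h1 := card_add_le_card_biUnion (L := fun v => ((L v).erase c).erase c') hr'Q hu
          (disjoint_erase_erase (disjoint_erase_erase hd c) c')
        have h2 := card_erase_add_of_disjoint hd c
        have h3 := card_erase_add_of_disjoint (disjoint_erase_erase hd c) c'
        have := h.listr'
        have := h.list u (hQU u hu).1.2.2 hur2 hur
        omega
      · push Not at hpair
        have hQinj : Set.InjOn χ Q := by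
          intro x hx y hy e
          by_contra hne
          have hxr : x ≠ r' := fun e' => hpair y hy (e' ▸ hx) (fun e'' => hne (e'.trans e''.symm))
            (e' ▸ e.symm)
          have hyr : y ≠ r' := fun e' => hpair x hx (e' ▸ hy) (fun e'' => hne (e''.trans e'.symm))
            (e' ▸ e)
          have hfree := h.free (hQU x hx).1.2.2 (hQU y hy).1.2.2 hne e (hQU x hx).1.2.1 hxr
            (hQU y hy).1.2.1 hyr
          rcases h.eq_or_eq hp hp' hpp hfree with e' | e'
          · rcases h.part.two p hp.memp x (hQU x hx).1.2.2 y (hQU y hy).1.2.2 e'.symm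
              (e'.symm.trans e) with e2 | e2 | e2
            · exact (hQU x hx).1.1 e2.symm
            · exact (hQU y hy).1.1 e2.symm
            · exact hne e2
          · exact (hQU x hx).2 e'
        have hQ3 := hU3.card_le_of_injOn hQ hQinj
        by_cases hs : ∃ s ∈ Q, χ s = χ r
        · obtain ⟨s, hs, hsr⟩ := hs
          have hd := h.disj s (hQU s hs).1.2.2 (hQU s hs).1.2.1 hsr
          have h1 := card_le_card_biUnion_of_mem (L := fun v => ((L v).erase c).erase c') hs
          have h2 := h.list s (hQU s hs).1.2.2 (hQU s hs).1.2.1 (fun e => h.ne (e ▸ hsr.symm))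
          have h3 := card_erase_ge ((L s).erase c) c'
          rw [Finset.erase_eq_of_notMem (Finset.disjoint_left.mp hd hcr)] at h1 h3
          omega
        · push Not at hs
          have hQ2 : Q.card ≤ 2 := by
            have hr3 : r ∈ U.filter fun w => χ w ≠ χ p' :=
              Finset.mem_filter.mpr ⟨h.memr, hp'.ner.symm⟩
            refine ((h.part.remove hp'.memp).remove hr3).card_le_of_injOn (fun x hx => ?_) hQinj
            exact Finset.mem_filter.mpr ⟨Finset.mem_filter.mpr ⟨(hQU x hx).1.2.2, (hQU x hx).2⟩,
              hs x hx⟩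
          by_cases hx : ∃ x ∈ Q, x ≠ r'
          · obtain ⟨x, hx, hxr⟩ := hx
            have h1 := card_le_card_biUnion_of_mem (L := fun v => ((L v).erase c).erase c') hx
            have h2 := hbig x (h.list x (hQU x hx).1.2.2 (hQU x hx).1.2.1 hxr)
            omega
          · push Not at hx
            rcases Q.eq_empty_or_nonempty with rfl | ⟨x, hxQ⟩
            · simp
            have h1 : Q ⊆ {r'} := fun y hy => Finset.mem_singleton.mpr (hx y hy)
            have h2 := Finset.card_le_card h1
            rw [Finset.card_singleton] at h2
            have h3 : 0 < (Q.biUnion fun v => ((L v).erase c).erase c').card := by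
              refine Finset.card_pos.mpr ⟨b, Finset.mem_biUnion.mpr ⟨x, hxQ, ?_⟩⟩
              rw [hx x hxQ]
              simp only [Finset.mem_insert, Finset.mem_singleton, not_or] at hbc
              simp [hb, hbc]
            omega)
    exact ColOn.of_injOn hf hf'
  · push Not at hcom
    left
    refine ColOn.of_pair hcr hcp hrp ?_
    have hcard := h.card_erase hp
    obtain ⟨f, hf, hf'⟩ := exists_injOn_choice ((U.erase r).erase p)
      (fun v => (L v).erase c) (by
      intro Q hQ
      have hQU : ∀ x ∈ Q, x ≠ p ∧ x ≠ r ∧ x ∈ U := fun x hx => by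
        have := hQ hx
        simpa only [Finset.mem_erase] using this
      have hQ6 := (Finset.card_le_card hQ).trans hcard
      by_cases hpair : ∃ u ∈ Q, ∃ v ∈ Q, u ≠ v ∧ χ u = χ v ∧ u ≠ r' ∧ v ≠ r'
      · obtain ⟨u, hu, v, hv, huv, e, hur, hvr⟩ := hpair
        have hfree := h.free (hQU u hu).2.2 (hQU v hv).2.2 huv e (hQU u hu).2.1 hur
            (hQU v hv).2.1 hvr
        have hup : χ p ≠ χ u := by
          intro e'
          rcases h.part.two p hp.memp u (hQU u hu).2.2 v (hQU v hv).2.2 e'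
              (e'.trans e) with e2 | e2 | e2
          · exact (hQU u hu).1 e2.symm
          · exact (hQU v hv).1 e2.symm
          · exact huv e2
        have hd : Disjoint ((L u).erase c) ((L v).erase c) := by
          refine Finset.disjoint_left.mpr fun a ha hb => ?_
          obtain ⟨h1, h2⟩ := Finset.mem_erase.mp ha
          exact h1 (hcom u v a hfree hup h2 (Finset.mem_of_mem_erase hb))
        have h1 := card_add_le_card_biUnion (L := fun v => (L v).erase c) hu hv hd
        have := h.list u (hQU u hu).2.2 (hQU u hu).2.1 hur
        have := h.list v (hQU v hv).2.2 (hQU v hv).2.1 hvr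
        have := card_erase_ge (L u) c
        have := card_erase_ge (L v) c
        omega
      · push Not at hpair
        have hinj' : Set.InjOn χ (Q.erase r' : Finset V) := by
          intro x hx y hy e
          have hx := Finset.mem_erase.mp hx
          have hy := Finset.mem_erase.mp hy
          by_contra hne
          exact hy.1 (hpair x hx.2 y hy.2 hne e hx.1)
        have h4 := h.part.card_le_of_injOn (fun x hx => (hQU x (Finset.mem_of_mem_erase hx)).2.2)
          hinj'
        have h5 := Finset.pred_card_le_card_erase (s := Q) (a := r')
        by_cases hpair' : ∃ u ∈ Q, r' ∈ Q ∧ u ≠ r' ∧ χ u = χ r'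
        · obtain ⟨u, hu, hr'Q, hur, e⟩ := hpair'
          have hur2 : u ≠ r := fun e' => h.ne (e' ▸ e)
          have hd := h.disj' u (hQU u hu).2.2 hur e
          have h1 := card_add_le_card_biUnion (L := fun v => (L v).erase c) hr'Q hu
            (disjoint_erase_erase hd c)
          have h2 := card_erase_add_of_disjoint hd c
          have := h.listr'
          have := h.list u (hQU u hu).2.2 hur2 hur
          omega
        · push Not at hpair'
          have hQinj : Set.InjOn χ Q := by
            intro x hx y hy e
            by_contra hne
            have hxr : x ≠ r' := fun e' => hpair' y hy (e' ▸ hx)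
              (fun e'' => hne (e'.trans e''.symm)) (e' ▸ e.symm)
            exact hpair' x hx (hpair x hx y hy hne e hxr ▸ hy) hxr
              (hpair x hx y hy hne e hxr ▸ e)
          have hQ4 := h.part.card_le_of_injOn (fun x hx => (hQU x hx).2.2) hQinj
          by_cases hs : ∃ s ∈ Q, χ s = χ r
          · obtain ⟨s, hs, hsr⟩ := hs
            have hd := h.disj s (hQU s hs).2.2 (hQU s hs).2.1 hsr
            have h1 := card_le_card_biUnion_of_mem (L := fun v => (L v).erase c) hs
            have h2 := h.list s (hQU s hs).2.2 (hQU s hs).2.1 (fun e => h.ne (e ▸ hsr.symm))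
            rw [Finset.erase_eq_of_notMem (Finset.disjoint_left.mp hd hcr)] at h1
            omega
          · push Not at hs
            have hQ3 : Q.card ≤ 3 := (h.part.remove h.memr).card_le_of_injOn
              (fun x hx => Finset.mem_filter.mpr ⟨(hQU x hx).2.2, hs x hx⟩) hQinj
            rcases Q.eq_empty_or_nonempty with rfl | ⟨y, hyQ⟩
            · simp
            by_cases hx : ∃ x ∈ Q, x ≠ r'
            · obtain ⟨x, hx, hxr⟩ := hx
              have h1 := card_le_card_biUnion_of_mem (L := fun v => (L v).erase c) hx
              have := h.list x (hQU x hx).2.2 (hQU x hx).2.1 hxr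
              have := card_erase_ge (L x) c
              omega
            · push Not at hx
              have h1 : Q ⊆ {r'} := fun y hy => Finset.mem_singleton.mpr (hx y hy)
              have h2 := Finset.card_le_card h1
              rw [Finset.card_singleton] at h2
              have h1 := card_le_card_biUnion_of_mem (L := fun v => (L v).erase c) hyQ
              rw [hx y hyQ] at h1
              have := h.listr'
              have := card_erase_ge (L r') c
              omega)
    exact ColOn.of_injOn hf hf'

/-- The last case: both roots have the same list `{c, c'}`. -/
lemma colOn_of_eq (h : TwoRoots G U χ L r r') (hp : Free U χ r r' p q)
    (hp' : Free U χ r r' p' q') (hpp : χ p ≠ χ p') (hrp : ¬ G.Adj r p) (hrp' : ¬ G.Adj r' p')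
    (hcc : c' ≠ c) (hcr : c ∈ L r) (hcr2 : c' ∈ L r) (hcr' : c ∈ L r') (hcr2' : c' ∈ L r')
    (hcp : c ∈ L p) (hcp' : c' ∈ L p') : ColOn G U L := by
  classical
  refine ColOn.of_pair hcr hcp hrp (ColOn.of_pair (r := r') (p := p') (a := c') (by simp [*])
    (by simp [*]) hrp' ?_)
  obtain ⟨f, hf, hf'⟩ := exists_injOn_choice ((((U.erase r).erase p).erase r').erase p')
    (fun v => ((L v).erase c).erase c') (by
    intro Q hQ
    have hQU : ∀ x ∈ Q, x ≠ p' ∧ x ≠ r' ∧ x ≠ p ∧ x ≠ r ∧ x ∈ U := fun x hx => by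
      have := hQ hx
      simpa only [Finset.mem_erase] using this
    have hQinj : Set.InjOn χ Q := by
      intro x hx y hy e
      by_contra hne
      obtain ⟨hx1, hx2, hx3, hx4, hx5⟩ := hQU x hx
      obtain ⟨hy1, hy2, hy3, hy4, hy5⟩ := hQU y hy
      rcases h.eq_or_eq hp hp' hpp (h.free hx5 hy5 hne e hx4 hx2 hy4 hy2) with e' | e'
      · rcases h.part.two p hp.memp x hx5 y hy5 e'.symm (e'.symm.trans e) with e2 | e2 | e2
        exacts [hx3 e2.symm, hy3 e2.symm, hne e2]
      · rcases h.part.two p' hp'.memp x hx5 y hy5 e'.symm (e'.symm.trans e) with e2 | e2 | e2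
        exacts [hx1 e2.symm, hy1 e2.symm, hne e2]
    have hQ4 := h.part.card_le_of_injOn (fun x hx => (hQU x hx).2.2.2.2) hQinj
    by_cases hs : ∃ s ∈ Q, χ s = χ r ∨ χ s = χ r'
    · obtain ⟨s, hs, hsr⟩ := hs
      obtain ⟨hs1, hs2, hs3, hs4, hs5⟩ := hQU s hs
      have h1 := card_le_card_biUnion_of_mem (L := fun v => ((L v).erase c).erase c') hs
      have h2 := h.list s hs5 hs4 hs2
      have h3 : c ∉ L s ∧ c' ∉ L s := by
        rcases hsr with e | e
        · have hd := Finset.disjoint_left.mp (h.disj s hs5 hs4 e)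
          exact ⟨hd hcr, hd hcr2⟩
        · have hd := Finset.disjoint_left.mp (h.disj' s hs5 hs2 e)
          exact ⟨hd hcr', hd hcr2'⟩
      rw [Finset.erase_eq_of_notMem h3.1, Finset.erase_eq_of_notMem h3.2] at h1
      omega
    · push Not at hs
      have hr3 : r' ∈ U.filter fun w => χ w ≠ χ r := Finset.mem_filter.mpr ⟨h.memr', h.ne.symm⟩
      have hQ2 : Q.card ≤ 2 := ((h.part.remove h.memr).remove hr3).card_le_of_injOn (fun x hx =>
        Finset.mem_filter.mpr ⟨Finset.mem_filter.mpr ⟨(hQU x hx).2.2.2.2, (hs x hx).1⟩,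
          (hs x hx).2⟩) hQinj
      rcases Q.eq_empty_or_nonempty with rfl | ⟨y, hy⟩
      · simp
      have h1 := card_le_card_biUnion_of_mem (L := fun v => ((L v).erase c).erase c') hy
      have := h.list y (hQU y hy).2.2.2.2 (hQU y hy).2.2.2.1 (hQU y hy).2.1
      have := card_erase_ge (L y) c
      have := card_erase_ge ((L y).erase c) c'
      omega)
  exact ColOn.of_injOn hf hf'

/-- Two roots in four parts, with no common colour in a part with a root. -/
lemma colOn (h : TwoRoots G U χ L r r')
    (hadj : ∀ x y, Free U χ r r' x y → ¬ G.Adj r x ∨ ¬ G.Adj r y)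
    (hadj' : ∀ x y, Free U χ r r' x y → ¬ G.Adj r' x ∨ ¬ G.Adj r' y)
    (hp : Free U χ r r' p q) (hcp : c ∈ L p) (hcq : c ∈ L q) (hcr : c ∈ L r) : ColOn G U L := by
  have step : ∀ {r r' p q : V} {c : ℕ}, TwoRoots G U χ L r r' →
      (∀ x y, Free U χ r r' x y → ¬ G.Adj r x ∨ ¬ G.Adj r y) → Free U χ r r' p q → c ∈ L p →
      c ∈ L q → c ∈ L r → ColOn G U L ∨ ∃ p' q' c', Free U χ r r' p' q' ∧ χ p ≠ χ p' ∧ c' ∈ L p' ∧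
        c' ∈ L q' ∧ c' ≠ c ∧ L r' = {c, c'} := by
    intro r r' p q c h hadj hp hcp hcq hcr
    rcases hadj p q hp with h1 | h1
    · exact h.colOn_or hp h1 hcr hcp
    · rcases h.colOn_or hp.symm h1 hcr hcq with h2 | ⟨p', q', c', h2, h3, h4⟩
      · exact Or.inl h2
      · exact Or.inr ⟨p', q', c', h2, hp.eq ▸ h3, h4⟩
  have hadj2 : ∀ x y, Free U χ r' r x y → ¬ G.Adj r' x ∨ ¬ G.Adj r' y :=
    fun x y hf => hadj' x y hf.swap
  rcases step h hadj hp hcp hcq hcr with h1 | ⟨p', q', c', hp', hpp, hcp', hcq', hcc, hLr'⟩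
  · exact h1
  have hcr' : c ∈ L r' := by simp [hLr']
  have hcr2' : c' ∈ L r' := by simp [hLr']
  rcases step h.symm hadj2 hp'.swap hcp' hcq' hcr2' with h1 | ⟨_, _, c2, _, _, _, _, _, hLr⟩
  · exact h1
  have hcr2 : c' ∈ L r := by simp [hLr]
  rcases hadj p q hp with h1 | h1 <;> rcases hadj' p' q' hp' with h2 | h2
  · exact h.colOn_of_eq hp hp' hpp h1 h2 hcc hcr hcr2 hcr' hcr2' hcp hcp'
  · exact h.colOn_of_eq hp hp'.symm (hp'.eq ▸ hpp) h1 h2 hcc hcr hcr2 hcr' hcr2' hcp hcq'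
  · exact h.colOn_of_eq hp.symm hp' (hp.eq ▸ hpp) h1 h2 hcc hcr hcr2 hcr' hcr2' hcq hcp'
  · exact h.colOn_of_eq hp.symm hp'.symm (hp.eq ▸ hp'.eq ▸ hpp) h1 h2 hcc hcr hcr2 hcr' hcr2' hcq hcq'

end TwoRoots
end rooted

section rooted
variable {G : SimpleGraph V} {U : Finset V} {χ : V → ℕ} {k : ℕ} {L : V → Finset ℕ}

lemma PartData.colOn_two_roots (h : PartData G U χ 4) {R : Finset V} (hRU : R ⊆ U)
    (hinj : Set.InjOn χ R) (hR2 : R.card = 2) (hLR : ∀ r ∈ R, 2 ≤ (L r).card)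
    (hL : ∀ v ∈ U, v ∉ R → 4 ≤ (L v).card)
    (hadj : ∀ r ∈ R, ∀ p ∈ U, ∀ q ∈ U, p ∉ R → q ∉ R → p ≠ q → χ p = χ q →
      ¬ G.Adj r p ∨ ¬ G.Adj r q) : ColOn G U L := by
  classical
  have hpartner : ∀ r ∈ R, ∀ s ∈ U, s ≠ r → χ s = χ r → ∀ a, a ∈ L r → a ∈ L s → ColOn G U L := by
    intro r hr s hs hsr e a har has
    have h1 : (R.erase r).card = 1 := by rw [Finset.card_erase_of_mem hr, hR2]
    obtain ⟨r', hr'⟩ := Finset.card_eq_one.mp h1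
    have hmem : r' ≠ r ∧ r' ∈ R := by
      have : r' ∈ R.erase r := by rw [hr']; simp
      exact Finset.mem_erase.mp this
    have hR' : ∀ v, v ≠ r → v ≠ r' → v ∉ R := by
      intro v h2 h3 h4
      have : v ∈ R.erase r := Finset.mem_erase.mpr ⟨h2, h4⟩
      rw [hr'] at this
      exact h3 (Finset.mem_singleton.mp this)
    refine ColOn.of_part h (hRU hr) hs hsr.symm e.symm har has
      ((h.remove (hRU hr)).colOn_one_root (r := r') ?_ ?_ ?_ ?_)
    · exact Finset.mem_filter.mpr ⟨hRU hmem.2, fun e => hmem.1 (hinj hmem.2 hr e)⟩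
    · have := hLR r' hmem.2
      have := card_erase_ge (L r') a
      exact Finset.card_pos.mp (by omega)
    · intro v hv hvr
      obtain ⟨hv1, hv2⟩ := Finset.mem_filter.mp hv
      have := hL v hv1 (hR' v (fun e => hv2 (e ▸ rfl)) hvr)
      have := card_erase_ge (L v) a
      omega
    · intro p hp q hq hpr hqr hpq e
      obtain ⟨hp1, hp2⟩ := Finset.mem_filter.mp hp
      obtain ⟨hq1, hq2⟩ := Finset.mem_filter.mp hq
      exact hadj r' hmem.2 p hp1 q hq1 (hR' p (fun e => hp2 (e ▸ rfl)) hpr)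
        (hR' q (fun e => hq2 (e ▸ rfl)) hqr) hpq e
  obtain ⟨r, r', hrr, hRe⟩ := Finset.card_eq_two.mp hR2
  have hr : r ∈ R := by simp [hRe]
  have hr' : r' ∈ R := by simp [hRe]
  have hnR : ∀ v, v ≠ r → v ≠ r' → v ∉ R := fun v h1 h2 => by simp [hRe, h1, h2]
  by_cases h1 : ∃ r ∈ R, ∃ s ∈ U, s ≠ r ∧ χ s = χ r ∧ ∃ a, a ∈ L r ∧ a ∈ L s
  · obtain ⟨r, hr, s, hs, hsr, e, a, h2, h3⟩ := h1
    exact hpartner r hr s hs hsr e a h2 h3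
  push Not at h1
  have hd : ∀ r ∈ R, ∀ s ∈ U, s ≠ r → χ s = χ r → Disjoint (L r) (L s) := fun r hr s hs hsr e =>
    Finset.disjoint_left.mpr fun a ha => h1 r hr s hs hsr e a ha
  have htr : TwoRoots G U χ L r r' := ⟨h, hRU hr, hRU hr', fun e => hrr (hinj hr hr' e), hLR r hr,
    hLR r' hr', fun v hv h1 h2 => hL v hv (hnR v h1 h2), hd r hr, hd r' hr'⟩
  have hfree : ∀ x y, TwoRoots.Free U χ r r' x y → x ∉ R ∧ y ∉ R := fun x y hf =>
    ⟨hnR x (fun e => hf.ner (e ▸ rfl)) (fun e => hf.ner' (e ▸ rfl)),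
      hnR y (fun e => hf.ner (e ▸ hf.eq)) (fun e => hf.ner' (e ▸ hf.eq))⟩
  have hadj1 : ∀ r0 ∈ R, ∀ x y, TwoRoots.Free U χ r r' x y → ¬ G.Adj r0 x ∨ ¬ G.Adj r0 y :=
    fun r0 hr0 x y hf => hadj r0 hr0 x hf.memp y hf.memq (hfree x y hf).1 (hfree x y hf).2 hf.ne
      hf.eq
  by_cases h2 : ∃ p q c, TwoRoots.Free U χ r r' p q ∧ c ∈ L p ∧ c ∈ L q
  · obtain ⟨p, q, c, hf, hcp, hcq⟩ := h2
    by_cases hcr : c ∈ L r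
    · exact htr.colOn (hadj1 r hr) (hadj1 r' hr') hf hcp hcq hcr
    by_cases hcr' : c ∈ L r'
    · exact htr.symm.colOn (fun x y hf => hadj1 r' hr' x y hf.swap)
        (fun x y hf => hadj1 r hr x y hf.swap) hf.swap hcp hcq hcr'
    have hLR' : ∀ x ∈ R, c ∉ L x := by
      intro x hx
      rw [hRe] at hx
      simp only [Finset.mem_insert, Finset.mem_singleton] at hx
      rcases hx with rfl | rfl <;> assumption
    refine ColOn.of_part h hf.memp hf.memq hf.ne hf.eq hcp hcq
      (PartData.colOn_roots_pred 2 _ R _ (h.remove hf.memp) ?_ hinj hR2 ?_ ?_ ?_)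
    · intro x hx
      refine Finset.mem_filter.mpr ⟨hRU hx, ?_⟩
      rw [hRe] at hx
      simp only [Finset.mem_insert, Finset.mem_singleton] at hx
      rcases hx with rfl | rfl
      · exact hf.ner.symm
      · exact hf.ner'.symm
    · intro x hx
      rw [Finset.erase_eq_of_notMem (hLR' x hx)]
      exact hLR x hx
    · intro v hv hvR
      have := hL v (Finset.mem_filter.mp hv).1 hvR
      have := card_erase_ge (L v) c
      omega
    · intro x hx p hp q hq
      exact hadj x hx p (Finset.mem_filter.mp hp).1 q (Finset.mem_filter.mp hq).1
  · push Not at h2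
    refine h.colOn_of_disjoint hRU hinj (fun r hr => hR2 ▸ hLR r hr) hL ?_
    intro u hu v hv huv e
    by_cases huR : u ∈ R
    · exact hd u huR v hv huv.symm e.symm
    · by_cases hvR : v ∈ R
      · exact (hd v hvR u hu huv e).symm
      · refine Finset.disjoint_left.mpr fun a ha => h2 u v a (htr.free hu hv huv e ?_ ?_ ?_ ?_) ha
        all_goals
          intro e'
          subst e'
          first | exact huR hr | exact huR hr' | exact hvR hr | exact hvR hr'

lemma PartData.colOn_roots (h : PartData G U χ k) (hk : k ≤ 4) {R : Finset V} (hRU : R ⊆ U)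
    (hinj : Set.InjOn χ R) (hRk : R.card + 1 ≤ k) (hLR : ∀ r ∈ R, R.card ≤ (L r).card)
    (hL : ∀ v ∈ U, v ∉ R → k ≤ (L v).card)
    (hadj : ∀ r ∈ R, ∀ p ∈ U, ∀ q ∈ U, p ∉ R → q ∉ R → p ≠ q → χ p = χ q →
      ¬ G.Adj r p ∨ ¬ G.Adj r q) : ColOn G U L := by
  classical
  by_cases h1 : k = R.card + 1
  · subst h1
    exact PartData.colOn_roots_pred _ U R L h hRU hinj rfl hLR hL hadj
  by_cases h0 : R.card = 0
  · rw [Finset.card_eq_zero] at h0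
    subst h0
    exact h.colOn fun v hv => hL v hv (by simp)
  by_cases h2 : R.card = 1
  · obtain ⟨r, rfl⟩ := Finset.card_eq_one.mp h2
    simp only [Finset.mem_singleton, forall_eq] at hadj
    exact h.colOn_one_root (r := r) (hRU (by simp))
      (Finset.card_pos.mp (by have := hLR r (by simp); rw [h2] at this; omega))
      (fun v hv hvr => hL v hv (by simpa using hvr)) hadj
  · have h3 : R.card = 2 := by omega
    have h4 : k = 4 := by omega
    subst h4
    rw [h3] at hLR
    exact h.colOn_two_roots hRU hinj h3 hLR hL hadj

/-- Join a colouring of `S \ T` with the given colouring of `T`. -/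
lemma ColOn.extend [DecidableEq V] {S T : Finset V} {L' : V → Finset ℕ} {f : V → ℕ}
    (hcol : ColOn G (S \ T) L') (hf : ∀ u ∈ T, ∀ v ∈ T, G.Adj u v → f u ≠ f v)
    (hL' : ∀ v ∈ S, v ∉ T → L' v ⊆ L v)
    (hLT : ∀ v ∈ S, v ∉ T → ∀ t ∈ T, G.Adj v t → f t ∉ L' v) :
    ∃ c : V → ℕ, (∀ v ∈ S, v ∉ T → c v ∈ L v) ∧ (∀ t ∈ T, c t = f t) ∧
      ∀ u ∈ S, ∀ v ∈ S, G.Adj u v → c u ≠ c v := by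
  obtain ⟨c, hc, hcp⟩ := hcol
  have key : ∀ t ∈ T, ∀ v ∈ S, v ∉ T → G.Adj v t → c v ≠ f t := by
    intro t ht v hv hvT hadj e
    exact hLT v hv hvT t ht hadj (e ▸ hc v (Finset.mem_sdiff.mpr ⟨hv, hvT⟩))
  refine ⟨fun v => if v ∈ T then f v else c v, ?_, ?_, ?_⟩
  · intro v hv hvT
    simp only [hvT, if_false]
    exact hL' v hv hvT (hc v (Finset.mem_sdiff.mpr ⟨hv, hvT⟩))
  · intro t ht
    simp only [ht, if_true]
  · intro u hu v hv huv
    by_cases h1 : u ∈ T <;> by_cases h2 : v ∈ T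
    · simp only [h1, h2, if_true]
      exact hf u h1 v h2 huv
    · simp only [h1, h2, if_true, if_false]
      exact (key u h1 v hv h2 huv.symm).symm
    · simp only [h1, h2, if_true, if_false]
      exact key v h2 u hu h1 huv
    · simp only [h1, h2, if_false]
      exact hcp u (Finset.mem_sdiff.mpr ⟨hu, h1⟩) v (Finset.mem_sdiff.mpr ⟨hv, h2⟩) huv

/-- Graphs without stable triples away from the attached clique. -/
lemma extendable_of_no_stable_triple {S T : Finset V} (hclaw : IsClawFree G) (hperf : PerfCol G)
    (hω : ∀ Q : Finset V, G.IsClique (Q : Set V) → Q.card ≤ k) (hk : k ≤ 4)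
    (hT : Attached G S T)
    (hS : ∀ x ∈ S, ∀ y ∈ S, ∀ z ∈ S, x ∉ T → y ∉ T → z ∉ T → x ≠ y → x ≠ z → y ≠ z →
      ¬ G.Adj x y → ¬ G.Adj x z → ¬ G.Adj y z → False) : Extendable G k S T := by
  classical
  intro L f hL hf
  obtain ⟨χ, hχ, hχ'⟩ := hperf (S \ T) k (fun Q _ hQ => hω Q hQ)
  have hpart : PartData G (S \ T) χ k := by
    refine ⟨hχ', ?_, ?_⟩
    · intro u hu v hv w hw e1 e2
      by_contra hne
      push Not at hne
      obtain ⟨hu1, hu2⟩ := Finset.mem_sdiff.mp hu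
      obtain ⟨hv1, hv2⟩ := Finset.mem_sdiff.mp hv
      obtain ⟨hw1, hw2⟩ := Finset.mem_sdiff.mp hw
      exact hS u hu1 v hv1 w hw1 hu2 hv2 hw2 hne.1 hne.2.1 hne.2.2
        (fun h => hχ' u hu v hv h e1) (fun h => hχ' u hu w hw h e2)
        (fun h => hχ' v hv w hw h (e1.symm.trans e2))
    · rw [← Finset.card_range k]
      refine Finset.card_le_card fun t ht => ?_
      obtain ⟨v, hv, rfl⟩ := Finset.mem_image.mp ht
      exact Finset.mem_range.mpr (hχ v hv)
  let R := (S \ T).filter fun v => ∃ t ∈ T, G.Adj v t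
  have hR : ∀ v, v ∈ R ↔ (v ∈ S ∧ v ∉ T) ∧ ∃ t ∈ T, G.Adj v t := fun v => by
    simp [R]
  have hRT : ∀ r ∈ R, ∀ t ∈ T, G.Adj r t := by
    intro r hr t ht
    obtain ⟨⟨h1, h2⟩, t', ht', h3⟩ := (hR r).mp hr
    exact hT.twin r h1 h2 t' ht' h3 t ht
  have hRc : ∀ u ∈ R, ∀ v ∈ R, u ≠ v → G.Adj u v := by
    intro u hu v hv huv
    obtain ⟨⟨h1, h2⟩, t, ht, h3⟩ := (hR u).mp hu
    obtain ⟨⟨h4, h5⟩, _⟩ := (hR v).mp hv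
    exact hT.nbr u h1 h2 v h4 h5 huv t ht h3 (hRT v hv t ht)
  have hdis : Disjoint R T := Finset.disjoint_left.mpr fun v hv => ((hR v).mp hv).1.2
  have hcard : R.card + T.card ≤ k := by
    rw [← Finset.card_union_of_disjoint hdis]
    refine hω _ ?_
    intro u hu v hv huv
    simp only [Finset.coe_union, Set.mem_union, Finset.mem_coe] at hu hv
    rcases hu with hu | hu <;> rcases hv with hv | hv
    · exact hRc u hu v hv huv
    · exact hRT u hu v hv
    · exact (hRT v hv u hu).symm
    · exact hT.clique u hu v hv huv
  let L' : V → Finset ℕ := fun v => if v ∈ R then L v \ T.image f else L v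
  have hcol : ColOn G (S \ T) L' := by
    by_cases hTe : T = ∅
    · refine hpart.colOn fun v hv => ?_
      obtain ⟨h1, h2⟩ := Finset.mem_sdiff.mp hv
      have : v ∉ R := fun h => by
        obtain ⟨_, t, ht, _⟩ := (hR v).mp h
        simp [hTe] at ht
      simp only [L', this, if_false]
      exact hL v h1 h2
    · have hTpos : 0 < T.card := Finset.card_pos.mpr (Finset.nonempty_iff_ne_empty.mpr hTe)
      refine hpart.colOn_roots hk (R := R) (Finset.filter_subset _ _) ?_ (by omega) ?_ ?_ ?_
      · intro x hx y hy e
        by_contra hne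
        exact hχ' x (Finset.filter_subset _ _ hx) y (Finset.filter_subset _ _ hy)
          (hRc x hx y hy hne) e
      · intro r hr
        simp only [L', hr, if_true]
        have h1 := hL r ((hR r).mp hr).1.1 ((hR r).mp hr).1.2
        have h2 := Finset.le_card_sdiff (T.image f) (L r)
        have h3 : (T.image f).card ≤ T.card := Finset.card_image_le
        omega
      · intro v hv hvR
        obtain ⟨h1, h2⟩ := Finset.mem_sdiff.mp hv
        simp only [L', hvR, if_false]
        exact hL v h1 h2
      · intro r hr p hp q hq hpR hqR hpq e
        obtain ⟨t, ht⟩ := Finset.card_pos.mp hTpos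
        by_contra hno
        push Not at hno
        obtain ⟨hp1, hp2⟩ := Finset.mem_sdiff.mp hp
        obtain ⟨hq1, hq2⟩ := Finset.mem_sdiff.mp hq
        refine hclaw r t p q (hRT r hr t ht) hno.1 hno.2 ?_ ?_ ?_ ?_ ?_ hpq
        · exact fun h => hpR ((hR p).mpr ⟨⟨hp1, hp2⟩, t, ht, h.symm⟩)
        · exact fun h => hqR ((hR q).mpr ⟨⟨hq1, hq2⟩, t, ht, h.symm⟩)
        · exact fun h => hχ' p hp q hq h e
        · exact fun h => hp2 (h ▸ ht)
        · exact fun h => hq2 (h ▸ ht)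
  refine hcol.extend (fun u hu v hv huv e => huv.ne (hf hu hv e)) ?_ ?_
  · intro v hv hvT
    simp only [L']
    split_ifs
    · exact Finset.sdiff_subset
    · exact subset_rfl
  · intro v hv hvT t ht hadj hmem
    have hvR : v ∈ R := (hR v).mpr ⟨⟨hv, hvT⟩, t, ht, hadj⟩
    simp only [L', hvR, if_true] at hmem
    exact (Finset.mem_sdiff.mp hmem).2 (Finset.mem_image_of_mem f ht)

end rooted

/-! ### Two cliques with homogeneous clique attachments -/

/-- List colouring of the union of two cliques, from lists which can colour a maximum clique. -/
lemma exists_coloring_of_two_cliques [DecidableEq V] {G : SimpleGraph V} {X Y : Finset V}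
    {χ : V → ℕ} {w : ℕ} (hXY : Disjoint X Y) (hX : ∀ u ∈ X, ∀ v ∈ X, u ≠ v → G.Adj u v)
    (hY : ∀ u ∈ Y, ∀ v ∈ Y, u ≠ v → G.Adj u v) (hw4 : w ≤ 4) (hXw : X.card ≤ w) (hYw : Y.card ≤ w)
    (hw : w < X.card + Y.card) (himg : ((X ∪ Y).image χ).card = w)
    (hp : ∀ u ∈ X ∪ Y, ∀ v ∈ X ∪ Y, G.Adj u v → χ u ≠ χ v) :
    (∃ x y, (X.Nonempty → x ∈ X) ∧ (Y.Nonempty → y ∈ Y) ∧ ∀ L : V → Finset ℕ,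
      (∀ x ∈ X, X.card ≤ (L x).card) → (∀ y ∈ Y, Y.card ≤ (L y).card) →
      w ≤ (L x ∪ L y).card → ColOn G (X ∪ Y) L) := by
  have hinjX : Set.InjOn χ X := fun u hu v hv e => by
    by_contra hne
    exact hp u (Finset.mem_union_left _ hu) v (Finset.mem_union_left _ hv) (hX u hu v hv hne) e
  have hinjY : Set.InjOn χ Y := fun u hu v hv e => by
    by_contra hne
    exact hp u (Finset.mem_union_right _ hu) v (Finset.mem_union_right _ hv) (hY u hu v hv hne) e
  have hpart : PartData G (X ∪ Y) χ w := by
    refine ⟨hp, ?_, himg.le⟩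
    intro u hu v hv z hz e1 e2
    rcases Finset.mem_union.mp hu with hu | hu <;> rcases Finset.mem_union.mp hv with hv | hv <;>
      rcases Finset.mem_union.mp hz with hz | hz
    · exact Or.inl (hinjX hu hv e1)
    · exact Or.inl (hinjX hu hv e1)
    · exact Or.inr (Or.inl (hinjX hu hz e2))
    · exact Or.inr (Or.inr (hinjY hv hz (e1.symm.trans e2)))
    · exact Or.inr (Or.inr (hinjX hv hz (e1.symm.trans e2)))
    · exact Or.inr (Or.inl (hinjY hu hz e2))
    · exact Or.inl (hinjY hu hv e1)
    · exact Or.inl (hinjY hu hv e1)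
  have hcard : (X ∪ Y).card = X.card + Y.card := Finset.card_union_of_disjoint hXY
  let sing : V → Prop := fun q => ∀ v ∈ X ∪ Y, χ v = χ q → v = q
  have hXs : ∀ Z ⊆ X, (∀ z ∈ Z, sing z) → Z.card + Y.card ≤ w := by
    intro Z hZ hZs
    rw [← Finset.card_union_of_disjoint (hXY.mono_left hZ)]
    refine hpart.card_le_of_injOn (Finset.union_subset_union_left hZ) ?_
    intro u hu v hv e
    simp only [Finset.coe_union, Set.mem_union, Finset.mem_coe] at hu hv
    rcases hu with hu | hu
    · refine (hZs u hu v ?_ e.symm).symm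
      rcases hv with hv | hv
      · exact Finset.mem_union_left _ (hZ hv)
      · exact Finset.mem_union_right _ hv
    · rcases hv with hv | hv
      · exact hZs v hv u (Finset.mem_union_right _ hu) e
      · exact hinjY hu hv e
  have hYs : ∀ Z ⊆ Y, (∀ z ∈ Z, sing z) → Z.card + X.card ≤ w := by
    intro Z hZ hZs
    rw [← Finset.card_union_of_disjoint (hXY.symm.mono_left hZ)]
    refine hpart.card_le_of_injOn (Finset.union_subset (hZ.trans Finset.subset_union_right)
      Finset.subset_union_left) ?_
    intro u hu v hv e
    simp only [Finset.coe_union, Set.mem_union, Finset.mem_coe] at hu hv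
    rcases hu with hu | hu
    · refine (hZs u hu v ?_ e.symm).symm
      rcases hv with hv | hv
      · exact Finset.mem_union_right _ (hZ hv)
      · exact Finset.mem_union_left _ hv
    · rcases hv with hv | hv
      · exact hZs v hv u (Finset.mem_union_left _ hu) e
      · exact hinjX hu hv e
  have hex : ∀ Z : Finset V, ∃ z, (Z.Nonempty → z ∈ Z) ∧ ((∃ z ∈ Z, sing z) → sing z) := by
    intro Z
    by_cases h1 : ∃ z ∈ Z, sing z
    · obtain ⟨z, hz, hs⟩ := h1
      exact ⟨z, fun _ => hz, fun _ => hs⟩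
    · by_cases h2 : Z.Nonempty
      · obtain ⟨z, hz⟩ := h2
        exact ⟨z, fun _ => hz, fun h => absurd h h1⟩
      · have : Nonempty V := by
          by_contra hV
          rw [not_nonempty_iff] at hV
          rw [Finset.eq_empty_of_isEmpty X, Finset.eq_empty_of_isEmpty Y] at hw
          simp at hw
        exact ⟨Classical.arbitrary V, fun h => absurd h h2, fun h => absurd h h1⟩
  obtain ⟨x, hx, hxs⟩ := hex X
  obtain ⟨y, hy, hys⟩ := hex Y
  refine ⟨x, y, hx, hy, ?_⟩
  intro L hLX hLY hL
  obtain ⟨c, hc, hc'⟩ := exists_coloring_of_parts (X ∪ Y) χ L hpart.two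
    (by
      intro u hu v hv _ _
      rw [himg, hcard]
      rcases Finset.mem_union.mp hu with hu | hu
      · have := hLX u hu; omega
      · have := hLY u hu; omega)
    (by
      intro u hu v hv huv e
      rw [hcard]
      rcases Finset.mem_union.mp hu with hu | hu <;> rcases Finset.mem_union.mp hv with hv | hv
      · exact absurd (hinjX hu hv e) huv
      · have := hLX u hu; have := hLY v hv; omega
      · have := hLY u hu; have := hLX v hv; omega
      · exact absurd (hinjY hu hv e) huv)
    (by
      intro Q hQ hne hs
      obtain ⟨q, hq⟩ := hne
      rw [himg, hcard]
      have hpos := hpart.card_add_card_le hQ hs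
      rw [himg, hcard] at hpos
      by_cases hqX : ∃ q ∈ Q, q ∈ X
      · obtain ⟨q, hq, hqX⟩ := hqX
        have h1 := card_le_card_biUnion_of_mem (L := L) hq
        have h2 := hLX q hqX
        by_cases hqY : ∃ q ∈ Q, q ∈ Y
        · obtain ⟨z, hz, hzY⟩ := hqY
          have h3 := card_le_card_biUnion_of_mem (L := L) hz
          have h4 := hLY z hzY
          have hxX := hx ⟨q, hqX⟩
          have hyY := hy ⟨z, hzY⟩
          have hxs' := hxs ⟨q, hqX, hs q hq⟩
          have hys' := hys ⟨z, hzY, hs z hz⟩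
          have hqX1 := hXs {q} (by simpa using hqX) (fun v hv => Finset.mem_singleton.mp hv ▸ hs q hq)
          have hzY1 := hYs {z} (by simpa using hzY) (fun v hv => Finset.mem_singleton.mp hv ▸ hs z hz)
          rw [Finset.card_singleton] at hqX1 hzY1
          by_cases hxQ : x ∈ Q
          · by_cases hyQ : y ∈ Q
            · have h5 : (L x ∪ L y).card ≤ (Q.biUnion L).card := Finset.card_le_card
                (Finset.union_subset (Finset.subset_biUnion_of_mem L hxQ)
                  (Finset.subset_biUnion_of_mem L hyQ))
              omega
            · have h5 := hpart.card_add_card_le (Q := insert y Q)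
                (Finset.insert_subset (Finset.mem_union_right _ hyY) hQ) (by
                  intro v hv
                  rcases Finset.mem_insert.mp hv with rfl | hv
                  · exact hys'
                  · exact hs v hv)
              rw [Finset.card_insert_of_notMem hyQ, himg, hcard] at h5
              have h6 := hYs {z, y} (by
                intro v hv
                rcases Finset.mem_insert.mp hv with rfl | hv
                · exact hzY
                · rw [Finset.mem_singleton.mp hv]; exact hyY) (by
                intro v hv
                rcases Finset.mem_insert.mp hv with rfl | hv
                · exact hs v hz
                · rw [Finset.mem_singleton.mp hv]; exact hys')
              rw [Finset.card_pair (fun e : z = y => hyQ (e ▸ hz))] at h6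
              omega
          · have h5 := hpart.card_add_card_le (Q := insert x Q)
              (Finset.insert_subset (Finset.mem_union_left _ hxX) hQ) (by
                intro v hv
                rcases Finset.mem_insert.mp hv with rfl | hv
                · exact hxs'
                · exact hs v hv)
            rw [Finset.card_insert_of_notMem hxQ, himg, hcard] at h5
            have h6 := hXs {q, x} (by
              intro v hv
              rcases Finset.mem_insert.mp hv with rfl | hv
              · exact hqX
              · rw [Finset.mem_singleton.mp hv]; exact hxX) (by
              intro v hv
              rcases Finset.mem_insert.mp hv with rfl | hv
              · exact hs v hq
              · rw [Finset.mem_singleton.mp hv]; exact hxs')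
            rw [Finset.card_pair (fun e : q = x => hxQ (e ▸ hq))] at h6
            omega
        · push Not at hqY
          have h3 := hXs Q (fun v hv => (Finset.mem_union.mp (hQ hv)).resolve_right (hqY v hv)) hs
          omega
      · push Not at hqX
        have hQY : Q ⊆ Y := fun v hv => (Finset.mem_union.mp (hQ hv)).resolve_left (hqX v hv)
        have h1 := card_le_card_biUnion_of_mem (L := L) hq
        have h2 := hLY q (hQY hq)
        have h3 := hYs Q hQY hs
        omega)
  exact ⟨c, hc, fun u hu v hv huv => hc' u hu v hv (hp u hu v hv huv)⟩

/-- Reduction of two cliques `X` and `Y` with homogeneous clique attachments. -/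
lemma extendable_of_gadget {G : SimpleGraph V} {k : ℕ} {S T X Y : Finset V} (hperf : PerfCol G)
    (hω : ∀ Q : Finset V, G.IsClique (Q : Set V) → Q.card ≤ k) (hk : k ≤ 4)
    (hT : Attached G S T)
    (ih : ∀ S' T', S'.card < S.card → Attached G S' T' → Extendable G k S' T')
    (hXS : X ⊆ S) (hYS : Y ⊆ S) (hXT : Disjoint X T) (hYT : Disjoint Y T) (hXY : Disjoint X Y)
    (hX : ∀ u ∈ X, ∀ v ∈ X, u ≠ v → G.Adj u v) (hY : ∀ u ∈ Y, ∀ v ∈ Y, u ≠ v → G.Adj u v)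
    (hnc : ∃ x ∈ X, ∃ y ∈ Y, ¬ G.Adj x y)
    (hhX : ∀ v ∈ S, v ∉ X → v ∉ Y → ∀ x ∈ X, G.Adj v x → ∀ x' ∈ X, G.Adj v x')
    (hhY : ∀ v ∈ S, v ∉ X → v ∉ Y → ∀ y ∈ Y, G.Adj v y → ∀ y' ∈ Y, G.Adj v y')
    (hKX : ∀ u ∈ S, u ∉ X → u ∉ Y → ∀ v ∈ S, v ∉ X → v ∉ Y → u ≠ v → ∀ x ∈ X, G.Adj u x →
      G.Adj v x → G.Adj u v)
    (hKY : ∀ u ∈ S, u ∉ X → u ∉ Y → ∀ v ∈ S, v ∉ X → v ∉ Y → u ≠ v → ∀ y ∈ Y, G.Adj u y →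
      G.Adj v y → G.Adj u v) : Extendable G k S T := by
  classical
  obtain ⟨x1, hx1, y1, hy1, hxy1⟩ := hnc
  obtain ⟨Q, hQm, hQmax⟩ := Finset.exists_max_image
    ((X ∪ Y).powerset.filter fun Q : Finset V => G.IsClique (Q : Set V)) Finset.card
    ⟨∅, by simp⟩
  obtain ⟨hQU, hQc⟩ := Finset.mem_filter.mp hQm
  rw [Finset.mem_powerset] at hQU
  have hmax : ∀ Q' ⊆ X ∪ Y, G.IsClique (Q' : Set V) → Q'.card ≤ Q.card := fun Q' h1 h2 =>
    hQmax Q' (Finset.mem_filter.mpr ⟨Finset.mem_powerset.mpr h1, h2⟩)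
  obtain ⟨χ, hχ, hχp⟩ := hperf (X ∪ Y) Q.card hmax
  have hUX : x1 ∈ X ∪ Y := Finset.mem_union_left _ hx1
  have hUY : y1 ∈ X ∪ Y := Finset.mem_union_right _ hy1
  have hQne : ∃ z ∈ X ∪ Y, z ∉ Q := by
    by_contra hno
    push Not at hno
    refine hxy1 (hQc (hno x1 hUX) (hno y1 hUY) ?_)
    exact fun e => Finset.disjoint_left.mp hXY hx1 (e ▸ hy1)
  obtain ⟨z1, hz1, hz1Q⟩ := hQne
  have himg : ((X ∪ Y).image χ).card = Q.card := by
    refine le_antisymm ?_ ?_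
    · rw [← Finset.card_range Q.card]
      refine Finset.card_le_card fun t ht => ?_
      obtain ⟨v, hv, rfl⟩ := Finset.mem_image.mp ht
      exact Finset.mem_range.mpr (hχ v hv)
    · have : Set.InjOn χ Q := fun u hu v hv e => by
        by_contra hne
        exact hχp u (hQU hu) v (hQU hv) (hQc hu hv hne) e
      rw [← Finset.card_image_of_injOn this]
      exact Finset.card_le_card (Finset.image_subset_image hQU)
  have hcardU : (X ∪ Y).card = X.card + Y.card := Finset.card_union_of_disjoint hXY
  obtain ⟨x0, y0, hx0, hy0, hcolor⟩ := exists_coloring_of_two_cliques (G := G) (χ := χ)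
    (w := Q.card) hXY hX hY ((hω Q hQc).trans hk)
    (hmax X Finset.subset_union_left (fun u hu v hv huv => hX u hu v hv huv))
    (hmax Y Finset.subset_union_right (fun u hu v hv huv => hY u hu v hv huv))
    (by rw [← hcardU]; exact Finset.card_lt_card ⟨hQU, fun h => hz1Q (h hz1)⟩) himg hχp
  have hx0 := hx0 ⟨x1, hx1⟩
  have hy0 := hy0 ⟨y1, hy1⟩
  have hUS : X ∪ Y ⊆ S := Finset.union_subset hXS hYS
  have hUT : ∀ v ∈ X ∪ Y, v ∉ T := by
    intro v hv hvT
    rcases Finset.mem_union.mp hv with hv | hv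
    · exact Finset.disjoint_left.mp hXT hv hvT
    · exact Finset.disjoint_left.mp hYT hv hvT
  have hYnX : ∀ y ∈ Y, y ∉ X := fun y hy hx => Finset.disjoint_left.mp hXY hx hy
  intro L f hL hf
  let S' := S.filter fun v => v ∈ X ∪ Y → v ∈ Q
  have hS' : ∀ v, v ∈ S' ↔ v ∈ S ∧ (v ∈ X ∪ Y → v ∈ Q) := fun v => by
    simp only [S', Finset.mem_filter]
  have hS'S : S' ⊆ S := Finset.filter_subset _ _
  let L1 : V → Finset ℕ := fun v => if v ∈ X then L x0 else if v ∈ Y then L y0 else L v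
  obtain ⟨c, hc, hcT, hcp⟩ := ih S' T (Finset.card_lt_card ⟨hS'S, fun h =>
    hz1Q (((hS' z1).mp (h (hUS hz1))).2 hz1)⟩) (hT.mono hS'S fun t ht =>
      (hS' t).mpr ⟨hT.sub ht, fun h => absurd ht (hUT t h)⟩) L1 f (by
      intro v hv hvT
      simp only [L1]
      split_ifs with h1 h2
      · exact hL x0 (hXS hx0) (hUT x0 (Finset.mem_union_left _ hx0))
      · exact hL y0 (hYS hy0) (hUT y0 (Finset.mem_union_right _ hy0))
      · exact hL v (hS'S hv) hvT) hf
  let KX := S.filter fun v => v ∉ X ∧ v ∉ Y ∧ ∃ x ∈ X, G.Adj v x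
  let KY := S.filter fun v => v ∉ X ∧ v ∉ Y ∧ ∃ y ∈ Y, G.Adj v y
  have hKXm : ∀ v, v ∈ KX ↔ v ∈ S ∧ v ∉ X ∧ v ∉ Y ∧ ∃ x ∈ X, G.Adj v x := fun v => by
    simp only [KX, Finset.mem_filter]
  have hKYm : ∀ v, v ∈ KY ↔ v ∈ S ∧ v ∉ X ∧ v ∉ Y ∧ ∃ y ∈ Y, G.Adj v y := fun v => by
    simp only [KY, Finset.mem_filter]
  have hKXa : ∀ v ∈ KX, ∀ x ∈ X, G.Adj v x := by
    intro v hv x hx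
    obtain ⟨h1, h2, h3, x', hx', h4⟩ := (hKXm v).mp hv
    exact hhX v h1 h2 h3 x' hx' h4 x hx
  have hKYa : ∀ v ∈ KY, ∀ y ∈ Y, G.Adj v y := by
    intro v hv x hx
    obtain ⟨h1, h2, h3, x', hx', h4⟩ := (hKYm v).mp hv
    exact hhY v h1 h2 h3 x' hx' h4 x hx
  have hcardX : X.card + KX.card ≤ k := by
    rw [← Finset.card_union_of_disjoint (Finset.disjoint_left.mpr fun v hv hv' =>
      ((hKXm v).mp hv').2.1 hv)]
    refine hω _ ?_
    intro u hu v hv huv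
    simp only [Finset.coe_union, Set.mem_union, Finset.mem_coe] at hu hv
    rcases hu with hu | hu <;> rcases hv with hv | hv
    · exact hX u hu v hv huv
    · exact (hKXa v hv u hu).symm
    · exact hKXa u hu v hv
    · obtain ⟨h1, h2, h3, _⟩ := (hKXm u).mp hu
      obtain ⟨h4, h5, h6, _⟩ := (hKXm v).mp hv
      exact hKX u h1 h2 h3 v h4 h5 h6 huv x0 hx0 (hKXa u hu x0 hx0) (hKXa v hv x0 hx0)
  have hcardY : Y.card + KY.card ≤ k := by
    rw [← Finset.card_union_of_disjoint (Finset.disjoint_left.mpr fun v hv hv' =>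
      ((hKYm v).mp hv').2.2.1 hv)]
    refine hω _ ?_
    intro u hu v hv huv
    simp only [Finset.coe_union, Set.mem_union, Finset.mem_coe] at hu hv
    rcases hu with hu | hu <;> rcases hv with hv | hv
    · exact hY u hu v hv huv
    · exact (hKYa v hv u hu).symm
    · exact hKYa u hu v hv
    · obtain ⟨h1, h2, h3, _⟩ := (hKYm u).mp hu
      obtain ⟨h4, h5, h6, _⟩ := (hKYm v).mp hv
      exact hKY u h1 h2 h3 v h4 h5 h6 huv y0 hy0 (hKYa u hu y0 hy0) (hKYa v hv y0 hy0)
  let L2 : V → Finset ℕ := fun v => if v ∈ X then L v \ KX.image c else L v \ KY.image c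
  have hL2X : ∀ v ∈ X, L2 v = L v \ KX.image c := fun v hv => by simp only [L2, hv, if_true]
  have hL2Y : ∀ v ∈ Y, L2 v = L v \ KY.image c := fun v hv => by
    simp only [L2, hYnX v hv, if_false]
  have hQ2 : Q.image c ⊆ L2 x0 ∪ L2 y0 := by
    intro t ht
    obtain ⟨q, hq, rfl⟩ := Finset.mem_image.mp ht
    have hqS : q ∈ S' := (hS' q).mpr ⟨hUS (hQU hq), fun _ => hq⟩
    have hcq := hc q hqS (hUT q (hQU hq))
    rw [hL2X x0 hx0, hL2Y y0 hy0]
    by_cases hqX : q ∈ X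
    · simp only [L1, hqX, if_true] at hcq
      refine Finset.mem_union_left _ (Finset.mem_sdiff.mpr ⟨hcq, fun h => ?_⟩)
      obtain ⟨v, hv, e⟩ := Finset.mem_image.mp h
      obtain ⟨h1, h2, h3, _⟩ := (hKXm v).mp hv
      refine hcp v ((hS' v).mpr ⟨h1, fun h => ?_⟩) q hqS (hKXa v hv q hqX) e
      rcases Finset.mem_union.mp h with h | h
      · exact absurd h h2
      · exact absurd h h3
    · have hqY : q ∈ Y := (Finset.mem_union.mp (hQU hq)).resolve_left hqX
      simp only [L1, hqX, hqY, if_true, if_false] at hcq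
      refine Finset.mem_union_right _ (Finset.mem_sdiff.mpr ⟨hcq, fun h => ?_⟩)
      obtain ⟨v, hv, e⟩ := Finset.mem_image.mp h
      obtain ⟨h1, h2, h3, _⟩ := (hKYm v).mp hv
      refine hcp v ((hS' v).mpr ⟨h1, fun h => ?_⟩) q hqS (hKYa v hv q hqY) e
      rcases Finset.mem_union.mp h with h | h
      · exact absurd h h2
      · exact absurd h h3
  have hQcard : (Q.image c).card = Q.card := Finset.card_image_of_injOn fun u hu v hv e => by
    by_contra hne
    exact hcp u ((hS' u).mpr ⟨hUS (hQU hu), fun _ => hu⟩) v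
      ((hS' v).mpr ⟨hUS (hQU hv), fun _ => hv⟩) (hQc hu hv hne) e
  obtain ⟨c', hc', hcp'⟩ := hcolor L2
    (by
      intro x hx
      rw [hL2X x hx]
      have h1 := Finset.le_card_sdiff (KX.image c) (L x)
      have h2 : (KX.image c).card ≤ KX.card := Finset.card_image_le
      have h3 := hL x (hXS hx) (hUT x (Finset.mem_union_left _ hx))
      omega)
    (by
      intro x hx
      rw [hL2Y x hx]
      have h1 := Finset.le_card_sdiff (KY.image c) (L x)
      have h2 : (KY.image c).card ≤ KY.card := Finset.card_image_le
      have h3 := hL x (hYS hx) (hUT x (Finset.mem_union_right _ hx))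
      omega)
    (by rw [← hQcard]; exact Finset.card_le_card hQ2)
  have key : ∀ u ∈ X ∪ Y, ∀ v ∈ S, v ∉ X ∪ Y → G.Adj u v → c' u ≠ c v := by
    intro u hu v hv hvU huv e
    have hvX : v ∉ X := fun h => hvU (Finset.mem_union_left _ h)
    have hvY : v ∉ Y := fun h => hvU (Finset.mem_union_right _ h)
    have h1 := hc' u hu
    rcases Finset.mem_union.mp hu with hu | hu
    · rw [hL2X u hu] at h1
      exact (Finset.mem_sdiff.mp h1).2 (e ▸ Finset.mem_image_of_mem c
        ((hKXm v).mpr ⟨hv, hvX, hvY, u, hu, huv.symm⟩))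
    · rw [hL2Y u hu] at h1
      exact (Finset.mem_sdiff.mp h1).2 (e ▸ Finset.mem_image_of_mem c
        ((hKYm v).mpr ⟨hv, hvX, hvY, u, hu, huv.symm⟩))
  have hout : ∀ v ∈ S, v ∉ X ∪ Y → v ∈ S' := fun v hv h => (hS' v).mpr ⟨hv, fun h' => absurd h' h⟩
  refine ⟨fun v => if v ∈ X ∪ Y then c' v else c v, ?_, ?_, ?_⟩
  · intro v hv hvT
    by_cases h1 : v ∈ X ∪ Y
    · simp only [h1, if_true]
      have h2 := hc' v h1
      simp only [L2] at h2
      split_ifs at h2 <;> exact (Finset.mem_sdiff.mp h2).1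
    · simp only [h1, if_false]
      have h2 := hc v (hout v hv h1) hvT
      have hvX : v ∉ X := fun h => h1 (Finset.mem_union_left _ h)
      have hvY : v ∉ Y := fun h => h1 (Finset.mem_union_right _ h)
      simpa only [L1, hvX, hvY, if_false] using h2
  · intro t ht
    have : t ∉ X ∪ Y := fun h => hUT t h ht
    simp only [this, if_false]
    exact hcT t ht
  · intro u hu v hv huv
    by_cases h1 : u ∈ X ∪ Y <;> by_cases h2 : v ∈ X ∪ Y
    · simp only [h1, h2, if_true]
      exact hcp' u h1 v h2 huv
    · simp only [h1, h2, if_true, if_false]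
      exact key u h1 v hv h2 huv
    · simp only [h1, h2, if_true, if_false]
      exact (key v h2 u hu h1 huv.symm).symm
    · simp only [h1, h2, if_false]
      exact hcp u (hout u hu h1) v (hout v hv h2) huv

/-! ### Galvin's kernel method -/

/-- Orient red edges towards smaller and blue edges towards larger values of `φ`; every finite set
has a kernel. -/
lemma exists_kernel [DecidableEq V] (ρ β φ : V → ℕ) (W : Finset V)
    (hρ : ∀ u ∈ W, ∀ v ∈ W, u ≠ v → ρ u = ρ v → φ u ≠ φ v)
    (hβ : ∀ u ∈ W, ∀ v ∈ W, u ≠ v → β u = β v → φ u ≠ φ v) :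
    ∃ M ⊆ W, (∀ u ∈ M, ∀ v ∈ M, u ≠ v → ρ u ≠ ρ v ∧ β u ≠ β v) ∧
      ∀ v ∈ W, v ∉ M → ∃ u ∈ M, ρ u = ρ v ∧ φ u < φ v ∨ β u = β v ∧ φ v < φ u := by
  induction hn : W.card using Nat.strong_induction_on generalizing W with
  | _ n ih =>
  subst hn
  by_cases h : ∃ u ∈ W, ∃ v ∈ W, (∀ w ∈ W, ρ w = ρ v → φ v ≤ φ w) ∧ β u = β v ∧ φ u < φ v
  · obtain ⟨u, hu, v, hv, hmin, hb, hlt⟩ := h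
    have hsub : ∀ x ∈ W.erase u, x ∈ W := fun x hx => Finset.mem_of_mem_erase hx
    obtain ⟨M, hM, hst, hdom⟩ := ih (W.erase u).card (Finset.card_erase_lt_of_mem hu) (W.erase u)
      (fun x hx y hy => hρ x (hsub x hx) y (hsub y hy))
      (fun x hx y hy => hβ x (hsub x hx) y (hsub y hy)) rfl
    refine ⟨M, fun x hx => hsub x (hM hx), hst, ?_⟩
    intro w hw hwM
    by_cases hwu : w = u
    · subst hwu
      by_cases hvM : v ∈ M
      · exact ⟨v, hvM, Or.inr ⟨hb.symm, hlt⟩⟩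
      · obtain ⟨x, hx, h1 | h1⟩ := hdom v
          (Finset.mem_erase.mpr ⟨fun e => by rw [e] at hlt; omega, hv⟩) hvM
        · have := hmin x (hsub x (hM hx)) h1.1
          omega
        · exact ⟨x, hx, Or.inr ⟨h1.1.trans hb.symm, by omega⟩⟩
    · exact hdom w (Finset.mem_erase.mpr ⟨hwu, hw⟩) hwM
  · push Not at h
    refine ⟨W.filter fun v => ∀ w ∈ W, ρ w = ρ v → φ v ≤ φ w, Finset.filter_subset _ _, ?_, ?_⟩
    · intro u hu v hv huv
      obtain ⟨hu1, hu2⟩ := Finset.mem_filter.mp hu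
      obtain ⟨hv1, hv2⟩ := Finset.mem_filter.mp hv
      refine ⟨fun e => hρ u hu1 v hv1 huv e (le_antisymm (hu2 v hv1 e.symm) (hv2 u hu1 e)),
        fun e => hβ u hu1 v hv1 huv e (le_antisymm (h v hv1 u hu1 hu2 e.symm)
          (h u hu1 v hv1 hv2 e))⟩
    · intro v hv hvM
      obtain ⟨u, hu, hmin⟩ := Finset.exists_min_image (W.filter fun w => ρ w = ρ v) φ
        ⟨v, Finset.mem_filter.mpr ⟨hv, rfl⟩⟩
      obtain ⟨hu1, hu2⟩ := Finset.mem_filter.mp hu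
      have humem : u ∈ W.filter fun v => ∀ w ∈ W, ρ w = ρ v → φ v ≤ φ w :=
        Finset.mem_filter.mpr ⟨hu1, fun w hw e => hmin w (Finset.mem_filter.mpr ⟨hw, e.trans hu2⟩)⟩
      refine ⟨u, humem, Or.inl ⟨hu2, lt_of_le_of_ne (hmin v (Finset.mem_filter.mpr ⟨hv, rfl⟩)) ?_⟩⟩
      exact hρ u hu1 v hv (fun e => hvM (e ▸ humem)) hu2

/-- Galvin's theorem. -/
lemma colOn_of_red_blue [DecidableEq V] {G : SimpleGraph V} (ρ β φ : V → ℕ) (U : Finset V)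
    (L : V → Finset ℕ) (hadj : ∀ u ∈ U, ∀ v ∈ U, G.Adj u v → ρ u = ρ v ∨ β u = β v)
    (hρ : ∀ u ∈ U, ∀ v ∈ U, u ≠ v → ρ u = ρ v → φ u ≠ φ v)
    (hβ : ∀ u ∈ U, ∀ v ∈ U, u ≠ v → β u = β v → φ u ≠ φ v)
    (hL : ∀ v ∈ U, (U.filter fun u => ρ u = ρ v ∧ φ u < φ v ∨ β u = β v ∧ φ v < φ u).card <
      (L v).card) : ColOn G U L := by
  induction hn : U.card using Nat.strong_induction_on generalizing U L with
  | _ n ih =>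
  subst hn
  rcases U.eq_empty_or_nonempty with rfl | ⟨v0, hv0⟩
  · exact ⟨fun _ => 0, by simp, by simp⟩
  obtain ⟨a, ha⟩ : (L v0).Nonempty := Finset.card_pos.mp (lt_of_le_of_lt (Nat.zero_le _) (hL v0 hv0))
  have hWU : ∀ x ∈ U.filter fun v => a ∈ L v, x ∈ U := fun x hx => (Finset.mem_filter.mp hx).1
  obtain ⟨M, hM, hst, hdom⟩ := exists_kernel ρ β φ (U.filter fun v => a ∈ L v)
    (fun x hx y hy => hρ x (hWU x hx) y (hWU y hy))
    (fun x hx y hy => hβ x (hWU x hx) y (hWU y hy))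
  have hMne : M.Nonempty := by
    by_cases h : v0 ∈ M
    · exact ⟨v0, h⟩
    · obtain ⟨u, hu, _⟩ := hdom v0 (Finset.mem_filter.mpr ⟨hv0, ha⟩) h
      exact ⟨u, hu⟩
  obtain ⟨m, hm⟩ := hMne
  have hsub : ∀ x ∈ U \ M, x ∈ U := fun x hx => (Finset.mem_sdiff.mp hx).1
  refine ColOn.of_stable (M := M) (U' := U \ M) (a := a)
    (fun x hx => (Finset.mem_filter.mp (hM hx)).2) ?_ ?_ (ih (U \ M).card ?_ (U \ M) _
    (fun x hx y hy => hadj x (hsub x hx) y (hsub y hy))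
    (fun x hx y hy => hρ x (hsub x hx) y (hsub y hy))
    (fun x hx y hy => hβ x (hsub x hx) y (hsub y hy)) ?_ rfl)
  · intro x hx y hy hxy
    have := hst x hx y hy hxy.ne
    rcases hadj x (hWU x (hM hx)) y (hWU y (hM hy)) hxy with h | h
    · exact this.1 h
    · exact this.2 h
  · intro v hv
    by_cases h : v ∈ M
    · exact Or.inl h
    · exact Or.inr (Finset.mem_sdiff.mpr ⟨hv, h⟩)
  · exact Finset.card_lt_card ⟨Finset.sdiff_subset, fun h =>
      (Finset.mem_sdiff.mp (h (hWU m (hM hm)))).2 hm⟩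
  · intro v hv
    obtain ⟨hvU, hvM⟩ := Finset.mem_sdiff.mp hv
    have h1 := hL v hvU
    by_cases hav : a ∈ L v
    · obtain ⟨u, hu, hu'⟩ := hdom v (Finset.mem_filter.mpr ⟨hvU, hav⟩) hvM
      have h2 : ((U \ M).filter fun u => ρ u = ρ v ∧ φ u < φ v ∨ β u = β v ∧ φ v < φ u).card <
          (U.filter fun u => ρ u = ρ v ∧ φ u < φ v ∨ β u = β v ∧ φ v < φ u).card := by
        refine Finset.card_lt_card ⟨Finset.filter_subset_filter _ Finset.sdiff_subset, fun h => ?_⟩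
        have := h (Finset.mem_filter.mpr ⟨hWU u (hM hu), hu'⟩)
        exact (Finset.mem_sdiff.mp (Finset.mem_filter.mp this).1).2 hu
      have := card_erase_ge (L v) a
      omega
    · rw [Finset.erase_eq_of_notMem hav]
      refine lt_of_le_of_lt (Finset.card_le_card ?_) h1
      exact Finset.filter_subset_filter _ Finset.sdiff_subset

/-- Line graphs of bipartite multigraphs, given by their red and blue cliques, where the
neighbours of the attached clique are a union of red cliques. -/
lemma extendable_of_red_blue {G : SimpleGraph V} {k : ℕ} {S T : Finset V} (hperf : PerfCol G)
    (hω : ∀ Q : Finset V, G.IsClique (Q : Set V) → Q.card ≤ k) (hT : Attached G S T) (ρ β : V → ℕ)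
    (hadj : ∀ u ∈ S, u ∉ T → ∀ v ∈ S, v ∉ T → u ≠ v → (G.Adj u v ↔ ρ u = ρ v ∨ β u = β v))
    (hR : ∀ t ∈ T, ∀ u ∈ S, u ∉ T → ∀ v ∈ S, v ∉ T → G.Adj u t → ρ u = ρ v → G.Adj v t) :
    Extendable G k S T := by
  classical
  intro L f hL hf
  obtain ⟨φ, hφ, hφp⟩ := hperf S k (fun Q _ hQ => hω Q hQ)
  let κ : ℕ → ℕ := fun n => if n ∈ T.image φ then n else n + k
  have hκ : ∀ m n, m < k → n < k → κ m = κ n → m = n := by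
    intro m n hm hn e
    simp only [κ] at e
    split_ifs at e <;> omega
  have hcl : ∀ u ∈ S \ T, ∀ v ∈ S \ T, u ≠ v → (ρ u = ρ v ∨ β u = β v) → φ u ≠ φ v := by
    intro u hu v hv huv h
    obtain ⟨h1, h2⟩ := Finset.mem_sdiff.mp hu
    obtain ⟨h3, h4⟩ := Finset.mem_sdiff.mp hv
    exact hφp u h1 v h3 ((hadj u h1 h2 v h3 h4 huv).mpr h)
  have hclκ : ∀ u ∈ S \ T, ∀ v ∈ S \ T, u ≠ v → (ρ u = ρ v ∨ β u = β v) → κ (φ u) ≠ κ (φ v) := by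
    intro u hu v hv huv h e
    exact hcl u hu v hv huv h (hκ _ _ (hφ u (Finset.mem_sdiff.mp hu).1)
      (hφ v (Finset.mem_sdiff.mp hv).1) e)
  let L' : V → Finset ℕ := fun v => if ∃ t ∈ T, G.Adj v t then L v \ T.image f else L v
  have hcol : ColOn G (S \ T) L' := by
    refine colOn_of_red_blue ρ β (fun v => κ (φ v)) (S \ T) L' ?_
      (fun u hu v hv huv e => hclκ u hu v hv huv (Or.inl e))
      (fun u hu v hv huv e => hclκ u hu v hv huv (Or.inr e)) ?_
    · intro u hu v hv huv
      obtain ⟨h1, h2⟩ := Finset.mem_sdiff.mp hu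
      obtain ⟨h3, h4⟩ := Finset.mem_sdiff.mp hv
      exact (hadj u h1 h2 v h3 h4 huv.ne).mp huv
    · intro v hv
      obtain ⟨hvS, hvT⟩ := Finset.mem_sdiff.mp hv
      set D := (S \ T).filter fun u => ρ u = ρ v ∧ κ (φ u) < κ (φ v) ∨ β u = β v ∧ κ (φ v) < κ (φ u)
        with hD
      have hDm : ∀ u ∈ D, u ∈ S \ T ∧ (ρ u = ρ v ∧ κ (φ u) < κ (φ v) ∨
          β u = β v ∧ κ (φ v) < κ (φ u)) := fun u hu => Finset.mem_filter.mp hu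
      have hDinj : Set.InjOn φ D := by
        intro x hx y hy e
        obtain ⟨hx1, hx2⟩ := hDm x hx
        obtain ⟨hy1, hy2⟩ := hDm y hy
        by_contra hne
        rcases hx2 with hx2 | hx2 <;> rcases hy2 with hy2 | hy2
        · exact hcl x hx1 y hy1 hne (Or.inl (hx2.1.trans hy2.1.symm)) e
        · rw [e] at hx2; omega
        · rw [e] at hx2; omega
        · exact hcl x hx1 y hy1 hne (Or.inr (hx2.1.trans hy2.1.symm)) e
      have hDv : φ v ∉ D.image φ := by
        intro h
        obtain ⟨u, hu, e⟩ := Finset.mem_image.mp h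
        rcases (hDm u hu).2 with h | h <;> (rw [e] at h; omega)
      have hlist := hL v hvS hvT
      by_cases hvR : ∃ t ∈ T, G.Adj v t
      · simp only [L', hvR, if_true]
        obtain ⟨t, ht, hvt⟩ := hvR
        have hvTall : ∀ t' ∈ T, G.Adj v t' := hT.twin v hvS hvT t ht hvt
        have hvφ : φ v ∉ T.image φ := by
          intro h
          obtain ⟨t', ht', e⟩ := Finset.mem_image.mp h
          exact hφp v hvS t' (hT.sub ht') (hvTall t' ht') e.symm
        have hdis : Disjoint (insert (φ v) (D.image φ)) (T.image φ) := by
          rw [Finset.disjoint_left]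
          intro n hn hnT
          rcases Finset.mem_insert.mp hn with rfl | hn
          · exact hvφ hnT
          · obtain ⟨u, hu, rfl⟩ := Finset.mem_image.mp hn
            obtain ⟨hu1, hu2⟩ := hDm u hu
            obtain ⟨huS, huT⟩ := Finset.mem_sdiff.mp hu1
            rcases hu2 with h | h
            · obtain ⟨t', ht', e⟩ := Finset.mem_image.mp hnT
              exact hφp u huS t' (hT.sub ht')
                (hR t' ht' v hvS hvT u huS huT (hvTall t' ht') h.1.symm) e.symm
            · have h1 : κ (φ u) = φ u := by simp only [κ, hnT, if_true]
              have h2 : κ (φ v) = φ v + k := by simp only [κ, hvφ, if_false]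
              have := hφ u huS
              omega
        have hsub : insert (φ v) (D.image φ) ∪ T.image φ ⊆ Finset.range k := by
          intro n hn
          rw [Finset.mem_range]
          rcases Finset.mem_union.mp hn with hn | hn
          · rcases Finset.mem_insert.mp hn with rfl | hn
            · exact hφ v hvS
            · obtain ⟨u, hu, rfl⟩ := Finset.mem_image.mp hn
              exact hφ u (Finset.mem_sdiff.mp (hDm u hu).1).1
          · obtain ⟨u, hu, rfl⟩ := Finset.mem_image.mp hn
            exact hφ u (hT.sub hu)
        have h1 := Finset.card_le_card hsub
        have hTinj : Set.InjOn φ T := by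
          intro x hx y hy e
          by_contra hne
          exact hφp x (hT.sub hx) y (hT.sub hy) (hT.clique x hx y hy hne) e
        rw [Finset.card_union_of_disjoint hdis, Finset.card_insert_of_notMem hDv,
          Finset.card_image_of_injOn hDinj, Finset.card_image_of_injOn hTinj,
          Finset.card_range] at h1
        have h2 := Finset.le_card_sdiff (T.image f) (L v)
        have h3 : (T.image f).card ≤ T.card := Finset.card_image_le
        omega
      · simp only [L', hvR, if_false]
        have hsub : insert (φ v) (D.image φ) ⊆ Finset.range k := by
          intro n hn
          rw [Finset.mem_range]
          rcases Finset.mem_insert.mp hn with rfl | hn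
          · exact hφ v hvS
          · obtain ⟨u, hu, rfl⟩ := Finset.mem_image.mp hn
            exact hφ u (Finset.mem_sdiff.mp (hDm u hu).1).1
        have h1 := Finset.card_le_card hsub
        rw [Finset.card_insert_of_notMem hDv, Finset.card_image_of_injOn hDinj,
          Finset.card_range] at h1
        omega
  refine hcol.extend (fun u hu v hv huv e => huv.ne (hf hu hv e)) ?_ ?_
  · intro v hv hvT
    simp only [L']
    split_ifs
    · exact Finset.sdiff_subset
    · exact subset_rfl
  · intro v hv hvT t ht hadj hmem
    have hvR : ∃ t ∈ T, G.Adj v t := ⟨t, ht, hadj⟩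
    simp only [L', hvR, if_true] at hmem
    exact (Finset.mem_sdiff.mp hmem).2 (Finset.mem_image_of_mem f ht)

/-! ### Three nonadjacent pairs and three further vertices -/

/-- From three families of two disjoint sets choose one set each, with a transversal. -/
lemma exists_transversal_choice (I : Finset (Fin 3)) (M : Fin 3 → Bool → Finset ℕ)
    (hd : ∀ i ∈ I, Disjoint (M i false) (M i true))
    (hs : ∀ i ∈ I, I.card + 1 ≤ (M i false).card + (M i true).card) :
    ∃ r : Fin 3 → Bool, (∀ i ∈ I, I.card + 1 ≤ 2 * (M i (r i)).card) ∧
      ∀ J ⊆ I, J.card ≤ (J.biUnion fun i => M i (r i)).card := by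
  have h1 : ∀ i, ∃ s, i ∈ I → I.card + 1 ≤ 2 * (M i s).card := by
    intro i
    by_cases hi : i ∈ I
    · have := hs i hi
      by_cases h : I.card + 1 ≤ 2 * (M i false).card
      · exact ⟨false, fun _ => h⟩
      · exact ⟨true, fun _ => by omega⟩
    · exact ⟨true, fun h => absurd h hi⟩
  choose r hr using h1
  have hI3 : I.card ≤ 3 := by simpa using I.card_le_univ
  have hall : ∀ r : Fin 3 → Bool, (∀ i ∈ I, I.card + 1 ≤ 2 * (M i (r i)).card) →
      (I.card = 3 → 3 ≤ (I.biUnion fun i => M i (r i)).card) →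
      ∀ J ⊆ I, J.card ≤ (J.biUnion fun i => M i (r i)).card := by
    intro r hr h3 J hJ
    rcases J.eq_empty_or_nonempty with rfl | ⟨j, hj⟩
    · simp
    have h2 := hr j (hJ hj)
    have h4 := card_le_card_biUnion_of_mem (L := fun i => M i (r i)) hj
    have h5 := Finset.card_le_card hJ
    by_cases h6 : J.card = 3
    · rw [Finset.eq_of_subset_of_card_le hJ (by omega)]
      have := h3 (by omega)
      omega
    · omega
  by_cases hc : I.card = 3
  swap
  · exact ⟨r, hr, hall r hr fun h => absurd h hc⟩
  have hIu : ∀ i, i ∈ I := by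
    have : I = Finset.univ := (Finset.card_eq_iff_eq_univ I).mp (by simpa using hc)
    simp [this]
  by_cases hbig : ∃ i s, 3 ≤ (M i s).card
  · obtain ⟨i, s, his⟩ := hbig
    have hr' : ∀ j ∈ I, I.card + 1 ≤ 2 * (M j (Function.update r i s j)).card := by
      intro j hj
      by_cases hji : j = i
      · subst hji; rw [Function.update_self]; omega
      · rw [Function.update_of_ne hji]; exact hr j hj
    refine ⟨Function.update r i s, hr', hall _ hr' fun _ => ?_⟩
    have := card_le_card_biUnion_of_mem (L := fun j => M j (Function.update r i s j)) (hIu i)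
    simp only [Function.update_self] at this
    omega
  · push Not at hbig
    have h2 : ∀ i s, (M i s).card = 2 := by
      intro i s
      have h1 := hbig i false
      have h2 := hbig i true
      have h3 := hs i (hIu i)
      cases s <;> omega
    obtain ⟨s, hs'⟩ : ∃ s, M 1 s ≠ M 0 (r 0) := by
      by_contra hno
      push Not at hno
      have h3 := hd 1 (hIu 1)
      rw [hno false, hno true, disjoint_self] at h3
      have := h2 0 (r 0)
      rw [h3] at this
      simp at this
    have hr' : ∀ j ∈ I, I.card + 1 ≤ 2 * (M j (Function.update r 1 s j)).card := by
      intro j hj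
      rw [h2]; omega
    refine ⟨Function.update r 1 s, hr', hall _ hr' fun _ => ?_⟩
    have hsub : M 0 (r 0) ∪ M 1 s ⊆ I.biUnion fun i => M i (Function.update r 1 s i) := by
      refine Finset.union_subset ?_ ?_
      · have := Finset.subset_biUnion_of_mem (fun i => M i (Function.update r 1 s i)) (hIu 0)
        rwa [Function.update_of_ne (by decide)] at this
      · have := Finset.subset_biUnion_of_mem (fun i => M i (Function.update r 1 s i)) (hIu 1)
        rwa [Function.update_self] at this
    refine le_trans ?_ (Finset.card_le_card hsub)
    by_contra hlt
    have h3 : M 0 (r 0) ∪ M 1 s = M 0 (r 0) :=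
      (Finset.eq_of_subset_of_card_le Finset.subset_union_left (by rw [h2]; omega)).symm
    have h4 : M 0 (r 0) ∪ M 1 s = M 1 s :=
      (Finset.eq_of_subset_of_card_le Finset.subset_union_right (by rw [h2]; omega)).symm
    exact hs' (h4.symm.trans h3)

/-- Colouring three pairs and three further vertices, the `i`-th of which sees the whole `i`-th pair
and one vertex of each other pair. -/
lemma exists_coloring_of_pairs (σ : Fin 3 → Fin 3 → Bool) (I : Finset (Fin 3))
    (L : Fin 3 → Bool → Finset ℕ) (Q : Fin 3 → Finset ℕ)
    (hL : ∀ i ∈ I, ∀ s, I.card + 1 ≤ (L i s).card) (hQ : ∀ i, I.card + 1 ≤ (Q i).card) :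
    ∃ (c : Fin 3 → Bool → ℕ) (d : Fin 3 → ℕ), (∀ i ∈ I, ∀ s, c i s ∈ L i s) ∧ (∀ i, d i ∈ Q i) ∧
      (∀ i ∈ I, ∀ j ∈ I, i ≠ j → ∀ s t, c i s ≠ c j t) ∧
      (∀ i, ∀ j ∈ I, i ≠ j → d i ≠ c j (σ i j)) ∧ ∀ i ∈ I, ∀ s, d i ≠ c i s := by
  induction hn : I.card generalizing I L Q with
  | zero =>
    rw [Finset.card_eq_zero] at hn
    subst hn
    have : ∀ i, ∃ x, x ∈ Q i := fun i => Finset.card_pos.mp (by have := hQ i; omega)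
    choose d hd using this
    exact ⟨fun _ _ => 0, d, by simp, hd, by simp, by simp, by simp⟩
  | succ m ih =>
  by_cases hcom : ∃ i ∈ I, ∃ x, x ∈ L i false ∧ x ∈ L i true
  · obtain ⟨i, hi, x, hx1, hx2⟩ := hcom
    have hcard : (I.erase i).card = m := by rw [Finset.card_erase_of_mem hi, hn]; rfl
    obtain ⟨c, d, h1, h2, h3, h4, h5⟩ := ih (I.erase i) (fun j s => (L j s).erase x)
      (fun j => (Q j).erase x)
      (by
        intro j hj s
        have := hL j (Finset.mem_of_mem_erase hj) s
        have := card_erase_ge (L j s) x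
        omega)
      (by
        intro j
        have := hQ j
        have := card_erase_ge (Q j) x
        omega) hcard
    have hdx : ∀ j, d j ≠ x := fun j => Finset.ne_of_mem_erase (h2 j)
    have hcx : ∀ j ∈ I, j ≠ i → ∀ s, c j s ≠ x := fun j hj hji s =>
      Finset.ne_of_mem_erase (h1 j (Finset.mem_erase.mpr ⟨hji, hj⟩) s)
    refine ⟨Function.update c i (fun _ => x), d, ?_, fun j => Finset.mem_of_mem_erase (h2 j),
      ?_, ?_, ?_⟩
    · intro j hj s
      by_cases hji : j = i
      · subst hji; rw [Function.update_self]; cases s <;> assumption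
      · rw [Function.update_of_ne hji]
        exact Finset.mem_of_mem_erase (h1 j (Finset.mem_erase.mpr ⟨hji, hj⟩) s)
    · intro j hj j' hj' hjj s t
      by_cases hji : j = i
      · have hji' : j' ≠ i := fun e => hjj (hji.trans e.symm)
        rw [hji, Function.update_self, Function.update_of_ne hji']
        exact (hcx j' hj' hji' t).symm
      · rw [Function.update_of_ne hji]
        by_cases hji' : j' = i
        · rw [hji', Function.update_self]
          exact hcx j hj hji s
        · rw [Function.update_of_ne hji']
          exact h3 j (Finset.mem_erase.mpr ⟨hji, hj⟩) j' (Finset.mem_erase.mpr ⟨hji', hj'⟩) hjj s t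
    · intro j j' hj' hjj
      by_cases hji : j' = i
      · rw [hji, Function.update_self]; exact hdx j
      · rw [Function.update_of_ne hji]
        exact h4 j j' (Finset.mem_erase.mpr ⟨hji, hj'⟩) hjj
    · intro j hj s
      by_cases hji : j = i
      · rw [hji, Function.update_self]; exact hdx i
      · rw [Function.update_of_ne hji]
        exact h5 j (Finset.mem_erase.mpr ⟨hji, hj⟩) s
  · push Not at hcom
    have hdL : ∀ i ∈ I, Disjoint (L i false) (L i true) := fun i hi =>
      Finset.disjoint_left.mpr fun x hx => hcom i hi x hx
    have hQ' : ∀ i, ∃ Q' ⊆ Q i, Q'.card = I.card + 1 := fun i =>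
      Finset.exists_subset_card_eq (hQ i)
    choose Q' hQ'sub hQ'card using hQ'
    obtain ⟨r, hr, hrH⟩ := exists_transversal_choice I (fun i s => L i s \ Q' i)
      (fun i hi => (hdL i hi).mono Finset.sdiff_subset Finset.sdiff_subset)
      (by
        intro i hi
        have h1 := hL i hi false
        have h2 := hL i hi true
        have h3 := Finset.card_sdiff_add_card_inter (L i false) (Q' i)
        have h4 := Finset.card_sdiff_add_card_inter (L i true) (Q' i)
        have h5 : (L i false ∩ Q' i).card + (L i true ∩ Q' i).card ≤ (Q' i).card := by
          rw [← Finset.card_union_of_disjoint ((hdL i hi).mono Finset.inter_subset_left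
            Finset.inter_subset_left)]
          exact Finset.card_le_card (Finset.union_subset Finset.inter_subset_right
            Finset.inter_subset_right)
        have h6 := hQ'card i
        omega)
    let N : Fin 3 × Bool → Finset ℕ := fun p =>
      if p.2 = r p.1 then L p.1 p.2 \ Q' p.1 else L p.1 p.2
    have hNL : ∀ p, N p ⊆ L p.1 p.2 := by
      intro p
      simp only [N]
      split_ifs
      · exact Finset.sdiff_subset
      · exact subset_rfl
    have hNr : ∀ i, N (i, r i) = L i (r i) \ Q' i := fun i => by simp [N]
    have hNo : ∀ i, N (i, !r i) = L i (!r i) := fun i => by simp [N]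
    have hNd : ∀ i ∈ I, Disjoint (N (i, r i)) (N (i, !r i)) := by
      intro i hi
      refine Disjoint.mono (hNL _) (hNL _) ?_
      cases r i
      · exact hdL i hi
      · exact (hdL i hi).symm
    obtain ⟨c, hc, hc'⟩ := exists_injOn_choice (I ×ˢ (Finset.univ : Finset Bool)) N (by
      intro J hJ
      have hJI : ∀ p ∈ J, p.1 ∈ I := fun p hp => (Finset.mem_product.mp (hJ hp)).1
      have hJc := Finset.card_le_card hJ
      rw [Finset.card_product, Finset.card_univ, Fintype.card_bool] at hJc
      by_cases hpair : ∃ i, (i, r i) ∈ J ∧ (i, !r i) ∈ J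
      · obtain ⟨i, h1, h2⟩ := hpair
        have hi := hJI _ h1
        have h3 := card_add_le_card_biUnion (L := N) h1 h2 (hNd i hi)
        have h4 := hr i hi
        have h5 := hL i hi (!r i)
        rw [hNo, hNr] at h3
        have hI3 : I.card ≤ 3 := by simpa using I.card_le_univ
        omega
      · push Not at hpair
        have hinj : Set.InjOn Prod.fst (J : Set (Fin 3 × Bool)) := by
          rintro ⟨i, s⟩ hx ⟨j, t⟩ hy e
          simp only at e
          subst e
          have h1 := hpair i
          simp only [Finset.mem_coe] at hx hy
          cases s <;> cases t <;> cases hri : r i <;> simp_all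
        have hcardJ : (J.image Prod.fst).card = J.card := Finset.card_image_of_injOn hinj
        have hJI' : J.image Prod.fst ⊆ I := by
          intro i hi
          obtain ⟨p, hp, rfl⟩ := Finset.mem_image.mp hi
          exact hJI p hp
        by_cases ho : ∃ p ∈ J, p.2 ≠ r p.1
        · obtain ⟨p, hp, hpr⟩ := ho
          have h1 := card_le_card_biUnion_of_mem (L := N) hp
          have h2 : N p = L p.1 p.2 := by simp only [N, hpr, if_false]
          rw [h2] at h1
          have h3 := hL p.1 (hJI p hp) p.2
          have h4 := Finset.card_le_card hJI'
          omega
        · push Not at ho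
          have h1 := hrH _ hJI'
          rw [Finset.image_biUnion, hcardJ] at h1
          refine h1.trans (Finset.card_le_card ?_)
          intro x hx
          obtain ⟨p, hp, hxp⟩ := Finset.mem_biUnion.mp hx
          refine Finset.mem_biUnion.mpr ⟨p, hp, ?_⟩
          simp only [N, ho p hp, if_true]
          exact hxp)
    have hmem : ∀ i ∈ I, ∀ s, (i, s) ∈ I ×ˢ (Finset.univ : Finset Bool) := fun i hi s =>
      Finset.mem_product.mpr ⟨hi, Finset.mem_univ _⟩
    have hd : ∀ i, ∃ x ∈ Q' i, ∀ j ∈ I, (if j = i then c (i, !r i) else c (j, σ i j)) ≠ x := fun i =>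
      exists_mem_sdiff_image (s := Q' i) (N := I)
        (fun j => if j = i then c (i, !r i) else c (j, σ i j)) (by rw [hQ'card]; omega)
    choose d hdQ hdn using hd
    refine ⟨fun i s => c (i, s), d, fun i hi s => hNL _ (hc' _ (hmem i hi s)),
      fun i => hQ'sub i (hdQ i), ?_, ?_, ?_⟩
    · intro i hi j hj hij s t e
      exact hij (congrArg Prod.fst (hc (hmem i hi s) (hmem j hj t) e))
    · intro i j hj hij e
      have := hdn i j hj
      rw [if_neg hij.symm] at this
      exact this e.symm
    · intro i hi s e
      replace e : d i = c (i, s) := e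
      by_cases hs : s = r i
      · have h1 := hc' _ (hmem i hi s)
        rw [hs, hNr] at h1
        refine (Finset.mem_sdiff.mp h1).2 ?_
        rw [← hs]
        exact e ▸ hdQ i
      · have h1 := hdn i i hi
        rw [if_pos rfl] at h1
        have : s = !r i := Bool.eq_not_of_ne hs
        exact h1 (this ▸ e.symm)

/-- `G` is covered by three nonadjacent pairs and three pairwise nonadjacent vertices, the `i`-th of
which sees at most one vertex of each pair but the `i`-th. -/
structure ThreePairs (G : SimpleGraph V) (p : Fin 3 → Bool → V) (q : Fin 3 → V) : Prop where
  cover : ∀ v, (∃ i s, v = p i s) ∨ ∃ i, v = q i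
  pair : ∀ i, ¬ G.Adj (p i false) (p i true)
  single : ∀ i j, ¬ G.Adj (q i) (q j)
  cross : ∀ i j, i ≠ j → ¬ (G.Adj (q i) (p j false) ∧ G.Adj (q i) (p j true))

lemma ThreePairs.exists_coloring {G : SimpleGraph V} {p : Fin 3 → Bool → V} {q : Fin 3 → V}
    (h : ThreePairs G p q) (L : V → Finset ℕ) (hL : ∀ v, 4 ≤ (L v).card) :
    ∃ c : V → ℕ, (∀ v, c v ∈ L v) ∧ ∀ u v, G.Adj u v → c u ≠ c v := by
  classical
  let σ : Fin 3 → Fin 3 → Bool := fun i j => decide (G.Adj (q i) (p j true))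
  obtain ⟨c, d, h1, h2, h3, h4, h5⟩ := exists_coloring_of_pairs σ Finset.univ
    (fun i s => L (p i s)) (fun i => L (q i)) (fun i _ s => by simpa using hL (p i s))
    (fun i => by simpa using hL (q i))
  have key : ∀ v, ∃ x, (∃ i s, v = p i s ∧ x = c i s) ∨ ∃ i, v = q i ∧ x = d i := by
    intro v
    rcases h.cover v with ⟨i, s, e⟩ | ⟨i, e⟩
    · exact ⟨c i s, Or.inl ⟨i, s, e, rfl⟩⟩
    · exact ⟨d i, Or.inr ⟨i, e, rfl⟩⟩
  choose x hx using key
  have hqp : ∀ i j s, G.Adj (q i) (p j s) → d i ≠ c j s := by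
    intro i j s hadj
    by_cases hij : i = j
    · subst hij; exact h5 i (Finset.mem_univ _) s
    · have hσ : σ i j = s := by
        have := h.cross i j hij
        cases s <;> simp_all [σ]
      have := h4 i j (Finset.mem_univ _) hij
      rwa [hσ] at this
  refine ⟨x, ?_, ?_⟩
  · intro v
    rcases hx v with ⟨i, s, e1, e2⟩ | ⟨i, e1, e2⟩
    · rw [e2, e1]; exact h1 i (Finset.mem_univ _) s
    · rw [e2, e1]; exact h2 i
  · intro u v huv
    rcases hx u with ⟨i, s, e1, e2⟩ | ⟨i, e1, e2⟩ <;> rcases hx v with ⟨j, t, e3, e4⟩ | ⟨j, e3, e4⟩ <;>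
      rw [e2, e4] <;> rw [e1, e3] at huv
    · by_cases hij : i = j
      · subst hij
        cases s <;> cases t
        · exact absurd rfl huv.ne
        · exact absurd huv (h.pair i)
        · exact absurd huv.symm (h.pair i)
        · exact absurd rfl huv.ne
      · exact h3 i (Finset.mem_univ _) j (Finset.mem_univ _) hij s t
    · exact (hqp j i s huv.symm).symm
    · exact hqp i j t huv
    · exact absurd huv (h.single i j)

/-! ### Atoms -/

/-- A claw-free graph with perfect colourings, cliques of size at most four, and no clique cutset. -/
structure Atom (G : SimpleGraph V) : Prop where
  claw : IsClawFree G
  perf : PerfCol G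
  four : ∀ Q : Finset V, G.IsClique (Q : Set V) → Q.card ≤ 4
  cut : ∀ A C : Set V, A.Nonempty → (∀ v ∈ A, v ∉ C) → G.IsClique C →
    (∀ a ∈ A, ∀ v, G.Adj a v → v ∈ A ∨ v ∈ C) → ∀ v, v ∈ A ∨ v ∈ C

/-- No three pairwise nonadjacent vertices. -/
def NoStableTriple (G : SimpleGraph V) : Prop :=
  ∀ x y z, x ≠ y → x ≠ z → y ≠ z → ¬ G.Adj x y → ¬ G.Adj x z → ¬ G.Adj y z → False

lemma PerfCol.no_five_hole {G : SimpleGraph V} (h : PerfCol G) {a b c d e : V} (hab : G.Adj a b)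
    (hbc : G.Adj b c) (hcd : G.Adj c d) (hde : G.Adj d e) (hea : G.Adj e a) (hac : ¬ G.Adj a c)
    (had : ¬ G.Adj a d) (hbd : ¬ G.Adj b d) (hbe : ¬ G.Adj b e) (hce : ¬ G.Adj c e) : False := by
  have := h.even_hole (n := 5) (by norm_num)
    (fun n => match n with | 0 => a | 1 => b | 2 => c | 3 => d | _ => e)
    (by
      intro i hi
      have : i < 4 := by omega
      interval_cases i <;> assumption)
    hea.symm
    (by
      intro i j hij hj hne
      have hlt : i < j := by omega
      interval_cases j <;> interval_cases i <;> omega)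
  exact absurd this (by decide)

/-- The common vertex of three pairwise nonadjacent vertices; a claw with the distinctness of the
leaves read off. -/
lemma Atom.no_claw {G : SimpleGraph V} (hG : Atom G) {v x y z : V} (hx : G.Adj v x) (hy : G.Adj v y)
    (hz : G.Adj v z) (hxy : x ≠ y) (hxz : x ≠ z) (hyz : y ≠ z) (nxy : ¬ G.Adj x y)
    (nxz : ¬ G.Adj x z) (nyz : ¬ G.Adj y z) : False :=
  hG.claw v x y z hx hy hz nxy nxz nyz hxy hxz hyz

lemma Atom.exists_nonadj_nbrs {G : SimpleGraph V} (hG : Atom G) (hs : ¬ NoStableTriple G) (v : V) :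
    ∃ x y, G.Adj v x ∧ G.Adj v y ∧ x ≠ y ∧ ¬ G.Adj x y := by
  by_contra hno
  push Not at hno
  have h1 := hG.cut {v} (G.neighborSet v) ⟨v, rfl⟩ (by
    rintro w hw h
    rw [Set.mem_singleton_iff] at hw
    subst hw
    exact (G.loopless.irrefl w) h) (fun x hx y hy hxy => hno x y hx hy hxy)
    (by
      rintro a ha w haw
      rw [Set.mem_singleton_iff] at ha
      subst ha
      exact Or.inr haw)
  refine hs fun x y z hxy hxz hyz nxy nxz nyz => ?_
  rcases h1 x with hx | hx <;> rcases h1 y with hy | hy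
  · exact hxy (hx.trans hy.symm)
  · rw [Set.mem_singleton_iff] at hx; exact nxy (hx ▸ hy)
  · rw [Set.mem_singleton_iff] at hy; exact nxy (hy ▸ hx.symm)
  · exact nxy (hno x y hx hy hxy)

/-! ### Components away from a set of vertices -/

/-- `z` is neither in `W` nor adjacent to `W`. -/
def Far (G : SimpleGraph V) (W : Set V) (z : V) : Prop := z ∉ W ∧ ∀ w ∈ W, ¬ G.Adj w z

/-- `Z` is a component of the vertices far from `W`. -/
structure FarComp (G : SimpleGraph V) (W Z : Set V) : Prop where
  nonempty : Z.Nonempty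
  far : ∀ z ∈ Z, Far G W z
  closed : ∀ z ∈ Z, ∀ y, G.Adj z y → Far G W y → y ∈ Z
  conn : ∀ z ∈ Z, ∀ z' ∈ Z, ∃ (n : ℕ) (g : ℕ → V), g 0 = z ∧ g n = z' ∧ (∀ i ≤ n, g i ∈ Z) ∧
    ∀ i < n, G.Adj (g i) (g (i + 1))

lemma exists_farComp {G : SimpleGraph V} {W : Set V} {o : V} (ho : Far G W o) :
    ∃ Z, FarComp G W Z ∧ o ∈ Z := by
  let H : SimpleGraph {z // Far G W z} := G.induce {z | Far G W z}
  let Z : Set V := {z | ∃ hz : Far G W z, H.Reachable ⟨o, ho⟩ ⟨z, hz⟩}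
  refine ⟨Z, ⟨⟨o, ho, Reachable.refl _⟩, fun z hz => hz.1, ?_, ?_⟩, ⟨ho, Reachable.refl _⟩⟩
  · rintro z ⟨hz, hr⟩ y hzy hy
    refine ⟨hy, hr.trans (Adj.reachable ?_)⟩
    exact hzy
  · rintro z ⟨hz, hr⟩ z' ⟨hz', hr'⟩
    obtain ⟨p⟩ := hr.symm.trans hr'
    refine ⟨p.length, fun i => (p.getVert i).1, by simp, by simp, ?_, ?_⟩
    · intro i _
      exact ⟨(p.getVert i).2, hr.trans ⟨p.take i⟩⟩
    · intro i hi
      exact p.adj_getVert_succ hi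

section farComp
variable {G : SimpleGraph V} {W Z : Set V} {u v : V}

/-- A shortest path between two neighbours of `Z` through `Z`. -/
lemma FarComp.exists_path (h : FarComp G W Z) (hu : ∃ z ∈ Z, G.Adj u z) (hv : ∃ z ∈ Z, G.Adj v z)
    (huv : ¬ G.Adj u v) (hne : u ≠ v) :
    ∃ (r : ℕ) (q : ℕ → V), 1 ≤ r ∧ q 0 = u ∧ q (r + 1) = v ∧ (∀ i, 1 ≤ i → i ≤ r → q i ∈ Z) ∧
      (∀ i ≤ r, G.Adj (q i) (q (i + 1))) ∧
      ∀ i j, i + 1 < j → j ≤ r + 1 → ¬ G.Adj (q i) (q j) := by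
  classical
  let P : ℕ → Prop := fun n => ∃ q : ℕ → V, q 0 = u ∧ q n = v ∧
    (∀ i, 1 ≤ i → i < n → q i ∈ Z) ∧ ∀ i < n, G.Adj (q i) (q (i + 1))
  have hP : ∃ n, P n := by
    obtain ⟨z, hz, huz⟩ := hu
    obtain ⟨z', hz', hvz⟩ := hv
    obtain ⟨n, g, h0, hn, hg, hadj⟩ := h.conn z hz z' hz'
    refine ⟨n + 2, fun i => if i = 0 then u else if i = n + 2 then v else g (i - 1), by simp,
      by simp, ?_, ?_⟩
    · intro i h1 h2
      have e1 : i ≠ 0 := by omega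
      have e2 : i ≠ n + 2 := by omega
      simp only [e1, e2, if_false]
      exact hg _ (by omega)
    · intro i hi
      have e1 : i + 1 ≠ 0 := by omega
      by_cases hi0 : i = 0
      · subst hi0
        have e2 : (0 : ℕ) + 1 ≠ n + 2 := by omega
        simp only [e1, e2, if_false, if_true]
        simpa [h0] using huz
      · have e3 : i ≠ n + 2 := by omega
        simp only [e1, e3, hi0, if_false]
        by_cases e2 : i + 1 = n + 2
        · simp only [e2, if_true]
          have : i - 1 = n := by omega
          rw [this, hn]
          exact hvz.symm
        · simp only [e2, if_false]
          have := hadj (i - 1) (by omega)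
          rwa [show i - 1 + 1 = i + 1 - 1 by omega] at this
  obtain ⟨q, h0, hn, hZ, hadj⟩ := Nat.find_spec hP
  have hmin : ∀ m < Nat.find hP, ¬ P m := fun m hm => Nat.find_min hP hm
  set n := Nat.find hP with hndef
  have hn2 : 2 ≤ n := by
    by_contra hlt
    have : n = 0 ∨ n = 1 := by omega
    rcases this with e | e
    · rw [e] at hn; exact hne (h0.symm.trans hn)
    · have := hadj 0 (by omega)
      rw [e] at hn
      rw [h0, zero_add, hn] at this
      exact huv this
  refine ⟨n - 1, q, by omega, h0, by rw [show n - 1 + 1 = n by omega]; exact hn,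
    fun i h1 h2 => hZ i h1 (by omega), fun i hi => hadj i (by omega), ?_⟩
  intro i j hij hj hadj'
  refine hmin (n - (j - i - 1)) (by omega)
    ⟨fun t => if t ≤ i then q t else q (t + (j - i - 1)), ?_, ?_, ?_, ?_⟩
  · simp [h0]
  · have : ¬ (n - (j - i - 1) ≤ i) := by omega
    simp only [this, if_false]
    rw [show n - (j - i - 1) + (j - i - 1) = n by omega]
    exact hn
  · intro t h1 h2
    by_cases ht : t ≤ i
    · simp only [ht, if_true]; exact hZ t h1 (by omega)
    · simp only [ht, if_false]; exact hZ _ (by omega) (by omega)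
  · intro t ht
    by_cases h1 : t + 1 ≤ i
    · have h2 : t ≤ i := by omega
      simp only [h1, h2, if_true]
      exact hadj t (by omega)
    · by_cases h2 : t ≤ i
      · have : t = i := by omega
        subst this
        simp only [h1, h2, if_true, if_false]
        rw [show t + 1 + (j - t - 1) = j by omega]
        exact hadj'
      · simp only [h1, h2, if_false]
        rw [show t + 1 + (j - i - 1) = t + (j - i - 1) + 1 by omega]
        exact hadj _ (by omega)

/-- Induced paths avoiding the neighbourhood of `Z` between two given neighbours of `Z` all have the
same parity. -/
lemma FarComp.parity (h : FarComp G W Z) (hperf : PerfCol G) (hu : ∃ z ∈ Z, G.Adj u z)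
    (hv : ∃ z ∈ Z, G.Adj v z) (huv : ¬ G.Adj u v) (hne : u ≠ v) :
    ∃ r : ℕ, ∀ (s : ℕ) (p : ℕ → V), 1 ≤ s → p 0 = u → p (s + 1) = v →
      (∀ i ≤ s, G.Adj (p i) (p (i + 1))) →
      (∀ i j, i + 1 < j → j ≤ s + 1 → ¬ G.Adj (p i) (p j)) →
      (∀ i, 1 ≤ i → i ≤ s → ∀ z ∈ Z, ¬ G.Adj (p i) z) → Even (r + s) := by
  obtain ⟨r, q, hr, hq0, hqv, hqZ, hqadj, hqno⟩ := h.exists_path hu hv huv hne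
  refine ⟨r, fun s p hs hp0 hpv hpadj hpno hpZ => ?_⟩
  have hfar : ∀ k, 1 ≤ k → k ≤ r → q (r + 1 - k) ∈ Z := fun k h1 h2 =>
    hqZ _ (by omega) (by omega)
  have heven := hperf.even_hole (n := s + 2 + r) (by omega)
    (fun t => if t ≤ s + 1 then p t else q (r + 1 - (t - (s + 1)))) ?_ ?_ ?_
  · rw [show s + 2 + r = r + s + 2 by omega] at heven
    exact (Nat.even_add.mp heven).mpr (by decide)
  · intro i hi
    by_cases h1 : i + 1 ≤ s + 1
    · have h2 : i ≤ s + 1 := by omega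
      simp only [h1, h2, if_true]
      exact hpadj i (by omega)
    · by_cases h2 : i ≤ s + 1
      · have : i = s + 1 := by omega
        subst this
        simp only [h1, h2, if_true, if_false]
        rw [hpv, ← hqv, show r + 1 - (s + 1 + 1 - (s + 1)) = r by omega]
        exact (hqadj r le_rfl).symm
      · simp only [h1, h2, if_false]
        have := hqadj (r + 1 - (i + 1 - (s + 1))) (by omega)
        rw [show r + 1 - (i + 1 - (s + 1)) + 1 = r + 1 - (i - (s + 1)) by omega] at this
        exact this.symm
  · have h1 : ¬ (s + 2 + r - 1 ≤ s + 1) := by omega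
    simp only [h1, if_false, Nat.zero_le, if_true]
    rw [hp0, ← hq0, show r + 1 - (s + 2 + r - 1 - (s + 1)) = 0 + 1 by omega]
    exact hqadj 0 (by omega)
  · intro i j hij hj hlast
    by_cases h1 : j ≤ s + 1
    · have h2 : i ≤ s + 1 := by omega
      simp only [h1, h2, if_true]
      exact hpno i j hij h1
    · by_cases h2 : i ≤ s + 1
      · simp only [h1, h2, if_true, if_false]
        by_cases h3 : i = 0
        · subst h3
          have := hlast rfl
          rw [hp0, ← hq0]
          exact hqno 0 _ (by omega) (by omega)
        · by_cases h4 : i = s + 1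
          · subst h4
            rw [hpv, ← hqv]
            exact fun hadj => hqno (r + 1 - (j - (s + 1))) (r + 1) (by omega) le_rfl hadj.symm
          · exact hpZ i (by omega) (by omega) _ (hqZ _ (by omega) (by omega))
      · simp only [h1, h2, if_false]
        exact fun hadj => hqno (r + 1 - (j - (s + 1))) (r + 1 - (i - (s + 1))) (by omega)
          (by omega) hadj.symm

/-- The cases of one, two and three inner vertices. -/
lemma FarComp.parity_short (h : FarComp G W Z) (hperf : PerfCol G) (hu : ∃ z ∈ Z, G.Adj u z)
    (hv : ∃ z ∈ Z, G.Adj v z) (huv : ¬ G.Adj u v) (hne : u ≠ v) :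
    ∃ r : ℕ, (∀ x, G.Adj u x → G.Adj x v → (∀ z ∈ Z, ¬ G.Adj x z) → Even (r + 1)) ∧
      (∀ x y, G.Adj u x → G.Adj x y → G.Adj y v → ¬ G.Adj u y → ¬ G.Adj x v →
        (∀ z ∈ Z, ¬ G.Adj x z) → (∀ z ∈ Z, ¬ G.Adj y z) → Even (r + 2)) ∧
      ∀ x y w, G.Adj u x → G.Adj x y → G.Adj y w → G.Adj w v → ¬ G.Adj u y → ¬ G.Adj u w →
        ¬ G.Adj x w → ¬ G.Adj x v → ¬ G.Adj y v → (∀ z ∈ Z, ¬ G.Adj x z) →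
        (∀ z ∈ Z, ¬ G.Adj y z) → (∀ z ∈ Z, ¬ G.Adj w z) → Even (r + 3) := by
  obtain ⟨r, hr⟩ := h.parity hperf hu hv huv hne
  refine ⟨r, ?_, ?_, ?_⟩
  · intro x h1 h2 h3
    refine hr 1 (fun n => match n with | 0 => u | 1 => x | _ => v) le_rfl rfl rfl ?_ ?_ ?_
    · intro i hi
      interval_cases i <;> assumption
    · intro i j hij hj
      have hlt : i < j := by omega
      interval_cases j <;> interval_cases i <;> omega
    · intro i h1 h2
      interval_cases i; assumption
  · intro x y h1 h2 h3 h4 h5 h6 h7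
    refine hr 2 (fun n => match n with | 0 => u | 1 => x | 2 => y | _ => v) (by norm_num) rfl rfl
      ?_ ?_ ?_
    · intro i hi
      interval_cases i <;> assumption
    · intro i j hij hj
      have hlt : i < j := by omega
      interval_cases j <;> interval_cases i <;> omega
    · intro i h1 h2
      interval_cases i <;> assumption
  · intro x y w h1 h2 h3 h4 h5 h6 h7 h8 h9 h10 h11 h12
    refine hr 3 (fun n => match n with | 0 => u | 1 => x | 2 => y | 3 => w | _ => v) (by norm_num)
      rfl rfl ?_ ?_ ?_
    · intro i hi
      interval_cases i <;> assumption
    · intro i j hij hj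
      have hlt : i < j := by omega
      interval_cases j <;> interval_cases i <;> omega
    · intro i h1 h2
      interval_cases i <;> assumption

/-- The neighbours of a far component do not form a clique. -/
lemma FarComp.exists_nonadj (h : FarComp G W Z) (hG : Atom G) (hW : W.Nonempty) :
    ∃ u v, u ≠ v ∧ ¬ G.Adj u v ∧ ¬ Far G W u ∧ ¬ Far G W v ∧ u ∉ W ∧ v ∉ W ∧
      (∃ z ∈ Z, G.Adj u z) ∧ ∃ z ∈ Z, G.Adj v z := by
  by_contra hno
  push Not at hno
  obtain ⟨w, hw⟩ := hW
  have hnear : ∀ u, (∃ z ∈ Z, G.Adj u z) → u ∉ Z → ¬ Far G W u ∧ u ∉ W := by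
    rintro u ⟨z, hz, huz⟩ huZ
    exact ⟨fun hf => huZ (h.closed z hz u huz.symm hf), fun hu => (h.far z hz).2 u hu huz⟩
  have := hG.cut Z {u | u ∉ Z ∧ ∃ z ∈ Z, G.Adj u z} h.nonempty (fun v hv hv' => hv'.1 hv)
    (by
      intro u hu v hv huv
      by_contra hadj
      obtain ⟨h1, h2⟩ := hnear u hu.2 hu.1
      obtain ⟨h3, h4⟩ := hnear v hv.2 hv.1
      obtain ⟨z, hz, hvz⟩ := hv.2
      exact hno u v huv hadj h1 h3 h2 h4 hu.2 z hz hvz)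
    (by
      intro a ha v hav
      by_cases hv : v ∈ Z
      · exact Or.inl hv
      · exact Or.inr ⟨hv, a, ha, hav.symm⟩) w
  rcases this with hw' | ⟨_, z, hz, hwz⟩
  · exact (h.far w hw').1 hw
  · exact (h.far z hz).2 w hw hwz

end farComp

/-! ### Neighbours of a maximal clique -/

/-- Close a goal about adjacency or distinctness from the hypotheses, up to symmetry. -/
lemma adjs {P : Prop} (h : P := by first
    | assumption
    | (apply SimpleGraph.Adj.symm; assumption)
    | (intro h; exact absurd (SimpleGraph.Adj.symm h) (by assumption))
    | (apply Ne.symm; assumption)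
    | (intro h; subst h; first
      | contradiction
      | (exact absurd (SimpleGraph.Adj.symm (by assumption)) (by assumption)))) : P := h

structure MaxClique (G : SimpleGraph V) (W : Set V) : Prop where
  clique : G.IsClique W
  max : ∀ v, v ∉ W → ∃ w ∈ W, ¬ G.Adj v w

section maxClique
variable {G : SimpleGraph V} {W Z : Set V} {x y u v w w' z : V}

lemma MaxClique.adj (hW : MaxClique G W) (h1 : w ∈ W) (h2 : w' ∈ W) (hne : w ≠ w') : G.Adj w w' :=
  hW.clique h1 h2 hne

lemma exists_maxClique [Finite V] {Q : Set V} (hQ : G.IsClique Q) : ∃ W, MaxClique G W ∧ Q ⊆ W := by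
  obtain ⟨W, hQW, hW⟩ := (Set.toFinite {W : Set V | G.IsClique W}).exists_le_maximal hQ
  refine ⟨W, ⟨hW.1, fun v hv => ?_⟩, hQW⟩
  by_contra hno
  push Not at hno
  have h1 : G.IsClique (insert v W) := by
    rw [isClique_insert]
    exact ⟨hW.1, fun w hw _ => hno w hw⟩
  exact hv (hW.2 h1 (Set.subset_insert v W) (Set.mem_insert v W))

/-- Nonadjacent vertices with a common neighbour in the clique cover the clique. -/
lemma MaxClique.cover (hW : MaxClique G W) (hG : Atom G) (hx : x ∉ W) (hy : y ∉ W) (hxy : x ≠ y)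
    (hn : ¬ G.Adj x y) (hw : w ∈ W) (h1 : G.Adj x w) (h2 : G.Adj y w) (hw' : w' ∈ W) :
    G.Adj x w' ∨ G.Adj y w' := by
  by_contra hno
  push Not at hno
  have hne : w ≠ w' := fun e => hno.1 (e ▸ h1)
  exact hG.no_claw h1.symm h2.symm (hW.adj hw hw' hne) hxy (fun e => hx (e ▸ hw'))
    (fun e => hy (e ▸ hw')) hn hno.1 hno.2

/-- Nonadjacent neighbours of a far component have no common neighbour in the clique. -/
lemma MaxClique.disjoint (hW : MaxClique G W) (hG : Atom G) (hZ : FarComp G W Z) (hu : u ∉ W)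
    (hv : v ∉ W) (huv : u ≠ v) (hn : ¬ G.Adj u v) (huZ : ∃ z ∈ Z, G.Adj u z)
    (hvZ : ∃ z ∈ Z, G.Adj v z) (hw : w ∈ W) (h1 : G.Adj u w) (h2 : G.Adj v w) : False := by
  obtain ⟨r, hr1, hr2, -⟩ := hZ.parity_short hG.perf huZ hvZ hn huv
  have hfar : ∀ w ∈ W, ∀ z ∈ Z, ¬ G.Adj w z := fun w hw z hz => (hZ.far z hz).2 w hw
  obtain ⟨b, hb, hub⟩ := hW.max u hu
  obtain ⟨a, ha, hva⟩ := hW.max v hv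
  have hvb := (hW.cover hG hu hv huv hn hw h1 h2 hb).resolve_left hub
  have hua := (hW.cover hG hu hv huv hn hw h1 h2 ha).resolve_right hva
  have hab : a ≠ b := fun e => hub (e ▸ hua)
  have e1 := hr1 w h1 h2.symm (hfar w hw)
  have e2 := hr2 a b hua (hW.adj ha hb hab) hvb.symm hub (fun h => hva h.symm) (hfar a ha)
    (hfar b hb)
  have e3 := (Nat.even_add_one.mp e2)
  exact e3 e1

/-- A far neighbour of `x` is a neighbour of every `y` which misses a clique neighbour of `x`. -/
lemma FarComp.pull (hG : Atom G) (hZ : FarComp G W Z) (hz : z ∈ Z) (hxz : G.Adj x z)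
    (hxy : G.Adj x y) (hyW : y ∉ W) (hw : w ∈ W) (hxw : G.Adj x w) (hyw : ¬ G.Adj y w)
    (hyz : y ≠ z) : G.Adj y z := by
  by_contra hno
  exact hG.no_claw hxz hxy hxw adjs (fun e => (hZ.far z hz).1 (e ▸ hw)) (fun e => hyW (e ▸ hw)) adjs
    (fun h => (hZ.far z hz).2 w hw h.symm) hyw

lemma Atom.no_five_clique (hG : Atom G) {a b c d e : V} (hab : G.Adj a b) (hac : G.Adj a c)
    (had : G.Adj a d) (hae : G.Adj a e) (hbc : G.Adj b c) (hbd : G.Adj b d) (hbe : G.Adj b e)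
    (hcd : G.Adj c d) (hce : G.Adj c e) (hde : G.Adj d e) : False := by
  classical
  have h1 : G.IsClique (({a, b, c, d, e} : Finset V) : Set V) := by
    intro x hx y hy hxy
    simp only [Finset.coe_insert, Finset.coe_singleton, Set.mem_insert_iff,
      Set.mem_singleton_iff] at hx hy
    rcases hx with rfl | rfl | rfl | rfl | rfl <;> rcases hy with rfl | rfl | rfl | rfl | rfl <;>
      first | exact absurd rfl hxy | exact adjs
  have h2 := hG.four _ h1
  rw [Finset.card_insert_of_notMem, Finset.card_insert_of_notMem, Finset.card_insert_of_notMem,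
    Finset.card_insert_of_notMem, Finset.card_singleton] at h2
  · omega
  all_goals simp only [Finset.mem_insert, Finset.mem_singleton, not_or]
  · exact hde.ne
  · exact ⟨hcd.ne, hce.ne⟩
  · exact ⟨hbc.ne, hbd.ne, hbe.ne⟩
  · exact ⟨hab.ne, hac.ne, had.ne, hae.ne⟩

end maxClique

/-! ### Suns in a clique of size four -/

/-- A clique `p p' q r` and a stable set `x y z` missing `p p'`, `q` and `r`. -/
structure FourSun (G : SimpleGraph V) (p p' q r x y z : V) : Prop where
  pp : G.Adj p p'
  pq : G.Adj p q
  pr : G.Adj p r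
  pq' : G.Adj p' q
  pr' : G.Adj p' r
  qr : G.Adj q r
  xq : G.Adj x q
  xr : G.Adj x r
  yp : G.Adj y p
  yp' : G.Adj y p'
  yr : G.Adj y r
  zp : G.Adj z p
  zp' : G.Adj z p'
  zq : G.Adj z q
  nxp : ¬ G.Adj x p
  nxp' : ¬ G.Adj x p'
  nyq : ¬ G.Adj y q
  nzr : ¬ G.Adj z r
  nxy : ¬ G.Adj x y
  nxz : ¬ G.Adj x z
  nyz : ¬ G.Adj y z

section fourSun
variable {G : SimpleGraph V} {p p' q r x y z u v : V}

lemma FourSun.swap (h : FourSun G p p' q r x y z) : FourSun G p p' r q x z y :=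
  ⟨h.pp, h.pr, h.pq, h.pr', h.pq', h.qr.symm, h.xr, h.xq, h.zp, h.zp', h.zq, h.yp, h.yp', h.yr,
    h.nxp, h.nxp', h.nzr, h.nyq, h.nxz, h.nxy, fun e => h.nyz e.symm⟩

lemma FourSun.flip (h : FourSun G p p' q r x y z) : FourSun G p' p q r x y z :=
  ⟨h.pp.symm, h.pq', h.pr', h.pq, h.pr, h.qr, h.xq, h.xr, h.yp', h.yp, h.yr, h.zp', h.zp, h.zq,
    h.nxp', h.nxp, h.nyq, h.nzr, h.nxy, h.nxz, h.nyz⟩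

/-- The clique of the sun. -/
lemma FourSun.maxClique (h : FourSun G p p' q r x y z) (hG : Atom G) :
    MaxClique G {p, p', q, r} := by
  obtain ⟨pp, pq, pr, pq', pr', qr, -⟩ := h
  refine ⟨?_, ?_⟩
  · intro a ha b hb hab
    simp only [Set.mem_insert_iff, Set.mem_singleton_iff] at ha hb
    rcases ha with rfl | rfl | rfl | rfl <;> rcases hb with rfl | rfl | rfl | rfl <;>
      first | exact absurd rfl hab | exact adjs
  · intro v _
    by_contra hno
    push Not at hno
    simp only [Set.mem_insert_iff, Set.mem_singleton_iff, forall_eq_or_imp, forall_eq] at hno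
    obtain ⟨h1, h2, h3, h4⟩ := hno
    exact hG.no_five_clique h1 h2 h3 h4 pp pq pr pq' pr' qr

lemma FourSun.adj_y (h : FourSun G p p' q r x y z) (hG : Atom G)
    (hu : u ∉ ({p, p', q, r} : Set V)) (hn : ∃ w ∈ ({p, p', q, r} : Set V), G.Adj u w)
    (huq : ¬ G.Adj u q) (huy : u ≠ y) : G.Adj u y := by
  have hW := h.maxClique hG
  obtain ⟨pp, pq, pr, pq', pr', qr, xq, xr, yp, yp', yr, zp, zp', zq, nxp, nxp', nyq, nzr, nxy, nxz,
    nyz⟩ := h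
  by_contra hno
  have hy : y ∉ ({p, p', q, r} : Set V) := by
    simp only [Set.mem_insert_iff, Set.mem_singleton_iff, not_or]
    exact ⟨yp.ne, yp'.ne, adjs, yr.ne⟩
  obtain ⟨w, hw, huw⟩ := hn
  have hyw : G.Adj y w := by
    simp only [Set.mem_insert_iff, Set.mem_singleton_iff] at hw
    rcases hw with rfl | rfl | rfl | rfl <;> first | assumption | exact absurd huw huq
  rcases hW.cover hG hu hy huy hno hw huw hyw (w' := q) (by simp) with h1 | h1
  · exact huq h1
  · exact nyq h1

lemma FourSun.adj_q_or_r (h : FourSun G p p' q r x y z) (hG : Atom G)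
    (hu : u ∉ ({p, p', q, r} : Set V)) (hn : ∃ w ∈ ({p, p', q, r} : Set V), G.Adj u w)
    : G.Adj u q ∨ G.Adj u r := by
  by_contra hno
  push Not at hno
  have hu' : u ∉ ({p, p', r, q} : Set V) := fun h' => hu (by
    simp only [Set.mem_insert_iff, Set.mem_singleton_iff] at h' ⊢; tauto)
  have hn' : ∃ w ∈ ({p, p', r, q} : Set V), G.Adj u w := by
    obtain ⟨w, hw, huw⟩ := hn
    exact ⟨w, by simp only [Set.mem_insert_iff, Set.mem_singleton_iff] at hw ⊢; tauto, huw⟩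
  have h1 := h.adj_y hG hu hn hno.1 (fun e => hno.2 (e ▸ h.yr))
  have h2 := h.swap.adj_y hG hu' hn' hno.2 (fun e => hno.1 (e ▸ h.zq))
  exact hG.perf.no_five_hole h1 h.yr h.qr.symm h.zq.symm h2.symm hno.2 hno.1 h.nyq h.nyz
    (fun e => h.nzr e.symm)

lemma FourSun.adj_p (h : FourSun G p p' q r x y z) (hG : Atom G)
    (hu : u ∉ ({p, p', q, r} : Set V)) (huq : G.Adj u q) (hur : ¬ G.Adj u r) (huz : G.Adj u z) : G.Adj u p := by
  have hW := h.maxClique hG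
  obtain ⟨pp, pq, pr, pq', pr', qr, xq, xr, yp, yp', yr, zp, zp', zq, nxp, nxp', nyq, nzr, nxy, nxz,
    nyz⟩ := h
  by_contra hno
  have hx : x ∉ ({p, p', q, r} : Set V) := by
    simp only [Set.mem_insert_iff, Set.mem_singleton_iff, not_or]
    exact ⟨adjs, adjs, xq.ne, xr.ne⟩
  have hux : G.Adj u x := by
    by_contra hux
    rcases hW.cover hG hu hx adjs hux (w := q) (by simp) huq xq (w' := p) (by simp) with h1 | h1
    · exact hno h1
    · exact nxp h1
  exact hG.perf.no_five_hole hux xr pr.symm zp.symm huz.symm hur hno nxp nxz adjs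

lemma FourSun.eq_z (h : FourSun G p p' q r x y z) (hG : Atom G)
    (hu : u ∉ ({p, p', q, r} : Set V)) (hn : ∃ w ∈ ({p, p', q, r} : Set V), G.Adj u w)
    (huq : G.Adj u q) (hur : ¬ G.Adj u r) : u = z := by
  by_contra huz
  have hu' : u ∉ ({p, p', r, q} : Set V) := fun h' => hu (by
    simp only [Set.mem_insert_iff, Set.mem_singleton_iff] at h' ⊢; tauto)
  have hu2 : u ∉ ({p', p, q, r} : Set V) := fun h' => hu (by
    simp only [Set.mem_insert_iff, Set.mem_singleton_iff] at h' ⊢; tauto)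
  have hn' : ∃ w ∈ ({p, p', r, q} : Set V), G.Adj u w := by
    obtain ⟨w, hw, huw⟩ := hn
    exact ⟨w, by simp only [Set.mem_insert_iff, Set.mem_singleton_iff] at hw ⊢; tauto, huw⟩
  have h2 := h.swap.adj_y hG hu' hn' hur huz
  exact hG.no_five_clique h2 (h.adj_p hG hu huq hur h2) (h.flip.adj_p hG hu2 huq hur h2) huq h.zp
    h.zp' h.zq h.pp h.pq h.pq'

end fourSun

/-- There is no sun in a clique of size four. -/
lemma FourSun.false {G : SimpleGraph V} {p p' q r x y z : V} (h : FourSun G p p' q r x y z)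
    (hG : Atom G) : False := by
  have hW := h.maxClique hG
  have htype : ∀ u, u ∉ ({p, p', q, r} : Set V) → (∃ w ∈ ({p, p', q, r} : Set V), G.Adj u w) →
      u = y ∨ u = z ∨ G.Adj u q ∧ G.Adj u r := by
    intro u hu hn
    have hu' : u ∉ ({p, p', r, q} : Set V) := fun h' => hu (by
      simp only [Set.mem_insert_iff, Set.mem_singleton_iff] at h' ⊢; tauto)
    have hn' : ∃ w ∈ ({p, p', r, q} : Set V), G.Adj u w := by
      obtain ⟨w, hw, huw⟩ := hn
      exact ⟨w, by simp only [Set.mem_insert_iff, Set.mem_singleton_iff] at hw ⊢; tauto, huw⟩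
    by_cases h1 : G.Adj u q <;> by_cases h2 : G.Adj u r
    · exact Or.inr (Or.inr ⟨h1, h2⟩)
    · exact Or.inr (Or.inl (h.eq_z hG hu hn h1 h2))
    · exact Or.inl (h.swap.eq_z hG hu' hn' h2 h1)
    · exact absurd (h.adj_q_or_r hG hu hn) (by tauto)
  obtain ⟨pp, pq, pr, pq', pr', qr, xq, xr, yp, yp', yr, zp, zp', zq, nxp, nxp', nyq, nzr, nxy, nxz,
    nyz⟩ := h
  have hnear : ∀ u, u ∉ ({p, p', q, r} : Set V) → ∃ w ∈ ({p, p', q, r} : Set V), G.Adj u w := by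
    intro o ho
    by_contra hno
    push Not at hno
    obtain ⟨Z, hZ, -⟩ := exists_farComp (G := G) (W := {p, p', q, r}) (o := o)
      ⟨ho, fun w hw h => hno w hw h.symm⟩
    obtain ⟨u, v, huv, hn, hfu, hfv, huW, hvW, huZ, hvZ⟩ := hZ.exists_nonadj hG ⟨p, by simp⟩
    have hu : ∃ w ∈ ({p, p', q, r} : Set V), G.Adj u w := by
      by_contra hno; push Not at hno; exact hfu ⟨huW, fun w hw h => hno w hw h.symm⟩
    have hv : ∃ w ∈ ({p, p', q, r} : Set V), G.Adj v w := by
      by_contra hno; push Not at hno; exact hfv ⟨hvW, fun w hw h => hno w hw h.symm⟩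
    obtain ⟨w, hw, h1, h2⟩ : ∃ w ∈ ({p, p', q, r} : Set V), G.Adj u w ∧ G.Adj v w := by
      rcases htype u huW hu with rfl | rfl | h1 <;> rcases htype v hvW hv with rfl | rfl | h2
      · exact absurd rfl huv
      · exact ⟨p, by simp, yp, zp⟩
      · exact ⟨r, by simp, yr, h2.2⟩
      · exact ⟨p, by simp, zp, yp⟩
      · exact absurd rfl huv
      · exact ⟨q, by simp, zq, h2.1⟩
      · exact ⟨r, by simp, h1.2, yr⟩
      · exact ⟨q, by simp, h1.1, zq⟩
      · exact ⟨q, by simp, h1.1, h2.1⟩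
    exact hW.disjoint hG hZ huW hvW huv hn huZ hvZ hw h1 h2
  have hs : ¬ NoStableTriple G := fun hs => hs x y z (by rintro rfl; exact nyq xq)
    (by rintro rfl; exact nzr xr) (by rintro rfl; exact nzr yr) nxy nxz nyz
  obtain ⟨a, b, hxa, hxb, hab, hnab⟩ := hG.exists_nonadj_nbrs hs x
  have hnbr : ∀ a, G.Adj x a → a = q ∨ a = r ∨ (a ∉ ({p, p', q, r} : Set V) ∧ G.Adj a q ∧ G.Adj a r)
      := by
    intro a hxa
    by_cases haW : a ∈ ({p, p', q, r} : Set V)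
    · simp only [Set.mem_insert_iff, Set.mem_singleton_iff] at haW
      rcases haW with rfl | rfl | rfl | rfl
      · exact absurd hxa nxp
      · exact absurd hxa nxp'
      · exact Or.inl rfl
      · exact Or.inr (Or.inl rfl)
    · rcases htype a haW (hnear a haW) with rfl | rfl | h1
      · exact absurd hxa nxy
      · exact absurd hxa nxz
      · exact Or.inr (Or.inr ⟨haW, h1⟩)
  rcases hnbr a hxa with rfl | rfl | ⟨haW, haq, har⟩ <;>
    rcases hnbr b hxb with rfl | rfl | ⟨hbW, hbq, hbr⟩
  · exact hab rfl
  · exact hnab adjs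
  · exact hnab adjs
  · exact hnab adjs
  · exact hab rfl
  · exact hnab adjs
  · exact hnab adjs
  · exact hnab adjs
  · have hap := hW.cover hG haW hbW hab hnab (w := q) (by simp) haq hbq (w' := p) (by simp)
    have hap' := hW.cover hG haW hbW hab hnab (w := q) (by simp) haq hbq (w' := p') (by simp)
    have hna : ¬ (G.Adj a p ∧ G.Adj a p') := fun h1 =>
      hG.no_five_clique h1.1 h1.2 haq har pp pq pr pq' pr' qr
    have hnb : ¬ (G.Adj b p ∧ G.Adj b p') := fun h1 =>
      hG.no_five_clique h1.1 h1.2 hbq hbr pp pq pr pq' pr' qr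
    rcases hap with h1 | h1 <;> rcases hap' with h2 | h2
    · exact hna ⟨h1, h2⟩
    · have h3 : ¬ G.Adj a p' := fun h => hna ⟨h1, h⟩
      have h4 : ¬ G.Adj b p := fun h => hnb ⟨h, h2⟩
      exact hG.perf.no_five_hole hxa.symm hxb h2 pp.symm h1.symm hnab h3 nxp' nxp h4
    · have h3 : ¬ G.Adj a p := fun h => hna ⟨h, h2⟩
      have h4 : ¬ G.Adj b p' := fun h => hnb ⟨h1, h⟩
      exact hG.perf.no_five_hole hxa.symm hxb h1 pp h2.symm hnab h3 nxp nxp' h4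
    · exact hnb ⟨h1, h2⟩

/-! ### Suns and the graph on nine vertices -/

/-- A triangle `w` and a stable set `s` such that `s i` misses exactly `w i`. -/
structure Sun (G : SimpleGraph V) (w s : Fin 3 → V) : Prop where
  ww : ∀ i j, i ≠ j → G.Adj (w i) (w j)
  ss : ∀ i j, ¬ G.Adj (s i) (s j)
  sw : ∀ i j, i ≠ j → G.Adj (s i) (w j)
  nsw : ∀ i, ¬ G.Adj (s i) (w i)

/-- Three pairs and three vertices with the adjacencies of an octahedron whose vertices see two of
the three vertices each. -/
structure NineVertex (G : SimpleGraph V) (p : Fin 3 → Bool → V) (q : Fin 3 → V) : Prop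
    extends ThreePairs G p q where
  adj : ∀ i j s t, i ≠ j → G.Adj (p i s) (p j t)
  own : ∀ i s, G.Adj (q i) (p i s)
  two : ∀ i s, ∃ j k, q j ≠ q k ∧ G.Adj (p i s) (q j) ∧ G.Adj (p i s) (q k)
  ne : ∀ i, p i false ≠ p i true

lemma exists_third : ∀ i j : Fin 3, ∃ k, k ≠ i ∧ k ≠ j := by decide

lemma exists_two_others : ∀ i : Fin 3, ∃ j k, j ≠ i ∧ k ≠ i ∧ j ≠ k := by decide

lemma eq_of_three : ∀ i j k l : Fin 3, i ≠ j → i ≠ k → j ≠ k → l = i ∨ l = j ∨ l = k := by decide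

section sun
variable {G : SimpleGraph V} {w s : Fin 3 → V}

lemma Sun.s_ne (h : Sun G w s) {i j : Fin 3} (hij : i ≠ j) : s i ≠ s j := fun e =>
  h.nsw j (e ▸ h.sw i j hij)

lemma Sun.no_common (h : Sun G w s) (hG : Atom G) {n : V} {i j k : Fin 3} (hij : i ≠ j)
    (hik : i ≠ k) (hjk : j ≠ k) (h1 : G.Adj n (s i)) (h2 : G.Adj n (s j)) (h3 : G.Adj n (s k)) :
    False :=
  hG.no_claw h1 h2 h3 (h.s_ne hij) (h.s_ne hik) (h.s_ne hjk) (h.ss i j) (h.ss i k) (h.ss j k)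

lemma Sun.fourSun (h : Sun G w s) {n : V} (hn : ∀ i, G.Adj n (w i)) {i j k : Fin 3} (hij : i ≠ j)
    (hik : i ≠ k) (hjk : j ≠ k) (h1 : ¬ G.Adj n (s i)) (h2 : G.Adj n (s j)) (h3 : G.Adj n (s k)) :
    FourSun G (w i) n (w j) (w k) (s i) (s j) (s k) :=
  ⟨(hn i).symm, h.ww i j hij, h.ww i k hik, hn j, hn k, h.ww j k hjk, h.sw i j hij, h.sw i k hik,
    h.sw j i hij.symm, h2.symm, h.sw j k hjk, h.sw k i hik.symm, h3.symm, h.sw k j hjk.symm,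
    h.nsw i, fun e => h1 e.symm, h.nsw j, h.nsw k, h.ss i j, h.ss i k, h.ss j k⟩

lemma Sun.no_fourth (h : Sun G w s) (hG : Atom G) (n : V) : ∃ i, ¬ G.Adj n (w i) := by
  by_contra hno
  push Not at hno
  have hne : ∀ i, n ≠ s i := fun i e => h.nsw i (e ▸ hno i)
  have hor : ∀ i j k, i ≠ j → i ≠ k → j ≠ k → G.Adj n (s i) ∨ G.Adj n (s j) := by
    intro i j k hij hik hjk
    by_contra h1
    push Not at h1
    exact hG.no_claw (hno k).symm (h.sw i k hik).symm (h.sw j k hjk).symm (hne i) (hne j)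
      (h.s_ne hij) h1.1 h1.2 (h.ss i j)
  have key : ∀ i j k, i ≠ j → i ≠ k → j ≠ k → ¬ G.Adj n (s i) → False := by
    intro i j k hij hik hjk h1
    exact (h.fourSun hno hij hik hjk h1 ((hor i j k hij hik hjk).resolve_left h1)
      ((hor i k j hik hij hjk.symm).resolve_left h1)).false hG
  by_cases h0 : G.Adj n (s 0)
  · by_cases h1 : G.Adj n (s 1)
    · by_cases h2 : G.Adj n (s 2)
      · exact h.no_common hG (by decide) (by decide) (by decide) h0 h1 h2
      · exact key 2 0 1 (by decide) (by decide) (by decide) h2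
    · exact key 1 0 2 (by decide) (by decide) (by decide) h1
  · exact key 0 1 2 (by decide) (by decide) (by decide) h0

lemma Sun.maxClique (h : Sun G w s) (hG : Atom G) : MaxClique G (Set.range w) := by
  refine ⟨?_, ?_⟩
  · rintro _ ⟨i, rfl⟩ _ ⟨j, rfl⟩ hne
    exact h.ww i j fun e => hne (e ▸ rfl)
  · intro v _
    obtain ⟨i, hi⟩ := h.no_fourth hG v
    exact ⟨w i, ⟨i, rfl⟩, hi⟩

lemma Sun.s_notMem (h : Sun G w s) (i : Fin 3) : s i ∉ Set.range w := by
  rintro ⟨j, e⟩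
  by_cases hij : i = j
  · subst hij
    obtain ⟨k, hk, -⟩ := exists_third i i
    exact h.ss k i (e ▸ h.sw k i hk)
  · exact (h.sw i j hij).ne e.symm

/-- A vertex missing `w i` is adjacent to `s i`. -/
lemma Sun.adj_s (h : Sun G w s) (hG : Atom G) {u : V} (hu : u ∉ Set.range w) {j : Fin 3}
    (hn : G.Adj u (w j)) {i : Fin 3} (hui : ¬ G.Adj u (w i)) (hus : u ≠ s i) : G.Adj u (s i) := by
  by_contra hno
  have hij : i ≠ j := fun e => hui (e ▸ hn)
  rcases (h.maxClique hG).cover hG hu (h.s_notMem i) hus hno ⟨j, rfl⟩ hn (h.sw i j hij)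
    (w' := w i) ⟨i, rfl⟩ with h1 | h1
  · exact hui h1
  · exact h.nsw i h1

/-- A vertex near the triangle misses exactly one of its vertices. -/
lemma Sun.unique_miss (h : Sun G w s) (hG : Atom G) {u : V} (hu : u ∉ Set.range w) {k : Fin 3}
    (hn : G.Adj u (w k)) {i j : Fin 3} (hui : ¬ G.Adj u (w i)) (huj : ¬ G.Adj u (w j)) : i = j := by
  by_contra hij
  have hsi : u ≠ s i := fun e => huj (e ▸ h.sw i j hij)
  have hsj : u ≠ s j := fun e => hui (e ▸ h.sw j i (Ne.symm hij))
  exact hG.perf.no_five_hole (h.adj_s hG hu hn hui hsi) (h.sw i j hij) (h.ww j i (Ne.symm hij))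
    (h.sw j i (Ne.symm hij)).symm (h.adj_s hG hu hn huj hsj).symm huj hui (h.nsw i) (h.ss i j)
    (fun e => h.nsw j e.symm)

/-- A graph with a sun has exactly nine vertices. -/
lemma Sun.nineVertex (h : Sun G w s) (hG : Atom G) : ∃ p q, NineVertex G p q := by
  have hW := h.maxClique hG
  have hstable : ¬ NoStableTriple G := fun hs => hs (s 0) (s 1) (s 2) (h.s_ne (by decide))
    (h.s_ne (by decide)) (h.s_ne (by decide)) (h.ss 0 1) (h.ss 0 2) (h.ss 1 2)
  have hmiss : ∀ u, u ∉ Set.range w → (∃ k, G.Adj u (w k)) →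
      ∃ i, ¬ G.Adj u (w i) ∧ ∀ j, j ≠ i → G.Adj u (w j) := by
    rintro u hu ⟨k, hk⟩
    obtain ⟨i, hi⟩ := h.no_fourth hG u
    refine ⟨i, hi, fun j hji => ?_⟩
    by_contra hj
    exact hji (h.unique_miss hG hu hk hj hi)
  have hnear : ∀ u, u ∉ Set.range w → ∃ k, G.Adj u (w k) := by
    intro o ho
    by_contra hno
    push Not at hno
    obtain ⟨Z, hZ, -⟩ := exists_farComp (G := G) (W := Set.range w) (o := o)
      ⟨ho, fun x hx hadj => by obtain ⟨k, rfl⟩ := hx; exact hno k hadj.symm⟩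
    obtain ⟨u, v, huv, hn, hfu, hfv, huW, hvW, huZ, hvZ⟩ := hZ.exists_nonadj hG ⟨w 0, 0, rfl⟩
    have hex : ∀ u, ¬ Far G (Set.range w) u → u ∉ Set.range w → ∃ k, G.Adj u (w k) := by
      intro u hfu huW
      by_contra hno
      push Not at hno
      exact hfu ⟨huW, fun x hx hadj => by obtain ⟨k, rfl⟩ := hx; exact hno k hadj.symm⟩
    obtain ⟨i, -, hi⟩ := hmiss u huW (hex u hfu huW)
    obtain ⟨j, -, hj⟩ := hmiss v hvW (hex v hfv hvW)
    obtain ⟨k, hki, hkj⟩ := exists_third i j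
    exact hW.disjoint hG hZ huW hvW huv hn huZ hvZ ⟨k, rfl⟩ (hi k hki) (hj k hkj)
  have hmiss' : ∀ u, u ∉ Set.range w → ∃ i, ¬ G.Adj u (w i) ∧ ∀ j, j ≠ i → G.Adj u (w j) :=
    fun u hu => hmiss u hu (hnear u hu)
  have hTclique : ∀ u v i, u ∉ Set.range w → v ∉ Set.range w → ¬ G.Adj u (w i) → ¬ G.Adj v (w i) →
      u ≠ v → G.Adj u v := by
    intro u v i hu hv hui hvi huv
    by_contra hno
    obtain ⟨j, hj1, hj2⟩ := hmiss' u hu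
    obtain ⟨k, hk1, hk2⟩ := hmiss' v hv
    have hji : i = j := by by_contra e; exact hui (hj2 i e)
    have hki : i = k := by by_contra e; exact hvi (hk2 i e)
    subst hji; subst hki
    obtain ⟨l, hl, -⟩ := exists_third i i
    rcases hW.cover hG hu hv huv hno ⟨l, rfl⟩ (hj2 l hl) (hk2 l hl) (w' := w i) ⟨i, rfl⟩ with h1 | h1
    · exact hui h1
    · exact hvi h1
  have hTtwo : ∀ u v i, u ∉ Set.range w → v ∉ Set.range w → ¬ G.Adj u (w i) → ¬ G.Adj v (w i) →
      u ≠ s i → v ≠ s i → u = v := by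
    intro u v i hu hv hui hvi hus hvs
    by_contra huv
    obtain ⟨j, hj1, hj2⟩ := hmiss' u hu
    obtain ⟨k, hk1, hk2⟩ := hmiss' v hv
    have hji : i = j := by by_contra e; exact hui (hj2 i e)
    have hki : i = k := by by_contra e; exact hvi (hk2 i e)
    subst hji; subst hki
    obtain ⟨l, m, hl, hm, hlm⟩ := exists_two_others i
    exact hG.no_five_clique (hTclique u v i hu hv hui hvi huv)
      (hTclique u (s i) i hu (h.s_notMem i) hui (h.nsw i) hus) (hj2 l hl) (hj2 m hm)
      (hTclique v (s i) i hv (h.s_notMem i) hvi (h.nsw i) hvs) (hk2 l hl) (hk2 m hm)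
      (h.sw i l hl.symm) (h.sw i m hm.symm) (h.ww l m hlm)
  have hex : ∀ i, ∃ t j, i ≠ j ∧ t ∉ Set.range w ∧ G.Adj t (s i) ∧ ¬ G.Adj t (w j) ∧
      ∀ l, l ≠ j → G.Adj t (w l) := by
    intro i
    by_contra hno
    push Not at hno
    obtain ⟨a, b, ha, hb, hab, hnab⟩ := hG.exists_nonadj_nbrs hstable (s i)
    have hnbr : ∀ a, G.Adj (s i) a → (∃ j, j ≠ i ∧ a = w j) ∨
        (a ∉ Set.range w ∧ ¬ G.Adj a (w i) ∧ ∀ j, j ≠ i → G.Adj a (w j)) := by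
      intro a ha
      by_cases haW : a ∈ Set.range w
      · obtain ⟨j, rfl⟩ := haW
        exact Or.inl ⟨j, fun e => h.nsw i (e ▸ ha), rfl⟩
      · obtain ⟨j, hj1, hj2⟩ := hmiss' a haW
        by_cases hij : i = j
        · subst hij; exact Or.inr ⟨haW, hj1, hj2⟩
        · obtain ⟨l, hl, hl'⟩ := hno a j hij haW ha.symm hj1
          exact absurd (hj2 l hl) hl'
    rcases hnbr a ha with ⟨j, hj, rfl⟩ | ⟨ha1, ha2, ha3⟩ <;>
      rcases hnbr b hb with ⟨k, hk, rfl⟩ | ⟨hb1, hb2, hb3⟩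
    · exact hnab (h.ww j k fun e => hab (e ▸ rfl))
    · exact hnab (hb3 j hj).symm
    · exact hnab (ha3 k hk)
    · exact hnab (hTclique a b i ha1 hb1 ha2 hb2 hab)
  choose t π hπ htW hts htn hta using hex
  have htsi : ∀ i, t i ≠ s (π i) := fun i e => h.ss (π i) i (e ▸ hts i)
  have htπ : ∀ i, G.Adj (t i) (s (π i)) := fun i =>
    h.adj_s hG (htW i) (hta i i (hπ i)) (htn i) (htsi i)
  have hinj : Function.Injective π := by
    intro i j e
    by_contra hij
    have htt : t i = t j := hTtwo (t i) (t j) (π i) (htW i) (htW j) (htn i) (e ▸ htn j) (htsi i)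
      (e ▸ htsi j)
    exact h.no_common hG hij (hπ i) (e ▸ hπ j) (hts i) (htt ▸ hts j) (htπ i)
  have hsurj : Function.Surjective π := Finite.surjective_of_injective hinj
  have hnts : ∀ i j, j ≠ i → j ≠ π i → ¬ G.Adj (t i) (s j) := fun i j h1 h2 h3 =>
    h.no_common hG h1.symm (hπ i) h2 (hts i) h3 (htπ i)
  have htt : ∀ i, G.Adj (t i) (t (π i)) := by
    intro i
    have h1 : π (π i) ≠ i := by
      intro e
      obtain ⟨k, hk1, hk2⟩ := exists_third i (π i)
      have h2 : π k ≠ k := (hπ k).symm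
      have h3 : π k ≠ π i := fun e' => hk1 (hinj e')
      have h4 : π k ≠ i := fun e' => hk2 (hinj (e'.trans e.symm))
      rcases eq_of_three i (π i) k (π k) (hπ i) hk1.symm hk2.symm with e' | e' | e' <;> contradiction
    by_contra hno
    exact hG.perf.no_five_hole (htπ i).symm (hts i) (h.sw i (π i) (hπ i))
      (hta (π i) (π i) (hπ (π i))).symm (hts (π i)) (h.ss _ _) (h.nsw _) (htn i) hno
      (fun e => hnts (π i) i (hπ i) h1.symm e.symm)
  have hcyc : ∀ i j, i ≠ j → π i = j ∨ π j = i := by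
    intro i j hij
    obtain ⟨k, hk1, hk2⟩ := exists_third i j
    by_contra hno
    push Not at hno
    have h1 : π i = k := by
      rcases eq_of_three i j k (π i) hij hk1.symm hk2.symm with e | e | e
      · exact absurd e.symm (hπ i)
      · exact absurd e hno.1
      · exact e
    have h2 : π j = k := by
      rcases eq_of_three i j k (π j) hij hk1.symm hk2.symm with e | e | e
      · exact absurd e hno.2
      · exact absurd e.symm (hπ j)
      · exact e
    exact hij (hinj (h1.trans h2.symm))
  refine ⟨fun i b => bif b then t i else w (π i), s, ⟨⟨?_, ?_, h.ss, ?_⟩, ?_, ?_, ?_, ?_⟩⟩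
  · intro v
    by_cases hv : v ∈ Set.range w
    · obtain ⟨j, rfl⟩ := hv
      obtain ⟨i, rfl⟩ := hsurj j
      exact Or.inl ⟨i, false, rfl⟩
    · obtain ⟨j, hj, -⟩ := hmiss' v hv
      obtain ⟨i, rfl⟩ := hsurj j
      by_cases hvs : v = s (π i)
      · exact Or.inr ⟨π i, hvs⟩
      · exact Or.inl ⟨i, true, hTtwo v (t i) (π i) hv (htW i) hj (htn i) hvs (htsi i)⟩
  · intro i e
    exact htn i e.symm
  · rintro i j hij ⟨h1, h2⟩
    have h3 : i ≠ π j := fun e => h.nsw i (by simpa [← e] using h1)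
    exact hnts j i hij h3 h2.symm
  · intro i j a b hij
    cases a <;> cases b
    · exact h.ww _ _ fun e => hij (hinj e)
    · exact (hta j (π i) fun e => hij (hinj e)).symm
    · exact hta i (π j) fun e => hij (hinj e.symm)
    · rcases hcyc i j hij with e | e
      · exact e ▸ htt i
      · exact (e ▸ htt j : G.Adj (t j) (t i)).symm
  · intro i b
    cases b
    · exact h.sw i (π i) (hπ i)
    · exact (hts i).symm
  · intro i b
    cases b
    · obtain ⟨k, hk1, hk2⟩ := exists_third i (π i)
      exact ⟨i, k, h.s_ne hk1.symm, (h.sw i (π i) (hπ i)).symm, (h.sw k (π i) hk2).symm⟩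
    · exact ⟨i, π i, h.s_ne (hπ i), hts i, htπ i⟩
  · intro i e
    exact htW i ⟨π i, e⟩

/-- In the graph on nine vertices no small clique has clique attachments. -/
lemma NineVertex.eq_empty {p : Fin 3 → Bool → V} {q : Fin 3 → V} (h : NineVertex G p q)
    {R : Finset V} (hcard : R.card ≤ 3)
    (hN : ∀ r ∈ R, ∀ x y, G.Adj r x → G.Adj r y → x ∉ R → y ∉ R → x ≠ y → G.Adj x y) : R = ∅ := by
  classical
  have hp : ∀ i b, p i b ∉ R := by
    intro i b hr
    obtain ⟨j, k, hji, hki, hjk⟩ := exists_two_others i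
    have hpair : ∀ j, j ≠ i → ∃ c, p j c ∈ R := by
      intro j hj
      by_contra hno
      push Not at hno
      exact h.pair j (hN _ hr _ _ (h.adj i j b false hj.symm) (h.adj i j b true hj.symm) (hno _)
        (hno _) (h.ne j))
    obtain ⟨c, hc⟩ := hpair j hji
    obtain ⟨d, hd⟩ := hpair k hki
    obtain ⟨m, hm⟩ : ∃ m, q m ∈ R := by
      obtain ⟨l, m, hlm, h1, h2⟩ := h.two i b
      by_contra hno
      push Not at hno
      exact h.single l m (hN _ hr _ _ h1 h2 (hno _) (hno _) hlm)
    have hqp : ∀ i b, q m ≠ p i b := by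
      intro i b e
      obtain ⟨l, _, _, h1, _⟩ := h.two i b
      exact h.single m l (e ▸ h1)
    have hsub : ({q m, p i b, p j c, p k d} : Finset V) ⊆ R := by
      intro x hx
      simp only [Finset.mem_insert, Finset.mem_singleton] at hx
      rcases hx with rfl | rfl | rfl | rfl <;> assumption
    have h4 := Finset.card_le_card hsub
    rw [Finset.card_insert_of_notMem, Finset.card_insert_of_notMem, Finset.card_insert_of_notMem,
      Finset.card_singleton] at h4
    · omega
    · simpa using (h.adj j k c d hjk).ne
    · simpa using ⟨(h.adj i j b c hji.symm).ne, (h.adj i k b d hki.symm).ne⟩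
    · simpa using ⟨hqp _ _, hqp _ _, hqp _ _⟩
  refine Finset.eq_empty_of_forall_notMem fun v hv => ?_
  rcases h.cover v with ⟨i, b, rfl⟩ | ⟨i, rfl⟩
  · exact hp i b hv
  · exact h.pair i (hN _ hv _ _ (h.own i false) (h.own i true) (hp _ _) (hp _ _) (h.ne i))

end sun

/-! ### Neighbours of a clique of size four seen by two nonadjacent vertices -/

lemma sun_of_vertices {G : SimpleGraph V} {w₀ w₁ w₂ s₀ s₁ s₂ : V} (h01 : G.Adj w₀ w₁)
    (h02 : G.Adj w₀ w₂) (h12 : G.Adj w₁ w₂) (n01 : ¬ G.Adj s₀ s₁) (n02 : ¬ G.Adj s₀ s₂)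
    (n12 : ¬ G.Adj s₁ s₂) (a01 : G.Adj s₀ w₁) (a02 : G.Adj s₀ w₂) (a10 : G.Adj s₁ w₀)
    (a12 : G.Adj s₁ w₂) (a20 : G.Adj s₂ w₀) (a21 : G.Adj s₂ w₁) (m0 : ¬ G.Adj s₀ w₀)
    (m1 : ¬ G.Adj s₁ w₁) (m2 : ¬ G.Adj s₂ w₂) : Sun G ![w₀, w₁, w₂] ![s₀, s₁, s₂] := by
  refine ⟨?_, ?_, ?_, ?_⟩
  · intro i j hij
    fin_cases i <;> fin_cases j <;> first | exact absurd rfl hij | exact adjs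
  · intro i j
    fin_cases i <;> fin_cases j <;> first | exact G.loopless.irrefl _ | exact adjs
  · intro i j hij
    fin_cases i <;> fin_cases j <;> first | exact absurd rfl hij | exact adjs
  · intro i
    fin_cases i <;> exact adjs

lemma exists_adj_of_not_far {G : SimpleGraph V} {W : Set V} {x : V} (h : ¬ Far G W x) (hx : x ∉ W) :
    ∃ w ∈ W, G.Adj x w := by
  by_contra hno
  push Not at hno
  exact h ⟨hx, fun w hw h' => hno w hw h'.symm⟩

/-- A clique `i i' j m` with two nonadjacent vertices `a`, `d` seeing `i i' j` and `j m`. -/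
structure CrossFour (G : SimpleGraph V) (a d i i' j m : V) : Prop where
  ii : G.Adj i i'
  ij : G.Adj i j
  im : G.Adj i m
  ij' : G.Adj i' j
  im' : G.Adj i' m
  jm : G.Adj j m
  ai : G.Adj a i
  ai' : G.Adj a i'
  aj : G.Adj a j
  nam : ¬ G.Adj a m
  dj : G.Adj d j
  dm : G.Adj d m
  ndi : ¬ G.Adj d i
  ndi' : ¬ G.Adj d i'
  nad : ¬ G.Adj a d

/-- A further vertex `l` which sees only `i` and `a`. -/
structure LeftVertex (G : SimpleGraph V) (a d i i' j m l : V) : Prop where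
  li : G.Adj l i
  la : G.Adj l a
  nli' : ¬ G.Adj l i'
  nlj : ¬ G.Adj l j
  nlm : ¬ G.Adj l m
  nld : ¬ G.Adj l d

section crossFour
variable {G : SimpleGraph V} {a d i i' j m l u v x y y' n : V}

lemma CrossFour.flip (h : CrossFour G a d i i' j m) : CrossFour G a d i' i j m :=
  ⟨h.ii.symm, h.ij', h.im', h.ij, h.im, h.jm, h.ai', h.ai, h.aj, h.nam, h.dj, h.dm, h.ndi', h.ndi,
    h.nad⟩

lemma notMem_four : x ∉ ({i, i', j, m} : Set V) ↔ x ≠ i ∧ x ≠ i' ∧ x ≠ j ∧ x ≠ m := by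
  simp only [Set.mem_insert_iff, Set.mem_singleton_iff, not_or]

lemma notMem_four_flip (h : x ∉ ({i, i', j, m} : Set V)) : x ∉ ({i', i, j, m} : Set V) := by
  rw [notMem_four] at h ⊢
  exact ⟨h.2.1, h.1, h.2.2⟩

lemma exists_mem_four {P : V → Prop} : (∃ w ∈ ({i, i', j, m} : Set V), P w) ↔
    P i ∨ P i' ∨ P j ∨ P m := by
  simp [Set.mem_insert_iff]

lemma CrossFour.maxClique (h : CrossFour G a d i i' j m) (hG : Atom G) :
    MaxClique G {i, i', j, m} := by
  obtain ⟨ii, ij, im, ij', im', jm, -⟩ := h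
  refine ⟨?_, ?_⟩
  · intro a ha b hb hab
    simp only [Set.mem_insert_iff, Set.mem_singleton_iff] at ha hb
    rcases ha with rfl | rfl | rfl | rfl <;> rcases hb with rfl | rfl | rfl | rfl <;>
      first | exact absurd rfl hab | exact adjs
  · intro v _
    by_contra hno
    push Not at hno
    simp only [Set.mem_insert_iff, Set.mem_singleton_iff, forall_eq_or_imp, forall_eq] at hno
    obtain ⟨h1, h2, h3, h4⟩ := hno
    exact hG.no_five_clique h1 h2 h3 h4 ii ij im ij' im' jm

lemma CrossFour.a_notMem (h : CrossFour G a d i i' j m) : a ∉ ({i, i', j, m} : Set V) := by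
  rw [notMem_four]
  exact ⟨h.ai.ne, h.ai'.ne, h.aj.ne, fun e => h.nad (e ▸ h.dm).symm⟩

lemma CrossFour.d_notMem (h : CrossFour G a d i i' j m) : d ∉ ({i, i', j, m} : Set V) := by
  rw [notMem_four]
  exact ⟨fun e => h.nad (e ▸ h.ai), fun e => h.nad (e ▸ h.ai'), h.dj.ne, h.dm.ne⟩

lemma CrossFour.leftVertex (h : CrossFour G a d i i' j m) (hG : Atom G)
    (hx : x ∉ ({i, i', j, m} : Set V)) (hn : ∃ w ∈ ({i, i', j, m} : Set V), G.Adj x w)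
    (hxm : ¬ G.Adj x m) (hxi : ¬ G.Adj x i') : LeftVertex G a d i i' j m x := by
  have hW := h.maxClique hG
  have haW := h.a_notMem
  have hdW := h.d_notMem
  obtain ⟨ii, ij, im, ij', im', jm, ai, ai', aj, nam, dj, dm, ndi, ndi', nad⟩ := h
  rw [exists_mem_four] at hn
  have hxa : G.Adj x a := by
    by_contra hno
    have key : ∀ w ∈ ({i, i', j, m} : Set V), G.Adj x w → G.Adj a w → False := by
      intro w hw h1 h2
      rcases hW.cover hG hx haW adjs hno hw h1 h2 (w' := m) (by simp) with h3 | h3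
      · exact hxm h3
      · exact nam h3
    rcases hn with h1 | h1 | h1 | h1
    · exact key i (by simp) h1 ai
    · exact hxi h1
    · exact key j (by simp) h1 aj
    · exact hxm h1
  have hxd : ¬ G.Adj x d := fun h1 =>
    hG.perf.no_five_hole hxa.symm h1 dm im'.symm ai'.symm nad nam hxm hxi ndi'
  have hxj : ¬ G.Adj x j := fun h1 => by
    rcases hW.cover hG hx hdW adjs hxd (w := j) (by simp) h1 dj (w' := i') (by simp) with h3 | h3
    · exact hxi h3
    · exact ndi' h3
  refine ⟨?_, hxa, hxi, hxj, hxm, hxd⟩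
  rcases hn with h1 | h1 | h1 | h1
  · exact h1
  all_goals contradiction

lemma CrossFour.adj_d (h : CrossFour G a d i i' j m) (hG : Atom G)
    (hx : x ∉ ({i, i', j, m} : Set V)) (hxm : G.Adj x m) (hxi : ¬ G.Adj x i ∨ ¬ G.Adj x i')
    (hxd : x ≠ d) : G.Adj x d := by
  by_contra hno
  have hc := fun w' hw' => (h.maxClique hG).cover hG hx h.d_notMem hxd hno (w := m) (by simp) hxm h.dm
    (w' := w') hw'
  have h1 := hc i (by simp)
  have h2 := hc i' (by simp)
  have := h.ndi
  have := h.ndi'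
  tauto

lemma CrossFour.adj_of_adj_m (h : CrossFour G a d i i' j m) (hG : Atom G)
    (hx : x ∉ ({i, i', j, m} : Set V)) (hxm : G.Adj x m) (hxi : ¬ G.Adj x i ∨ ¬ G.Adj x i')
    (hy : y ∉ ({i, i', j, m} : Set V)) (hym : G.Adj y m) (hyi : ¬ G.Adj y i ∨ ¬ G.Adj y i')
    (hxy : x ≠ y) : G.Adj x y := by
  by_cases e1 : x = d
  · subst e1; exact (h.adj_d hG hy hym hyi hxy.symm).symm
  by_cases e2 : y = d
  · subst e2; exact h.adj_d hG hx hxm hxi hxy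
  have hxd := h.adj_d hG hx hxm hxi e1
  have hyd := h.adj_d hG hy hym hyi e2
  by_contra hno
  have hc := fun w' hw' => (h.maxClique hG).cover hG hx hy hxy hno (w := m) (by simp) hxm hym
    (w' := w') hw'
  have h1 := hc i (by simp)
  have h2 := hc i' (by simp)
  have := h.ndi
  have := h.ndi'
  have ii := h.ii
  by_cases e3 : G.Adj x i
  · have e4 : ¬ G.Adj x i' := by tauto
    have e5 : G.Adj y i' := by tauto
    have e6 : ¬ G.Adj y i := by tauto
    exact hG.perf.no_five_hole hxd.symm e3 ii e5.symm hyd adjs adjs adjs adjs adjs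
  · have e4 : G.Adj y i := by tauto
    have e5 : ¬ G.Adj y i' := by tauto
    have e6 : G.Adj x i' := by tauto
    exact hG.perf.no_five_hole hxd.symm e6 ii.symm e4.symm hyd adjs adjs adjs adjs adjs

lemma CrossFour.adj_of_miss_m (h : CrossFour G a d i i' j m) (hG : Atom G)
    (hx : x ∉ ({i, i', j, m} : Set V)) (hxn : ∃ w ∈ ({i, i', j, m} : Set V), G.Adj x w)
    (hxm : ¬ G.Adj x m) (hy : y ∉ ({i, i', j, m} : Set V))
    (hyn : ∃ w ∈ ({i, i', j, m} : Set V), G.Adj y w) (hym : ¬ G.Adj y m)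
    (hxy : x ≠ y) : G.Adj x y := by
  by_contra hno
  have key : ∀ w ∈ ({i, i', j, m} : Set V), G.Adj x w → G.Adj y w → False := by
    intro w hw h1 h2
    rcases (h.maxClique hG).cover hG hx hy hxy hno hw h1 h2 (w' := m) (by simp) with h3 | h3
    · exact hxm h3
    · exact hym h3
  have hflip : ∀ {x}, (∃ w ∈ ({i, i', j, m} : Set V), G.Adj x w) →
      ∃ w ∈ ({i', i, j, m} : Set V), G.Adj x w := by
    intro x hx
    rw [exists_mem_four] at hx ⊢
    tauto
  have hleft : ∀ {x}, x ∉ ({i, i', j, m} : Set V) → (∃ w ∈ ({i, i', j, m} : Set V), G.Adj x w) →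
      ¬ G.Adj x m → (¬ G.Adj x i ∨ ¬ G.Adj x i') → G.Adj x a ∧ ¬ G.Adj x j := by
    intro x hx hxn hxm hxi
    rcases hxi with h1 | h1
    · have h2 := h.flip.leftVertex hG (notMem_four_flip hx) (hflip hxn) hxm h1
      exact ⟨h2.la, h2.nlj⟩
    · have h2 := h.leftVertex hG hx hxn hxm h1
      exact ⟨h2.la, h2.nlj⟩
  have ki := key i (by simp)
  have ki' := key i' (by simp)
  have hxi : ¬ G.Adj x i ∨ ¬ G.Adj x i' := by
    by_contra hc
    push Not at hc
    have hyi : ¬ G.Adj y i := fun e => ki hc.1 e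
    have hyi' : ¬ G.Adj y i' := fun e => ki' hc.2 e
    exact hyi (h.leftVertex hG hy hyn hym hyi').li
  have hyi : ¬ G.Adj y i ∨ ¬ G.Adj y i' := by
    by_contra hc
    push Not at hc
    have hyi : ¬ G.Adj x i := fun e => ki e hc.1
    have hyi' : ¬ G.Adj x i' := fun e => ki' e hc.2
    exact hyi (h.leftVertex hG hx hxn hxm hyi').li
  obtain ⟨xa, xj⟩ := hleft hx hxn hxm hxi
  obtain ⟨ya, yj⟩ := hleft hy hyn hym hyi
  rw [notMem_four] at hx hy
  exact hG.no_claw xa.symm ya.symm h.aj hxy hx.2.2.1 hy.2.2.1 hno xj yj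

/-- The left vertices are anticomplete to the vertices on the right. -/
lemma LeftVertex.not_adj_right (hsun : ∀ w s, ¬ Sun G w s) (hl : LeftVertex G a d i i' j m l)
    (h : CrossFour G a d i i' j m) (hG : Atom G)
    (hx : v ∉ ({i, i', j, m} : Set V)) (hvm : G.Adj v m) (hvi : ¬ G.Adj v i ∨ ¬ G.Adj v i') :
    ¬ G.Adj l v := by
  intro hlv
  have hvd : G.Adj v d := h.adj_d hG hx hvm hvi fun e => hl.nld (e ▸ hlv)
  obtain ⟨ii, ij, im, ij', im', jm, ai, ai', aj, nam, dj, dm, ndi, ndi', nad⟩ := h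
  obtain ⟨li, la, nli', nlj, nlm, nld⟩ := hl
  have hvi' : ¬ G.Adj v i' := fun h1 => hG.no_claw hlv.symm hvd h1 adjs
    (by rintro rfl; exact nlj ij') (by rintro rfl; exact nad ai') nld nli' ndi'
  have hva : G.Adj v a := by
    by_contra hno
    exact hG.perf.no_five_hole la.symm hlv hvm im'.symm ai'.symm adjs nam nlm nli' hvi'
  by_cases h1 : G.Adj v i
  · exact hsun _ _ (sun_of_vertices (w₀ := v) (w₁ := i) (w₂ := m) (s₀ := i') (s₁ := d) (s₂ := l)
      adjs adjs adjs adjs adjs adjs adjs adjs adjs adjs adjs adjs adjs adjs adjs)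
  · by_cases h2 : G.Adj v j
    · exact hsun _ _ (sun_of_vertices (w₀ := v) (w₁ := j) (w₂ := a) (s₀ := i') (s₁ := l) (s₂ := d)
        adjs adjs adjs adjs adjs adjs adjs adjs adjs adjs adjs adjs adjs adjs adjs)
    · exact hG.perf.no_five_hole hlv.symm li ij dj.symm hvd.symm h1 h2 nlj nld adjs

lemma LeftVertex.no_far_nbr (hsun : ∀ w s, ¬ Sun G w s) (hl : LeftVertex G a d i i' j m l)
    (h : CrossFour G a d i i' j m) (hG : Atom G) {Z : Set V} (hZ : FarComp G {i, i', j, m} Z)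
    (hlZ : ∃ z ∈ Z, G.Adj l z) (hv : v ∉ ({i, i', j, m} : Set V)) (hvm : G.Adj v m)
    (hvi : ¬ G.Adj v i ∨ ¬ G.Adj v i') (hvZ : ∃ z ∈ Z, G.Adj v z) : False := by
  have hfar : ∀ w ∈ ({i, i', j, m} : Set V), ∀ z ∈ Z, ¬ G.Adj w z := fun w hw z hz =>
    (hZ.far z hz).2 w hw
  have fi := hfar i (by simp)
  have fi' := hfar i' (by simp)
  have fj := hfar j (by simp)
  have fm := hfar m (by simp)
  have key : ∀ v, v ∉ ({i, i', j, m} : Set V) → G.Adj v m → ¬ G.Adj v i → ¬ G.Adj v i' →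
      (∃ z ∈ Z, G.Adj v z) → False := by
    intro v hv hvm hvi hvi' hvZ
    have hlv := hl.not_adj_right hsun h hG hv hvm (Or.inl hvi)
    have hvd := h.adj_d hG hv hvm (Or.inl hvi)
    have hW := h.maxClique hG
    have haW := h.a_notMem
    have hdW := h.d_notMem
    obtain ⟨ii, ij, im, ij', im', jm, ai, ai', aj, nam, dj, dm, ndi, ndi', nad⟩ := h
    obtain ⟨li, la, nli', nlj, nlm, nld⟩ := hl
    obtain ⟨r, -, h2, h3⟩ := hZ.parity_short hG.perf hlZ hvZ hlv (by rintro rfl; exact nlm hvm)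
    have e2 := h2 i m li im adjs nlm adjs fi fm
    have e3 : ¬ Even (r + 3) := Nat.even_add_one.not.mpr (not_not.mpr e2)
    have hva : ¬ G.Adj v a := fun h1 => hG.no_claw la.symm h1.symm ai' adjs
      (by rintro rfl; exact nlm im') (fun e => hvi (e ▸ ii.symm)) hlv nli' hvi'
    by_cases haZ : ∃ z ∈ Z, G.Adj a z
    · have hvj : ¬ G.Adj v j := fun h1 =>
        hW.disjoint hG hZ haW hv adjs adjs haZ hvZ (w := j) (by simp) aj h1
      have hdZ : ∀ z ∈ Z, ¬ G.Adj d z := fun z hz hdz =>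
        hW.disjoint hG hZ haW hdW (by rintro rfl; exact nam dm) nad haZ ⟨z, hz, hdz⟩ (w := j)
          (by simp) aj dj
      have hvd' := hvd (by rintro rfl; exact hvj dj)
      exact e3 (h3 i j d li ij dj.symm hvd'.symm nlj nld adjs adjs adjs fi fj hdZ)
    · push Not at haZ
      exact e3 (h3 a i' m la ai' im' hvm.symm nli' nlm nam adjs adjs haZ fi' fm)
  by_cases h1 : ¬ G.Adj v i ∧ ¬ G.Adj v i'
  · exact key v hv hvm h1.1 h1.2 hvZ
  · refine key d h.d_notMem h.dm h.ndi h.ndi' ?_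
    by_cases hvd : v = d
    · exact hvd ▸ hvZ
    · have hadj := h.adj_d hG hv hvm hvi hvd
      obtain ⟨z, hz, hvz⟩ := hvZ
      have hdz : d ≠ z := fun e => (hZ.far z hz).2 m (by simp) (e ▸ h.dm.symm)
      by_cases h2 : G.Adj v i
      · exact ⟨z, hz, hZ.pull hG hz hvz hadj h.d_notMem (w := i) (by simp) h2 h.ndi hdz⟩
      · have h3 : G.Adj v i' := by tauto
        exact ⟨z, hz, hZ.pull hG hz hvz hadj h.d_notMem (w := i') (by simp) h3 h.ndi' hdz⟩

lemma LeftVertex.near (hsun : ∀ w s, ¬ Sun G w s) (hl : LeftVertex G a d i i' j m l)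
    (h : CrossFour G a d i i' j m) (hG : Atom G) (hx : x ∉ ({i, i', j, m} : Set V)) :
    ∃ w ∈ ({i, i', j, m} : Set V), G.Adj x w := by
  have hW := h.maxClique hG
  refine exists_adj_of_not_far (fun hfar => ?_) hx
  obtain ⟨Z, hZ, -⟩ := exists_farComp hfar
  obtain ⟨u, v, huv, hn, hfu, hfv, huW, hvW, huZ, hvZ⟩ := hZ.exists_nonadj hG ⟨i, by simp⟩
  have hdis := fun w hw h1 h2 => hW.disjoint hG hZ huW hvW huv hn huZ hvZ (w := w) hw h1 h2
  have hun := exists_adj_of_not_far hfu huW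
  have hvn := exists_adj_of_not_far hfv hvW
  have hlW : l ∉ ({i, i', j, m} : Set V) := by
    rw [notMem_four]
    exact ⟨hl.li.ne, fun e => hl.nlj (e ▸ h.ij'), fun e => hl.nlm (e ▸ h.jm),
      fun e => hl.nlj (e ▸ h.jm.symm)⟩
  have key : ∀ u v, u ∉ ({i, i', j, m} : Set V) → v ∉ ({i, i', j, m} : Set V) →
      (∃ w ∈ ({i, i', j, m} : Set V), G.Adj u w) → (∃ z ∈ Z, G.Adj u z) → (∃ z ∈ Z, G.Adj v z) →
      (∀ w ∈ ({i, i', j, m} : Set V), G.Adj u w → G.Adj v w → False) → ¬ G.Adj u m → G.Adj v m →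
      False := by
    intro u v huW hvW hun huZ hvZ hdis hum hvm
    by_cases h1 : G.Adj u i'
    · have hvi' : ¬ G.Adj v i' := fun e => hdis i' (by simp) h1 e
      by_cases h2 : G.Adj u i
      · by_cases e : u = l
        · exact hl.nli' (e ▸ h1)
        have hul : G.Adj u l := h.adj_of_miss_m hG huW hun hum hlW ⟨i, by simp, hl.li⟩ hl.nlm e
        obtain ⟨z, hz, huz⟩ := huZ
        have hlz : G.Adj l z := hZ.pull hG hz huz hul hlW (w := i') (by simp) h1 hl.nli'
          fun e => (hZ.far z hz).2 i (by simp) (e ▸ hl.li.symm)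
        exact hl.no_far_nbr hsun h hG hZ ⟨z, hz, hlz⟩ hvW hvm (Or.inr hvi') hvZ
      · have hset : ({i', i, j, m} : Set V) = {i, i', j, m} := Set.insert_comm _ _ _
        have hu := h.flip.leftVertex hG (hset ▸ huW) (hset ▸ hun) hum h2
        exact hu.no_far_nbr hsun h.flip hG (hset ▸ hZ) huZ (hset ▸ hvW) hvm (Or.inl hvi') hvZ
    · have hu := h.leftVertex hG huW hun hum h1
      exact hu.no_far_nbr hsun h hG hZ huZ hvW hvm
        (Or.inl fun e => hdis i (by simp) hu.li e) hvZ
  by_cases hum : G.Adj u m <;> by_cases hvm : G.Adj v m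
  · exact hdis m (by simp) hum hvm
  · exact key v u hvW huW hvn hvZ huZ (fun w hw h1 h2 => hdis w hw h2 h1) hvm hum
  · exact key u v huW hvW hun huZ hvZ hdis hum hvm
  · exact hn (h.adj_of_miss_m hG huW hun hum hvW hvn hvm huv)

lemma LeftVertex.false (hsun : ∀ w s, ¬ Sun G w s) (hS : ¬ NoStableTriple G)
    (hl : LeftVertex G a d i i' j m l) (h : CrossFour G a d i i' j m) (hG : Atom G) : False := by
  have hnear : ∀ x, x ∉ ({i, i', j, m} : Set V) → _ := fun x hx => hl.near hsun h hG hx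
  have hW := h.maxClique hG
  have hlW : l ∉ ({i, i', j, m} : Set V) := by
    rw [notMem_four]
    exact ⟨hl.li.ne, fun e => hl.nlj (e ▸ h.ij'), fun e => hl.nlm (e ▸ h.jm),
      fun e => hl.nlj (e ▸ h.jm.symm)⟩
  have hset : ({i', i, j, m} : Set V) = {i, i', j, m} := Set.insert_comm _ _ _
  by_cases hN : ∃ n, n ∉ ({i, i', j, m} : Set V) ∧ G.Adj n i ∧ G.Adj n i' ∧ G.Adj n m
  · obtain ⟨n, hnW, ni, ni', nm⟩ := hN
    have nj : ¬ G.Adj n j := fun h1 =>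
      hG.no_five_clique ni ni' h1 nm h.ii h.ij h.im h.ij' h.im' h.jm
    obtain ⟨x, y, hdx, hdy, hxy, hno⟩ := hG.exists_nonadj_nbrs hS d
    have hld : ∀ n, G.Adj n l → G.Adj n i' → ¬ G.Adj n d := fun n h1 h2 h3 =>
      hG.no_claw h1 h3 h2 (fun e => h.ndi (e ▸ hl.li)) (fun e => hl.nlj (e ▸ h.ij'))
        (fun e => h.nad (e ▸ h.ai')) hl.nld hl.nli' h.ndi'
    have nl : G.Adj n l := by
      by_contra hno
      rcases hW.cover hG hnW hlW (fun e => hl.nlm (e ▸ nm)) hno (w := i) (by simp) ni hl.li (w' := j)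
        (by simp) with h1 | h1
      · exact nj h1
      · exact hl.nlj h1
    have nd := hld n nl ni'
    have hnbr : ∀ x, G.Adj d x → x = j ∨ x = m ∨ (x ∉ ({i, i', j, m} : Set V) ∧ G.Adj x m ∧
        (¬ G.Adj x i ∨ ¬ G.Adj x i') ∧ G.Adj x j) := by
      intro x hdx
      by_cases hxW : x ∈ ({i, i', j, m} : Set V)
      · simp only [Set.mem_insert_iff, Set.mem_singleton_iff] at hxW
        rcases hxW with rfl | rfl | rfl | rfl
        · exact absurd hdx h.ndi
        · exact absurd hdx h.ndi'
        · exact Or.inl rfl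
        · exact Or.inr (Or.inl rfl)
      have hxm : G.Adj x m := by
        by_contra hxm
        by_cases h1 : G.Adj x i'
        · have hxl : x ≠ l := fun e => hl.nli' (e ▸ h1)
          exact hld x (h.adj_of_miss_m hG hxW (hnear x hxW) hxm hlW ⟨i, by simp, hl.li⟩ hl.nlm hxl) h1
            hdx.symm
        · exact (h.leftVertex hG hxW (hnear x hxW) hxm h1).nld hdx.symm
      have hxi : ¬ G.Adj x i ∨ ¬ G.Adj x i' := by
        by_contra hc
        push Not at hc
        have xj : ¬ G.Adj x j := fun h1 =>
          hG.no_five_clique hc.1 hc.2 h1 hxm h.ii h.ij h.im h.ij' h.im' h.jm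
        have xl : G.Adj x l := by
          by_contra hno
          rcases hW.cover hG hxW hlW (fun e => hl.nlm (e ▸ hxm)) hno (w := i) (by simp) hc.1 hl.li
            (w' := j) (by simp) with h1 | h1
          · exact xj h1
          · exact hl.nlj h1
        exact hld x xl hc.2 hdx.symm
      refine Or.inr (Or.inr ⟨hxW, hxm, hxi, ?_⟩)
      by_contra xj
      have hxn : G.Adj n x := by
        by_contra hno
        rcases hW.cover hG hnW hxW (fun e => nd (e ▸ hdx.symm)) hno (w := m) (by simp) nm hxm
          (w' := j) (by simp) with h1 | h1
        · exact nj h1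
        · exact xj h1
      have ndi := h.ndi
      have ndi' := h.ndi'
      rcases hxi with h1 | h1
      · exact hG.perf.no_five_hole h.dj h.ij.symm ni.symm hxn hdx.symm ndi adjs adjs adjs adjs
      · exact hG.perf.no_five_hole h.dj h.ij'.symm ni'.symm hxn hdx.symm ndi' adjs adjs adjs adjs
    have jm := h.jm
    rcases hnbr x hdx with rfl | rfl | ⟨hx1, hx2, hx3, hx4⟩ <;>
      rcases hnbr y hdy with rfl | rfl | ⟨hy1, hy2, hy3, hy4⟩
    · exact hxy rfl
    · exact hno adjs
    · exact hno adjs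
    · exact hno adjs
    · exact hxy rfl
    · exact hno adjs
    · exact hno adjs
    · exact hno adjs
    · exact hno (h.adj_of_adj_m hG hx1 hx2 hx3 hy1 hy2 hy3 hxy)
  · push Not at hN
    have := hG.cut {x | x ∉ ({i, i', j, m} : Set V) ∧ ¬ G.Adj x m ∧ (¬ G.Adj x i ∨ ¬ G.Adj x i')}
      {x | x = i ∨ x = i' ∨ (x ∉ ({i, i', j, m} : Set V) ∧ ¬ G.Adj x m ∧ G.Adj x i ∧ G.Adj x i')}
      ⟨l, hlW, hl.nlm, Or.inr hl.nli'⟩ ?_ ?_ ?_ d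
    · have := h.dm
      have := h.ndi
      have := h.d_notMem
      have e1 : d ≠ i := fun e => h.nad (e ▸ h.ai)
      have e2 : d ≠ i' := fun e => h.nad (e ▸ h.ai')
      simp only [Set.mem_ofPred_eq] at *
      tauto
    · rintro x ⟨h1, h2, h3⟩ (rfl | rfl | ⟨h4, h5, h6, h7⟩)
      · exact h1 (by simp)
      · exact h1 (by simp)
      · tauto
    · rintro x hx y hy hxy
      have ii := h.ii
      rcases hx with rfl | rfl | ⟨h4, h5, h6, h7⟩ <;> rcases hy with rfl | rfl | ⟨g4, g5, g6, g7⟩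
      · exact absurd rfl hxy
      · exact adjs
      · exact adjs
      · exact adjs
      · exact absurd rfl hxy
      · exact adjs
      · exact adjs
      · exact adjs
      · exact h.adj_of_miss_m hG h4 (hnear x h4) h5 g4 (hnear y g4) g5 hxy
    · rintro x ⟨hx1, hx2, hx3⟩ y hxy
      have hxj : ¬ G.Adj x j := by
        rcases hx3 with h1 | h1
        · exact (h.flip.leftVertex hG (hset ▸ hx1) (hset ▸ hnear x hx1) hx2 h1).nlj
        · exact (h.leftVertex hG hx1 (hnear x hx1) hx2 h1).nlj
      by_cases hyW : y ∈ ({i, i', j, m} : Set V)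
      · simp only [Set.mem_insert_iff, Set.mem_singleton_iff] at hyW
        rcases hyW with rfl | rfl | rfl | rfl
        · exact Or.inr (Or.inl rfl)
        · exact Or.inr (Or.inr (Or.inl rfl))
        · exact absurd hxy hxj
        · exact absurd hxy hx2
      · by_cases hyi : ¬ G.Adj y i ∨ ¬ G.Adj y i'
        · refine Or.inl ⟨hyW, fun hym => ?_, hyi⟩
          rcases hx3 with h1 | h1
          · exact (h.flip.leftVertex hG (hset ▸ hx1) (hset ▸ hnear x hx1) hx2 h1).not_adj_right hsun
              h.flip hG (hset ▸ hyW) hym hyi.symm hxy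
          · exact (h.leftVertex hG hx1 (hnear x hx1) hx2 h1).not_adj_right hsun h hG hyW hym hyi hxy
        · push Not at hyi
          exact Or.inr (Or.inr (Or.inr ⟨hyW, hN y hyW hyi.1 hyi.2, hyi⟩))

end crossFour

/-! ### Maximal cliques seen by two nonadjacent vertices -/

/-- Two nonadjacent vertices `a` and `d` outside a maximal clique with a common neighbour `j` in
it. -/
structure Crossing (G : SimpleGraph V) (W : Set V) (a d j : V) : Prop where
  max : MaxClique G W
  ha : a ∉ W
  hd : d ∉ W
  ne : a ≠ d
  nad : ¬ G.Adj a d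
  hj : j ∈ W
  aj : G.Adj a j
  dj : G.Adj d j

section crossing
variable {G : SimpleGraph V} {W Z : Set V} {a d j w i k x y x' y' : V}

lemma Crossing.swap (h : Crossing G W a d j) : Crossing G W d a j :=
  ⟨h.max, h.hd, h.ha, h.ne.symm, fun e => h.nad e.symm, h.hj, h.dj, h.aj⟩

lemma Crossing.cover (h : Crossing G W a d j) (hG : Atom G) (hw : w ∈ W) : G.Adj a w ∨ G.Adj d w :=
  h.max.cover hG h.ha h.hd h.ne h.nad h.hj h.aj h.dj hw

lemma Crossing.adj_a (h : Crossing G W a d j) (hG : Atom G) (hw : w ∈ W) (hn : ¬ G.Adj d w) :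
    G.Adj a w :=
  (h.cover hG hw).resolve_right hn

lemma Crossing.adj_d (h : Crossing G W a d j) (hG : Atom G) (hw : w ∈ W) (hn : ¬ G.Adj a w) :
    G.Adj d w :=
  (h.cover hG hw).resolve_left hn

lemma Crossing.not_left (hsun : ∀ w s, ¬ Sun G w s) (hS : ¬ NoStableTriple G)
    (h : Crossing G W a d j) (hG : Atom G) (hx : x ∉ W) (hxa : G.Adj x a) (hxd : ¬ G.Adj x d)
    (hn : ∃ w ∈ W, G.Adj x w) (hi : i ∈ W) (hdi : ¬ G.Adj d i) (hxi : ¬ G.Adj x i) (hk : k ∈ W)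
    (hak : ¬ G.Adj a k) (hxk : ¬ G.Adj x k) : False := by
  have hne : x ≠ d := by rintro rfl; exact h.nad hxa.symm
  have hdis : ∀ w ∈ W, G.Adj x w → ¬ G.Adj d w := by
    intro w hw h1 h2
    rcases h.max.cover hG hx h.hd hne hxd hw h1 h2 hi with h3 | h3
    · exact hxi h3
    · exact hdi h3
  obtain ⟨w, hw, hxw⟩ := hn
  have hdw := hdis w hw hxw
  have hxj : ¬ G.Adj x j := fun e => hdis j h.hj e h.dj
  have hai := h.adj_a hG hi hdi
  have haw := h.adj_a hG hw hdw
  have hdk := h.adj_d hG hk hak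
  have hj := h.hj
  have aj := h.aj
  have dj := h.dj
  have hcl : ∀ u ∈ W, ∀ v ∈ W, u ≠ v → G.Adj u v := fun u hu v hv => h.max.adj hu hv
  refine LeftVertex.false hsun hS (l := x) (i := w) (i' := i) (j := j) (m := k) (a := a) (d := d)
    ⟨hxw, hxa, hxi, hxj, hxk, hxd⟩
    ⟨hcl _ hw _ hi adjs, hcl _ hw _ hj adjs, hcl _ hw _ hk adjs, hcl _ hi _ hj adjs,
      hcl _ hi _ hk adjs, hcl _ hj _ hk adjs, haw, hai, aj, hak, dj, hdk, hdw, hdi, h.nad⟩ hG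

/-- A near vertex sees everything on one of the two sides. -/
lemma Crossing.side (hsun : ∀ w s, ¬ Sun G w s) (hS : ¬ NoStableTriple G)
    (h : Crossing G W a d j) (hG : Atom G) (hx : x ∉ W) (hn : ∃ w ∈ W, G.Adj x w) :
    (∀ i ∈ W, ¬ G.Adj d i → G.Adj x i) ∨ ∀ k ∈ W, ¬ G.Adj a k → G.Adj x k := by
  by_contra hno
  push Not at hno
  obtain ⟨⟨i, hi, hdi, hxi⟩, k, hk, hak, hxk⟩ := hno
  have hai := h.adj_a hG hi hdi
  have hdk := h.adj_d hG hk hak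
  have hne1 : x ≠ a := adjs
  have hne2 : x ≠ d := adjs
  have nad := h.nad
  by_cases hxa : G.Adj x a
  · by_cases hxd : G.Adj x d
    · have hki : G.Adj k i := h.max.adj hk hi adjs
      exact hG.perf.no_five_hole hxa.symm hxd hdk hki hai.symm nad hak hxk hxi hdi
    · exact h.not_left hsun hS hG hx hxa hxd hn hi hdi hxi hk hak hxk
  · by_cases hxd : G.Adj x d
    · exact h.swap.not_left hsun hS hG hx hxd hxa hn hk hak hxk hi hdi hxi
    · obtain ⟨w, hw, hxw⟩ := hn
      rcases h.cover hG hw with h1 | h1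
      · rcases h.max.cover hG hx h.ha hne1 hxa hw hxw h1 hk with h2 | h2 <;> contradiction
      · rcases h.max.cover hG hx h.hd hne2 hxd hw hxw h1 hi with h2 | h2 <;> contradiction

/-- A vertex outside `W` which sees the whole side of `a` but not the whole side of `d`. -/
structure OnSide (G : SimpleGraph V) (W : Set V) (a d x : V) : Prop where
  notMem : x ∉ W
  full : ∀ i ∈ W, ¬ G.Adj d i → G.Adj x i
  miss : ∃ k ∈ W, ¬ G.Adj a k ∧ ¬ G.Adj x k

lemma Crossing.exists_left (h : Crossing G W a d j) : ∃ i ∈ W, ¬ G.Adj d i := h.max.max d h.hd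

lemma OnSide.near (hx : OnSide G W a d x) (h : Crossing G W a d j) : ∃ w ∈ W, G.Adj x w := by
  obtain ⟨i, hi, hdi⟩ := h.exists_left
  exact ⟨i, hi, hx.full i hi hdi⟩

lemma Crossing.onSide_a (h : Crossing G W a d j) (hG : Atom G) : OnSide G W a d a :=
  ⟨h.ha, fun _ hi hdi => h.adj_a hG hi hdi, by
    obtain ⟨k, hk, hak⟩ := h.swap.exists_left
    exact ⟨k, hk, hak, hak⟩⟩

lemma OnSide.adj_a (hx : OnSide G W a d x) (h : Crossing G W a d j) (hG : Atom G) (hne : x ≠ a) :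
    G.Adj x a := by
  by_contra hno
  obtain ⟨k, hk, hak, hxk⟩ := hx.miss
  obtain ⟨i, hi, hdi⟩ := h.exists_left
  rcases h.max.cover hG hx.notMem h.ha hne hno hi (hx.full i hi hdi) (h.adj_a hG hi hdi) hk with
    h1 | h1 <;> contradiction

lemma OnSide.adj (hx : OnSide G W a d x) (hy : OnSide G W a d y) (h : Crossing G W a d j)
    (hG : Atom G) (hne : x ≠ y) : G.Adj x y := by
  by_cases e1 : x = a
  · subst e1; exact (hy.adj_a h hG hne.symm).symm
  by_cases e2 : y = a
  · subst e2; exact hx.adj_a h hG hne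
  by_contra hno
  have hxa := hx.adj_a h hG e1
  have hya := hy.adj_a h hG e2
  obtain ⟨k, hk, hak, hxk⟩ := hx.miss
  obtain ⟨k', hk', hak', hyk⟩ := hy.miss
  obtain ⟨i, hi, hdi⟩ := h.exists_left
  have hc := fun w hw => h.max.cover hG hx.notMem hy.notMem hne hno hi (hx.full i hi hdi)
    (hy.full i hi hdi) (w' := w) hw
  have h1 := (hc k hk).resolve_left hxk
  have h2 := (hc k' hk').resolve_right hyk
  have h3 : G.Adj k k' := h.max.adj hk hk' adjs
  exact hG.perf.no_five_hole hxa.symm h2 h3.symm h1.symm hya adjs adjs adjs adjs adjs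

/-- Nonadjacent vertices on the two sides which leave a gap at `j`. -/
structure GapPair (G : SimpleGraph V) (W : Set V) (a d j x y : V) : Prop where
  left : OnSide G W a d x
  right : OnSide G W d a y
  nxy : ¬ G.Adj x y
  dis : ∀ w ∈ W, G.Adj x w → ¬ G.Adj y w
  nxj : ¬ G.Adj x j
  nyj : ¬ G.Adj y j

lemma GapPair.swap (g : GapPair G W a d j x y) : GapPair G W d a j y x :=
  ⟨g.right, g.left, fun e => g.nxy e.symm, fun w hw h1 h2 => g.dis w hw h2 h1, g.nyj, g.nxj⟩

lemma GapPair.ne_right (g : GapPair G W a d j x y) (hy : OnSide G W d a y')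
    (h : Crossing G W a d j) : x ≠ y' := by
  rintro rfl
  obtain ⟨k, hk, hak⟩ := h.swap.exists_left
  exact g.dis k hk (hy.full k hk hak) (g.right.full k hk hak)

lemma GapPair.not_adj (g : GapPair G W a d j x y) (h : Crossing G W a d j) (hG : Atom G)
    (hy : OnSide G W d a y') : ¬ G.Adj x y' := by
  have key : ∀ y', OnSide G W d a y' → G.Adj y' j → ¬ G.Adj x y' := by
    intro y' hy hyj hxy
    have hne : y' ≠ y := by rintro rfl; exact g.nyj hyj
    exact hG.no_claw hyj hxy.symm (hy.adj g.right h.swap hG hne) (fun e => g.left.notMem (e ▸ h.hj))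
      (fun e => g.right.notMem (e ▸ h.hj)) (g.ne_right g.right h) (fun e => g.nxj e.symm)
      (fun e => g.nyj e.symm) g.nxy
  intro hxy
  have hyj : ¬ G.Adj y' j := fun e => key y' hy e hxy
  have hxd : ¬ G.Adj x d := key d (h.swap.onSide_a hG) h.dj
  obtain ⟨i, hi, hdi, hyi⟩ := hy.miss
  have dj := h.dj
  have hij : G.Adj i j := h.max.adj hi h.hj adjs
  have hyd : G.Adj y' d := hy.adj_a h.swap hG (by rintro rfl; exact hyj h.dj)
  exact hG.perf.no_five_hole (g.left.full i hi hdi) hij dj.symm hyd.symm hxy.symm g.nxj hxd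
    adjs adjs adjs

/-- The left vertex of the pair can be moved to a neighbour of a far component. -/
lemma GapPair.move_left (g : GapPair G W a d j x y) (h : Crossing G W a d j) (hG : Atom G)
    (hZ : FarComp G W Z) (hu : OnSide G W a d x') (huZ : ∃ z ∈ Z, G.Adj x' z) :
    ∃ x', GapPair G W a d j x' y ∧ ∃ z ∈ Z, G.Adj x' z := by
  by_cases hsub : ∀ w ∈ W, G.Adj x' w → G.Adj x w
  · exact ⟨x', ⟨hu, g.right, fun e => g.swap.not_adj h.swap hG hu e.symm,
      fun w hw h1 => g.dis w hw (hsub w hw h1), fun e => g.nxj (hsub j h.hj e), g.nyj⟩, huZ⟩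
  · push Not at hsub
    obtain ⟨w, hw, h1, h2⟩ := hsub
    obtain ⟨z, hz, hxz⟩ := huZ
    have hne : x ≠ z := by
      rintro rfl
      obtain ⟨i, hi, hxi⟩ := g.left.near h
      exact (hZ.far x hz).2 i hi hxi.symm
    exact ⟨x, g, z, hz, hZ.pull hG hz hxz (hu.adj g.left h hG adjs) g.left.notMem hw h1 h2 hne⟩

lemma GapPair.not_far_nbrs (g : GapPair G W a d j x y) (h : Crossing G W a d j) (hG : Atom G)
    (hZ : FarComp G W Z) (hx : ∃ z ∈ Z, G.Adj x z) (hy : ∃ z ∈ Z, G.Adj y z) : False := by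
  obtain ⟨i, hi, hdi⟩ := h.exists_left
  obtain ⟨k, hk, hak⟩ := h.swap.exists_left
  have hxi := g.left.full i hi hdi
  have hyk := g.right.full k hk hak
  have hyi := g.dis i hi hxi
  have hxk : ¬ G.Adj x k := fun e => g.dis k hk e hyk
  have hfar : ∀ w ∈ W, ∀ z ∈ Z, ¬ G.Adj w z := fun w hw z hz => (hZ.far z hz).2 w hw
  have hik : G.Adj i k := h.max.adj hi hk adjs
  have nxj := g.nxj
  have nyj := g.nyj
  have aj := h.aj
  have dj := h.dj
  obtain ⟨r, -, h2, h3⟩ := hZ.parity_short hG.perf hx hy g.nxy (g.ne_right g.right h)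
  have e2 := h2 i k hxi hik hyk.symm hxk adjs (hfar i hi) (hfar k hk)
  have e3 : ¬ Even (r + 3) := Nat.even_add_one.not.mpr (not_not.mpr e2)
  have hij : G.Adj i j := h.max.adj hi h.hj adjs
  have hkj : G.Adj k j := h.max.adj hk h.hj adjs
  by_cases haZ : ∃ z ∈ Z, G.Adj a z
  · have hdZ : ∀ z ∈ Z, ¬ G.Adj d z := fun z hz hdz =>
      h.max.disjoint hG hZ h.ha h.hd h.ne h.nad haZ ⟨z, hz, hdz⟩ h.hj h.aj h.dj
    have hyd : G.Adj y d := g.right.adj_a h.swap hG adjs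
    have hxd : ¬ G.Adj x d := g.not_adj h hG (h.swap.onSide_a hG)
    exact e3 (h3 i j d hxi hij dj.symm hyd.symm nxj hxd adjs adjs adjs (hfar i hi) (hfar j h.hj) hdZ)
  · push Not at haZ
    have hxa : G.Adj x a := g.left.adj_a h hG adjs
    have hya : ¬ G.Adj y a := g.swap.not_adj h.swap hG (h.onSide_a hG)
    exact e3 (h3 a j k hxa aj hkj.symm hyk.symm nxj hxk hak adjs adjs haZ (hfar j h.hj) (hfar k hk))

lemma Crossing.onSide_or (hsun : ∀ w s, ¬ Sun G w s) (hS : ¬ NoStableTriple G)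
    (h : Crossing G W a d j) (hG : Atom G) (hx : x ∉ W) (hn : ∃ w ∈ W, G.Adj x w) :
    OnSide G W a d x ∨ OnSide G W d a x ∨
      (∀ i ∈ W, ¬ G.Adj d i → G.Adj x i) ∧ ∀ k ∈ W, ¬ G.Adj a k → G.Adj x k := by
  by_cases h1 : ∀ i ∈ W, ¬ G.Adj d i → G.Adj x i
  · by_cases h2 : ∀ k ∈ W, ¬ G.Adj a k → G.Adj x k
    · exact Or.inr (Or.inr ⟨h1, h2⟩)
    · push Not at h2
      exact Or.inl ⟨hx, h1, h2⟩
  · have h2 := (h.side hsun hS hG hx hn).resolve_left h1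
    push Not at h1
    exact Or.inr (Or.inl ⟨hx, h2, h1⟩)

/-- With a gap pair there are no far vertices. -/
lemma GapPair.near (hsun : ∀ w s, ¬ Sun G w s) (hS : ¬ NoStableTriple G)
    (g : GapPair G W a d j x y) (h : Crossing G W a d j) (hG : Atom G) (hx : x' ∉ W) :
    ∃ w ∈ W, G.Adj x' w := by
  refine exists_adj_of_not_far (fun hfar => ?_) hx
  obtain ⟨Z, hZ, -⟩ := exists_farComp hfar
  obtain ⟨u, v, huv, hn, hfu, hfv, huW, hvW, huZ, hvZ⟩ := hZ.exists_nonadj hG ⟨j, h.hj⟩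
  have hdis := fun w hw h1 h2 => h.max.disjoint hG hZ huW hvW huv hn huZ hvZ (w := w) hw h1 h2
  obtain ⟨i, hi, hdi⟩ := h.exists_left
  obtain ⟨k, hk, hak⟩ := h.swap.exists_left
  have key : ∀ u v, OnSide G W a d u → OnSide G W d a v → (∃ z ∈ Z, G.Adj u z) →
      (∃ z ∈ Z, G.Adj v z) → False := by
    intro u v hu hv huZ hvZ
    obtain ⟨x₁, g₁, hx₁⟩ := g.move_left h hG hZ hu huZ
    obtain ⟨y₁, g₂, hy₁⟩ := g₁.swap.move_left h.swap hG hZ hv hvZ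
    exact g₂.swap.not_far_nbrs h hG hZ hx₁ hy₁
  rcases h.onSide_or hsun hS hG huW (exists_adj_of_not_far hfu huW) with hu | hu | hu <;>
    rcases h.onSide_or hsun hS hG hvW (exists_adj_of_not_far hfv hvW) with hv | hv | hv
  · exact hn (hu.adj hv h hG huv)
  · exact key u v hu hv huZ hvZ
  · exact hdis i hi (hu.full i hi hdi) (hv.1 i hi hdi)
  · exact key v u hv hu hvZ huZ
  · exact hn (hu.adj hv h.swap hG huv)
  · exact hdis k hk (hu.full k hk hak) (hv.2 k hk hak)
  · exact hdis i hi (hu.1 i hi hdi) (hv.full i hi hdi)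
  · exact hdis k hk (hu.2 k hk hak) (hv.full k hk hak)
  · exact hdis k hk (hu.2 k hk hak) (hv.2 k hk hak)

/-- The left vertex of a gap pair sees more than its side. -/
lemma GapPair.exists_extra (hsun : ∀ w s, ¬ Sun G w s) (hS : ¬ NoStableTriple G)
    (g : GapPair G W a d j x y) (h : Crossing G W a d j) (hG : Atom G) :
    ∃ w ∈ W, G.Adj d w ∧ G.Adj x w := by
  by_contra hno
  push Not at hno
  have hnot : ∀ w ∈ W, G.Adj x w → ¬ G.Adj d w := fun w hw h1 h2 => hno w hw h2 h1
  obtain ⟨u, v, hxu, hxv, huv, hn⟩ := hG.exists_nonadj_nbrs hS x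
  obtain ⟨i, hi, hdi⟩ := h.exists_left
  obtain ⟨k₀, hk₀, hak₀⟩ := h.swap.exists_left
  have hnbr : ∀ u, G.Adj x u → (u ∈ W ∧ ¬ G.Adj d u) ∨ OnSide G W a d u ∨
      (u ∉ W ∧ (∀ i ∈ W, ¬ G.Adj d i → G.Adj u i) ∧ ∀ k ∈ W, ¬ G.Adj a k → G.Adj u k) := by
    intro u hxu
    by_cases huW : u ∈ W
    · exact Or.inl ⟨huW, hnot u huW hxu⟩
    · rcases h.onSide_or hsun hS hG huW (g.near hsun hS h hG huW) with hu | hu | hu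
      · exact Or.inr (Or.inl hu)
      · exact absurd hxu (g.not_adj h hG hu)
      · exact Or.inr (Or.inr ⟨huW, hu⟩)
  have hXN : ∀ u n, G.Adj x u → G.Adj x n → OnSide G W a d u → n ∉ W →
      (∀ i ∈ W, ¬ G.Adj d i → G.Adj n i) → (∀ k ∈ W, ¬ G.Adj a k → G.Adj n k) → u ≠ n →
      G.Adj u n := by
    intro u n hxu hxn hu hnW hn1 hn2 hne
    by_contra hno
    obtain ⟨k, hk, hak, huk⟩ := hu.miss
    obtain ⟨w, hw, hnw⟩ := h.max.max n hnW
    have huw := (h.max.cover hG hu.notMem hnW hne hno hi (hu.full i hi hdi) (hn1 i hi hdi) hw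
      ).resolve_right hnw
    have hdw : G.Adj d w := by by_contra hc; exact hnw (hn1 w hw hc)
    have hxw : ¬ G.Adj x w := fun e => hnot w hw e hdw
    have hxk : ¬ G.Adj x k := fun e => hnot k hk e (h.adj_d hG hk hak)
    have hnk := hn2 k hk hak
    have hwk : G.Adj w k := h.max.adj hw hk adjs
    exact hG.perf.no_five_hole hxu huw hwk hnk.symm hxn.symm hxw hxk huk hno adjs
  rcases hnbr u hxu with hu | hu | ⟨hu1, hu2, hu3⟩ <;>
    rcases hnbr v hxv with hv | hv | ⟨hv1, hv2, hv3⟩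
  · exact hn (h.max.adj hu.1 hv.1 huv)
  · exact hn (hv.full u hu.1 hu.2).symm
  · exact hn (hv2 u hu.1 hu.2).symm
  · exact hn (hu.full v hv.1 hv.2)
  · exact hn (hu.adj hv h hG huv)
  · exact hn (hXN u v hxu hxv hu hv1 hv2 hv3 huv)
  · exact hn (hu2 v hv.1 hv.2)
  · exact hn (hXN v u hxv hxu hv hu1 hu2 hu3 huv.symm).symm
  · obtain ⟨w, hw, huw⟩ := h.max.max u hu1
    obtain ⟨w', hw', hvw⟩ := h.max.max v hv1
    have hc := fun w hw => h.max.cover hG hu1 hv1 huv hn hi (hu2 i hi hdi) (hv2 i hi hdi) (w' := w) hw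
    have h1 := (hc w hw).resolve_left huw
    have h2 := (hc w' hw').resolve_right hvw
    have hdw : G.Adj d w := by by_contra hc; exact huw (hu2 w hw hc)
    have hdw' : G.Adj d w' := by by_contra hc; exact hvw (hv2 w' hw' hc)
    have hxw : ¬ G.Adj x w := fun e => hnot w hw e hdw
    have hxw' : ¬ G.Adj x w' := fun e => hnot w' hw' e hdw'
    have hww : G.Adj w' w := h.max.adj hw' hw adjs
    exact hG.perf.no_five_hole hxu h2 hww h1.symm hxv.symm hxw' hxw huw hn adjs

lemma GapPair.false (hsun : ∀ w s, ¬ Sun G w s) (hS : ¬ NoStableTriple G)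
    (g : GapPair G W a d j x y) (h : Crossing G W a d j) (hG : Atom G) : False := by
  obtain ⟨u, hu, hdu, hxu⟩ := g.exists_extra hsun hS h hG
  obtain ⟨v, hv, hav, hyv⟩ := g.swap.exists_extra hsun hS h.swap hG
  obtain ⟨i, hi, hdi⟩ := h.exists_left
  obtain ⟨k, hk, hak⟩ := h.swap.exists_left
  have hxi := g.left.full i hi hdi
  have hyk := g.right.full k hk hak
  have hyi := g.dis i hi hxi
  have hyu := g.dis u hu hxu
  have hxk : ¬ G.Adj x k := fun e => g.dis k hk e hyk
  have hxv : ¬ G.Adj x v := fun e => g.dis v hv e hyv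
  have nxj := g.nxj
  have nyj := g.nyj
  have hj := h.hj
  have hcl : ∀ u ∈ W, ∀ v ∈ W, u ≠ v → G.Adj u v := fun u hu v hv => h.max.adj hu hv
  exact hG.no_five_clique (hcl _ hi _ hk adjs) (hcl _ hi _ hj adjs) (hcl _ hi _ hu adjs)
    (hcl _ hi _ hv adjs) (hcl _ hk _ hj adjs) (hcl _ hk _ hu adjs) (hcl _ hk _ hv adjs)
    (hcl _ hj _ hu adjs) (hcl _ hj _ hv adjs) (hcl _ hu _ hv adjs)

/-- Nonadjacent near vertices see the whole clique between them, whether or not they have a common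
neighbour. -/
lemma Crossing.cover_of_not_adj (hsun : ∀ w s, ¬ Sun G w s) (hS : ¬ NoStableTriple G)
    (h : Crossing G W a d j) (hG : Atom G) (hx : x ∉ W) (hy : y ∉ W)
    (hxn : ∃ w ∈ W, G.Adj x w) (hyn : ∃ w ∈ W, G.Adj y w) (hxy : x ≠ y) (hn : ¬ G.Adj x y)
    (hw : w ∈ W) : G.Adj x w ∨ G.Adj y w := by
  by_contra hno
  push Not at hno
  have hdis : ∀ w ∈ W, G.Adj x w → ¬ G.Adj y w := by
    intro w' hw' h1 h2
    rcases h.max.cover hG hx hy hxy hn hw' h1 h2 hw with h3 | h3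
    · exact hno.1 h3
    · exact hno.2 h3
  obtain ⟨i, hi, hdi⟩ := h.exists_left
  obtain ⟨k, hk, hak⟩ := h.swap.exists_left
  have key : ∀ x y, OnSide G W a d x → OnSide G W d a y → ¬ G.Adj x y →
      (∀ w ∈ W, G.Adj x w → ¬ G.Adj y w) → ¬ G.Adj x w → ¬ G.Adj y w → False := by
    intro x y hx hy hn hdis h1 h2
    have hdw : G.Adj d w := by by_contra hc; exact h1 (hx.full w hw hc)
    have haw : G.Adj a w := by by_contra hc; exact h2 (hy.full w hw hc)
    exact GapPair.false hsun hS (j := w) ⟨hx, hy, hn, hdis, h1, h2⟩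
      ⟨h.max, h.ha, h.hd, h.ne, h.nad, hw, haw, hdw⟩ hG
  rcases h.onSide_or hsun hS hG hx hxn with h1 | h1 | h1 <;>
    rcases h.onSide_or hsun hS hG hy hyn with h2 | h2 | h2
  · exact hdis i hi (h1.full i hi hdi) (h2.full i hi hdi)
  · exact key x y h1 h2 hn hdis hno.1 hno.2
  · exact hdis i hi (h1.full i hi hdi) (h2.1 i hi hdi)
  · exact key y x h2 h1 (fun e => hn e.symm) (fun w hw h1 h2 => hdis w hw h2 h1) hno.2 hno.1
  · exact hdis k hk (h1.full k hk hak) (h2.full k hk hak)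
  · exact hdis k hk (h1.full k hk hak) (h2.2 k hk hak)
  · exact hdis i hi (h1.1 i hi hdi) (h2.full i hi hdi)
  · exact hdis k hk (h1.2 k hk hak) (h2.full k hk hak)
  · exact hdis k hk (h1.2 k hk hak) (h2.2 k hk hak)

/-- The closed neighbourhood of the clique has no stable triple. -/
lemma Crossing.no_stable_triple (hsun : ∀ w s, ¬ Sun G w s) (hS : ¬ NoStableTriple G)
    (h : Crossing G W a d j) (hG : Atom G) {z : V} (hx : ¬ Far G W x) (hy : ¬ Far G W y)
    (hz : ¬ Far G W z) (hxy : x ≠ y) (hxz : x ≠ z) (hyz : y ≠ z) (nxy : ¬ G.Adj x y)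
    (nxz : ¬ G.Adj x z) (nyz : ¬ G.Adj y z) : False := by
  have key : ∀ x y z, ¬ Far G W x → ¬ Far G W y → x ≠ y → x ≠ z → y ≠ z → ¬ G.Adj x y →
      ¬ G.Adj x z → ¬ G.Adj y z → z ∉ W := by
    intro x y z hx hy hxy hxz hyz nxy nxz nyz hzW
    have hxW : x ∉ W := fun e => nxz (h.max.adj e hzW hxz)
    have hyW : y ∉ W := fun e => nyz (h.max.adj e hzW hyz)
    rcases h.cover_of_not_adj hsun hS hG hxW hyW (exists_adj_of_not_far hx hxW)
      (exists_adj_of_not_far hy hyW) hxy nxy hzW with h1 | h1 <;> contradiction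
  have hzW := key x y z hx hy hxy hxz hyz nxy nxz nyz
  have hyW := key x z y hx hz hxz hxy hyz.symm nxz nxy (fun e => nyz e.symm)
  have hxW := key y z x hy hz hyz hxy.symm hxz.symm nyz (fun e => nxy e.symm) (fun e => nxz e.symm)
  have hc := fun {u v : V} (hu : ¬ Far G W u) (hv : ¬ Far G W v) (huW : u ∉ W) (hvW : v ∉ W) huv hn w
    (hw : w ∈ W) => h.cover_of_not_adj hsun hS hG huW hvW (exists_adj_of_not_far hu huW)
      (exists_adj_of_not_far hv hvW) huv hn hw
  obtain ⟨u, hu, hxu⟩ := h.max.max x hxW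
  obtain ⟨v, hv, hyv⟩ := h.max.max y hyW
  obtain ⟨w, hw, hzw⟩ := h.max.max z hzW
  have h1 := (hc hx hy hxW hyW hxy nxy u hu).resolve_left hxu
  have h2 := (hc hx hz hxW hzW hxz nxz u hu).resolve_left hxu
  have h3 := (hc hx hy hxW hyW hxy nxy v hv).resolve_right hyv
  have h4 := (hc hy hz hyW hzW hyz nyz v hv).resolve_left hyv
  have h5 := (hc hx hz hxW hzW hxz nxz w hw).resolve_right hzw
  have h6 := (hc hy hz hyW hzW hyz nyz w hw).resolve_right hzw
  exact hsun _ _ (sun_of_vertices (h.max.adj hu hv adjs) (h.max.adj hu hw adjs)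
    (h.max.adj hv hw adjs) nxy nxz nyz h3 h5 h1 h6 h2 h4 hxu hyv hzw)

end crossing

/-! ### Splitting the neighbourhood of a maximal clique into two cliques -/

/-- The closed neighbourhood of a maximal clique `W` is split by `f` into two cliques. -/
structure NearSplit (G : SimpleGraph V) (W : Set V) (f : V → Bool) : Prop where
  max : MaxClique G W
  nonempty : W.Nonempty
  sep : ∀ u v, ¬ Far G W u → ¬ Far G W v → u ≠ v → ¬ G.Adj u v → f u ≠ f v

/-- The vertices on one side without neighbours far from `W`. -/
def innerSide (G : SimpleGraph V) (W : Set V) (f : V → Bool) (b : Bool) : Set V :=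
  {v | ¬ Far G W v ∧ f v = b ∧ ∀ z, Far G W z → ¬ G.Adj v z}

/-- The vertices on one side with a neighbour far from `W`. -/
def outerSide (G : SimpleGraph V) (W : Set V) (f : V → Bool) (b : Bool) : Set V :=
  {v | ¬ Far G W v ∧ f v = b ∧ ∃ z, Far G W z ∧ G.Adj v z}

section nearSplit
variable {G : SimpleGraph V} {W Z : Set V} {f : V → Bool} {b : Bool} {u v w k x y : V}

lemma not_far_of_mem (hw : w ∈ W) : ¬ Far G W w := fun h => h.1 hw

lemma NearSplit.adj (h : NearSplit G W f) (hu : ¬ Far G W u) (hv : ¬ Far G W v) (huv : u ≠ v)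
    (hf : f u = f v) : G.Adj u v := by
  by_contra hno
  exact h.sep u v hu hv huv hno hf

lemma mem_innerSide_of_mem (hw : w ∈ W) : w ∈ innerSide G W f (f w) :=
  ⟨not_far_of_mem hw, rfl, fun _ hz => hz.2 w hw⟩

lemma outerSide_notMem (hk : k ∈ outerSide G W f b) : k ∉ W := fun hkW => by
  obtain ⟨-, -, z, hz, hkz⟩ := hk
  exact hz.2 k hkW hkz

lemma NearSplit.exists_pair (h : NearSplit G W f) (hG : Atom G) (hZ : FarComp G W Z) (b : Bool) :
    ∃ u v, ¬ Far G W u ∧ ¬ Far G W v ∧ u ∉ W ∧ v ∉ W ∧ ¬ G.Adj u v ∧ f u = b ∧ f v = !b ∧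
      (∃ z ∈ Z, G.Adj u z) ∧ (∃ z ∈ Z, G.Adj v z) ∧ (∀ w ∈ W, G.Adj u w ↔ f w = b) ∧
      ∀ w ∈ W, G.Adj v w ↔ f w = !b := by
  obtain ⟨u, v, huv, hn, hfu, hfv, huW, hvW, huZ, hvZ⟩ := hZ.exists_nonadj hG h.nonempty
  have key : ∀ u v, u ≠ v → ¬ G.Adj u v → ¬ Far G W u → ¬ Far G W v → u ∉ W → v ∉ W →
      (∃ z ∈ Z, G.Adj u z) → (∃ z ∈ Z, G.Adj v z) → ∀ w ∈ W, G.Adj u w ↔ f w = f u := by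
    intro u v huv hn hfu hfv huW hvW huZ hvZ w hw
    constructor
    · intro huw
      by_contra hne
      have hwv : G.Adj v w := (h.adj (not_far_of_mem hw) hfv (fun e => hvW (e ▸ hw)) (by
        have := h.sep u v hfu hfv huv hn
        revert hne this
        cases f w <;> cases f u <;> cases f v <;> simp)).symm
      exact h.max.disjoint hG hZ huW hvW huv hn huZ hvZ hw huw hwv
    · intro e
      exact h.adj hfu (not_far_of_mem hw) (fun e' => huW (e' ▸ hw)) e.symm
  have hsep := h.sep u v hfu hfv huv hn
  have k1 := key u v huv hn hfu hfv huW hvW huZ hvZ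
  have k2 := key v u huv.symm (fun e => hn e.symm) hfv hfu hvW huW hvZ huZ
  by_cases hb : f u = b
  · have hvb : f v = !b := by revert hb hsep; cases f u <;> cases f v <;> cases b <;> simp
    exact ⟨u, v, hfu, hfv, huW, hvW, hn, hb, hvb, huZ, hvZ, hb ▸ k1, hvb ▸ k2⟩
  · have hub : f u = !b := by revert hb; cases f u <;> cases b <;> simp
    have hvb : f v = b := by revert hb hsep; cases f u <;> cases f v <;> cases b <;> simp
    exact ⟨v, u, hfv, hfu, hvW, huW, fun e => hn e.symm, hvb, hub, hvZ, huZ, hvb ▸ k2, hub ▸ k1⟩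

lemma exists_mem_side (hn : ¬ Far G W u) (huW : u ∉ W) (h : ∀ w ∈ W, G.Adj u w ↔ f w = b) :
    ∃ w ∈ W, f w = b := by
  obtain ⟨w, hw, huw⟩ := exists_adj_of_not_far hn huW
  exact ⟨w, hw, (h w hw).1 huw⟩

/-- An outer vertex has no inner neighbour on the other side. -/
lemma NearSplit.not_adj (h : NearSplit G W f) (hG : Atom G) (hk : k ∈ outerSide G W f b)
    (hy : y ∈ innerSide G W f (!b)) : ¬ G.Adj k y := by
  classical
  intro hky
  have hkW := outerSide_notMem hk
  obtain ⟨hkn, hkb, z, hz, hkz⟩ := hk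
  obtain ⟨hyn, hyb, hyf⟩ := hy
  obtain ⟨Z, hZ, hzZ⟩ := exists_farComp hz
  obtain ⟨u, v, hun, hvn, huW, hvW, huv, hub, hvb, huZ, hvZ, huw, hvw⟩ := h.exists_pair hG hZ b
  obtain ⟨x, hxW, hxb⟩ := exists_mem_side hun huW huw
  obtain ⟨m, hmW, hmb⟩ := exists_mem_side hvn hvW hvw
  have hbb : ∀ b : Bool, b ≠ !b := by decide
  have hkv' : k ≠ v := by rintro rfl; exact hbb b (hkb.symm.trans hvb)
  have hyv : y ≠ v := by
    rintro rfl
    obtain ⟨z, hz, hyz⟩ := hvZ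
    exact hyf z (hZ.far z hz) hyz
  have hnotZ : ∀ w ∈ W, ∀ z ∈ Z, ¬ G.Adj w z := fun w hw z hz => (hZ.far z hz).2 w hw
  have hkx : G.Adj k x := h.adj hkn (not_far_of_mem hxW) (fun e => hkW (e ▸ hxW)) (hkb.trans hxb.symm)
  have hvm : G.Adj v m := (hvw m hmW).2 hmb
  have hvx : ¬ G.Adj v x := fun e => hbb b (hxb.symm.trans ((hvw x hxW).1 e))
  have hkv : G.Adj k v := by
    by_contra hno
    obtain ⟨r, h1, h2, -⟩ := hZ.parity_short hG.perf ⟨z, hzZ, hkz⟩ hvZ hno hkv'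
    have hkm : ¬ G.Adj k m := fun e =>
      h.max.disjoint hG hZ hkW hvW hkv' hno ⟨z, hzZ, hkz⟩ hvZ hmW e hvm
    have e1 := h1 y hky (h.adj hyn hvn hyv (hyb.trans hvb.symm)) fun z hz => hyf z (hZ.far z hz)
    have e2 := h2 x m hkx (h.max.adj hxW hmW adjs) hvm.symm hkm adjs (hnotZ x hxW) (hnotZ m hmW)
    exact Nat.even_add_one.mp e2 e1
  have hyz : ¬ G.Adj y z := hyf z hz
  have hyx' : ∀ x ∈ W, f x = b → G.Adj y x := by
    intro x hxW hxb
    by_contra hno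
    have hkx : G.Adj k x :=
      h.adj hkn (not_far_of_mem hxW) (fun e => hkW (e ▸ hxW)) (hkb.trans hxb.symm)
    exact hG.no_claw hkz hky hkx (by rintro rfl; exact hyn hz) (fun e => hz.1 (e ▸ hxW))
      (by rintro rfl; exact hbb b (hxb.symm.trans hyb)) (fun e => hyz e.symm)
      (fun e => hz.2 x hxW e.symm) hno
  have hyW : y ∈ W := by
    by_contra hyW
    obtain ⟨w, hw, hyw⟩ := h.max.max y hyW
    by_cases hwb : f w = b
    · exact hyw (hyx' w hw hwb)
    · have : f w = !b := by revert hwb; cases f w <;> cases b <;> simp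
      exact hyw (h.adj hyn (not_far_of_mem hw) (fun e => hyW (e ▸ hw)) (hyb.trans this.symm))
  have huy : ¬ G.Adj u y := fun e => hbb b (((huw y hyW).1 e).symm.trans hyb)
  have hku' : k ≠ u := by rintro rfl; exact huv hkv
  have hku : G.Adj k u := h.adj hkn hun hku' (hkb.trans hub.symm)
  have hzx : ¬ G.Adj z x := fun e => hz.2 x hxW e.symm
  have hS : ∀ w ∈ ({z, x, v, u, y} : Finset V), G.Adj k w := by
    intro w hw
    simp only [Finset.mem_insert, Finset.mem_singleton] at hw
    rcases hw with rfl | rfl | rfl | rfl | rfl <;> assumption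
  obtain ⟨g, hg⟩ := hG.perf.exists_cobipartition {z, x, v, u, y}
    (fun p hp q hq r hr hpq hpr hqr n1 n2 n3 =>
      hG.no_claw (hS p hp) (hS q hq) (hS r hr) hpq hpr hqr n1 n2 n3)
  have e1 := hg z (by simp) x (by simp) (fun e => hz.1 (e ▸ hxW)) hzx
  have e2 := hg x (by simp) v (by simp) (fun e => hvW (e ▸ hxW)) (fun e => hvx e.symm)
  have e3 := hg v (by simp) u (by simp) (by rintro rfl; exact hbb b (hub.symm.trans hvb))
    (fun e => huv e.symm)
  have e4 := hg u (by simp) y (by simp) (fun e => huW (e ▸ hyW)) huy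
  have e5 := hg y (by simp) z (by simp) (fun e => hz.1 (e ▸ hyW)) hyz
  revert e1 e2 e3 e4 e5
  cases g z <;> cases g x <;> cases g v <;> cases g u <;> cases g y <;> simp

/-- Vertices near `W` are inner or outer. -/
lemma mem_inner_or_outer (hv : ¬ Far G W v) :
    v ∈ innerSide G W f (f v) ∨ v ∈ outerSide G W f (f v) := by
  by_cases h : ∃ z, Far G W z ∧ G.Adj v z
  · exact Or.inr ⟨hv, rfl, h⟩
  · push Not at h
    exact Or.inl ⟨hv, rfl, h⟩

/-- Two cliques, homogeneous to the rest of the graph, which are disjoint from the clique `R` or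
lie in it. -/
structure IsGadget (G : SimpleGraph V) (R : Set V) (P : Bool → Set V) : Prop where
  disj : ∀ v, v ∈ P true → v ∉ P false
  clique : ∀ b, G.IsClique (P b)
  nc : ∃ x ∈ P true, ∃ y ∈ P false, ¬ G.Adj x y
  hom : ∀ b v, v ∉ P true → v ∉ P false → ∀ x ∈ P b, G.Adj v x → ∀ x' ∈ P b, G.Adj v x'
  nbr : ∀ b u v, u ∉ P true → u ∉ P false → v ∉ P true → v ∉ P false → u ≠ v → ∀ x ∈ P b,
    G.Adj u x → G.Adj v x → G.Adj u v
  attach : ∀ b, (∀ x ∈ P b, x ∉ R) ∨ (∀ x ∈ P b, x ∈ R) ∧ ∀ u, u ∉ P true → u ∉ P false →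
    ∀ x ∈ P b, G.Adj u x → u ∈ R

/-- A neighbour of an inner side, not itself inner, is on the same side. -/
lemma NearSplit.side_of_adj (h : NearSplit G W f) (hG : Atom G) {D : Set V}
    (hD : ∀ b, ∀ r ∈ innerSide G W f b, r ∈ D → ∀ y ∈ innerSide G W f (!b), y ∉ D → ¬ G.Adj r y)
    (hx : x ∈ innerSide G W f b \ D) (hv : ∀ c, v ∉ innerSide G W f c \ D) (hvx : G.Adj v x) :
    ¬ Far G W v ∧ f v = b := by
  have hvn : ¬ Far G W v := fun hv => hx.1.2.2 v hv hvx.symm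
  refine ⟨hvn, ?_⟩
  by_contra hne
  have hb : b = !f v := by revert hne; cases f v <;> cases b <;> simp
  rcases mem_inner_or_outer (f := f) hvn with h1 | h1
  · have hvD : v ∈ D := by by_contra hc; exact hv _ ⟨h1, hc⟩
    exact hD _ v h1 hvD x (hb ▸ hx.1) hx.2 hvx
  · exact h.not_adj hG h1 (hb ▸ hx.1) hvx

lemma NearSplit.isGadget (h : NearSplit G W f) (hG : Atom G) {a d j : V} (hc : Crossing G W a d j)
    (hb : ∀ b, ∃ w ∈ W, f w = b) {D R : Set V}
    (hD : ∀ b, ∀ r ∈ innerSide G W f b, r ∈ D → ∀ y ∈ innerSide G W f (!b), y ∉ D → ¬ G.Adj r y)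
    (hWD : ∃ w ∈ W, w ∉ D)
    (hR : ∀ b, (∀ x ∈ innerSide G W f b \ D, x ∉ R) ∨ (∀ x ∈ innerSide G W f b \ D, x ∈ R) ∧
      ∀ u, u ∉ innerSide G W f true \ D → u ∉ innerSide G W f false \ D →
        ∀ x ∈ innerSide G W f b \ D, G.Adj u x → u ∈ R) :
    IsGadget G R fun b => innerSide G W f b \ D := by
  have hside : ∀ {b x v}, x ∈ innerSide G W f b \ D → (∀ c, v ∉ innerSide G W f c \ D) →
      G.Adj v x → ¬ Far G W v ∧ f v = b := fun hx hv hvx => h.side_of_adj hG hD hx hv hvx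
  have hall : ∀ {v}, v ∉ innerSide G W f true \ D → v ∉ innerSide G W f false \ D →
      ∀ c, v ∉ innerSide G W f c \ D := by
    rintro v h1 h2 (_ | _) <;> assumption
  refine ⟨?_, ?_, ?_, ?_, ?_, hR⟩
  · intro v h1 h2
    exact absurd (h1.1.2.1.symm.trans h2.1.2.1) (by decide)
  · intro b x hx y hy hxy
    exact h.adj hx.1.1 hy.1.1 hxy (hx.1.2.1.trans hy.1.2.1.symm)
  · by_contra hno
    push Not at hno
    have hWD' : ∀ w ∈ W, w ∉ D := by
      intro r hr hrD
      obtain ⟨w, hw, hwD⟩ := hWD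
      have h1 : ∀ r ∈ W, r ∈ D → ∀ w ∈ W, f w = !f r → w ∈ D := by
        intro r hr hrD w hw hwr
        by_contra hwD
        exact hD _ r (mem_innerSide_of_mem hr) hrD w (hwr ▸ mem_innerSide_of_mem hw) hwD
          (h.max.adj hr hw fun e => hwD (e ▸ hrD))
      obtain ⟨w', hw', hwr'⟩ := hb (!f r)
      have hw'D := h1 r hr hrD w' hw' hwr'
      by_cases e : f w = f r
      · exact hwD (h1 w' hw' hw'D w hw (by rw [hwr', e, Bool.not_not]))
      · exact hwD (h1 r hr hrD w hw (by revert e; cases f w <;> cases f r <;> simp))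
    have hmem : ∀ b, ∀ x ∈ innerSide G W f b \ D, x ∈ W := by
      intro b x hx
      by_contra hxW
      obtain ⟨w, hw, hxw⟩ := h.max.max x hxW
      have hwP : w ∈ innerSide G W f (f w) \ D := ⟨mem_innerSide_of_mem hw, hWD' w hw⟩
      by_cases e : f w = b
      · exact hxw (h.adj hx.1.1 (not_far_of_mem hw) (fun e => hxW (e ▸ hw)) (hx.1.2.1.trans e.symm))
      · cases b
        · exact hxw (hno w ((by simpa using e : f w = true) ▸ hwP) x hx).symm
        · exact hxw (hno x hx w ((by simpa using e : f w = false) ▸ hwP))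
    have hjP : j ∈ innerSide G W f (f j) \ D := ⟨mem_innerSide_of_mem hc.hj, hWD' j hc.hj⟩
    obtain ⟨ha, ea⟩ := hside hjP (fun c e => hc.ha (hmem c a e)) hc.aj
    obtain ⟨hd, ed⟩ := hside hjP (fun c e => hc.hd (hmem c d e)) hc.dj
    exact h.sep a d ha hd hc.ne hc.nad (ea.trans ed.symm)
  · intro b v h1 h2 x hx hvx x' hx'
    obtain ⟨hv, e⟩ := hside hx (hall h1 h2) hvx
    exact h.adj hv hx'.1.1 (fun e' => hall h1 h2 b (e' ▸ hx')) (e.trans hx'.1.2.1.symm)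
  · intro b u v h1 h2 h3 h4 huv x hx hux hvx
    obtain ⟨hu, e⟩ := hside hx (hall h1 h2) hux
    obtain ⟨hv, e'⟩ := hside hx (hall h3 h4) hvx
    exact h.adj hu hv huv (e.trans e'.symm)

end nearSplit

/-- A crossing gives a gadget. -/
lemma Crossing.exists_isGadget {G : SimpleGraph V} [Finite V] {W R : Set V} {a d j : V}
    (hsun : ∀ w s, ¬ Sun G w s) (hS : ¬ NoStableTriple G) (hc : Crossing G W a d j) (hG : Atom G)
    (hR : G.IsClique R)
    (hRN : ∀ r ∈ R, ∀ x y, G.Adj r x → G.Adj r y → x ∉ R → y ∉ R → x ≠ y → G.Adj x y) :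
    ∃ P, IsGadget G R P := by
  classical
  have := Fintype.ofFinite V
  obtain ⟨f, hf⟩ := hG.perf.exists_cobipartition (Finset.univ.filter fun v => ¬ Far G W v) (by
    intro x hx y hy z hz
    simp only [Finset.mem_filter, Finset.mem_univ, true_and] at hx hy hz
    exact hc.no_stable_triple hsun hS hG hx hy hz)
  have h : NearSplit G W f := ⟨hc.max, ⟨j, hc.hj⟩, fun u v hu hv =>
    hf u (by simpa using hu) v (by simpa using hv)⟩
  have hfar : ∃ z, Far G W z := by
    by_contra hno
    push Not at hno
    exact hS fun x y z => hc.no_stable_triple hsun hS hG (hno x) (hno y) (hno z)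
  obtain ⟨o, ho⟩ := hfar
  obtain ⟨Z, hZ, -⟩ := exists_farComp ho
  have hb : ∀ b, (∃ w ∈ W, f w = b) ∧ ∃ k, k ∈ outerSide G W f b := by
    intro b
    obtain ⟨u, v, hun, -, huW, -, -, hub, -, ⟨z, hz, huz⟩, -, huw, -⟩ := h.exists_pair hG hZ b
    exact ⟨exists_mem_side hun huW huw, u, hun, hub, z, hZ.far z hz, huz⟩
  by_cases hα : ∃ b, ∃ r ∈ innerSide G W f b, r ∈ R ∧ ∃ y ∈ innerSide G W f (!b), y ∉ R ∧ G.Adj r y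
  · obtain ⟨b, r, hr, hrR, y, hy, hyR, hry⟩ := hα
    have hK : ∀ k ∈ outerSide G W f b, k ∈ R := by
      intro k hk
      by_contra hkR
      have hrk : G.Adj r k := h.adj hr.1 hk.1 (fun e => hkR (e ▸ hrR)) (hr.2.1.trans hk.2.1.symm)
      exact h.not_adj hG hk hy (hRN r hrR k y hrk hry hkR hyR fun e =>
        absurd (hk.2.1.symm.trans ((congrArg f e).trans hy.2.1)) (by cases b <;> decide))
    obtain ⟨k, hk⟩ := (hb b).2
    have hkR := hK k hk
    obtain ⟨hkn, hkb, z, hz, hkz⟩ := id hk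
    have hzR : z ∉ R := fun e => hr.2.2 z hz (hR hrR e fun e' => hr.1 (e' ▸ hz))
    have hX : ∀ x ∈ innerSide G W f b, x ∈ R := by
      intro x hx
      by_contra hxR
      have hkx : G.Adj k x := h.adj hkn hx.1 (fun e => hxR (e ▸ hkR)) (hkb.trans hx.2.1.symm)
      exact hx.2.2 z hz (hRN k hkR x z hkx hkz hxR hzR fun e => hx.1 (e ▸ hz))
    have hY : ∀ y ∈ innerSide G W f (!b), y ∉ R := fun y hy hyR =>
      h.not_adj hG hk hy (hR hkR hyR fun e =>
        absurd (hkb.symm.trans ((congrArg f e).trans hy.2.1)) (by cases b <;> decide))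
    have hD : ∀ b, ∀ r ∈ innerSide G W f b, r ∈ (∅ : Set V) → ∀ y ∈ innerSide G W f (!b),
        y ∉ (∅ : Set V) → ¬ G.Adj r y := fun _ _ _ h => absurd h (Set.notMem_empty _)
    refine ⟨_, h.isGadget hG hc (fun b => (hb b).1) (D := ∅) hD ⟨j, hc.hj, Set.notMem_empty _⟩ ?_⟩
    intro c
    by_cases e : c = b
    · subst e
      refine Or.inr ⟨fun x hx => hX x hx.1, fun u h1 h2 x hx hux => ?_⟩
      have hall : ∀ c, u ∉ innerSide G W f c \ ∅ := by rintro (_ | _) <;> assumption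
      obtain ⟨hu, e⟩ := h.side_of_adj hG hD hx hall hux
      rcases mem_inner_or_outer (f := f) hu with h3 | h3
      · exact hX u (e ▸ h3)
      · exact hK u (e ▸ h3)
    · have e' : c = !b := by revert e; cases b <;> cases c <;> simp
      subst e'
      exact Or.inl fun x hx => hY x hx.1
  · push Not at hα
    refine ⟨_, h.isGadget hG hc (fun b => (hb b).1) (D := R)
      (fun b r hr hrR y hy hyR => hα b r hr hrR y hy hyR) ?_ fun b => Or.inl fun x hx => hx.2⟩
    by_contra hno
    push Not at hno
    have hRW : ∀ x ∈ R, x ∈ W := by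
      intro x hx
      by_contra hxW
      obtain ⟨w, hw, hxw⟩ := hc.max.max x hxW
      exact hxw (hR hx (hno w hw) fun e => hxW (e ▸ hw))
    exact hc.nad (hRN j (hno j hc.hj) a d hc.aj.symm hc.dj.symm (fun e => hc.ha (hRW a e))
      (fun e => hc.hd (hRW d e)) hc.ne)

/-! ### Graphs without crossings -/

/-- A vertex adjacent to all vertices of an induced four-cycle. -/
structure Wheel (G : SimpleGraph V) (v : V) (c : Fin 4 → V) : Prop where
  hub : ∀ i, G.Adj v (c i)
  rim : ∀ i, G.Adj (c i) (c (i + 1))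
  opp : ∀ i, ¬ G.Adj (c i) (c (i + 2))
  ne : ∀ i, c i ≠ c (i + 2)

/-- No vertex is adjacent to all vertices of an induced path on four vertices. -/
def GemFree (G : SimpleGraph V) : Prop :=
  ∀ v a b c d, G.Adj v a → G.Adj v b → G.Adj v c → G.Adj v d → G.Adj a b → G.Adj b c → G.Adj c d →
    ¬ G.Adj a c → ¬ G.Adj a d → ¬ G.Adj b d → False

lemma gemFree_of_no_crossing {G : SimpleGraph V} [Finite V]
    (h : ∀ W a d j, ¬ Crossing G W a d j) : GemFree G := by
  intro v a b c d va vb vc vd ab bc cd nac nad nbd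
  obtain ⟨W, hW, hsub⟩ := exists_maxClique (G := G) (Q := {v, b, c}) (by
    intro x hx y hy hxy
    simp only [Set.mem_insert_iff, Set.mem_singleton_iff] at hx hy
    rcases hx with rfl | rfl | rfl <;> rcases hy with rfl | rfl | rfl <;>
      first | exact absurd rfl hxy | exact adjs)
  have hv : v ∈ W := hsub (by simp)
  have hb : b ∈ W := hsub (by simp)
  have hc : c ∈ W := hsub (by simp)
  exact h W a d v ⟨hW, fun e => nac (hW.adj e hc (by rintro rfl; exact nad cd)),
    fun e => nbd (hW.adj hb e (by rintro rfl; exact nad ab)), (by rintro rfl; exact nac cd.symm), nad,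
    hv, va.symm, vd.symm⟩

lemma fin_four_cases : ∀ i j : Fin 4, j = i ∨ j = i + 1 ∨ j = i + 2 ∨ j = i + 3 := by decide

lemma fin_four_add : ∀ i : Fin 4, i + 2 + 2 = i ∧ i + 3 + 1 = i ∧ i + 1 + 1 = i + 2 ∧
    i + 2 + 1 = i + 3 ∧ i + 1 + 2 = i + 3 := by decide

lemma fin_four_ne : ∀ i : Fin 4, i + 1 ≠ i ∧ i + 2 ≠ i ∧ i + 3 ≠ i := by decide

lemma fin_four_common : ∀ i j k : Fin 4, ∃ l, l ≠ i ∧ l ≠ j ∧ l ≠ k := by decide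

section wheel
variable {G : SimpleGraph V} {v u x y z : V} {c : Fin 4 → V}

lemma Wheel.rim' (h : Wheel G v c) (i : Fin 4) : G.Adj (c i) (c (i + 3)) := by
  have := h.rim (i + 3)
  rw [(fin_four_add i).2.1] at this
  exact this.symm

lemma Wheel.three (h : Wheel G v c) (hG : Atom G) (hg : GemFree G) (hx : G.Adj v x)
    (hxc : ∀ i, x ≠ c i) : ∃ i, ∀ j, j ≠ i → G.Adj x (c j) := by
  have h1 : ∀ i, G.Adj x (c i) ∨ G.Adj x (c (i + 2)) := by
    intro i
    by_contra hno
    push Not at hno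
    exact hG.no_claw hx (h.hub i) (h.hub (i + 2)) (hxc _) (hxc _) (h.ne i) hno.1 hno.2 (h.opp i)
  have h2 : ∀ i, G.Adj x (c i) ∨ G.Adj x (c (i + 1)) := by
    intro i
    by_contra hno
    push Not at hno
    have h3 := (h1 i).resolve_left hno.1
    have h4 := h.rim (i + 1)
    rw [(fin_four_add i).2.2.1] at h4
    exact hg v x (c (i + 2)) (c (i + 1)) (c i) hx (h.hub _) (h.hub _) (h.hub _) h3 h4.symm
      (h.rim i).symm hno.2 hno.1 fun e => h.opp i e.symm
  by_cases hall : ∀ i, G.Adj x (c i)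
  · exact ⟨0, fun j _ => hall j⟩
  · push Not at hall
    obtain ⟨i, hi⟩ := hall
    refine ⟨i, fun j hj => ?_⟩
    rcases fin_four_cases i j with rfl | rfl | rfl | rfl
    · exact absurd rfl hj
    · exact (h2 i).resolve_left hi
    · exact (h1 i).resolve_left hi
    · have := h2 (i + 3)
      rw [(fin_four_add i).2.1] at this
      exact this.resolve_right hi

/-- A vertex which sees the rim but not the hub sees the whole rim. -/
lemma Wheel.complete (h : Wheel G v c) (hG : Atom G) (hg : GemFree G) (hy : ¬ G.Adj v y)
    {i : Fin 4} (hi : G.Adj y (c i)) (j : Fin 4) : G.Adj y (c j) := by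
  have hyc : ∀ i, y ≠ c i := fun i e => hy (e ▸ h.hub i)
  have hstep : ∀ i, G.Adj y (c i) → G.Adj y (c (i + 1)) ∧ G.Adj y (c (i + 3)) := by
    intro i hi
    have hopp : ¬ G.Adj (c (i + 1)) (c (i + 3)) := by
      have := h.opp (i + 1)
      rwa [(fin_four_add i).2.2.2.2] at this
    have hne : c (i + 1) ≠ c (i + 3) := by
      have := h.ne (i + 1)
      rwa [(fin_four_add i).2.2.2.2] at this
    have h1 := h.rim i
    have h2 := h.rim' i
    have v0 := h.hub i
    have v1 := h.hub (i + 1)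
    have v3 := h.hub (i + 3)
    by_cases e1 : G.Adj y (c (i + 1)) <;> by_cases e3 : G.Adj y (c (i + 3))
    · exact ⟨e1, e3⟩
    · exact (hg (c i) y (c (i + 1)) v (c (i + 3)) adjs adjs adjs adjs adjs adjs adjs adjs adjs adjs).elim
    · exact (hg (c i) y (c (i + 3)) v (c (i + 1)) adjs adjs adjs adjs adjs adjs adjs adjs adjs adjs).elim
    · exact (hG.no_claw (v := c i) adjs h1 h2 (hyc _) (hyc _) hne e1 e3 hopp).elim
  have h1 := hstep i hi
  have h2 := (hstep (i + 1) h1.1).1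
  rw [(fin_four_add i).2.2.1] at h2
  rcases fin_four_cases i j with rfl | rfl | rfl | rfl
  · exact hi
  · exact h1.1
  · exact h2
  · exact h1.2

lemma Wheel.noStableTriple (h : Wheel G v c) (hG : Atom G) (hg : GemFree G) : NoStableTriple G := by
  have hcl := hG.cut {u | u = v ∨ G.Adj v u ∨ ∀ i, G.Adj u (c i)} ∅ ⟨v, Or.inl rfl⟩
    (fun _ _ => Set.notMem_empty _) (fun x hx => absurd hx (Set.notMem_empty x)) (by
      intro u hu y huy
      refine Or.inl ?_
      by_cases e1 : y = v
      · exact Or.inl e1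
      by_cases e2 : G.Adj v y
      · exact Or.inr (Or.inl e2)
      refine Or.inr (Or.inr ?_)
      have hyc : ∀ i, y ≠ c i := fun i e => e2 (e ▸ h.hub i)
      by_cases huc : ∃ i, u = c i
      · obtain ⟨i, rfl⟩ := huc
        exact h.complete hG hg e2 huy.symm
      push Not at huc
      rcases hu with rfl | hu | hu
      · exact absurd huy e2
      · obtain ⟨i, hi⟩ := h.three hG hg hu huc
        have h1 := (fin_four_ne i).1
        have h3 := (fin_four_ne i).2.2
        have hopp := h.opp (i + 1)
        have hne := h.ne (i + 1)
        rw [(fin_four_add i).2.2.2.2] at hopp hne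
        have : G.Adj y (c (i + 1)) ∨ G.Adj y (c (i + 3)) := by
          by_contra hno
          push Not at hno
          exact hG.no_claw huy (hi _ h1) (hi _ h3) (hyc _) (hyc _) hne hno.1 hno.2 hopp
        rcases this with h4 | h4
        · exact h.complete hG hg e2 h4
        · exact h.complete hG hg e2 h4
      · obtain ⟨i, hi⟩ := (⟨hu, h.rim, h.opp, h.ne⟩ : Wheel G u c).three hG hg huy hyc
        obtain ⟨l, hl, -⟩ := fin_four_common i i i
        exact h.complete hG hg e2 (hi l hl))
  have hthree : ∀ u, (∃ i, u = c i) ∨ ∃ i, ∀ j, j ≠ i → G.Adj u (c j) := by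
    intro u
    by_cases huc : ∃ i, u = c i
    · exact Or.inl huc
    push Not at huc
    refine Or.inr ?_
    rcases hcl u with (rfl | hu | hu) | hu
    · exact ⟨0, fun j _ => h.hub j⟩
    · exact h.three hG hg hu huc
    · exact ⟨0, fun j _ => hu j⟩
    · exact absurd hu (Set.notMem_empty u)
  have hmiss : ∀ u i, u ≠ c i → ¬ G.Adj u (c i) → u = c (i + 2) ∨ ∀ j, j ≠ i → G.Adj u (c j) := by
    intro u i hne hn
    rcases hthree u with ⟨j, rfl⟩ | ⟨j, hj⟩
    · rcases fin_four_cases i j with rfl | rfl | rfl | rfl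
      · exact absurd rfl hne
      · exact absurd (h.rim i).symm hn
      · exact Or.inl rfl
      · exact absurd (h.rim' i).symm hn
    · have : i = j := by by_contra e; exact hn (hj i e)
      exact Or.inr (this ▸ hj)
  have hrim : ∀ i y z, c i ≠ y → c i ≠ z → y ≠ z → ¬ G.Adj (c i) y → ¬ G.Adj (c i) z →
      ¬ G.Adj y z → False := by
    intro i y z hy hz hyz ny nz nyz
    have h1 := (fin_four_ne i).1
    have h2 := (fin_four_ne i).2.1
    rcases hmiss y i hy.symm (fun e => ny e.symm) with rfl | h3 <;>
      rcases hmiss z i hz.symm (fun e => nz e.symm) with rfl | h4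
    · exact hyz rfl
    · exact nyz (h4 _ h2).symm
    · exact nyz (h3 _ h2)
    · exact hG.no_claw (h.rim i).symm (h3 _ h1).symm (h4 _ h1).symm hy hz hyz ny nz nyz
  intro x y z hxy hxz hyz nxy nxz nyz
  rcases hthree x with ⟨i, rfl⟩ | ⟨i, hi⟩
  · exact hrim i y z hxy hxz hyz nxy nxz nyz
  rcases hthree y with ⟨j, rfl⟩ | ⟨j, hj⟩
  · exact hrim j x z hxy.symm hyz hxz (fun e => nxy e.symm) nyz nxz
  rcases hthree z with ⟨k, rfl⟩ | ⟨k, hk⟩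
  · exact hrim k x y hxz.symm hyz.symm hxy (fun e => nxz e.symm) (fun e => nyz e.symm) nxy
  obtain ⟨l, h1, h2, h3⟩ := fin_four_common i j k
  exact hG.no_claw (hi l h1).symm (hj l h2).symm (hk l h3).symm hxy hxz hyz nxy nxz nyz

end wheel

/-! ### Graphs in which every vertex lies in two maximal cliques -/

/-- Claw-free, without gems and wheels, and no vertex has a clique as neighbourhood. -/
structure TwoCliques (G : SimpleGraph V) : Prop where
  claw : ∀ {v x y z}, G.Adj v x → G.Adj v y → G.Adj v z → x ≠ y → x ≠ z → y ≠ z → ¬ G.Adj x y →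
    ¬ G.Adj x z → ¬ G.Adj y z → False
  path : ∀ {v a b c d}, G.Adj v a → G.Adj v b → G.Adj v c → G.Adj v d → G.Adj a b → G.Adj b c →
    G.Adj c d → ¬ G.Adj a c → ¬ G.Adj b d → a ≠ c → b ≠ d → False
  nonadj : ∀ v, ∃ x y, G.Adj v x ∧ G.Adj v y ∧ x ≠ y ∧ ¬ G.Adj x y

lemma Atom.twoCliques {G : SimpleGraph V} (hG : Atom G) (hS : ¬ NoStableTriple G)
    (hg : GemFree G) : TwoCliques G := by
  refine ⟨hG.no_claw, ?_, hG.exists_nonadj_nbrs hS⟩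
  intro v a b c d va vb vc vd ab bc cd nac nbd hac hbd
  by_cases had : G.Adj a d
  · refine hS (Wheel.noStableTriple (v := v) (c := ![a, b, c, d]) ⟨?_, ?_, ?_, ?_⟩ hG hg)
    · intro i; fin_cases i <;> assumption
    · intro i; fin_cases i <;> exact adjs
    · intro i; fin_cases i <;> exact adjs
    · intro i; fin_cases i <;> exact adjs
  · exact hg v a b c d va vb vc vd ab bc cd nac had nbd

section twoCliques
variable {G : SimpleGraph V} {v p q x y : V} {M : Set V}

/-- The vertices `v`, `p` and their common neighbours. -/
def edgeClique (G : SimpleGraph V) (v p : V) : Set V := {x | x = v ∨ G.Adj v x ∧ (x = p ∨ G.Adj x p)}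

lemma TwoCliques.maxClique (h : TwoCliques G) (hp : G.Adj v p) (hq : G.Adj v q) (hpq : p ≠ q)
    (hn : ¬ G.Adj p q) : MaxClique G (edgeClique G v p) := by
  refine ⟨?_, ?_⟩
  · have key : ∀ x y, G.Adj v x → G.Adj v y → G.Adj x p → G.Adj y p → x ≠ y → G.Adj x y := by
      intro x y vx vy xp yp hxy
      by_contra hno
      have : G.Adj q x ∨ G.Adj q y := by
        by_contra hc
        push Not at hc
        exact h.claw hq vx vy (by rintro rfl; exact hn xp.symm) (by rintro rfl; exact hn yp.symm) hxy
          hc.1 hc.2 hno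
      rcases this with h1 | h1
      · exact h.path hq vx hp vy h1 xp yp.symm adjs hno adjs hxy
      · exact h.path hq vy hp vx h1 yp xp.symm adjs adjs adjs adjs
    rintro x (rfl | ⟨vx, hx⟩) y (rfl | ⟨vy, hy⟩) hxy
    · exact absurd rfl hxy
    · exact vy
    · exact vx.symm
    · rcases hx with rfl | hx <;> rcases hy with rfl | hy
      · exact absurd rfl hxy
      · exact hy.symm
      · exact hx
      · exact key x y vx vy hx hy hxy
  · intro x hx
    by_contra hno
    push Not at hno
    have h1 := hno v (Or.inl rfl)
    have h2 := hno p (Or.inr ⟨hp, Or.inl rfl⟩)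
    exact hx (Or.inr ⟨h1.symm, Or.inr h2⟩)

lemma MaxClique.eq_of_subset {W : Set V} (hM : MaxClique G M) (hW : MaxClique G W) (h : M ⊆ W) :
    M = W := by
  refine Set.Subset.antisymm h fun x hx => ?_
  by_contra hxM
  obtain ⟨w, hw, hn⟩ := hM.max x hxM
  exact hn (hW.adj hx (h hw) fun e => hxM (e ▸ hw))

/-- Every maximal clique through `v` is one of the two. -/
lemma TwoCliques.eq_or_eq (h : TwoCliques G) (hp : G.Adj v p) (hq : G.Adj v q) (hpq : p ≠ q)
    (hn : ¬ G.Adj p q) (hM : MaxClique G M) (hv : v ∈ M) :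
    M = edgeClique G v p ∨ M = edgeClique G v q := by
  have hMp := h.maxClique hp hq hpq hn
  have hMq := h.maxClique hq hp hpq.symm fun e => hn e.symm
  by_cases hsub : M ⊆ edgeClique G v p
  · exact Or.inl (hM.eq_of_subset hMp hsub)
  right
  refine hM.eq_of_subset hMq fun y hy => ?_
  by_contra hyq
  rw [Set.not_subset] at hsub
  obtain ⟨x, hx, hxp⟩ := hsub
  have hxv : x ≠ v := fun e => hxp (Or.inl e)
  have hyv : y ≠ v := fun e => hyq (Or.inl e)
  have vx : G.Adj v x := hM.adj hv hx hxv.symm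
  have vy : G.Adj v y := hM.adj hv hy hyv.symm
  have hxp' : x ≠ p ∧ ¬ G.Adj x p := by
    constructor
    · exact fun e => hxp (Or.inr ⟨vx, Or.inl e⟩)
    · exact fun e => hxp (Or.inr ⟨vx, Or.inr e⟩)
  have hyq' : y ≠ q ∧ ¬ G.Adj y q := by
    constructor
    · exact fun e => hyq (Or.inr ⟨vy, Or.inl e⟩)
    · exact fun e => hyq (Or.inr ⟨vy, Or.inr e⟩)
  have hxy : x = y ∨ G.Adj x y := by
    by_cases e : x = y
    · exact Or.inl e
    · exact Or.inr (hM.adj hx hy e)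
  obtain ⟨hxp1, hxp2⟩ := hxp'
  obtain ⟨hyq1, hyq2⟩ := hyq'
  have hxq : x = q ∨ G.Adj x q := by
    by_contra hno
    push Not at hno
    exact h.claw vx hp hq hxp1 hno.1 hpq hxp2 hno.2 hn
  have hyp : y = p ∨ G.Adj y p := by
    by_contra hno
    push Not at hno
    exact h.claw vy hp hq hno.1 hyq1 hpq hno.2 hyq2 hn
  rcases hxq with rfl | hxq
  · rcases hxy with e | e
    · exact hyq1 e.symm
    · exact hyq2 e.symm
  rcases hyp with rfl | hyp
  · rcases hxy with e | e
    · exact hxp1 e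
    · exact hxp2 e
  rcases hxy with rfl | e
  · exact hxp2 hyp
  · exact h.path hp vy vx hq hyp.symm e.symm hxq adjs hyq2 adjs hyq1

lemma TwoCliques.ne (hp : G.Adj v p) (hpq : p ≠ q) (hn : ¬ G.Adj p q) :
    edgeClique G v p ≠ edgeClique G v q := by
  intro e
  have h1 : p ∈ edgeClique G v p := Or.inr ⟨hp, Or.inl rfl⟩
  rw [e] at h1
  rcases h1 with h1 | ⟨-, h1 | h1⟩
  · exact hp.ne h1.symm
  · exact hpq h1
  · exact hn h1

/-- No vertex lies in three maximal cliques. -/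
lemma TwoCliques.not_three (h : TwoCliques G) {A B C : Set V} (hA : MaxClique G A)
    (hB : MaxClique G B) (hC : MaxClique G C) (vA : v ∈ A) (vB : v ∈ B) (vC : v ∈ C) :
    A = B ∨ A = C ∨ B = C := by
  obtain ⟨p, q, hp, hq, hpq, hn⟩ := h.nonadj v
  rcases h.eq_or_eq hp hq hpq hn hA vA with e1 | e1 <;>
    rcases h.eq_or_eq hp hq hpq hn hB vB with e2 | e2 <;>
    rcases h.eq_or_eq hp hq hpq hn hC vC with e3 | e3 <;> simp [e1, e2, e3]

end twoCliques

/-! ### Colouring the maximal cliques -/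

/-- The maximal cliques of `G`, adjacent when they intersect. -/
def maxCliqueGraph (G : SimpleGraph V) : SimpleGraph {M : Set V // MaxClique G M} where
  Adj M N := M ≠ N ∧ (M.1 ∩ N.1).Nonempty
  symm := ⟨fun M N h => ⟨h.1.symm, by rw [Set.inter_comm]; exact h.2⟩⟩
  loopless := ⟨fun _ h => h.1 rfl⟩

section twoCliques
variable {G : SimpleGraph V} {R : Set V}

lemma TwoCliques.colorable [Finite V] (h : TwoCliques G) (hperf : PerfCol G) :
    (maxCliqueGraph G).Colorable 2 := by
  by_contra hcol
  obtain ⟨n, g, hodd, hgn, hadj, hinj⟩ := exists_odd_cycle hcol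
  have hn0 : 0 < n := hodd.pos
  have hn1 : n ≠ 1 := by
    rintro rfl
    exact (hadj 0 (by norm_num)).1 hgn.symm
  have hn3 : 3 ≤ n := by
    obtain ⟨k, hk⟩ := hodd
    omega
  choose f hf using fun i => (hadj (i % n) (Nat.mod_lt i hn0)).2
  have hf1 : ∀ i < n, f i ∈ (g i).1 := fun i hi => by
    have := (hf i).1
    rwa [Nat.mod_eq_of_lt hi] at this
  have hf2 : ∀ i < n, f i ∈ (g (i + 1)).1 := fun i hi => by
    have := (hf i).2
    rwa [Nat.mod_eq_of_lt hi] at this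
  have hne : ∀ i < n, ∀ j < n, i ≠ j → g i ≠ g j := fun i hi j hj hij e => hij (hinj hi hj e)
  have hmem : ∀ i < n, ∀ M, f i ∈ M.1 → M = g i ∨ M = g (i + 1) := by
    intro i hi M hM
    rcases h.not_three M.2 (g i).2 (g (i + 1)).2 hM (hf1 i hi) (hf2 i hi) with e | e | e
    · exact Or.inl (Subtype.ext e)
    · exact Or.inr (Subtype.ext e)
    · exact absurd (Subtype.ext e) (hadj i hi).1
  have hcommon : ∀ u v, G.Adj u v → ∃ M : {M : Set V // MaxClique G M}, u ∈ M.1 ∧ v ∈ M.1 := by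
    intro u v huv
    obtain ⟨M, hM, hsub⟩ := exists_maxClique (G := G) (Q := {u, v}) (by
      rw [isClique_pair]; exact fun _ => huv)
    exact ⟨⟨M, hM⟩, hsub (by simp), hsub (by simp)⟩
  have hA : ∀ i, i + 1 < n → G.Adj (f i) (f (i + 1)) := by
    intro i hi
    refine (g (i + 1)).2.adj (hf2 i (by omega)) (hf1 (i + 1) hi) fun e => ?_
    have h1 := hf2 (i + 1) hi
    rw [← e] at h1
    rcases hmem i (by omega) _ h1 with e' | e'
    · by_cases hi2 : i + 1 + 1 < n
      · exact hne _ hi2 i (by omega) (by omega) e'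
      · rw [show i + 1 + 1 = n by omega, hgn] at e'
        exact hne 0 hn0 i (by omega) (by omega) e'
    · exact (hadj (i + 1) hi).1 e'.symm
  have hclose : G.Adj (f 0) (f (n - 1)) := by
    have h1 := hf2 (n - 1) (by omega)
    rw [show n - 1 + 1 = n by omega, hgn] at h1
    refine (g 0).2.adj (hf1 0 hn0) h1 fun e => ?_
    have h2 := hf1 (n - 1) (by omega)
    rw [← e] at h2
    rcases hmem 0 hn0 _ h2 with e' | e'
    · exact hne _ (by omega) 0 hn0 (by omega) e'
    · exact hne _ (by omega) (0 + 1) (by omega) (by omega) e'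
  by_cases hn : n = 3
  · subst hn
    have h01 := hA 0 (by norm_num)
    have h12 := hA 1 (by norm_num)
    obtain ⟨M, hM, hsub⟩ := exists_maxClique (G := G) (Q := {f 0, f 1, f 2}) (by
      intro x hx y hy hxy
      simp only [Set.mem_insert_iff, Set.mem_singleton_iff] at hx hy
      have h02 : G.Adj (f 0) (f 2) := hclose
      have h01 : G.Adj (f 0) (f 1) := h01
      have h12 : G.Adj (f 1) (f 2) := h12
      rcases hx with rfl | rfl | rfl <;> rcases hy with rfl | rfl | rfl <;>
        first | exact absurd rfl hxy | assumption | (apply Adj.symm; assumption))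
    have n01 := hne 0 (by norm_num) 1 (by norm_num) (by norm_num)
    have n02 := hne 0 (by norm_num) 2 (by norm_num) (by norm_num)
    have n12 := hne 1 (by norm_num) 2 (by norm_num) (by norm_num)
    have e0 := hmem 0 (by norm_num) ⟨M, hM⟩ (hsub (by simp))
    have e1 := hmem 1 (by norm_num) ⟨M, hM⟩ (hsub (by simp))
    have e2 := hmem 2 (by norm_num) ⟨M, hM⟩ (hsub (by simp))
    rw [show 2 + 1 = 3 by norm_num, hgn] at e2
    rw [show 1 + 1 = 2 by norm_num] at e1
    rw [show 0 + 1 = 1 by norm_num] at e0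
    rcases e0 with e0 | e0 <;> rcases e1 with e1 | e1 <;> rcases e2 with e2 | e2
    · exact n01 (e0.symm.trans e1)
    · exact n01 (e0.symm.trans e1)
    · exact n02 (e0.symm.trans e1)
    · exact n02 (e0.symm.trans e1)
    · exact n12 (e1.symm.trans e2)
    · exact n01 (e2.symm.trans e1)
    · exact n12 (e0.symm.trans e1)
    · exact n12 (e0.symm.trans e1)
  · have heven := hperf.even_hole (by omega) f hA hclose (by
      intro i j hij hj hlast hadj'
      obtain ⟨M, hi, hj'⟩ := hcommon _ _ hadj'
      have h1 : ∀ a b, a < n → b < n → M = g a → M = g b → a = b := by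
        intro a b ha hb e1 e2
        by_contra hab
        exact hne a ha b hb hab (e1.symm.trans e2)
      have h2 := hmem i (by omega) M hi
      have h3 := hmem j hj M hj'
      by_cases hjn : j + 1 < n
      · rcases h2 with e | e <;> rcases h3 with e' | e'
        · have := h1 _ _ (by omega) (by omega) e e'; omega
        · have := h1 _ _ (by omega) (by omega) e e'; omega
        · have := h1 _ _ (by omega) (by omega) e e'; omega
        · have := h1 _ _ (by omega) (by omega) e e'; omega
      · rw [show j + 1 = n by omega, hgn] at h3
        rcases h2 with e | e <;> rcases h3 with e' | e'
        · have := h1 _ _ (by omega) (by omega) e e'; omega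
        · have := h1 _ _ (by omega) (by omega) e e'; omega
        · have := h1 _ _ (by omega) (by omega) e e'; omega
        · have := h1 _ _ (by omega) (by omega) e e'; omega)
    exact (Nat.not_even_iff_odd.mpr hodd) heven

/-- A nonempty clique with clique attachments is maximal. -/
lemma TwoCliques.maxClique_of_attached (h : TwoCliques G) (hR : G.IsClique R)
    (hRN : ∀ r ∈ R, ∀ x y, G.Adj r x → G.Adj r y → x ∉ R → y ∉ R → x ≠ y → G.Adj x y) {r : V}
    (hr : r ∈ R) : MaxClique G R := by
  obtain ⟨p, q, hp, hq, hpq, hn, hpR, hqR⟩ : ∃ p q, G.Adj r p ∧ G.Adj r q ∧ p ≠ q ∧ ¬ G.Adj p q ∧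
      p ∈ R ∧ q ∉ R := by
    obtain ⟨p, q, hp, hq, hpq, hn⟩ := h.nonadj r
    by_cases h1 : p ∈ R <;> by_cases h2 : q ∈ R
    · exact absurd (hR h1 h2 hpq) hn
    · exact ⟨p, q, hp, hq, hpq, hn, h1, h2⟩
    · exact ⟨q, p, hq, hp, hpq.symm, fun e => hn e.symm, h2, h1⟩
    · exact absurd (hRN r hr p q hp hq h1 h2 hpq) hn
  have hM := h.maxClique hp hq hpq hn
  have hsub : R ⊆ edgeClique G r p := by
    intro x hx
    by_cases e : x = r
    · exact Or.inl e
    · refine Or.inr ⟨hR hr hx (Ne.symm e), ?_⟩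
      by_cases e' : x = p
      · exact Or.inl e'
      · exact Or.inr (hR hx hpR e')
  have heq : R = edgeClique G r p := by
    refine Set.Subset.antisymm hsub fun u hu => ?_
    by_contra huR
    have hpM : p ∈ edgeClique G r p := hsub hpR
    have hur : u ≠ r := fun e => huR (e ▸ hr)
    have hup : u ≠ p := fun e => huR (e ▸ hpR)
    have ru : G.Adj r u := hM.adj (hsub hr) hu hur.symm
    have pu : G.Adj p u := hM.adj hpM hu hup.symm
    have huq : G.Adj u q := hRN r hr u q ru hq huR hqR (by rintro rfl; exact hn pu)
    obtain ⟨s, hps, hsM⟩ : ∃ s, G.Adj p s ∧ s ∉ edgeClique G r p := by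
      obtain ⟨s, t, hs, ht, hst, hno⟩ := h.nonadj p
      by_cases h1 : s ∈ edgeClique G r p
      · exact ⟨t, ht, fun h2 => hno (hM.adj h1 h2 hst)⟩
      · exact ⟨s, hs, h1⟩
    have hsR : s ∉ R := fun e => hsM (hsub e)
    have hsu : s ≠ u := fun e => hsM (e ▸ hu)
    have hus : G.Adj s u := hRN p hpR s u hps pu hsR huR hsu
    have hsr : ¬ G.Adj s r := fun e => hsM (Or.inr ⟨e.symm, Or.inr hps.symm⟩)
    have hsr' : s ≠ r := fun e => hsM (Or.inl e)
    exact h.path (v := u) (a := s) (b := p) (c := r) (d := q) hus.symm pu.symm ru.symm huq hps.symm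
      hp.symm hq hsr hn hsr' hpq
  exact heq ▸ hM

lemma fin_two_eq : ∀ a b r : Fin 2, a ≠ r → b ≠ r → a = b := by decide

/-- Adjacency is the union of two equivalence relations, and a clique with clique attachments is a
class of the first. -/
lemma TwoCliques.exists_red_blue [Finite V] (h : TwoCliques G) (hperf : PerfCol G)
    (hR : G.IsClique R)
    (hRN : ∀ r ∈ R, ∀ x y, G.Adj r x → G.Adj r y → x ∉ R → y ∉ R → x ≠ y → G.Adj x y) :
    ∃ ρ β : V → ℕ, (∀ u v, u ≠ v → (G.Adj u v ↔ ρ u = ρ v ∨ β u = β v)) ∧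
      ∀ r ∈ R, ∀ v, ρ r = ρ v → v ∈ R := by
  classical
  obtain ⟨col⟩ := h.colorable hperf
  obtain ⟨red, hred⟩ : ∃ red : Fin 2, ∀ hR : MaxClique G R, col ⟨R, hR⟩ = red := by
    by_cases hRm : MaxClique G R
    · exact ⟨col ⟨R, hRm⟩, fun _ => rfl⟩
    · exact ⟨0, fun e => absurd e hRm⟩
  have huniq : ∀ v (M N : {M : Set V // MaxClique G M}), v ∈ M.1 → v ∈ N.1 → col M = col N →
      M = N := by
    intro v M N hM hN e
    by_contra hne
    exact col.valid (v := M) (w := N) ⟨hne, v, hM, hN⟩ e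
  have hex : ∀ v, (∃ M : {M : Set V // MaxClique G M}, v ∈ M.1 ∧ col M = red) ∧
      ∃ M : {M : Set V // MaxClique G M}, v ∈ M.1 ∧ col M ≠ red := by
    intro v
    obtain ⟨p, q, hp, hq, hpq, hn⟩ := h.nonadj v
    let M : {M : Set V // MaxClique G M} := ⟨_, h.maxClique hp hq hpq hn⟩
    let N : {M : Set V // MaxClique G M} := ⟨_, h.maxClique hq hp hpq.symm fun e => hn e.symm⟩
    have hvM : v ∈ M.1 := Or.inl rfl
    have hvN : v ∈ N.1 := Or.inl rfl
    have hMN : M ≠ N := fun e => TwoCliques.ne hp hpq hn (congrArg Subtype.val e)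
    have hcol : col M ≠ col N := fun e => hMN (huniq v M N hvM hvN e)
    by_cases e : col M = red
    · exact ⟨⟨M, hvM, e⟩, N, hvN, fun e' => hcol (e.trans e'.symm)⟩
    · refine ⟨⟨N, hvN, ?_⟩, M, hvM, e⟩
      by_contra e'
      exact hcol (fin_two_eq _ _ _ e e')
  choose A hvA hA using fun v => (hex v).1
  choose B hvB hB using fun v => (hex v).2
  obtain ⟨code, hcode⟩ := Countable.exists_injective_nat {M : Set V // MaxClique G M}
  refine ⟨fun v => code (A v), fun v => code (B v), ?_, ?_⟩
  · intro u v huv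
    constructor
    · intro hadj
      obtain ⟨M, hM, hsub⟩ := exists_maxClique (G := G) (Q := {u, v}) (by
        rw [isClique_pair]; exact fun _ => hadj)
      have hu : u ∈ M := hsub (by simp)
      have hv : v ∈ M := hsub (by simp)
      by_cases e : col ⟨M, hM⟩ = red
      · left
        have e1 := huniq u (A u) ⟨M, hM⟩ (hvA u) hu ((hA u).trans e.symm)
        have e2 := huniq v (A v) ⟨M, hM⟩ (hvA v) hv ((hA v).trans e.symm)
        show code (A u) = code (A v)
        rw [e1, e2]
      · right
        have e1 := huniq u (B u) ⟨M, hM⟩ (hvB u) hu (fin_two_eq _ _ _ (hB u) e)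
        have e2 := huniq v (B v) ⟨M, hM⟩ (hvB v) hv (fin_two_eq _ _ _ (hB v) e)
        show code (B u) = code (B v)
        rw [e1, e2]
    · rintro (e | e)
      · exact (A u).2.adj (hvA u) (hcode e ▸ hvA v) huv
      · exact (B u).2.adj (hvB u) (hcode e ▸ hvB v) huv
  · intro r hr v e
    have hRm := h.maxClique_of_attached hR hRN hr
    have e1 := huniq r (A r) ⟨R, hRm⟩ (hvA r) hr ((hA r).trans (hred hRm).symm)
    have e2 : A r = A v := hcode e
    have hv := hvA v
    rw [← e2, e1] at hv
    exact hv

end twoCliques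

/-! ### The structure of atoms -/

/-- An atom has no stable triple, is the graph on nine vertices, has a gadget, or its adjacency is
the union of two equivalence relations. -/
lemma Atom.decomposition {G : SimpleGraph V} [Finite V] (hG : Atom G) {R : Set V} (hR : G.IsClique R)
    (hRN : ∀ r ∈ R, ∀ x y, G.Adj r x → G.Adj r y → x ∉ R → y ∉ R → x ≠ y → G.Adj x y) :
    NoStableTriple G ∨ (∃ p q, NineVertex G p q) ∨ (∃ P, IsGadget G R P) ∨
      ∃ ρ β : V → ℕ, (∀ u v, u ≠ v → (G.Adj u v ↔ ρ u = ρ v ∨ β u = β v)) ∧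
        ∀ r ∈ R, ∀ v, ρ r = ρ v → v ∈ R := by
  by_cases hS : NoStableTriple G
  · exact Or.inl hS
  right
  by_cases hsun : ∃ w s, Sun G w s
  · obtain ⟨w, s, h⟩ := hsun
    exact Or.inl (h.nineVertex hG)
  push Not at hsun
  right
  by_cases hc : ∃ W a d j, Crossing G W a d j
  · obtain ⟨W, a, d, j, hc⟩ := hc
    exact Or.inl (hc.exists_isGadget hsun hS hG hR hRN)
  push Not at hc
  exact Or.inr ((hG.twoCliques hS (gemFree_of_no_crossing hc)).exists_red_blue hG.perf hR hRN)

lemma NineVertex.exists_four_clique {G : SimpleGraph V} {p : Fin 3 → Bool → V} {q : Fin 3 → V}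
    (h : NineVertex G p q) : ∃ Q : Finset V, G.IsClique (Q : Set V) ∧ Q.card = 4 := by
  classical
  have hex : ∀ i b, ∃ m, m ≠ i ∧ G.Adj (p i b) (q m) := by
    intro i b
    obtain ⟨j, k, hjk, hj, hk⟩ := h.two i b
    by_cases e : j = i
    · exact ⟨k, fun e' => hjk (by rw [e, e']), hk⟩
    · exact ⟨j, e, hj⟩
  obtain ⟨m, hm0, hm⟩ := hex 0 false
  obtain ⟨l, hl0, hlm⟩ := exists_third 0 m
  obtain ⟨b, hb⟩ : ∃ b, G.Adj (p l b) (q m) := by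
    by_contra hno
    push Not at hno
    have h0 : ∀ b, G.Adj (q 0) (p l b) := by
      intro b
      obtain ⟨n, hnl, hn⟩ := hex l b
      rcases eq_of_three 0 m l n hm0.symm hl0.symm hlm.symm with rfl | rfl | rfl
      · exact hn.symm
      · exact absurd hn (hno b)
      · exact absurd rfl hnl
    exact h.cross 0 l hl0.symm ⟨h0 false, h0 true⟩
  have h1 := h.own m false
  have h2 := h.adj m 0 false false hm0
  have h3 := h.adj m l false b hlm.symm
  have h4 := h.adj 0 l false b hl0.symm
  refine ⟨{q m, p m false, p 0 false, p l b}, ?_, ?_⟩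
  · intro x hx y hy hxy
    simp only [Finset.coe_insert, Finset.coe_singleton, Set.mem_insert_iff,
      Set.mem_singleton_iff] at hx hy
    rcases hx with rfl | rfl | rfl | rfl <;> rcases hy with rfl | rfl | rfl | rfl <;>
      first | exact absurd rfl hxy | assumption | (apply Adj.symm; assumption)
  · rw [Finset.card_insert_of_notMem, Finset.card_insert_of_notMem, Finset.card_insert_of_notMem,
      Finset.card_singleton]
    · simpa using h4.ne
    · simpa using ⟨h2.ne, h3.ne⟩
    · simpa using ⟨h1.ne, hm.ne.symm, hb.ne.symm⟩

/-! ### Extending colourings -/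

section extend
variable {G : SimpleGraph V} {k : ℕ} {S T : Finset V}

/-- The vertices of `S` outside `T`. -/
def offSet (S T : Finset V) : Set V := {v | v ∈ S ∧ v ∉ T}

/-- The neighbours of `T`. -/
def nbrSet (G : SimpleGraph V) (S T : Finset V) : Set (offSet S T) := {v | ∃ t ∈ T, G.Adj v.1 t}

lemma Attached.adj_of_mem (hT : Attached G S T) {v : offSet S T} (hv : v ∈ nbrSet G S T) {t : V}
    (ht : t ∈ T) : G.Adj v.1 t := by
  obtain ⟨t', ht', h⟩ := hv
  exact hT.twin v.1 v.2.1 v.2.2 t' ht' h t ht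

lemma Attached.isClique_nbrSet (hT : Attached G S T) :
    (G.induce (offSet S T)).IsClique (nbrSet G S T) := by
  rintro u hu v hv huv
  obtain ⟨t, ht, -⟩ := id hu
  exact hT.nbr u.1 u.2.1 u.2.2 v.1 v.2.1 v.2.2 (fun e => huv (Subtype.ext e)) t ht
    (hT.adj_of_mem hu ht) (hT.adj_of_mem hv ht)

lemma IsClawFree.adj_of_adj_nbrSet (hclaw : IsClawFree G) (r : offSet S T) (hr : r ∈ nbrSet G S T)
    (x y : offSet S T) (hx : (G.induce (offSet S T)).Adj r x) (hy : (G.induce (offSet S T)).Adj r y)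
    (hxR : x ∉ nbrSet G S T) (hyR : y ∉ nbrSet G S T) (hxy : x ≠ y) :
    (G.induce (offSet S T)).Adj x y := by
  by_contra hno
  obtain ⟨t, ht, hrt⟩ := hr
  exact hclaw r.1 x.1 y.1 t hx hy hrt hno (fun e => hxR ⟨t, ht, e⟩) (fun e => hyR ⟨t, ht, e⟩)
    (fun e => hxy (Subtype.ext e)) (fun e => x.2.2 (e ▸ ht)) (fun e => y.2.2 (e ▸ ht))

lemma isClique_map_induce {s : Set V} {Q : Finset s} (hQ : (G.induce s).IsClique (Q : Set s)) :
    G.IsClique ((Q.map (Function.Embedding.subtype _) : Finset V) : Set V) := by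
  intro u hu v hv huv
  simp only [Finset.coe_map, Set.mem_image, Finset.mem_coe] at hu hv
  obtain ⟨u, hu, rfl⟩ := hu
  obtain ⟨v, hv, rfl⟩ := hv
  exact hQ hu hv fun e => huv (e ▸ rfl)

lemma atom_offSet [Finite V] (hclaw : IsClawFree G) (hperf : PerfCol G)
    (hω : ∀ Q : Finset V, G.IsClique (Q : Set V) → Q.card ≤ 4)
    (hcut : ∀ A C : Finset V, (∀ v ∈ A, v ∈ offSet S T) → (∀ v ∈ C, v ∈ offSet S T) → A.Nonempty →
      (∀ v ∈ A, v ∉ C) → (∀ u ∈ C, ∀ v ∈ C, u ≠ v → G.Adj u v) →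
      (∀ a ∈ A, ∀ v ∈ offSet S T, G.Adj a v → v ∈ A ∨ v ∈ C) → ∀ v ∈ offSet S T, v ∈ A ∨ v ∈ C) :
    Atom (G.induce (offSet S T)) := by
  classical
  have := Fintype.ofFinite V
  refine ⟨hclaw.induce _, hperf.induce _, fun Q hQ => ?_, ?_⟩
  · simpa using hω _ (isClique_map_induce hQ)
  · intro A C hA hAC hC hcl v
    have hmem : ∀ (B : Set (offSet S T)) (v : V),
        v ∈ Finset.univ.filter (fun v => ∃ h : v ∈ offSet S T, (⟨v, h⟩ : offSet S T) ∈ B) ↔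
          ∃ h : v ∈ offSet S T, (⟨v, h⟩ : offSet S T) ∈ B := fun B v => by simp
    have key := hcut (Finset.univ.filter fun v => ∃ h : v ∈ offSet S T, (⟨v, h⟩ : offSet S T) ∈ A)
      (Finset.univ.filter fun v => ∃ h : v ∈ offSet S T, (⟨v, h⟩ : offSet S T) ∈ C)
    simp only [hmem] at key
    obtain ⟨a, ha⟩ := hA
    have := key (fun v h => h.1) (fun v h => h.1) ⟨a.1, (hmem A _).2 ⟨a.2, ha⟩⟩
      (fun v ⟨h, hv⟩ ⟨_, hv'⟩ => hAC _ hv hv')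
      (fun u ⟨hu, hu'⟩ v ⟨hv, hv'⟩ huv => hC hu' hv' fun e => huv (congrArg Subtype.val e))
      (fun a ⟨ha, ha'⟩ v hv hav => (hcl ⟨a, ha⟩ ha' ⟨v, hv⟩ hav).imp (fun h => ⟨hv, h⟩)
        fun h => ⟨hv, h⟩) v.1 v.2
    exact this.imp (fun h => h.2) fun h => h.2

lemma extendable_of_isGadget [Finite V] {P : Bool → Set (offSet S T)} (hperf : PerfCol G)
    (hω : ∀ Q : Finset V, G.IsClique (Q : Set V) → Q.card ≤ k) (hk : k ≤ 4)
    (hT : Attached G S T)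
    (ih : ∀ S' T', S'.card < S.card → Attached G S' T' → Extendable G k S' T')
    (hP : IsGadget (G.induce (offSet S T)) (nbrSet G S T) P) : Extendable G k S T := by
  classical
  have := Fintype.ofFinite V
  let F : Bool → Finset V := fun b =>
    Finset.univ.filter fun v => ∃ h : v ∈ offSet S T, (⟨v, h⟩ : offSet S T) ∈ P b
  have hF : ∀ b v, v ∈ F b ↔ ∃ h : v ∈ offSet S T, (⟨v, h⟩ : offSet S T) ∈ P b := fun b v => by
    simp [F]
  have hnot : ∀ {b v} (h : v ∈ offSet S T), v ∉ F b → (⟨v, h⟩ : offSet S T) ∉ P b :=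
    fun h hv hv' => hv ((hF _ _).2 ⟨h, hv'⟩)
  have hsub : ∀ b, F b ⊆ S := fun b v hv => ((hF b v).1 hv).1.1
  have hdisT : ∀ b, Disjoint (F b) T := fun b => Finset.disjoint_left.2 fun v hv =>
    ((hF b v).1 hv).1.2
  have hclique : ∀ b, ∀ u ∈ F b, ∀ v ∈ F b, u ≠ v → G.Adj u v := by
    intro b u hu v hv huv
    obtain ⟨hu, hu'⟩ := (hF b u).1 hu
    obtain ⟨hv, hv'⟩ := (hF b v).1 hv
    exact hP.clique b hu' hv' fun e => huv (congrArg Subtype.val e)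
  have hTR : ∀ b, ∀ t ∈ T, ∀ x ∈ F b, G.Adj t x → (∀ x' ∈ F b, G.Adj t x') ∧
      ∀ u ∈ S, u ∉ T → u ∉ F true → u ∉ F false → G.Adj u x → G.Adj u t := by
    intro b t ht x hx htx
    obtain ⟨hx, hx'⟩ := (hF b x).1 hx
    rcases hP.attach b with h | ⟨h1, h2⟩
    · exact absurd ⟨t, ht, htx.symm⟩ (h _ hx')
    · refine ⟨fun x' hx'' => ?_, fun u hu huT h3 h4 hux => ?_⟩
      · obtain ⟨hx1, hx2⟩ := (hF b x').1 hx''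
        exact (hT.adj_of_mem (h1 _ hx2) ht).symm
      · have huo : u ∈ offSet S T := ⟨hu, huT⟩
        exact hT.adj_of_mem (h2 ⟨u, huo⟩ (hnot huo h3) (hnot huo h4) _ hx' hux) ht
  have hom : ∀ b, ∀ v ∈ S, v ∉ F true → v ∉ F false → ∀ x ∈ F b, G.Adj v x →
      ∀ x' ∈ F b, G.Adj v x' := by
    intro b v hv h1 h2 x hx hvx x' hx'
    by_cases hvT : v ∈ T
    · exact (hTR b v hvT x hx hvx).1 x' hx'
    · have hvo : v ∈ offSet S T := ⟨hv, hvT⟩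
      obtain ⟨hx1, hx2⟩ := (hF b x).1 hx
      obtain ⟨hx1', hx2'⟩ := (hF b x').1 hx'
      exact hP.hom b ⟨v, hvo⟩ (hnot hvo h1) (hnot hvo h2) _ hx2 hvx _ hx2'
  have hnbr : ∀ b, ∀ u ∈ S, u ∉ F true → u ∉ F false → ∀ v ∈ S, v ∉ F true → v ∉ F false → u ≠ v →
      ∀ x ∈ F b, G.Adj u x → G.Adj v x → G.Adj u v := by
    intro b u hu h1 h2 v hv h3 h4 huv x hx hux hvx
    by_cases huT : u ∈ T <;> by_cases hvT : v ∈ T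
    · exact hT.clique u huT v hvT huv
    · exact ((hTR b u huT x hx hux).2 v hv hvT h3 h4 hvx).symm
    · exact (hTR b v hvT x hx hvx).2 u hu huT h1 h2 hux
    · have huo : u ∈ offSet S T := ⟨hu, huT⟩
      have hvo : v ∈ offSet S T := ⟨hv, hvT⟩
      obtain ⟨hx1, hx2⟩ := (hF b x).1 hx
      exact hP.nbr b ⟨u, huo⟩ ⟨v, hvo⟩ (hnot huo h1) (hnot huo h2) (hnot hvo h3) (hnot hvo h4)
        (fun e => huv (congrArg Subtype.val e)) _ hx2 hux hvx
  refine extendable_of_gadget hperf hω hk hT ih (hsub true) (hsub false) (hdisT true) (hdisT false)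
    (Finset.disjoint_left.2 fun v h1 h2 => ?_) (hclique true) (hclique false) ?_ (hom true)
    (hom false) (hnbr true) (hnbr false)
  · obtain ⟨h, h1⟩ := (hF true v).1 h1
    obtain ⟨_, h2⟩ := (hF false v).1 h2
    exact hP.disj _ h1 h2
  · obtain ⟨x, hx, y, hy, hn⟩ := hP.nc
    exact ⟨x.1, (hF true _).2 ⟨x.2, hx⟩, y.1, (hF false _).2 ⟨y.2, hy⟩, hn⟩

lemma extendable_of_nineVertex [Finite V] {p : Fin 3 → Bool → offSet S T} {q : Fin 3 → offSet S T}
    (hclaw : IsClawFree G) (hω : ∀ Q : Finset V, G.IsClique (Q : Set V) → Q.card ≤ k) (hk : k ≤ 4)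
    (hT : Attached G S T) (h : NineVertex (G.induce (offSet S T)) p q) : Extendable G k S T := by
  classical
  have := Fintype.ofFinite V
  obtain ⟨Q, hQ, hQc⟩ := h.exists_four_clique
  have hk4 : 4 ≤ k := by simpa [hQc] using hω _ (isClique_map_induce hQ)
  have hempty : ∀ v ∈ S, v ∉ T → ∀ t ∈ T, ¬ G.Adj v t := by
    intro v hv hvT t ht hvt
    let R : Finset (offSet S T) := Finset.univ.filter fun v => v ∈ nbrSet G S T
    have hR : ∀ v, v ∈ R ↔ v ∈ nbrSet G S T := fun v => by simp [R]
    have hRc : (G.induce (offSet S T)).IsClique (R : Set (offSet S T)) := by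
      intro u hu v hv
      exact hT.isClique_nbrSet ((hR u).1 hu) ((hR v).1 hv)
    have hcard : R.card ≤ 3 := by
      have h1 : G.IsClique ((insert t (R.map (Function.Embedding.subtype _)) : Finset V) : Set V) := by
        rw [Finset.coe_insert, isClique_insert]
        refine ⟨isClique_map_induce hRc, fun b hb _ => ?_⟩
        simp only [Finset.coe_map, Set.mem_image, Finset.mem_coe] at hb
        obtain ⟨u, hu, rfl⟩ := hb
        exact (hT.adj_of_mem ((hR u).1 hu) ht).symm
      have h2 := hω _ h1
      rw [Finset.card_insert_of_notMem, Finset.card_map] at h2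
      · omega
      · intro hmem
        rw [Finset.mem_map] at hmem
        obtain ⟨u, -, e⟩ := hmem
        exact u.2.2 (by rw [← e] at ht; exact ht)
    have h3 := h.eq_empty hcard fun r hr x y hx hy hxR hyR => hclaw.adj_of_adj_nbrSet r ((hR r).1 hr)
      x y hx hy (fun e => hxR ((hR x).2 e)) fun e => hyR ((hR y).2 e)
    exact Finset.notMem_empty _ (h3 ▸ (hR ⟨v, hv, hvT⟩).2 ⟨t, ht, hvt⟩)
  intro L f hL hf
  obtain ⟨c, hc, hc'⟩ := h.exists_coloring (fun v => L v.1) fun v => hk4.trans (hL v.1 v.2.1 v.2.2)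
  refine ⟨fun v => if hv : v ∈ offSet S T then c ⟨v, hv⟩ else f v, ?_, ?_, ?_⟩
  · intro v hv hvT
    have hvo : v ∈ offSet S T := ⟨hv, hvT⟩
    simpa [hvo] using hc ⟨v, hvo⟩
  · intro t ht
    have hto : t ∉ offSet S T := fun e => e.2 ht
    simp [hto]
  · intro u hu v hv huv
    by_cases huT : u ∈ T <;> by_cases hvT : v ∈ T
    · have h1 : u ∉ offSet S T := fun e => e.2 huT
      have h2 : v ∉ offSet S T := fun e => e.2 hvT
      simp only [h1, h2, dif_neg, not_false_iff]
      exact fun e => huv.ne (hf huT hvT e)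
    · exact absurd huv.symm (hempty v hv hvT u huT)
    · exact absurd huv (hempty u hu huT v hvT)
    · have h1 : u ∈ offSet S T := ⟨hu, huT⟩
      have h2 : v ∈ offSet S T := ⟨hv, hvT⟩
      simp only [h1, h2, dif_pos]
      exact hc' _ _ huv

/-- Injective colourings of attached cliques extend. -/
theorem extendable_of_attached [Finite V] (hclaw : IsClawFree G) (hperf : PerfCol G)
    (hω : ∀ Q : Finset V, G.IsClique (Q : Set V) → Q.card ≤ k) (hk : k ≤ 4) (S T : Finset V)
    (hT : Attached G S T) : Extendable G k S T := by
  classical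
  induction hn : S.card using Nat.strong_induction_on generalizing S T with
  | _ n ihn =>
  subst hn
  have ih : ∀ S' T', S'.card < S.card → Attached G S' T' → Extendable G k S' T' :=
    fun S' T' hlt hT' => ihn _ hlt S' T' hT' rfl
  have hα := extendable_of_no_stable_triple hclaw hperf hω hk hT
  rcases extendable_or_atom hclaw hω hk hT ih hα with hext | hcut
  · exact hext
  have hmem : ∀ v, v ∈ S \ T ↔ v ∈ offSet S T := fun v => Finset.mem_sdiff
  have hG : Atom (G.induce (offSet S T)) := atom_offSet hclaw hperf (fun Q hQ => (hω Q hQ).trans hk)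
    fun A C hA hC hne hAC hCc hcl v hv => hcut A C (fun v hv => (hmem v).2 (hA v hv))
      (fun v hv => (hmem v).2 (hC v hv)) hne hAC hCc (fun a ha v hv => hcl a ha v ((hmem v).1 hv)) v
      ((hmem v).2 hv)
  rcases hG.decomposition hT.isClique_nbrSet hclaw.adj_of_adj_nbrSet with hS | ⟨p, q, h⟩ | ⟨P, hP⟩ |
    ⟨ρ, β, hadj, hρ⟩
  · exact hα fun x hx y hy z hz hxT hyT hzT hxy hxz hyz =>
      hS ⟨x, hx, hxT⟩ ⟨y, hy, hyT⟩ ⟨z, hz, hzT⟩ (fun e => hxy (congrArg Subtype.val e))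
        (fun e => hxz (congrArg Subtype.val e)) fun e => hyz (congrArg Subtype.val e)
  · exact extendable_of_nineVertex hclaw hω hk hT h
  · exact extendable_of_isGadget hperf hω hk hT ih hP
  · refine extendable_of_red_blue hperf hω hT
      (fun v => if hv : v ∈ offSet S T then ρ ⟨v, hv⟩ else 0)
      (fun v => if hv : v ∈ offSet S T then β ⟨v, hv⟩ else 0) ?_ ?_
    · intro u hu huT v hv hvT huv
      have h1 : u ∈ offSet S T := ⟨hu, huT⟩
      have h2 : v ∈ offSet S T := ⟨hv, hvT⟩
      simp only [h1, h2, dif_pos]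
      exact hadj ⟨u, h1⟩ ⟨v, h2⟩ fun e => huv (congrArg Subtype.val e)
    · intro t ht u hu huT v hv hvT hut e
      have h1 : u ∈ offSet S T := ⟨hu, huT⟩
      have h2 : v ∈ offSet S T := ⟨hv, hvT⟩
      simp only [h1, h2, dif_pos] at e
      exact hT.adj_of_mem (hρ ⟨u, h1⟩ ⟨t, ht, hut⟩ ⟨v, h2⟩ e) ht

end extend

/-! ### Choice number and chromatic number -/

lemma Choosable.colorable {G : SimpleGraph V} {m : ℕ} (h : Choosable G m) : G.Colorable m := by
  obtain ⟨c, hc, hc'⟩ := h (fun _ => Finset.range m) fun _ => Finset.card_range m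
  exact ⟨Coloring.mk (fun v => ⟨c v, Finset.mem_range.1 (hc v)⟩) fun huv e =>
    hc' huv (congrArg Fin.val e)⟩

lemma choosable_cliqueNumber [Fintype V] {G : SimpleGraph V} (hclaw : IsClawFree G)
    (hperf : PerfCol G) (homega : cliqueNumber G ≤ 4) : Choosable G (cliqueNumber G) := by
  intro L hL
  obtain ⟨c, hc, -, hc'⟩ := extendable_of_attached hclaw hperf (fun Q hQ => card_le_cliqueNumber hQ)
    homega Finset.univ ∅ (attached_empty G _) L (fun _ => 0) (fun v _ _ => (hL v).ge) (by simp)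
  exact ⟨c, fun v => hc v (Finset.mem_univ v) (Finset.notMem_empty v), fun u w huw =>
    hc' u (Finset.mem_univ u) w (Finset.mem_univ w) huw⟩

/-- Every claw-free perfect graph `G` with `ω(G) ≤ 4` satisfies
`ch(G) = χ(G)`. -/
theorem claw_free_perfect_choice_eq_chromatic
    {V : Type*} [Fintype V] (G : SimpleGraph V)
    (hclaw : IsClawFree G) (hperf : IsPerfect G) (homega : cliqueNumber G ≤ 4) :
    (choiceNumber G : ℕ∞) = G.chromaticNumber := by
  have hk := choosable_cliqueNumber hclaw (perfCol_of_isPerfect hperf) homega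
  have hmin : Choosable G (choiceNumber G) := Nat.sInf_mem (s := {k | Choosable G k}) ⟨_, hk⟩
  refine le_antisymm ?_ hmin.colorable.chromaticNumber_le
  refine le_trans (Nat.cast_le.2 (Nat.sInf_le hk)) ?_
  obtain ⟨m, hm⟩ := ENat.ne_top_iff_exists.1 (chromaticNumber_ne_top_iff_exists.2 ⟨_, hk.colorable⟩)
  rw [← hm, Nat.cast_le]
  refine cliqueNumber_le_of_forall fun Q hQ => ?_
  have h1 := hQ.card_le_chromaticNumber
  rw [← hm] at h1
  exact_mod_cast h1
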